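/- Let 2 < α ≤ 3 and let u ∈ C^∞(S²) be a solution of −Δu + α = e^{2u} on S². Let q be a critical point of u and z ∈ T_qS² a unit eigenvector of the Hessian D²u(q), and set y = q × z. If ∫_{H_y} e^{2u} dμ = ∫_{H_{−y}} e^{2u} dμ, then u ∘ R_y = u, i.e. u is symmetric with respect to the great circle C_y. -/

import Mathlib

open MeasureTheory Real
open scoped RealInnerProductSpace ContDiff

noncomputable section

abbrev E3 : Type := EuclideanSpace ℝ (Fin 3)

/-- The unit sphere `S²` as a subset of `ℝ³`. -/
def S2 : Set E3 := Metric.sphere 0 1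

/-- The Euclidean Laplacian of `u : ℝ³ → ℝ`.  For a `0`-homogeneous function it
coincides on `S²` with the Laplace–Beltrami operator of the round metric applied
to the restriction of `u` to `S²`. -/
def lap (u : E3 → ℝ) (x : E3) : ℝ :=
  ∑ i : Fin 3, iteratedFDeriv ℝ 2 u x ![EuclideanSpace.single i 1, EuclideanSpace.single i 1]

/-- `u : ℝ³ → ℝ` is positively homogeneous of degree `0`, i.e. it is the radial
extension of a function on `S²`. -/
def Hom0 (u : E3 → ℝ) : Prop := ∀ (x : E3) (r : ℝ), 0 < r → u (r • x) = u x

/-- `u` represents a smooth solution of the mean field equation `-Δ_{S²} u + α = e^{2u}`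
on `S²`, encoded through its degree-zero homogeneous extension to `ℝ³ \ {0}`. -/
def MFE (u : E3 → ℝ) (α : ℝ) : Prop :=
  ContDiffOn ℝ ∞ u {(0 : E3)}ᶜ ∧ Hom0 u ∧
    ∀ x ∈ S2, -lap u x + α = Real.exp (2 * u x)

/-- Reflection of `ℝ³` across the plane `{x · y = 0}`. -/
def Refl (y x : E3) : E3 := x - (2 * ⟪x, y⟫) • y

/-- The closed half-sphere `H_y`. -/
def halfSphere (y : E3) : Set E3 := {x ∈ S2 | 0 ≤ ⟪x, y⟫}

/-- The great circle `C_y`. -/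
def circleOf (y : E3) : Set E3 := {x ∈ S2 | ⟪x, y⟫ = 0}

/-- `u` is axially symmetric with respect to `p`: on the sphere it depends only on `x · p`. -/
def AxiallySymmetric (u : E3 → ℝ) (p : E3) : Prop :=
  ∀ x ∈ S2, ∀ y ∈ S2, ⟪x, p⟫ = ⟪y, p⟫ → u x = u y

/-- `p` is an umbilical critical point of `u` (viewed as a function on `S²`):
the (intrinsic) gradient vanishes and the Hessian, as a quadratic form on the
tangent plane `p^⊥`, is a multiple of the metric. -/
def UmbilicalCritical (u : E3 → ℝ) (p : E3) : Prop :=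
  fderiv ℝ u p = 0 ∧
    ∃ c : ℝ, ∀ v : E3, ⟪v, p⟫ = 0 → iteratedFDeriv ℝ 2 u p ![v, v] = c * ‖v‖ ^ 2

/-- `z` is an eigenvector of the Hessian `D²u(q)` viewed as a symmetric bilinear
form on the tangent plane `q^⊥`. -/
def HessEigen (u : E3 → ℝ) (q z : E3) : Prop :=
  ∃ lam : ℝ, ∀ v : E3, ⟪v, q⟫ = 0 → iteratedFDeriv ℝ 2 u q ![z, v] = lam * ⟪z, v⟫

/-- Cross product on `ℝ³`. -/
def cross (a b : E3) : E3 :=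
  (WithLp.equiv 2 (Fin 3 → ℝ)).symm
    (crossProduct ((WithLp.equiv 2 (Fin 3 → ℝ)) a) ((WithLp.equiv 2 (Fin 3 → ℝ)) b))

/-- `Ω` is a nodal domain of `w` on the sphere: a connected component of
`S² \ w⁻¹(0)` (in the subspace topology of `S²`). -/
def IsNodalDomain (w : E3 → ℝ) (Ω : Set E3) : Prop :=
  ∃ x ∈ S2, w x ≠ 0 ∧ Ω = connectedComponentIn {z ∈ S2 | w z ≠ 0} x

end

/-! ### Calculus in the plane -/

section PlaneCalculus

variable {F : Type*} [NormedAddCommGroup F] [NormedSpace ℝ F]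

/-- The partial derivative in the real direction. -/
noncomputable def dx (f : ℂ → F) (z : ℂ) : F := fderiv ℝ f z 1

/-- The partial derivative in the imaginary direction. -/
noncomputable def dy (f : ℂ → F) (z : ℂ) : F := fderiv ℝ f z Complex.I

/-- The Laplacian in the plane. -/
noncomputable def lapC (f : ℂ → F) (z : ℂ) : F := dx (dx f) z + dy (dy f) z

/-- The length of the gradient. -/
noncomputable def gradN (f : ℂ → ℝ) (z : ℂ) : ℝ := √(dx f z ^ 2 + dy f z ^ 2)

theorem ContDiffAt.dx {f : ℂ → F} {z : ℂ} {m n : WithTop ℕ∞} (h : ContDiffAt ℝ n f z)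
    (hmn : m + 1 ≤ n) : ContDiffAt ℝ m (dx f) z :=
  (h.fderiv_right hmn).clm_apply contDiffAt_const

theorem ContDiffAt.dy {f : ℂ → F} {z : ℂ} {m n : WithTop ℕ∞} (h : ContDiffAt ℝ n f z)
    (hmn : m + 1 ≤ n) : ContDiffAt ℝ m (dy f) z :=
  (h.fderiv_right hmn).clm_apply contDiffAt_const

theorem continuousAt_lapC {f : ℂ → F} {z : ℂ} (h : ContDiffAt ℝ 2 f z) :
    ContinuousAt (lapC f) z :=
  (((h.dx (m := 1) (by norm_num)).dx (m := 0) (by norm_num)).add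
    ((h.dy (m := 1) (by norm_num)).dy (m := 0) (by norm_num))).continuousAt

theorem integral_mul_fderiv_of_compact {𝕜 : Type*} [NormedField 𝕜] [NormedAlgebra ℝ 𝕜]
    {φ ψ : ℂ → 𝕜} (hφ : ContDiff ℝ 1 φ) (hc : HasCompactSupport φ)
    (hψ : ∀ z ∈ tsupport φ, ContDiffAt ℝ 1 ψ z) (v : ℂ) :
    ∫ z, φ z * fderiv ℝ ψ z v = -∫ z, fderiv ℝ φ z v * ψ z := by
  have key : ∀ g : ℂ → 𝕜, tsupport g ⊆ tsupport φ → (∀ z ∈ tsupport φ, ContinuousAt g z) →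
      Integrable g := fun g h1 h2 =>
    (continuous_of_tsupport fun z hz => h2 z (h1 hz)).integrable_of_hasCompactSupport
      (hc.of_isClosed_subset (isClosed_tsupport _) h1)
  have hd : Continuous fun z => fderiv ℝ φ z v :=
    (hφ.continuous_fderiv (by norm_num)).clm_apply continuous_const
  apply integral_mul_fderiv_eq_neg_fderiv_mul_of_integrable
  · refine key _ ((tsupport_mul_subset_left).trans ?_) fun z hz =>
      hd.continuousAt.mul (hψ z hz).continuousAt
    exact tsupport_fderiv_apply_subset ℝ v
  · exact key _ tsupport_mul_subset_left fun z hz => hφ.continuous.continuousAt.mul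
      (((hψ z hz).fderiv_right (m := 0) (by norm_num)).continuousAt.clm_apply continuousAt_const)
  · exact key _ tsupport_mul_subset_left fun z hz => hφ.continuous.continuousAt.mul
      (hψ z hz).continuousAt
  · exact fun z _ => (hφ.differentiable (by norm_num)) z
  · exact fun z hz => (hψ z hz).differentiableAt (by norm_num)

theorem integrable_mul_of_compact {𝕜 : Type*} [NormedField 𝕜] [NormedAlgebra ℝ 𝕜]
    {φ g : ℂ → 𝕜} (hφ : Continuous φ) (hc : HasCompactSupport φ)
    (hg : ∀ z ∈ tsupport φ, ContinuousAt g z) : Integrable fun z => φ z * g z :=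
  (continuous_of_tsupport fun z hz => hφ.continuousAt.mul
    (hg z (tsupport_mul_subset_left hz))).integrable_of_hasCompactSupport hc.mul_right

theorem tsupport_dx_subset (f : ℂ → F) : tsupport (dx f) ⊆ tsupport f :=
  tsupport_fderiv_apply_subset ℝ 1

theorem tsupport_dy_subset (f : ℂ → F) : tsupport (dy f) ⊆ tsupport f :=
  tsupport_fderiv_apply_subset ℝ Complex.I

theorem HasCompactSupport.dx {f : ℂ → F} (h : HasCompactSupport f) : HasCompactSupport (dx f) :=
  h.of_isClosed_subset (isClosed_tsupport _) (tsupport_dx_subset f)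

theorem HasCompactSupport.dy {f : ℂ → F} (h : HasCompactSupport f) : HasCompactSupport (dy f) :=
  h.of_isClosed_subset (isClosed_tsupport _) (tsupport_dy_subset f)

theorem ContDiff.dx {f : ℂ → F} {m n : WithTop ℕ∞} (h : ContDiff ℝ n f)
    (hmn : m + 1 ≤ n) : ContDiff ℝ m (dx f) :=
  contDiff_iff_contDiffAt.2 fun _ => h.contDiffAt.dx hmn

theorem ContDiff.dy {f : ℂ → F} {m n : WithTop ℕ∞} (h : ContDiff ℝ n f)
    (hmn : m + 1 ≤ n) : ContDiff ℝ m (dy f) :=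
  contDiff_iff_contDiffAt.2 fun _ => h.contDiffAt.dy hmn

/-- Green's first identity for a compactly supported test function. -/
theorem integral_grad_mul_grad {φ v : ℂ → ℝ} (hφ : ContDiff ℝ 1 φ) (hc : HasCompactSupport φ)
    (hv : ∀ z ∈ tsupport φ, ContDiffAt ℝ 2 v z) :
    ∫ z, (dx φ z * dx v z + dy φ z * dy v z) = -∫ z, φ z * lapC v z := by
  have h1 := integral_mul_fderiv_of_compact (ψ := dx v) hφ hc
    (fun z hz => (hv z hz).dx (by norm_num)) 1
  have h2 := integral_mul_fderiv_of_compact (ψ := dy v) hφ hc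
    (fun z hz => (hv z hz).dy (by norm_num)) Complex.I
  have i1 : Integrable fun z => dx φ z * dx v z :=
    integrable_mul_of_compact (hφ.dx (m := 0) (by norm_num)).continuous hc.dx fun z hz =>
      ((hv z (tsupport_dx_subset _ hz)).dx (m := 1) (by norm_num)).continuousAt
  have i2 : Integrable fun z => dy φ z * dy v z :=
    integrable_mul_of_compact (hφ.dy (m := 0) (by norm_num)).continuous hc.dy fun z hz =>
      ((hv z (tsupport_dy_subset _ hz)).dy (m := 1) (by norm_num)).continuousAt
  have i3 : Integrable fun z => φ z * dx (dx v) z :=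
    integrable_mul_of_compact hφ.continuous hc fun z hz =>
      (((hv z hz).dx (m := 1) (by norm_num)).dx (m := 0) (by norm_num)).continuousAt
  have i4 : Integrable fun z => φ z * dy (dy v) z :=
    integrable_mul_of_compact hφ.continuous hc fun z hz =>
      (((hv z hz).dy (m := 1) (by norm_num)).dy (m := 0) (by norm_num)).continuousAt
  rw [integral_add i1 i2]
  have : ∫ z, φ z * lapC v z = (∫ z, φ z * dx (dx v) z) + ∫ z, φ z * dy (dy v) z := by
    rw [← integral_add i3 i4]; simp only [lapC, mul_add]
  rw [this]
  change (∫ z, φ z * dx (dx v) z) = -∫ z, dx φ z * dx v z at h1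
  change (∫ z, φ z * dy (dy v) z) = -∫ z, dy φ z * dy v z at h2
  linarith

/-- Green's second identity for a compactly supported test function. -/
theorem integral_mul_lapC_comm {φ v : ℂ → ℝ} (hφ : ContDiff ℝ 2 φ) (hc : HasCompactSupport φ)
    (hv : ContDiff ℝ 2 v) : ∫ z, φ z * lapC v z = ∫ z, lapC φ z * v z := by
  have h0 := integral_grad_mul_grad (hφ.of_le (by norm_num)) hc fun z _ => hv.contDiffAt (x := z)
  have h1 := integral_mul_fderiv_of_compact (ψ := v) (hφ.dx (m := 1) (by norm_num)) hc.dx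
    (fun z _ => (hv.of_le (by norm_num)).contDiffAt) 1
  have h2 := integral_mul_fderiv_of_compact (ψ := v) (hφ.dy (m := 1) (by norm_num)) hc.dy
    (fun z _ => (hv.of_le (by norm_num)).contDiffAt) Complex.I
  change (∫ z, dx φ z * dx v z) = -∫ z, dx (dx φ) z * v z at h1
  change (∫ z, dy φ z * dy v z) = -∫ z, dy (dy φ) z * v z at h2
  have hv' := hv.continuous
  have i1 : Integrable fun z => dx φ z * dx v z :=
    integrable_mul_of_compact (hφ.dx (m := 0) (by norm_num)).continuous hc.dx fun z hz =>
      (hv.dx (m := 1) (by norm_num)).continuous.continuousAt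
  have i2 : Integrable fun z => dy φ z * dy v z :=
    integrable_mul_of_compact (hφ.dy (m := 0) (by norm_num)).continuous hc.dy fun z hz =>
      (hv.dy (m := 1) (by norm_num)).continuous.continuousAt
  have i3 : Integrable fun z => dx (dx φ) z * v z :=
    integrable_mul_of_compact ((hφ.dx (m := 1) (by norm_num)).dx (m := 0) (by norm_num)).continuous
      hc.dx.dx fun z hz => hv'.continuousAt
  have i4 : Integrable fun z => dy (dy φ) z * v z :=
    integrable_mul_of_compact ((hφ.dy (m := 1) (by norm_num)).dy (m := 0) (by norm_num)).continuous
      hc.dy.dy fun z hz => hv'.continuousAt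
  rw [integral_add i1 i2] at h0
  have : ∫ z, lapC φ z * v z = (∫ z, dx (dx φ) z * v z) + ∫ z, dy (dy φ) z * v z := by
    rw [← integral_add i3 i4]; simp only [lapC, add_mul]
  linarith

end PlaneCalculus

/-! ### Wirtinger derivatives -/

section Wirtinger

open Complex in
/-- The real-linear map `w ↦ a w + b (conj w)`. -/
noncomputable def wirtMap (a b : ℂ) : ℂ →L[ℝ] ℂ :=
  a • ContinuousLinearMap.id ℝ ℂ + b • (conjCLE : ℂ →L[ℝ] ℂ)

@[simp] theorem wirtMap_apply (a b w : ℂ) : wirtMap a b w = a * w + b * starRingEnd ℂ w := by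
  simp [wirtMap]

/-- `f` is real differentiable at `z` with Wirtinger derivatives `a = ∂f`, `b = ∂̄f`. -/
def HasWirt (f : ℂ → ℂ) (a b z : ℂ) : Prop := HasFDerivAt f (wirtMap a b) z

variable {f g : ℂ → ℂ} {a b c d z : ℂ}

theorem HasDerivAt.hasWirt (h : HasDerivAt f a z) : HasWirt f a 0 z := by
  refine (h.hasFDerivAt.restrictScalars ℝ).congr_fderiv ?_
  ext w
  simp [mul_comm]

theorem hasWirt_conj (z : ℂ) : HasWirt (starRingEnd ℂ) 0 1 z := by
  refine (Complex.conjCLE.hasFDerivAt (x := z)).congr_fderiv ?_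
  ext w
  simp

theorem hasWirt_const (c z : ℂ) : HasWirt (fun _ => c) 0 0 z := (hasDerivAt_const z c).hasWirt

theorem hasWirt_id (z : ℂ) : HasWirt (fun z => z) 1 0 z := (hasDerivAt_id z).hasWirt

theorem HasWirt.add (hf : HasWirt f a b z) (hg : HasWirt g c d z) :
    HasWirt (fun z => f z + g z) (a + c) (b + d) z := by
  refine (HasFDerivAt.add hf hg).congr_fderiv ?_
  ext w
  simp [wirtMap]
  ring

theorem HasWirt.mul (hf : HasWirt f a b z) (hg : HasWirt g c d z) :
    HasWirt (fun z => f z * g z) (a * g z + f z * c) (b * g z + f z * d) z := by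
  refine (HasFDerivAt.mul hf hg).congr_fderiv ?_
  ext w
  simp [wirtMap]
  ring

/-- Composition with a holomorphic function on the outside. -/
theorem HasWirt.holo_comp (hg : HasDerivAt g c (f z)) (hf : HasWirt f a b z) :
    HasWirt (fun z => g (f z)) (c * a) (c * b) z := by
  refine ((hg.comp_hasFDerivAt (𝕜 := ℝ) z hf)).congr_fderiv ?_
  ext w
  simp [wirtMap]
  ring

/-- Composition with a holomorphic function on the inside. -/
theorem HasWirt.comp_holo (hf : HasWirt f a b (g z)) (hg : HasDerivAt g c z) :
    HasWirt (fun z => f (g z)) (a * c) (b * starRingEnd ℂ c) z := by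
  refine (HasFDerivAt.comp z hf (hg.hasFDerivAt.restrictScalars ℝ)).congr_fderiv ?_
  ext w
  simp [wirtMap]
  ring

/-- The operator `∂̄`. -/
noncomputable def dbar (f : ℂ → ℂ) (z : ℂ) : ℂ := (dx f z + Complex.I * dy f z) / 2

theorem HasWirt.dbar_eq (h : HasWirt f a b z) : dbar f z = b := by
  simp only [dbar, dx, dy, HasFDerivAt.fderiv h]
  simp
  linear_combination (a / 2 - b / 2) * Complex.I_sq

theorem integral_mul_dbar {φ ψ : ℂ → ℂ} (hφ : ContDiff ℝ 1 φ) (hc : HasCompactSupport φ)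
    (hψ : ∀ z ∈ tsupport φ, ContDiffAt ℝ 1 ψ z) :
    ∫ z, φ z * dbar ψ z = -∫ z, dbar φ z * ψ z := by
  have h1 := integral_mul_fderiv_of_compact hφ hc hψ 1
  have h2 := integral_mul_fderiv_of_compact hφ hc hψ Complex.I
  change (∫ z, φ z * dx ψ z) = -∫ z, dx φ z * ψ z at h1
  change (∫ z, φ z * dy ψ z) = -∫ z, dy φ z * ψ z at h2
  have i1 : Integrable fun z => φ z * dx ψ z := integrable_mul_of_compact hφ.continuous hc
    fun z hz => ((hψ z hz).dx (m := 0) (by norm_num)).continuousAt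
  have i2 : Integrable fun z => φ z * dy ψ z := integrable_mul_of_compact hφ.continuous hc
    fun z hz => ((hψ z hz).dy (m := 0) (by norm_num)).continuousAt
  have i3 : Integrable fun z => dx φ z * ψ z :=
    integrable_mul_of_compact (hφ.dx (m := 0) (by norm_num)).continuous hc.dx
      fun z hz => (hψ z (tsupport_dx_subset _ hz)).continuousAt
  have i4 : Integrable fun z => dy φ z * ψ z :=
    integrable_mul_of_compact (hφ.dy (m := 0) (by norm_num)).continuous hc.dy
      fun z hz => (hψ z (tsupport_dy_subset _ hz)).continuousAt
  have e1 : ∫ z, φ z * dbar ψ z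
      = (∫ z, φ z * dx ψ z) * (1/2) + (∫ z, φ z * dy ψ z) * (Complex.I / 2) := by
    rw [← integral_mul_const, ← integral_mul_const,
      ← integral_add (i1.mul_const _) (i2.mul_const _)]
    congr 1; ext z; simp only [dbar]; ring
  have e2 : ∫ z, dbar φ z * ψ z
      = (∫ z, dx φ z * ψ z) * (1/2) + (∫ z, dy φ z * ψ z) * (Complex.I / 2) := by
    rw [← integral_mul_const, ← integral_mul_const,
      ← integral_add (i3.mul_const _) (i4.mul_const _)]
    congr 1; ext z; simp only [dbar]; ring
  rw [e1, e2, h1, h2]; ring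

theorem continuous_dbar (hf : ContDiff ℝ 1 f) : Continuous (dbar f) :=
  (((hf.dx (m := 0) (by norm_num)).continuous).add (continuous_const.mul
    ((hf.dy (m := 0) (by norm_num)).continuous))).div_const _

theorem tsupport_dbar_subset (f : ℂ → ℂ) : tsupport (dbar f) ⊆ tsupport f := by
  refine closure_minimal (fun z hz => ?_) (isClosed_tsupport _)
  by_contra h
  refine hz ?_
  have h1 : dx f z = 0 := image_eq_zero_of_notMem_tsupport fun h' => h (tsupport_dx_subset _ h')
  have h2 : dy f z = 0 := image_eq_zero_of_notMem_tsupport fun h' => h (tsupport_dy_subset _ h')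
  simp [dbar, h1, h2]

theorem dbar_ofReal {φ : ℂ → ℝ} (h : DifferentiableAt ℝ φ z) :
    dbar (fun z => (φ z : ℂ)) z = (((dx φ z : ℝ) : ℂ) + Complex.I * (dy φ z : ℝ)) / 2 := by
  have : HasFDerivAt (fun z => (φ z : ℂ)) (Complex.ofRealCLM.comp (fderiv ℝ φ z)) z :=
    Complex.ofRealCLM.hasFDerivAt.comp z h.hasFDerivAt
  simp [dbar, dx, dy, this.fderiv]

theorem norm_dbar_ofReal {φ : ℂ → ℝ} (h : DifferentiableAt ℝ φ z) :
    ‖dbar (fun z => (φ z : ℂ)) z‖ = gradN φ z / 2 := by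
  rw [dbar_ofReal h, norm_div, mul_comm Complex.I, Complex.norm_add_mul_I, gradN]; simp

/-- Integration of radial functions in the plane. -/
theorem integral_radial {f g : ℝ → ℝ} {l : ℝ} (hd : ∀ x ∈ Set.Ici (0 : ℝ), HasDerivAt g (x * f x) x)
    (hf : ∀ x ∈ Set.Ioi (0 : ℝ), 0 ≤ f x) (hl : Filter.Tendsto g Filter.atTop (nhds l)) :
    Integrable (fun z : ℂ => f ‖z‖) ∧ ∫ z : ℂ, f ‖z‖ = 2 * π * (l - g 0) := by
  have hp : ∀ x ∈ Set.Ioi (0 : ℝ), 0 ≤ x * f x := fun x hx => mul_nonneg (le_of_lt hx) (hf x hx)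
  constructor
  · rw [integrable_fun_norm_addHaar]
    simpa using integrableOn_Ioi_deriv_of_nonneg' hd hp hl
  · rw [integral_fun_norm_addHaar]
    have := integral_Ioi_of_hasDerivAt_of_nonneg' hd hp hl
    simp [Measure.real, this]
    ring

end Wirtinger

/-! ### Carleman's isoperimetric inequality for flat metrics -/

section Carleman

open ComplexConjugate

theorem mul_conj_add_ne_zero {δ : ℝ} (hδ : 0 < δ) (D : ℂ) : D * conj D + δ ≠ 0 := by
  rw [Complex.mul_conj, ← Complex.ofReal_add, Complex.ofReal_ne_zero]
  exact (add_pos_of_nonneg_of_pos (Complex.normSq_nonneg D) hδ).ne'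

/-- A regularisation of `conj D / D`. -/
noncomputable def carlF (δ : ℝ) (D : ℂ) : ℂ := conj D ^ 2 * (D * conj D + δ)⁻¹

noncomputable def carlF₁ (δ : ℝ) (D : ℂ) : ℂ :=
  (D * conj D ^ 2 + 2 * δ * conj D) * ((D * conj D + δ) ^ 2)⁻¹

noncomputable def carlF₂ (δ : ℝ) (D : ℂ) : ℝ := 2 * δ ^ 2 / (‖D‖ ^ 2 + δ) ^ 3

theorem HasWirt.congr {f g : ℂ → ℂ} {a b b' z : ℂ} (h : HasWirt f a b z) (hf : g = f)
    (hb : b' = b) : HasWirt g a b' z := by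
  rw [hf, hb]; exact h

theorem hasWirt_mul_conj_add (δ : ℝ) (D : ℂ) :
    HasWirt (fun D => D * conj D + (δ : ℂ)) (conj D) D D := by
  convert ((hasWirt_id D).mul (hasWirt_conj D)).add (hasWirt_const δ D) using 1 <;> ring

theorem hasWirt_carlF {δ : ℝ} (hδ : 0 < δ) (D : ℂ) :
    ∃ a, HasWirt (carlF δ) a (carlF₁ δ D) D := by
  have h0 := mul_conj_add_ne_zero hδ D
  have h1 := HasWirt.holo_comp (hasDerivAt_inv h0)
    (f := fun D => D * conj D + (δ : ℂ)) (hasWirt_mul_conj_add δ D)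
  have h2 := ((hasWirt_conj D).mul (hasWirt_conj D)).mul h1
  refine ⟨_, h2.congr ?_ ?_⟩
  · ext; simp only [carlF]; ring
  · simp only [carlF₁]
    field_simp
    ring

theorem hasWirt_carlF₁ {δ : ℝ} (hδ : 0 < δ) (D : ℂ) :
    ∃ a, HasWirt (carlF₁ δ) a (carlF₂ δ D) D := by
  have h0 := mul_conj_add_ne_zero hδ D
  have hN := hasWirt_mul_conj_add δ D
  have h1 := HasWirt.holo_comp (hasDerivAt_inv (pow_ne_zero 2 h0))
    (f := fun D => (D * conj D + (δ : ℂ)) ^ 2)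
    (by simpa only [sq] using hN.mul hN)
  have hc := hasWirt_conj D
  have h2 := (((hasWirt_id D).mul (hc.mul hc)).add ((hasWirt_const (2 * δ) D).mul hc)).mul h1
  refine ⟨_, h2.congr ?_ ?_⟩
  · ext; simp only [carlF₁]; ring
  · have : ((carlF₂ δ D : ℝ) : ℂ) = 2 * δ ^ 2 / (D * conj D + δ) ^ 3 := by
      simp only [carlF₂]; push_cast; rw [Complex.mul_conj']
    rw [this]
    field_simp
    ring

theorem norm_carlF_le {δ : ℝ} (hδ : 0 < δ) (D : ℂ) : ‖carlF δ D‖ ≤ 1 := by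
  have : D * conj D + δ = ((‖D‖ ^ 2 + δ : ℝ) : ℂ) := by rw [Complex.mul_conj']; push_cast; rfl
  rw [carlF, this, norm_mul, norm_inv, Complex.norm_real, norm_pow, RCLike.norm_conj,
    Real.norm_of_nonneg (by positivity), ← div_eq_mul_inv, div_le_one (by positivity)]
  linarith

theorem contDiff_carlF {δ : ℝ} (hδ : 0 < δ) {n : WithTop ℕ∞} : ContDiff ℝ n (carlF δ) := by
  have hc : ContDiff ℝ n fun D : ℂ => conj D := Complex.conjCLE.contDiff
  exact (hc.pow 2).mul (((contDiff_id.mul hc).add contDiff_const).inv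
    fun D => mul_conj_add_ne_zero hδ D)

theorem contDiff_carlF₁ {δ : ℝ} (hδ : 0 < δ) {n : WithTop ℕ∞} : ContDiff ℝ n (carlF₁ δ) := by
  have hc : ContDiff ℝ n fun D : ℂ => conj D := Complex.conjCLE.contDiff
  exact ((contDiff_id.mul (hc.pow 2)).add (contDiff_const.mul hc)).mul
    ((((contDiff_id.mul hc).add contDiff_const).pow 2).inv
    fun D => pow_ne_zero 2 (mul_conj_add_ne_zero hδ D))

theorem continuous_carlF₂ {δ : ℝ} (hδ : 0 < δ) : Continuous (carlF₂ δ) := by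
  refine continuous_const.div (by fun_prop) fun D => ?_
  positivity

variable {G E : ℂ → ℂ} {φ : ℂ → ℝ}

theorem carleman_kernel (hG : ∀ z, HasDerivAt G (E z) z) (hE : Differentiable ℂ E)
    (hφ : ContDiff ℝ ∞ φ) (hc : HasCompactSupport φ) {δ : ℝ} (hδ : 0 < δ) :
    4 * ∫ z, ∫ ζ, φ z * φ ζ * ‖E z‖ ^ 2 * ‖E ζ‖ ^ 2 * carlF₂ δ (G ζ - G z) ≤
      (∫ z, ‖E z‖ * gradN φ z) ^ 2 := by
  set Φ : ℂ → ℂ := fun z => (φ z : ℂ) with hΦ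
  have sΦ : ContDiff ℝ ∞ Φ := Complex.ofRealCLM.contDiff.comp hφ
  have sΦ1 : ContDiff ℝ 1 Φ := sΦ.of_le (by norm_cast)
  have cΦ : HasCompactSupport Φ := hc.comp_left (g := fun x : ℝ => (x : ℂ)) (by simp)
  have sE : ContDiff ℝ ∞ E := (hE.contDiff (n := ∞)).restrict_scalars ℝ
  have dG : Differentiable ℂ G := fun z => (hG z).differentiableAt
  have sG : ContDiff ℝ ∞ G := (dG.contDiff (n := ∞)).restrict_scalars ℝ
  have eE : ∀ z, E z * conj (E z) = ((‖E z‖ ^ 2 : ℝ) : ℂ) := fun z => by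
    rw [Complex.mul_conj']; push_cast; rfl
  have cdb : HasCompactSupport (dbar Φ) :=
    cΦ.of_isClosed_subset (isClosed_tsupport _) (tsupport_dbar_subset _)
  -- integration by parts in `ζ`
  have ibp1 : ∀ z, ∫ ζ, dbar Φ ζ * (carlF δ (G ζ - G z) * E ζ)
      = -∫ ζ, Φ ζ * (carlF₁ δ (G ζ - G z) * (‖E ζ‖ ^ 2 : ℝ)) := by
    intro z
    have hs : ContDiff ℝ ∞ fun ζ => carlF δ (G ζ - G z) * E ζ :=
      ((contDiff_carlF hδ).comp (sG.sub contDiff_const)).mul sE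
    have := integral_mul_dbar sΦ1 cΦ (ψ := fun ζ => carlF δ (G ζ - G z) * E ζ)
      fun w _ => (hs.of_le (by norm_cast)).contDiffAt
    rw [eq_neg_iff_add_eq_zero, add_comm, ← eq_neg_iff_add_eq_zero, ← this]
    congr 1
    ext ζ
    congr 1
    obtain ⟨a, ha⟩ := hasWirt_carlF hδ (G ζ - G z)
    have h1 := (ha.comp_holo (g := fun ζ => G ζ - G z) ((hG ζ).sub_const _)).mul
      (hE ζ).hasDerivAt.hasWirt
    rw [h1.dbar_eq, ← eE]; ring
  have ibp2 : ∀ ζ, ∫ z, dbar Φ z * (carlF₁ δ (G ζ - G z) * E z)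
      = ∫ z, Φ z * (carlF₂ δ (G ζ - G z) * (‖E z‖ ^ 2 : ℝ)) := by
    intro ζ
    have hs : ContDiff ℝ ∞ fun z => carlF₁ δ (G ζ - G z) * E z :=
      ((contDiff_carlF₁ hδ).comp (contDiff_const.sub sG)).mul sE
    have := integral_mul_dbar sΦ1 cΦ (ψ := fun z => carlF₁ δ (G ζ - G z) * E z)
      fun w _ => (hs.of_le (by norm_cast)).contDiffAt
    rw [← neg_eq_iff_eq_neg] at this
    rw [← this, ← integral_neg]
    congr 1
    ext z
    rw [← mul_neg]
    congr 1
    obtain ⟨a, ha⟩ := hasWirt_carlF₁ hδ (G ζ - G z)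
    have h1 := (ha.comp_holo (g := fun z => G ζ - G z) ((hG z).const_sub _)).mul
      (hE z).hasDerivAt.hasWirt
    rw [h1.dbar_eq, ← eE, map_neg]; ring
  -- the double integral
  have key : ∫ z, dbar Φ z * E z * ∫ ζ, dbar Φ ζ * (carlF δ (G ζ - G z) * E ζ)
      = -((∫ z, ∫ ζ, φ z * φ ζ * ‖E z‖ ^ 2 * ‖E ζ‖ ^ 2 * carlF₂ δ (G ζ - G z) : ℝ) : ℂ) := by
    simp_rw [ibp1, mul_neg, ← integral_const_mul, integral_neg]
    congr 1
    have cEn : Continuous E := sE.continuous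
    have cGn : Continuous G := sG.continuous
    have cdbn := continuous_dbar sΦ1
    have cΦn := sΦ.continuous
    have cF1 := (contDiff_carlF₁ hδ (n := 0)).continuous
    have cF2 := continuous_carlF₂ hδ
    rw [integral_integral_swap_of_hasCompactSupport]
    · have : ∀ ζ, ∫ z, dbar Φ z * E z * (Φ ζ * (carlF₁ δ (G ζ - G z) * (‖E ζ‖ ^ 2 : ℝ)))
          = ∫ z, ((φ z * φ ζ * ‖E z‖ ^ 2 * ‖E ζ‖ ^ 2 * carlF₂ δ (G ζ - G z) : ℝ) : ℂ) := by
        intro ζ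
        calc _ = (Φ ζ * (‖E ζ‖ ^ 2 : ℝ)) * ∫ z, dbar Φ z * (carlF₁ δ (G ζ - G z) * E z) := by
              rw [← integral_const_mul]; congr 1; ext z; ring
          _ = _ := by
              rw [ibp2, ← integral_const_mul]; congr 1; ext z; simp only [hΦ]; push_cast; ring
      simp_rw [this, integral_complex_ofReal]
      norm_cast
      rw [integral_integral_swap_of_hasCompactSupport]
      · simp only [Function.uncurry_def]; fun_prop
      · refine HasCompactSupport.intro (hc.isCompact.prod hc.isCompact) fun p hp => ?_
        rw [Set.mem_prod, not_and_or] at hp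
        rcases hp with h | h
        · simp [Function.uncurry, image_eq_zero_of_notMem_tsupport h]
        · simp [Function.uncurry, image_eq_zero_of_notMem_tsupport h]
    · simp only [Function.uncurry_def]; fun_prop
    · refine HasCompactSupport.intro (cdb.isCompact.prod cΦ.isCompact) fun p hp => ?_
      rw [Set.mem_prod, not_and_or] at hp
      rcases hp with h | h
      · simp [Function.uncurry, image_eq_zero_of_notMem_tsupport h]
      · simp [Function.uncurry, image_eq_zero_of_notMem_tsupport h]
  have nb : ∀ z, ‖dbar Φ z‖ = gradN φ z / 2 := fun z =>
    norm_dbar_ofReal (hφ.differentiable (by simp) z)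
  have iE : Integrable fun z => ‖E z‖ * (gradN φ z / 2) := by
    have e : (fun z => ‖E z‖ * (gradN φ z / 2)) = fun z => ‖E z‖ * ‖dbar Φ z‖ := by
      ext z; rw [nb]
    rw [e]
    have := (integrable_mul_of_compact (continuous_dbar sΦ1) cdb
      fun z _ => sE.continuous.continuousAt (x := z)).norm
    simpa [mul_comm] using this
  have inner : ∀ z, ‖∫ ζ, dbar Φ ζ * (carlF δ (G ζ - G z) * E ζ)‖ ≤
      ∫ ζ, ‖E ζ‖ * (gradN φ ζ / 2) := fun z => by
    refine norm_integral_le_of_norm_le iE (Filter.Eventually.of_forall fun ζ => ?_)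
    rw [norm_mul, norm_mul, nb]
    have := norm_carlF_le hδ (G ζ - G z)
    have h0 : 0 ≤ gradN φ ζ / 2 := by rw [← nb]; exact norm_nonneg _
    nlinarith [mul_le_mul_of_nonneg_right this (mul_nonneg (norm_nonneg (E ζ)) h0)]
  have outer : ‖∫ z, dbar Φ z * E z * ∫ ζ, dbar Φ ζ * (carlF δ (G ζ - G z) * E ζ)‖ ≤
      (∫ z, ‖E z‖ * (gradN φ z / 2)) * ∫ ζ, ‖E ζ‖ * (gradN φ ζ / 2) := by
    rw [← integral_mul_const]
    refine norm_integral_le_of_norm_le (iE.mul_const _) (Filter.Eventually.of_forall fun z => ?_)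
    rw [norm_mul, norm_mul, nb, mul_comm (gradN φ z / 2)]
    have h0 : 0 ≤ gradN φ z / 2 := by rw [← nb]; exact norm_nonneg _
    gcongr
    exact inner z
  rw [key, norm_neg, Complex.norm_real] at outer
  have h2 : ∫ z, ‖E z‖ * (gradN φ z / 2) = (∫ z, ‖E z‖ * gradN φ z) / 2 := by
    rw [← integral_div]; congr 1; ext; ring
  rw [h2] at outer
  have := le_trans (le_abs_self _) outer
  nlinarith

end Carleman

section CarlemanInequality

theorem integral_two_div_cube {c : ℝ} (hc : 0 < c) :
    Integrable (fun ξ : ℂ => 2 / (c * ‖ξ‖ ^ 2 + 1) ^ 3) ∧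
      ∫ ξ : ℂ, 2 / (c * ‖ξ‖ ^ 2 + 1) ^ 3 = π / c := by
  have := integral_radial (f := fun r => 2 / (c * r ^ 2 + 1) ^ 3)
    (g := fun r => -(1 / (2 * c)) * ((c * r ^ 2 + 1) ^ 2)⁻¹) (l := -(1 / (2 * c)) * 0)
    (fun r _ => ?_) (fun r _ => by positivity) ?_
  · refine ⟨this.1, this.2.trans ?_⟩
    field_simp
    norm_num
  · have h0 : c * r ^ 2 + 1 ≠ 0 := by positivity
    have h1 : HasDerivAt (fun r : ℝ => (c * r ^ 2 + 1) ^ 2)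
        (2 * (c * r ^ 2 + 1) * (c * (2 * r))) r := by
      have := ((((hasDerivAt_id r).fun_pow 2).const_mul c).add_const 1).fun_pow 2
      simpa using this
    refine ((h1.fun_inv (pow_ne_zero 2 h0)).const_mul (-(1 / (2 * c)))).congr_deriv ?_
    field_simp
  · refine Filter.Tendsto.const_mul _ (Filter.Tendsto.inv_tendsto_atTop ?_)
    refine Filter.tendsto_atTop_mono (f := fun r => c * r ^ 2) (fun r => ?_) ?_
    · nlinarith [mul_nonneg hc.le (sq_nonneg r), sq_nonneg (c * r ^ 2)]
    · exact (Filter.tendsto_pow_atTop two_ne_zero).const_mul_atTop hc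

variable {E : ℂ → ℂ} {φ : ℂ → ℝ}

/-- Carleman's inequality: the isoperimetric inequality in functional form for the flat metric
`|E|² |dz|²`, `E` entire without zeros. -/
theorem carleman_inequality (hE : Differentiable ℂ E) (hE0 : ∀ z, E z ≠ 0)
    (hφ : ContDiff ℝ ∞ φ) (hc : HasCompactSupport φ) (hφ0 : ∀ z, 0 ≤ φ z) :
    4 * π * ∫ z, ‖E z‖ ^ 2 * φ z ^ 2 ≤ (∫ z, ‖E z‖ * gradN φ z) ^ 2 := by
  obtain ⟨G, hG'⟩ := hE.isExactOn_univ
  have hG : ∀ z, HasDerivAt G (E z) z := fun z => hG' z (Set.mem_univ z)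
  have cE : Continuous E := hE.continuous
  have cG : Continuous G := continuous_iff_continuousAt.2 fun z => (hG z).continuousAt
  have cφ := hφ.continuous
  set ε : ℕ → ℝ := fun n => 1 / ((n : ℝ) + 1) with hε
  have εpos : ∀ n, 0 < ε n := fun n => Nat.one_div_pos_of_nat
  have εlim : Filter.Tendsto ε Filter.atTop (nhds 0) := tendsto_one_div_add_atTop_nhds_zero_nat
  set H : ℕ → ℂ → ℂ → ℝ := fun n z ξ => φ z * φ (z + ε n • ξ) * ‖E z‖ ^ 2 *
    ‖E (z + ε n • ξ)‖ ^ 2 * (2 / (‖(ε n)⁻¹ • (G (z + ε n • ξ) - G z)‖ ^ 2 + 1) ^ 3) with hH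
  have Hnn : ∀ n z ξ, 0 ≤ H n z ξ := fun n z ξ => by
    have := hφ0 z
    have := hφ0 (z + ε n • ξ)
    positivity
  set J := (∫ z, ‖E z‖ * gradN φ z) ^ 2 / 4 with hJ
  have Hcont : ∀ n, Continuous (Function.uncurry (H n)) := fun n => by
    have hp : ∀ p : ℂ × ℂ, (‖(ε n)⁻¹ • (G (p.1 + ε n • p.2) - G p.1)‖ ^ 2 + 1) ^ 3 ≠ 0 := fun p => by
      positivity
    simp only [hH, Function.uncurry_def]
    fun_prop (disch := exact hp)
  have Hsupp : ∀ n, HasCompactSupport (Function.uncurry (H n)) := fun n => by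
    have : IsCompact ((fun p : ℂ × ℂ => (p.1, (ε n)⁻¹ • (p.2 - p.1))) ''
        (tsupport φ ×ˢ tsupport φ)) :=
      (hc.isCompact.prod hc.isCompact).image (by fun_prop)
    refine HasCompactSupport.intro this fun p hp => ?_
    by_contra hne
    refine hp ⟨(p.1, p.1 + ε n • p.2), ⟨?_, ?_⟩, ?_⟩
    · by_contra h
      exact hne (by simp [Function.uncurry, hH, image_eq_zero_of_notMem_tsupport h])
    · by_contra h
      exact hne (by simp only [Function.uncurry, hH, image_eq_zero_of_notMem_tsupport h]; simp)
    · ext1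
      · rfl
      · simp [(εpos n).ne']
  -- uniform bound along the sequence
  have bound : ∀ n, ∫⁻ p : ℂ × ℂ, ENNReal.ofReal (H n p.1 p.2) ≤ ENNReal.ofReal J := fun n => by
    have hi : Integrable (Function.uncurry (H n)) (volume.prod volume) :=
      (Hcont n).integrable_of_hasCompactSupport (Hsupp n)
    have e1 : ∫⁻ p : ℂ × ℂ, ENNReal.ofReal (H n p.1 p.2)
        = ENNReal.ofReal (∫ p, Function.uncurry (H n) p ∂(volume.prod volume)) := by
      rw [ofReal_integral_eq_lintegral_ofReal hi
        (Filter.Eventually.of_forall fun p => Hnn n p.1 p.2)]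
      rfl
    rw [e1]
    apply ENNReal.ofReal_le_ofReal
    rw [integral_prod _ hi]
    have hδ : 0 < ε n ^ 2 := pow_pos (εpos n) 2
    have ck := carleman_kernel hG hE hφ hc hδ
    have e2 : ∀ z, ∫ ξ, Function.uncurry (H n) (z, ξ) =
        ∫ ζ, φ z * φ ζ * ‖E z‖ ^ 2 * ‖E ζ‖ ^ 2 * carlF₂ (ε n ^ 2) (G ζ - G z) := fun z => by
      have hs := Measure.integral_comp_smul (volume : Measure ℂ) (fun ζ => φ z * φ (z + ζ) *
        ‖E z‖ ^ 2 * ‖E (z + ζ)‖ ^ 2 * carlF₂ (ε n ^ 2) (G (z + ζ) - G z)) (ε n)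
      have ht := integral_add_left_eq_self (μ := (volume : Measure ℂ)) (fun ζ => φ z * φ ζ *
        ‖E z‖ ^ 2 * ‖E ζ‖ ^ 2 * carlF₂ (ε n ^ 2) (G ζ - G z)) z
      rw [ht] at hs
      simp only [Complex.finrank_real_complex, smul_eq_mul, abs_inv, abs_pow,
        abs_of_pos (εpos n)] at hs
      rw [eq_inv_mul_iff_mul_eq₀ hδ.ne', ← integral_const_mul] at hs
      rw [← hs]
      congr 1
      ext ξ
      simp only [Function.uncurry, hH, carlF₂, norm_smul, norm_inv,
        Real.norm_of_nonneg (εpos n).le]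
      have := (εpos n).ne'
      have h3 : ‖G (z + ε n • ξ) - G z‖ ^ 2 + ε n ^ 2 ≠ 0 := by positivity
      have h4 : ((ε n)⁻¹ * ‖G (z + ε n • ξ) - G z‖) ^ 2 + 1
          = (‖G (z + ε n • ξ) - G z‖ ^ 2 + ε n ^ 2) / ε n ^ 2 := by field_simp
      rw [h4]
      field_simp
    simp_rw [e2, hJ]
    linarith
  -- pointwise limit
  have lim : ∀ p : ℂ × ℂ, Filter.Tendsto (fun n => ENNReal.ofReal (H n p.1 p.2)) Filter.atTop
      (nhds (ENNReal.ofReal (φ p.1 ^ 2 * ‖E p.1‖ ^ 4 *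
        (2 / (‖E p.1‖ ^ 2 * ‖p.2‖ ^ 2 + 1) ^ 3)))) := fun ⟨z, ξ⟩ => by
    refine ENNReal.tendsto_ofReal ?_
    have l0 : Filter.Tendsto (fun n => z + ε n • ξ) Filter.atTop (nhds z) := by
      have := (εlim.smul_const ξ).const_add z
      simpa using this
    have l1 : Filter.Tendsto (fun n => (ε n)⁻¹ • (G (z + ε n • ξ) - G z)) Filter.atTop
        (nhds (E z * ξ)) := by
      have hd : HasFDerivAt G (((ContinuousLinearMap.toSpanSingleton ℂ (E z))).restrictScalars ℝ) z :=
        (hG z).hasFDerivAt.restrictScalars ℝ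
      have hl := hd.lim_real ξ
      have := hl.comp (tendsto_natCast_atTop_atTop.comp (Filter.tendsto_add_atTop_nat 1))
      simp only [Function.comp_def] at this
      refine (this.congr fun n => ?_).trans ?_
      · simp [hε]
      · simp [mul_comm]
    have l2 := (cφ.tendsto z).comp l0
    have l3 := (cE.tendsto z).comp l0
    have l4 : Filter.Tendsto (fun n => 2 / (‖(ε n)⁻¹ • (G (z + ε n • ξ) - G z)‖ ^ 2 + 1) ^ 3)
        Filter.atTop (nhds (2 / (‖E z * ξ‖ ^ 2 + 1) ^ 3)) :=
      tendsto_const_nhds.div (((l1.norm.pow 2).add_const 1).pow 3) (by positivity)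
    have := (((tendsto_const_nhds (x := φ z)).mul l2).mul_const (‖E z‖ ^ 2)).mul (l3.norm.pow 2)
    have e : φ z ^ 2 * ‖E z‖ ^ 4 * (2 / (‖E z‖ ^ 2 * ‖ξ‖ ^ 2 + 1) ^ 3) =
        φ z * φ z * ‖E z‖ ^ 2 * ‖E z‖ ^ 2 * (2 / (‖E z * ξ‖ ^ 2 + 1) ^ 3) := by
      rw [norm_mul, mul_pow]; ring
    rw [e]
    exact this.mul l4
  have fatou := lintegral_liminf_le (μ := (volume : Measure (ℂ × ℂ))) (u := Filter.atTop)
    (f := fun n p => ENNReal.ofReal (H n p.1 p.2))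
    fun n => ((Hcont n).measurable.ennreal_ofReal)
  simp_rw [(lim _).liminf_eq] at fatou
  have fatou2 := fatou.trans ((Filter.liminf_le_liminf (Filter.Eventually.of_forall bound)).trans
    (Filter.liminf_const _).le)
  have e3 : ∀ z, ∫⁻ ξ : ℂ, ENNReal.ofReal (φ z ^ 2 * ‖E z‖ ^ 4 *
      (2 / (‖E z‖ ^ 2 * ‖ξ‖ ^ 2 + 1) ^ 3)) = ENNReal.ofReal (π * (‖E z‖ ^ 2 * φ z ^ 2)) := fun z => by
    have hc : 0 < ‖E z‖ ^ 2 := pow_pos (norm_pos_iff.2 (hE0 z)) 2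
    obtain ⟨h1, h2⟩ := integral_two_div_cube hc
    rw [← ofReal_integral_eq_lintegral_ofReal (h1.const_mul _)
      (Filter.Eventually.of_forall fun ξ => by positivity), integral_const_mul, h2]
    congr 1
    field_simp
  have hmeas : Measurable fun p : ℂ × ℂ => ENNReal.ofReal (φ p.1 ^ 2 * ‖E p.1‖ ^ 4 *
        (2 / (‖E p.1‖ ^ 2 * ‖p.2‖ ^ 2 + 1) ^ 3)) := by
    refine Measurable.ennreal_ofReal (Continuous.measurable ?_)
    have hp : ∀ p : ℂ × ℂ, (‖E p.1‖ ^ 2 * ‖p.2‖ ^ 2 + 1) ^ 3 ≠ 0 := fun p => by positivity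
    fun_prop (disch := exact hp)
  rw [Measure.volume_eq_prod, lintegral_prod _ hmeas.aemeasurable] at fatou2
  simp_rw [e3] at fatou2
  have hi : Integrable fun z => π * (‖E z‖ ^ 2 * φ z ^ 2) := by
    refine Continuous.integrable_of_hasCompactSupport (by fun_prop) ?_
    refine HasCompactSupport.intro hc.isCompact fun z hz => ?_
    simp [image_eq_zero_of_notMem_tsupport hz]
  rw [← ofReal_integral_eq_lintegral_ofReal hi (Filter.Eventually.of_forall fun z => by positivity),
    ENNReal.ofReal_le_ofReal_iff (by positivity), integral_const_mul, hJ] at fatou2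
  linarith

end CarlemanInequality

section LevelODE

open Filter Topology

/-- A function whose right upper slopes are at most `-c` and which does not jump upwards decreases
at rate at least `c`. -/
theorem le_sub_of_right_slope {f : ℝ → ℝ} {a b c : ℝ} (hab : a ≤ b)
    (hr : ∀ s ∈ Set.Ico a b, ∀ η > 0, ∀ᶠ ε in 𝓝[>] (0 : ℝ), f (s + ε) - f s ≤ (-c + η) * ε)
    (hl : ∀ s ∈ Set.Ioc a b, ∀ η > 0, ∀ᶠ s' in 𝓝[<] s, f s - η ≤ f s') :
    f b ≤ f a - c * (b - a) := by
  have main : ∀ η > 0, f b ≤ f a + (-c + η) * (b - a) := by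
    intro η hη
    set S := {x | x ∈ Set.Icc a b ∧ ∀ y ∈ Set.Icc a x, f y ≤ f a + (-c + η) * (y - a)} with hS
    have haS : a ∈ S := ⟨⟨le_rfl, hab⟩, fun y hy => by
      have : y = a := le_antisymm hy.2 hy.1
      simp [this]⟩
    have hbdd : BddAbove S := ⟨b, fun x hx => hx.1.2⟩
    have hne : S.Nonempty := ⟨a, haS⟩
    set x := sSup S with hx
    have hax : a ≤ x := le_csSup hbdd haS
    have hxb : x ≤ b := csSup_le hne fun y hy => hy.1.2
    have hlt : ∀ y, a ≤ y → y < x → f y ≤ f a + (-c + η) * (y - a) := fun y hy hyx => by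
      obtain ⟨w, hw, hyw⟩ := exists_lt_of_lt_csSup hne hyx
      exact hw.2 y ⟨hy, hyw.le⟩
    have hxx : f x ≤ f a + (-c + η) * (x - a) := by
      rcases hax.eq_or_lt with h | h
      · simp [← h]
      · refine le_of_forall_pos_le_add fun θ hθ => ?_
        have h1 := hl x ⟨h, hxb⟩ θ hθ
        have h2 : ∀ᶠ s' in 𝓝[<] x, f x - θ ≤ f a + (-c + η) * (s' - a) := by
          filter_upwards [h1, Ioo_mem_nhdsLT h] with s' h1 h2
          exact h1.trans (hlt s' h2.1.le h2.2)
        have h3 : Tendsto (fun s' => f a + (-c + η) * (s' - a)) (𝓝[<] x)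
            (𝓝 (f a + (-c + η) * (x - a))) :=
          (Continuous.tendsto (by fun_prop) x).mono_left nhdsWithin_le_nhds
        linarith [ge_of_tendsto h3 h2]
    rcases hxb.eq_or_lt with h | h
    · rwa [h] at hxx
    · exfalso
      have h1 := hr x ⟨hax, h⟩ η hη
      have h2 : ∀ᶠ ε in 𝓝[>] (0 : ℝ), ε ∈ Set.Ioo 0 (b - x) := Ioo_mem_nhdsGT (by linarith)
      obtain ⟨ε, hε0, hε⟩ := (mem_nhdsGT_iff_exists_Ioo_subset).1 (h1.and h2)
      have hε0' : 0 < ε := hε0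
      have : x + ε / 2 ∈ S := by
        refine ⟨⟨by linarith, ?_⟩, fun y hy => ?_⟩
        · have := (hε (a := ε / 2) ⟨by linarith, by linarith⟩).2.2
          linarith
        · rcases lt_trichotomy y x with h | h | h
          · exact hlt y hy.1 h
          · rwa [h]
          · have := (hε (a := y - x) ⟨by linarith, by linarith [hy.2]⟩).1
            rw [add_sub_cancel] at this
            linarith
      linarith [le_csSup hbdd this]
  refine le_of_forall_pos_le_add fun θ hθ => ?_
  have := main (θ / (b - a + 1)) (by have := sub_nonneg.2 hab; positivity)
  have h1 : θ / (b - a + 1) * (b - a) ≤ θ := by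
    rw [div_mul_eq_mul_div, div_le_iff₀ (by linarith)]
    nlinarith
  linarith

theorem level_ode {A B : ℝ → ℝ} {s₀ M κ₀ κ₁ κ₀' : ℝ} (hκ₀ : 0 ≤ κ₀) (hκ₁ : 0 ≤ κ₁)
    (hκ : κ₀' ≤ κ₀)
    (hA0 : ∀ s, s₀ < s → 0 ≤ A s) (hB0 : ∀ s, s₀ < s → 0 ≤ B s)
    (hA : ∀ s t, s₀ < s → s ≤ t → A t ≤ A s)
    (hB1 : ∀ s t, s₀ < s → s ≤ t → exp (2 * s) * (A s - A t) ≤ B s - B t)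
    (hB2 : ∀ s t, s₀ < s → s ≤ t → B s - B t ≤ exp (2 * t) * (A s - A t))
    (hAc : ∀ s, s₀ < s → Tendsto A (𝓝[>] s) (𝓝 (A s)))
    (hAM : ∀ s, s₀ < s → M ≤ s → A s = 0) (hBM : ∀ s, s₀ < s → M ≤ s → B s = 0)
    (hpos : ∀ s, s₀ < s → s < M → 0 < κ₁ * B s - κ₀ * A s)
    (hiso : ∀ s, s₀ < s → s < M → ∀ τ > 0, τ < 1 → ∀ᶠ ε in 𝓝[>] (0 : ℝ),
      ε * ((1 - τ) * (4 * π * A (s + ε) - κ₀' * A (s + ε) ^ 2)) ≤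
        (A s - A (s + ε)) * (κ₁ * B s - κ₀ * A (s + ε)))
    {s s₁ : ℝ} (hs : s₀ < s) (hs₁ : s ≤ s₁) :
    2 * exp (2 * s) * (κ₀ - κ₀') * A s₁ ^ 2 * (s₁ - s) ≤
      exp (2 * s) * A s * (4 * π - κ₀ * A s) - B s * (4 * π - κ₁ * B s) := by
  set Q : ℝ → ℝ := fun s => exp (2 * s) * A s * (4 * π - κ₀ * A s) - B s * (4 * π - κ₁ * B s)
    with hQ
  have hπ := Real.pi_pos
  have hpos' : ∀ s, s₀ < s → 0 ≤ κ₁ * B s - κ₀ * A s := fun s h => by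
    rcases lt_or_ge s M with h1 | h1
    · exact (hpos s h h1).le
    · simp [hAM s h h1, hBM s h h1]
  have hB : ∀ s t, s₀ < s → s ≤ t → B t ≤ B s := fun s t h1 h2 => by
    have := hB1 s t h1 h2
    have := mul_nonneg (exp_pos (2 * s)).le (sub_nonneg.2 (hA s t h1 h2))
    linarith
  have left : ∀ s, s₀ < s → ∀ η > 0, ∀ᶠ s' in 𝓝[<] s, Q s - η ≤ Q s' := by
    intro s hs η hη
    set s₁ := (s₀ + s) / 2
    have h1 : s₀ < s₁ := by simp only [s₁]; linarith
    have h2 : s₁ < s := by simp only [s₁]; linarith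
    set C := 4 * π * A s₁ + A s₁ * (κ₁ * (2 * B s₁)) with hC
    have hA1 := hA0 s₁ h1
    have hB1' := hB0 s₁ h1
    have bound : ∀ s', s₁ < s' → s' < s →
        Q s - C * (exp (2 * s) - exp (2 * s')) ≤ Q s' := by
      intro s' h3 h4
      have a0 := hA0 s hs
      have b0 := hB0 s hs
      have a1 := hA s' s (h1.trans h3) h4.le
      have a2 := hA s₁ s' h1 h3.le
      have b1 := hB s' s (h1.trans h3) h4.le
      have b2 := hB s₁ s' h1 h3.le
      have c1 := hB1 s' s (h1.trans h3) h4.le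
      have c2 := hB2 s' s (h1.trans h3) h4.le
      have p1 := hpos' s hs
      have p2 := hpos' s' (h1.trans h3)
      set d := exp (2 * s) - exp (2 * s') with hd
      have d0 : 0 ≤ d := by rw [hd, sub_nonneg]; exact exp_le_exp.2 (by linarith)
      have es := exp_pos (2 * s)
      set r := exp (2 * s) * (A s' - A s) - (B s' - B s) with hr
      have r0 : 0 ≤ r := by linarith
      have r1 : r ≤ d * A s₁ := by
        have : r ≤ d * (A s' - A s) := by rw [hr, hd]; linarith
        refine this.trans (mul_le_mul_of_nonneg_left (by linarith) d0)
      have e : Q s' - Q s = - (d * A s' * (4 * π - κ₀ * A s')) +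
          exp (2 * s) * (A s' - A s) * ((κ₁ * B s - κ₀ * A s) + (κ₁ * B s' - κ₀ * A s')) +
          r * (4 * π - κ₁ * (B s + B s')) := by
        simp only [hQ, hr, hd]; ring
      have t1 : d * A s' * (4 * π - κ₀ * A s') ≤ d * A s₁ * (4 * π) := by
        have : 0 ≤ A s' := by linarith
        have h5 : d * A s' ≤ d * A s₁ := mul_le_mul_of_nonneg_left a2 d0
        have h6 : 0 ≤ d * A s' := mul_nonneg d0 this
        nlinarith [mul_nonneg h6 (mul_nonneg hκ₀ this)]
      have t2 : 0 ≤ exp (2 * s) * (A s' - A s) *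
          ((κ₁ * B s - κ₀ * A s) + (κ₁ * B s' - κ₀ * A s')) :=
        mul_nonneg (mul_nonneg es.le (by linarith)) (by linarith)
      have t3 : -(d * A s₁ * (κ₁ * (2 * B s₁))) ≤ r * (4 * π - κ₁ * (B s + B s')) := by
        have h5 : κ₁ * (B s + B s') ≤ κ₁ * (2 * B s₁) :=
          mul_le_mul_of_nonneg_left (by linarith) hκ₁
        have h6 : r * (κ₁ * (B s + B s')) ≤ (d * A s₁) * (κ₁ * (2 * B s₁)) :=
          mul_le_mul r1 h5 (mul_nonneg hκ₁ (by linarith)) (mul_nonneg d0 hA1)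
        have h7 : 0 ≤ r * (4 * π) := by positivity
        linarith
      have : C * d = d * A s₁ * (4 * π) + d * A s₁ * (κ₁ * (2 * B s₁)) := by rw [hC]; ring
      linarith
    have h3 : Tendsto (fun s' => C * (exp (2 * s) - exp (2 * s'))) (𝓝[<] s) (𝓝 0) := by
      have : Continuous fun s' => C * (exp (2 * s) - exp (2 * s')) := by fun_prop
      have := this.tendsto s
      simp only [sub_self, mul_zero] at this
      exact this.mono_left nhdsWithin_le_nhds
    filter_upwards [h3.eventually_lt_const hη, Ioo_mem_nhdsLT h2] with s' h4 h5
    linarith [bound s' h5.1 h5.2]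
  have right : ∀ s, s₀ < s → s < M → ∀ η > 0, ∀ᶠ ε in 𝓝[>] (0 : ℝ),
      Q (s + ε) - Q s ≤ (-(2 * exp (2 * s) * (κ₀ - κ₀') * A s ^ 2) + η) * ε := by
    intro s hs hsM η hη
    have es := exp_pos (2 * s)
    have hAε : Tendsto (fun ε => A (s + ε)) (𝓝[>] 0) (𝓝 (A s)) := by
      refine (hAc s hs).comp ?_
      refine tendsto_nhdsWithin_iff.2 ⟨?_, ?_⟩
      · have : Continuous fun ε : ℝ => s + ε := by fun_prop
        have := this.tendsto 0
        rw [add_zero] at this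
        exact this.mono_left nhdsWithin_le_nhds
      · filter_upwards [self_mem_nhdsWithin] with ε hε
        exact lt_add_of_pos_right s hε
    have hexp : Tendsto (fun ε => (exp (2 * ε) - 1) / ε) (𝓝[>] 0) (𝓝 2) := by
      have h1 : HasDerivAt (fun ε => exp (2 * ε)) 2 0 := by
        have := ((hasDerivAt_id (0 : ℝ)).const_mul 2).exp
        simpa using this
      have := h1.tendsto_slope_zero_right
      refine this.congr fun ε => ?_
      simp [div_eq_inv_mul]
    -- choice of the tolerance
    obtain ⟨τ, hτ0, hτ1, hτ⟩ : ∃ τ : ℝ, 0 < τ ∧ τ < 1 ∧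
        exp (2 * s) * (2 * (A s * (4 * π - κ₀ * A s)) -
          2 * (1 - τ) * ((1 - τ) * (4 * π * A s - κ₀' * A s ^ 2))) <
          -(2 * exp (2 * s) * (κ₀ - κ₀') * A s ^ 2) + η := by
      have : Continuous fun τ : ℝ => exp (2 * s) * (2 * (A s * (4 * π - κ₀ * A s)) -
          2 * (1 - τ) * ((1 - τ) * (4 * π * A s - κ₀' * A s ^ 2))) := by fun_prop
      have h1 := (this.tendsto 0).mono_left (nhdsWithin_le_nhds (s := Set.Ioi 0))
      have h2 := h1.eventually_lt_const
        (u := -(2 * exp (2 * s) * (κ₀ - κ₀') * A s ^ 2) + η) (by linarith)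
      obtain ⟨τ, h3, h4⟩ := (h2.and (Ioo_mem_nhdsGT (zero_lt_one' ℝ))).exists
      exact ⟨τ, h4.1, h4.2, h3⟩
    have hlim : Tendsto (fun ε => exp (2 * s) * ((exp (2 * ε) - 1) / ε *
        (A (s + ε) * (4 * π - κ₀ * A (s + ε))) -
          2 * (1 - τ) * ((1 - τ) * (4 * π * A (s + ε) - κ₀' * A (s + ε) ^ 2))) +
          4 * π * exp (2 * s) * ((exp (2 * ε) - 1) / ε) * (A s - A (s + ε))) (𝓝[>] 0)
        (𝓝 (exp (2 * s) * (2 * (A s * (4 * π - κ₀ * A s)) -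
          2 * (1 - τ) * ((1 - τ) * (4 * π * A s - κ₀' * A s ^ 2))) +
          4 * π * exp (2 * s) * 2 * (A s - A s))) := by
      refine (Tendsto.const_mul _ ((hexp.mul (hAε.mul ((hAε.const_mul _).const_sub _))).sub
        (Tendsto.const_mul _ (Tendsto.const_mul _ ((hAε.const_mul _).sub
          ((hAε.pow 2).const_mul _)))))).add ((hexp.const_mul _).mul (hAε.const_sub _))
    rw [sub_self, mul_zero, add_zero] at hlim
    have hJ : Tendsto (fun ε => 2 * τ * (κ₁ * B s - κ₀ * A (s + ε)) -
        (κ₁ * exp (2 * (s + ε)) + κ₀) * (A s - A (s + ε))) (𝓝[>] 0)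
        (𝓝 (2 * τ * (κ₁ * B s - κ₀ * A s) - (κ₁ * exp (2 * (s + 0)) + κ₀) * (A s - A s))) := by
      have : Continuous fun ε => κ₁ * exp (2 * (s + ε)) + κ₀ := by fun_prop
      exact (((hAε.const_mul _).const_sub _).const_mul _).sub
        (((this.tendsto 0).mono_left nhdsWithin_le_nhds).mul (hAε.const_sub _))
    have hJ0 : 0 < 2 * τ * (κ₁ * B s - κ₀ * A s) -
        (κ₁ * exp (2 * (s + 0)) + κ₀) * (A s - A s) := by
      rw [sub_self, mul_zero, sub_zero]
      exact mul_pos (by linarith) (hpos s hs hsM)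
    filter_upwards [hiso s hs hsM τ hτ0 hτ1, hlim.eventually_lt_const hτ,
      hJ.eventually_const_lt hJ0, self_mem_nhdsWithin] with ε h1 h2 h3 hε
    have hε : 0 < ε := hε
    have a1 := hA s (s + ε) hs (by linarith)
    have b0 := hB0 (s + ε) (by linarith)
    have b1 := hB s (s + ε) hs (by linarith)
    have c1 := hB1 s (s + ε) hs (by linarith)
    have c2 := hB2 s (s + ε) hs (by linarith)
    rw [show 2 * (s + ε) = 2 * s + 2 * ε by ring, exp_add] at c2 h3
    set A' := A (s + ε)
    set B' := B (s + ε)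
    set x := exp (2 * ε) - 1 with hx
    have hx0 : 0 ≤ x := by rw [hx, sub_nonneg]; exact one_le_exp (by linarith)
    have hex : exp (2 * ε) = x + 1 := by rw [hx]; ring
    set r := (B s - B') - exp (2 * s) * (A s - A') with hr
    have r0 : 0 ≤ r := by linarith
    have r1 : r ≤ exp (2 * s) * x * (A s - A') := by rw [hr]; rw [hex] at c2; linarith
    have e : Q (s + ε) - Q s = exp (2 * s) * (x * (A' * (4 * π - κ₀ * A'))) -
        exp (2 * s) * ((A s - A') * (κ₁ * (B s + B') - κ₀ * (A s + A'))) +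
        r * (4 * π - κ₁ * (B s + B')) := by
      simp only [hQ, hr]
      rw [show 2 * (s + ε) = 2 * s + 2 * ε by ring, exp_add, hex]
      ring
    have t1 : r * (4 * π - κ₁ * (B s + B')) ≤ 4 * π * exp (2 * s) * x * (A s - A') := by
      have : 0 ≤ r * (κ₁ * (B s + B')) := mul_nonneg r0 (mul_nonneg hκ₁ (by linarith))
      nlinarith
    have t2 : 2 * (1 - τ) * (ε * ((1 - τ) * (4 * π * A' - κ₀' * A' ^ 2))) ≤
        (A s - A') * (κ₁ * (B s + B') - κ₀ * (A s + A')) := by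
      have h4 : 2 * (1 - τ) * ((A s - A') * (κ₁ * B s - κ₀ * A')) ≤
          (A s - A') * (κ₁ * (B s + B') - κ₀ * (A s + A')) := by
        have : 2 * (1 - τ) * (κ₁ * B s - κ₀ * A') ≤ κ₁ * (B s + B') - κ₀ * (A s + A') := by
          have := mul_le_mul_of_nonneg_left c2 hκ₁
          linarith
        have := mul_le_mul_of_nonneg_left this (sub_nonneg.2 a1)
        linarith
      exact (mul_le_mul_of_nonneg_left h1 (by linarith)).trans h4
    have t3 := mul_le_mul_of_nonneg_left t2 es.le
    have t4 := mul_le_mul_of_nonneg_right h2.le hε.le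
    have t5 : (exp (2 * s) * (x / ε * (A' * (4 * π - κ₀ * A')) -
          2 * (1 - τ) * ((1 - τ) * (4 * π * A' - κ₀' * A' ^ 2))) +
          4 * π * exp (2 * s) * (x / ε) * (A s - A')) * ε =
        exp (2 * s) * (x * (A' * (4 * π - κ₀ * A'))) -
        exp (2 * s) * (2 * (1 - τ) * (ε * ((1 - τ) * (4 * π * A' - κ₀' * A' ^ 2)))) +
        4 * π * exp (2 * s) * x * (A s - A') := by
      field_simp
    linarith
  have nonneg : ∀ s, s₀ < s → 0 ≤ Q s := fun s hs => by
    rcases le_or_gt M s with h | h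
    · simp [hQ, hAM s hs h, hBM s hs h]
    · have := le_sub_of_right_slope (f := Q) (c := 0) h.le (fun t ht η hη => ?_)
        fun t ht => left t (hs.trans ht.1)
      · have hM := hs.trans h
        have : Q M = 0 := by simp [hQ, hAM M hM le_rfl, hBM M hM le_rfl]
        linarith
      · have ht0 : s₀ < t := hs.trans_le ht.1
        filter_upwards [right t ht0 ht.2 η hη, self_mem_nhdsWithin] with ε h1 hε
        have hε : 0 < ε := hε
        have : 0 ≤ 2 * exp (2 * t) * (κ₀ - κ₀') * A t ^ 2 := by
          have := sub_nonneg.2 hκ; positivity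
        nlinarith
  rcases le_or_gt M s₁ with h | h
  · rw [hAM s₁ (hs.trans_le hs₁) h]
    rw [zero_pow two_ne_zero, mul_zero, zero_mul]
    exact nonneg s hs
  · have := le_sub_of_right_slope (f := Q) (c := 2 * exp (2 * s) * (κ₀ - κ₀') * A s₁ ^ 2) hs₁
      (fun t ht η hη => ?_) fun t ht => left t (hs.trans ht.1)
    · have := nonneg s₁ (hs.trans_le hs₁)
      simp only [hQ] at *
      linarith
    · have ht0 : s₀ < t := hs.trans_le ht.1
      filter_upwards [right t ht0 (ht.2.trans h) η hη, self_mem_nhdsWithin] with ε h1 hε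
      have hε : 0 < ε := hε
      refine h1.trans (mul_le_mul_of_nonneg_right ?_ hε.le)
      have hk := sub_nonneg.2 hκ
      have h2 : exp (2 * s) ≤ exp (2 * t) := exp_le_exp.2 (by linarith [ht.1])
      have h3 : A s₁ ^ 2 ≤ A t ^ 2 :=
        pow_le_pow_left₀ (hA0 s₁ (hs.trans_le hs₁)) (hA t s₁ ht0 ht.2.le) 2
      have h4 : exp (2 * s) * A s₁ ^ 2 ≤ exp (2 * t) * A t ^ 2 :=
        mul_le_mul h2 h3 (sq_nonneg _) (exp_pos _).le
      nlinarith [mul_le_mul_of_nonneg_left h4 hk]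

end LevelODE

section LevelSets

open Filter Topology

/-- A smooth step function whose slope exceeds the optimal one by a factor at most `1 + δ`. -/
theorem exists_smooth_step (s : ℝ) {ε δ : ℝ} (hε : 0 < ε) (hδ : 0 < δ) :
    ∃ η : ℝ → ℝ, ContDiff ℝ ∞ η ∧ (∀ x ≤ s, η x = 0) ∧ (∀ x, s + ε ≤ x → η x = 1) ∧
      (∀ x, 0 ≤ η x) ∧ (∀ x, η x ≤ 1) ∧ (∀ x, 0 ≤ deriv η x) ∧
      (∀ x, deriv η x ≤ (1 + δ) / ε) ∧ (∀ x ≤ s, deriv η x = 0) ∧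
      ∀ x, s + ε ≤ x → deriv η x = 0 := by
  have hr : ε / 2 / (1 + δ) < ε / 2 := by
    rw [div_lt_iff₀ (by linarith)]; nlinarith
  let b : ContDiffBump (s + ε / 2) := ⟨ε / 2 / (1 + δ), ε / 2, by positivity, hr⟩
  set n : ℝ → ℝ := b.normed volume with hn
  have cn : Continuous n := b.continuous_normed
  have ns : Function.support n = Set.Ioo s (s + ε) := by
    rw [hn, b.support_normed_eq, Real.ball_eq_Ioo]
    change Set.Ioo (s + ε / 2 - ε / 2) (s + ε / 2 + ε / 2) = _
    congr 1 <;> ring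
  have n0 : ∀ x, x ∉ Set.Ioo s (s + ε) → n x = 0 := fun x hx => by
    rwa [← ns, Function.notMem_support] at hx
  have nn : ∀ x, 0 ≤ n x := fun x => b.nonneg_normed x
  set η : ℝ → ℝ := fun x => ∫ t in s..x, n t with hη
  have hd : ∀ x, HasDerivAt η (n x) x := fun x =>
    intervalIntegral.integral_hasDerivAt_right (cn.intervalIntegrable _ _)
      cn.stronglyMeasurable.stronglyMeasurableAtFilter cn.continuousAt
  have hd' : deriv η = n := funext fun x => (hd x).deriv
  have h0 : ∀ x ≤ s, η x = 0 := fun x hx => by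
    simp only [hη]
    rw [intervalIntegral.integral_congr (g := fun _ => (0 : ℝ)), intervalIntegral.integral_zero]
    intro t ht
    rw [Set.uIcc_of_ge hx] at ht
    exact n0 t fun h => absurd h.1 (not_lt.2 ht.2)
  have h1 : ∀ x, s + ε ≤ x → η x = 1 := fun x hx => by
    simp only [hη]
    rw [intervalIntegral.integral_eq_integral_of_support_subset, b.integral_normed]
    rw [ns]
    exact fun t ht => ⟨ht.1, ht.2.le.trans hx⟩
  have mono : Monotone η := monotone_of_deriv_nonneg (fun x => (hd x).differentiableAt)
    fun x => by rw [hd']; exact nn x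
  refine ⟨η, ?_, h0, h1, fun x => ?_, fun x => ?_, fun x => by rw [hd']; exact nn x,
    fun x => ?_, fun x hx => ?_, fun x hx => ?_⟩
  · rw [contDiff_infty_iff_deriv, hd']
    exact ⟨fun x => (hd x).differentiableAt, b.contDiff_normed⟩
  · rcases le_total x s with h | h
    · exact (h0 x h).ge
    · rw [← h0 s le_rfl]; exact mono h
  · rcases le_total x (s + ε) with h | h
    · rw [← h1 (s + ε) le_rfl]; exact mono h
    · exact (h1 x h).le
  · rw [hd']
    refine (b.normed_le_div_measure_closedBall_rIn volume x).trans_eq ?_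
    have hp : 0 ≤ 2 * (ε / 2 / (1 + δ)) := by positivity
    rw [measureReal_def, Real.volume_closedBall]
    change 1 / (ENNReal.ofReal (2 * (ε / 2 / (1 + δ)))).toReal = _
    rw [ENNReal.toReal_ofReal hp]
    field_simp
  · rw [hd']; exact n0 x fun h => absurd h.1 (not_lt.2 hx)
  · rw [hd']; exact n0 x fun h => absurd h.2 (not_lt.2 hx)

/-- A function that is smooth at every point of its support is smooth. -/
theorem contDiff_of_forall_tsupport {E F : Type*} [NormedAddCommGroup E] [NormedSpace ℝ E]
    [NormedAddCommGroup F] [NormedSpace ℝ F] {f : E → F} {n : WithTop ℕ∞}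
    (h : ∀ z ∈ tsupport f, ContDiffAt ℝ n f z) : ContDiff ℝ n f := by
  refine contDiff_iff_contDiffAt.2 fun z => ?_
  by_cases hz : z ∈ tsupport f
  · exact h z hz
  · exact (contDiffAt_const (c := (0 : F))).congr_of_eventuallyEq
      (notMem_tsupport_iff_eventuallyEq.1 hz)

variable {O : Set ℂ} {v ρ : ℂ → ℝ}

/-- Functions of `v` vanishing below a compact superlevel set extend by zero to the plane. -/
theorem level_cutoff {n : WithTop ℕ∞} (hO : IsOpen O) (hv : ∀ z ∈ O, ContDiffAt ℝ n v z) {s : ℝ}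
    (hK : IsCompact {z | z ∈ O ∧ s ≤ v z}) {F : ℝ → ℝ} (hF : ContDiff ℝ n F)
    (hF0 : ∀ x ≤ s, F x = 0) :
    ContDiff ℝ n (O.indicator (F ∘ v)) ∧ HasCompactSupport (O.indicator (F ∘ v)) ∧
      tsupport (O.indicator (F ∘ v)) ⊆ {z | z ∈ O ∧ s ≤ v z} := by
  have hs : tsupport (O.indicator (F ∘ v)) ⊆ {z | z ∈ O ∧ s ≤ v z} := by
    refine closure_minimal (fun z hz => ?_) hK.isClosed
    have hzO : z ∈ O := Set.mem_of_indicator_ne_zero hz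
    refine ⟨hzO, le_of_not_ge fun h => hz ?_⟩
    rw [Set.indicator_of_mem hzO]
    exact hF0 _ h
  refine ⟨contDiff_of_forall_tsupport fun z hz => ?_, hK.of_isClosed_subset (isClosed_tsupport _) hs, hs⟩
  have hzO := (hs hz).1
  refine (hF.contDiffAt.comp z (hv z hzO)).congr_of_eventuallyEq ?_
  filter_upwards [hO.mem_nhds hzO] with w hw
  rw [Set.indicator_of_mem hw]

theorem isOpen_superlevel (hO : IsOpen O) (hv : ∀ z ∈ O, ContinuousAt v z) (s : ℝ) :
    IsOpen {z | z ∈ O ∧ s < v z} := by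
  refine isOpen_iff_mem_nhds.2 fun z hz => ?_
  filter_upwards [hO.mem_nhds hz.1, (hv z hz.1).eventually_const_lt hz.2] with w h1 h2
  exact ⟨h1, h2⟩

theorem integrableOn_superlevel {s : ℝ} (hK : IsCompact {z | z ∈ O ∧ s ≤ v z})
    (hρ : ∀ z ∈ O, ContinuousAt ρ z) : IntegrableOn ρ {z | z ∈ O ∧ s < v z} :=
  (ContinuousOn.integrableOn_compact hK fun z hz => (hρ z hz.1).continuousWithinAt).mono_set
    fun _ hz => ⟨hz.1, hz.2.le⟩

theorem dx_comp {F : ℝ → ℝ} {z : ℂ} (hF : DifferentiableAt ℝ F (v z))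
    (hv : DifferentiableAt ℝ v z) : dx (F ∘ v) z = deriv F (v z) * dx v z := by
  simp only [dx, fderiv_comp z hF hv, ContinuousLinearMap.comp_apply]
  rw [← toSpanSingleton_deriv]
  simp [mul_comm]

theorem dy_comp {F : ℝ → ℝ} {z : ℂ} (hF : DifferentiableAt ℝ F (v z))
    (hv : DifferentiableAt ℝ v z) : dy (F ∘ v) z = deriv F (v z) * dy v z := by
  simp only [dy, fderiv_comp z hF hv, ContinuousLinearMap.comp_apply]
  rw [← toSpanSingleton_deriv]
  simp [mul_comm]

theorem level_energy (hO : IsOpen O) (hv : ∀ z ∈ O, ContDiffAt ℝ ∞ v z)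
    (hρ : ∀ z ∈ O, ContinuousAt ρ z) {s ε κ₀ κ₁ C : ℝ} (hκ₀ : 0 ≤ κ₀) (hκ₁ : 0 ≤ κ₁)
    (hε : 0 < ε) (hK : IsCompact {z | z ∈ O ∧ s ≤ v z})
    (flux : ∀ z ∈ O, s < v z → -lapC v z ≤ κ₁ * (ρ z ^ 2 * exp (2 * v z)) - κ₀ * ρ z ^ 2)
    (iso : ∀ φ : ℂ → ℝ, ContDiff ℝ ∞ φ → (∀ z, 0 ≤ φ z) → tsupport φ ⊆ {z | z ∈ O ∧ s ≤ v z} →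
      (∀ z ∈ O, s + ε < v z → φ z = 1) → C ≤ (∫ z, ρ z * gradN φ z) ^ 2) :
    ε * C ≤ ((∫ z in {z | z ∈ O ∧ s < v z}, ρ z ^ 2) - ∫ z in {z | z ∈ O ∧ s + ε < v z}, ρ z ^ 2) *
      (κ₁ * (∫ z in {z | z ∈ O ∧ s < v z}, ρ z ^ 2 * exp (2 * v z)) -
        κ₀ * ∫ z in {z | z ∈ O ∧ s + ε < v z}, ρ z ^ 2) := by
  have cv : ∀ z ∈ O, ContinuousAt v z := fun z hz => (hv z hz).continuousAt
  set L : ℝ → Set ℂ := fun s => {z | z ∈ O ∧ s < v z} with hL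
  have mL : ∀ s, MeasurableSet (L s) := fun s => (isOpen_superlevel hO cv s).measurableSet
  have LL : L (s + ε) ⊆ L s := fun z hz => ⟨hz.1, by have := hz.2; linarith⟩
  have cρ2 : ∀ z ∈ O, ContinuousAt (fun z => ρ z ^ 2) z := fun z hz => (hρ z hz).pow 2
  have ce : ∀ z ∈ O, ContinuousAt (fun z => ρ z ^ 2 * exp (2 * v z)) z := fun z hz =>
    (cρ2 z hz).mul (continuous_exp.continuousAt.comp ((cv z hz).const_mul 2))
  have iA := integrableOn_superlevel hK cρ2
  have iB := integrableOn_superlevel hK ce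
  have iA' : IntegrableOn (fun z => ρ z ^ 2) (L (s + ε)) := iA.mono_set LL
  set X := (∫ z in L s, ρ z ^ 2) - ∫ z in L (s + ε), ρ z ^ 2 with hX
  set Y := κ₁ * (∫ z in L s, ρ z ^ 2 * exp (2 * v z)) - κ₀ * ∫ z in L (s + ε), ρ z ^ 2 with hY
  have key : ∀ δ > 0, C ≤ (1 + δ) / ε * X * Y := by
    intro δ hδ
    obtain ⟨η, ηs, η0, η1, ηn, ηl, dn, dl, d0, d1⟩ := exists_smooth_step s hε hδ
    have ηd : Differentiable ℝ η := ηs.differentiable (by simp)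
    have dηs : ContDiff ℝ ∞ (deriv η) := (contDiff_infty_iff_deriv.1 ηs).2
    obtain ⟨φs, φc, φK⟩ := level_cutoff hO hv hK ηs η0
    obtain ⟨ψs, ψc, ψK⟩ := level_cutoff hO hv hK dηs d0
    set φ := O.indicator (η ∘ v) with hφ
    set ψ := O.indicator (deriv η ∘ v) with hψ
    have φO : ∀ z ∈ O, φ z = η (v z) := fun z hz => Set.indicator_of_mem hz _
    have ψO : ∀ z ∈ O, ψ z = deriv η (v z) := fun z hz => Set.indicator_of_mem hz _
    have ψn : ∀ z, 0 ≤ ψ z := fun z => Set.indicator_nonneg (fun z _ => dn (v z)) z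
    have φn : ∀ z, 0 ≤ φ z := fun z => Set.indicator_nonneg (fun z _ => ηn (v z)) z
    have gr : ∀ z, dx φ z = ψ z * dx v z ∧ dy φ z = ψ z * dy v z := fun z => by
      by_cases hz : z ∈ O
      · have e : φ =ᶠ[𝓝 z] η ∘ v := by
          filter_upwards [hO.mem_nhds hz] with w hw
          exact φO w hw
        have dv : DifferentiableAt ℝ v z := (hv z hz).differentiableAt (by simp)
        rw [ψO z hz, ← dx_comp (ηd _) dv, ← dy_comp (ηd _) dv]
        simp only [dx, dy, e.fderiv_eq, and_self]
      · have h1 : ψ z = 0 := Set.indicator_of_notMem hz _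
        have h2 : z ∉ tsupport φ := fun h => hz (φK h).1
        rw [h1, zero_mul, zero_mul]
        exact ⟨image_eq_zero_of_notMem_tsupport fun h => h2 (tsupport_dx_subset _ h),
          image_eq_zero_of_notMem_tsupport fun h => h2 (tsupport_dy_subset _ h)⟩
    have gN : ∀ z, gradN φ z = ψ z * gradN v z := fun z => by
      rw [gradN, (gr z).1, (gr z).2, mul_pow, mul_pow, ← mul_add, sqrt_mul (sq_nonneg _),
        sqrt_sq (ψn z), gradN]
    have cg : ∀ z ∈ O, ContinuousAt (gradN v) z := fun z hz =>
      (((((hv z hz).dx (m := 0) (by simp)).continuousAt).pow 2).add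
        ((((hv z hz).dy (m := 0) (by simp)).continuousAt).pow 2)).sqrt
    have i1 : Integrable fun z => ψ z * ρ z ^ 2 :=
      integrable_mul_of_compact ψs.continuous ψc fun z hz => cρ2 z (ψK hz).1
    have i2 : Integrable fun z => ψ z * (ρ z * gradN v z) :=
      integrable_mul_of_compact ψs.continuous ψc fun z hz =>
        (hρ z (ψK hz).1).mul (cg z (ψK hz).1)
    have i3 : Integrable fun z => ψ z * gradN v z ^ 2 :=
      integrable_mul_of_compact ψs.continuous ψc fun z hz => (cg z (ψK hz).1).pow 2
    -- the first factor
    have b1 : ∫ z, ψ z * ρ z ^ 2 ≤ (1 + δ) / ε * X := by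
      have hXe : X = ∫ z in L s \ L (s + ε), ρ z ^ 2 := by
        rw [setIntegral_sdiff (mL _) iA LL]
      rw [hXe, ← integral_const_mul, ← integral_indicator ((mL _).diff (mL _))]
      refine integral_mono i1 (IntegrableOn.integrable_indicator
        ((iA.mono_set Set.sdiff_subset).const_mul _) ((mL _).diff (mL _))) fun z => ?_
      by_cases hz : z ∈ L s \ L (s + ε)
      · rw [Set.indicator_of_mem hz]
        dsimp only
        rw [ψO z hz.1.1]
        exact mul_le_mul_of_nonneg_right (dl _) (sq_nonneg _)
      · rw [Set.indicator_of_notMem hz]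
        have : ψ z = 0 := by
          by_cases hzO : z ∈ O
          · rw [ψO z hzO]
            by_cases h : s < v z
            · refine d1 _ (le_of_lt ?_)
              by_contra h'
              exact hz ⟨⟨hzO, h⟩, fun h2 => h' h2.2⟩
            · exact d0 _ (not_lt.1 h)
          · exact Set.indicator_of_notMem hzO _
        simp [this]
    -- the second factor
    have b2 : ∫ z, ψ z * gradN v z ^ 2 ≤ Y := by
      have e1 : ∫ z, ψ z * gradN v z ^ 2 = ∫ z, (dx φ z * dx v z + dy φ z * dy v z) := by
        congr 1
        ext z
        rw [(gr z).1, (gr z).2, gradN, sq_sqrt (by positivity)]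
        ring
      rw [e1, integral_grad_mul_grad (φs.of_le (by norm_cast)) φc fun z hz =>
        (hv z (φK hz).1).of_le (by norm_cast), ← integral_neg, hY, ← integral_const_mul,
        ← integral_const_mul, ← integral_indicator (mL _), ← integral_indicator (mL _),
        ← integral_sub]
      · refine integral_mono ?_ ?_ fun z => ?_
        · exact (integrable_mul_of_compact φs.continuous φc fun z hz =>
            continuousAt_lapC ((hv z (φK hz).1).of_le (by norm_cast))).neg
        · exact (IntegrableOn.integrable_indicator (iB.const_mul _) (mL _)).sub
            (IntegrableOn.integrable_indicator (iA'.const_mul _) (mL _))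
        · by_cases hz : z ∈ L s
          · have f := flux z hz.1 hz.2
            have h1 := ηl (v z)
            have h2 := ηn (v z)
            have p1 : 0 ≤ κ₁ * (ρ z ^ 2 * exp (2 * v z)) := by positivity
            have p2 : 0 ≤ κ₀ * ρ z ^ 2 := by positivity
            dsimp only
            rw [Set.indicator_of_mem hz, φO z hz.1]
            by_cases hz' : z ∈ L (s + ε)
            · rw [Set.indicator_of_mem hz', η1 _ hz'.2.le]
              linarith
            · rw [Set.indicator_of_notMem hz']
              have := mul_le_mul_of_nonneg_left f h2
              have := mul_le_mul_of_nonneg_right h1 p1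
              have := mul_nonneg h2 p2
              linarith
          · dsimp only
            rw [Set.indicator_of_notMem hz, Set.indicator_of_notMem fun h => hz (LL h)]
            have : φ z = 0 := by
              by_cases hzO : z ∈ O
              · rw [φO z hzO]
                exact η0 _ (not_lt.1 fun h => hz ⟨hzO, h⟩)
              · exact Set.indicator_of_notMem hzO _
            simp [this]
      · exact IntegrableOn.integrable_indicator (iB.const_mul _) (mL _)
      · exact IntegrableOn.integrable_indicator (iA'.const_mul _) (mL _)
    -- Cauchy-Schwarz
    have cs : (∫ z, ψ z * (ρ z * gradN v z)) ^ 2 ≤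
        (∫ z, ψ z * ρ z ^ 2) * ∫ z, ψ z * gradN v z ^ 2 := by
      have := discrim_le_zero (a := ∫ z, ψ z * ρ z ^ 2)
        (b := -2 * ∫ z, ψ z * (ρ z * gradN v z)) (c := ∫ z, ψ z * gradN v z ^ 2) fun t => by
          have h : 0 ≤ ∫ z, ψ z * (t * ρ z - gradN v z) ^ 2 :=
            integral_nonneg fun z => mul_nonneg (ψn z) (sq_nonneg _)
          have e : ∫ z, ψ z * (t * ρ z - gradN v z) ^ 2 =
              ∫ z, (t * t * (ψ z * ρ z ^ 2) - 2 * t * (ψ z * (ρ z * gradN v z))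
                + ψ z * gradN v z ^ 2) := by
            congr 1; ext z; ring
          have e2 := integral_add ((i1.const_mul (t * t)).sub (i2.const_mul (2 * t))) i3
          simp only [Pi.sub_apply] at e2
          rw [e, e2, integral_sub (i1.const_mul _) (i2.const_mul _), integral_const_mul,
            integral_const_mul] at h
          linarith
      rw [discrim] at this
      linarith
    have h := iso φ φs φn φK fun z hz hvz => by rw [φO z hz]; exact η1 _ hvz.le
    have e : ∫ z, ρ z * gradN φ z = ∫ z, ψ z * (ρ z * gradN v z) := by
      congr 1; ext z; rw [gN]; ring
    rw [e] at h
    have n2 : 0 ≤ ∫ z, ψ z * gradN v z ^ 2 :=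
      integral_nonneg fun z => mul_nonneg (ψn z) (sq_nonneg _)
    have n1 : 0 ≤ ∫ z, ψ z * ρ z ^ 2 :=
      integral_nonneg fun z => mul_nonneg (ψn z) (sq_nonneg _)
    exact h.trans (cs.trans (mul_le_mul b1 b2 n2 (n1.trans b1)))
  have lim : Tendsto (fun δ : ℝ => (1 + δ) / ε * X * Y) (𝓝[>] 0) (𝓝 ((1 + 0) / ε * X * Y)) := by
    have : Continuous fun δ : ℝ => (1 + δ) / ε * X * Y := by fun_prop
    exact (this.tendsto 0).mono_left nhdsWithin_le_nhds
  have := ge_of_tendsto lim (by filter_upwards [self_mem_nhdsWithin] with δ hδ using key δ hδ)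
  have h2 : ε * ((1 + 0) / ε * X * Y) = X * Y := by field_simp; ring
  rw [← h2]
  exact mul_le_mul_of_nonneg_left this hε.le

theorem level_set_inequality (hO : IsOpen O) (hv : ∀ z ∈ O, ContDiffAt ℝ ∞ v z)
    (hρ : ∀ z ∈ O, ContinuousAt ρ z) (hρ0 : ∀ z ∈ O, 0 < ρ z) {s₀ κ₀ κ₁ κ₀' : ℝ} (hκ₀ : 0 ≤ κ₀)
    (hκ₁ : 0 ≤ κ₁) (hκ : κ₀' ≤ κ₀) (hK : ∀ s, s₀ < s → IsCompact {z | z ∈ O ∧ s ≤ v z})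
    (flux : ∀ z ∈ O, s₀ < v z → -lapC v z ≤ κ₁ * (ρ z ^ 2 * exp (2 * v z)) - κ₀ * ρ z ^ 2)
    (hpos : ∀ s, s₀ < s → 0 < ∫ z in {z | z ∈ O ∧ s < v z}, ρ z ^ 2 →
      0 < κ₁ * (∫ z in {z | z ∈ O ∧ s < v z}, ρ z ^ 2 * exp (2 * v z)) -
        κ₀ * ∫ z in {z | z ∈ O ∧ s < v z}, ρ z ^ 2)
    (iso : ∀ s, s₀ < s → ∀ τ > 0, τ < 1 → ∀ᶠ ε in 𝓝[>] (0 : ℝ), ∀ φ : ℂ → ℝ, ContDiff ℝ ∞ φ →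
      (∀ z, 0 ≤ φ z) → tsupport φ ⊆ {z | z ∈ O ∧ s ≤ v z} →
      (∀ z ∈ O, s + ε < v z → φ z = 1) →
      (1 - τ) * (4 * π * (∫ z in {z | z ∈ O ∧ s + ε < v z}, ρ z ^ 2) -
        κ₀' * (∫ z in {z | z ∈ O ∧ s + ε < v z}, ρ z ^ 2) ^ 2) ≤ (∫ z, ρ z * gradN φ z) ^ 2)
    {s s₁ : ℝ} (hs : s₀ < s) (hs₁ : s ≤ s₁) :
    2 * exp (2 * s) * (κ₀ - κ₀') * (∫ z in {z | z ∈ O ∧ s₁ < v z}, ρ z ^ 2) ^ 2 * (s₁ - s) ≤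
      exp (2 * s) * (∫ z in {z | z ∈ O ∧ s < v z}, ρ z ^ 2) *
        (4 * π - κ₀ * ∫ z in {z | z ∈ O ∧ s < v z}, ρ z ^ 2) -
      (∫ z in {z | z ∈ O ∧ s < v z}, ρ z ^ 2 * exp (2 * v z)) *
        (4 * π - κ₁ * ∫ z in {z | z ∈ O ∧ s < v z}, ρ z ^ 2 * exp (2 * v z)) := by
  have cv : ∀ z ∈ O, ContinuousAt v z := fun z hz => (hv z hz).continuousAt
  set L : ℝ → Set ℂ := fun s => {z | z ∈ O ∧ s < v z} with hL
  have oL : ∀ s, IsOpen (L s) := fun s => isOpen_superlevel hO cv s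
  have mL : ∀ s, MeasurableSet (L s) := fun s => (oL s).measurableSet
  have LL : ∀ s t, s ≤ t → L t ⊆ L s := fun s t h z hz => ⟨hz.1, h.trans_lt hz.2⟩
  have cρ2 : ∀ z ∈ O, ContinuousAt (fun z => ρ z ^ 2) z := fun z hz => (hρ z hz).pow 2
  have ce : ∀ z ∈ O, ContinuousAt (fun z => ρ z ^ 2 * exp (2 * v z)) z := fun z hz =>
    (cρ2 z hz).mul (continuous_exp.continuousAt.comp ((cv z hz).const_mul 2))
  have iA : ∀ s, s₀ < s → IntegrableOn (fun z => ρ z ^ 2) (L s) := fun s hs =>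
    integrableOn_superlevel (hK s hs) cρ2
  have iB : ∀ s, s₀ < s → IntegrableOn (fun z => ρ z ^ 2 * exp (2 * v z)) (L s) := fun s hs =>
    integrableOn_superlevel (hK s hs) ce
  set A : ℝ → ℝ := fun s => ∫ z in L s, ρ z ^ 2 with hA
  set B : ℝ → ℝ := fun s => ∫ z in L s, ρ z ^ 2 * exp (2 * v z) with hB
  change 2 * exp (2 * s) * (κ₀ - κ₀') * A s₁ ^ 2 * (s₁ - s) ≤
    exp (2 * s) * A s * (4 * π - κ₀ * A s) - B s * (4 * π - κ₁ * B s)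
  rcases (L s).eq_empty_or_nonempty with he | ⟨w, hw⟩
  · have e1 : A s = 0 := by simp [hA, he]
    have e2 : B s = 0 := by simp [hB, he]
    have e3 : A s₁ = 0 := by simp [hA, Set.subset_eq_empty (LL s s₁ hs₁) he]
    simp [e1, e2, e3]
  obtain ⟨m, hm, hmax⟩ := (hK s hs).exists_isMaxOn ⟨w, hw.1, hw.2.le⟩
    (f := v) fun z hz => (cv z hz.1).continuousWithinAt
  have hM : ∀ t, v m ≤ t → L t = ∅ := fun t ht => by
    refine Set.eq_empty_iff_forall_notMem.2 fun z hz => ?_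
    have h1 : v m < v z := ht.trans_lt hz.2
    exact absurd (hmax ⟨hz.1, hm.2.trans h1.le⟩) (not_le.2 h1)
  have sub : ∀ s t, s₀ < s → s ≤ t → A s - A t = ∫ z in L s \ L t, ρ z ^ 2 := fun s t h1 h2 => by
    rw [setIntegral_sdiff (mL _) (iA s h1) (LL s t h2)]
  have sub' : ∀ s t, s₀ < s → s ≤ t →
      B s - B t = ∫ z in L s \ L t, ρ z ^ 2 * exp (2 * v z) := fun s t h1 h2 => by
    rw [setIntegral_sdiff (mL _) (iB s h1) (LL s t h2)]
  have hApos : ∀ t, s₀ < t → t < v m → 0 < A t := fun t h1 h2 => by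
    rw [hA, setIntegral_pos_iff_support_of_nonneg_ae
      (Filter.Eventually.of_forall fun z => sq_nonneg _) (iA t h1)]
    refine lt_of_lt_of_le ((oL t).measure_pos volume ⟨m, hm.1, h2⟩) (measure_mono fun z hz => ?_)
    exact ⟨(pow_pos (hρ0 z hz.1) 2).ne', hz⟩
  refine level_ode (M := v m) hκ₀ hκ₁ hκ (fun s _ => integral_nonneg fun z => sq_nonneg _)
    (fun s _ => integral_nonneg fun z => by positivity) (fun s t h1 h2 => ?_) (fun s t h1 h2 => ?_)
    (fun s t h1 h2 => ?_) (fun s h1 => ?_) (fun s _ h => by change ∫ z in L s, _ = 0; simp [hM s h])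
    (fun s _ h => by change ∫ z in L s, _ = 0; simp [hM s h]) (fun s h1 h2 => hpos s h1 (hApos s h1 h2))
    (fun s h1 h2 τ hτ hτ1 => ?_) hs hs₁
  · exact setIntegral_mono_set (iA s h1) (Filter.Eventually.of_forall fun z => sq_nonneg _)
      (LL s t h2).eventuallyLE
  · rw [sub s t h1 h2, sub' s t h1 h2, ← integral_const_mul]
    refine setIntegral_mono_on (((iA s h1).mono_set Set.sdiff_subset).const_mul _)
      ((iB s h1).mono_set Set.sdiff_subset) ((mL _).diff (mL _)) fun z hz => ?_
    rw [mul_comm]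
    exact mul_le_mul_of_nonneg_left (exp_le_exp.2 (by linarith [hz.1.2])) (sq_nonneg _)
  · rw [sub s t h1 h2, sub' s t h1 h2, ← integral_const_mul]
    refine setIntegral_mono_on ((iB s h1).mono_set Set.sdiff_subset)
      (((iA s h1).mono_set Set.sdiff_subset).const_mul _) ((mL _).diff (mL _)) fun z hz => ?_
    rw [mul_comm (exp (2 * t))]
    refine mul_le_mul_of_nonneg_left (exp_le_exp.2 ?_) (sq_nonneg _)
    have : v z ≤ t := not_lt.1 fun h => hz.2 ⟨hz.1.1, h⟩
    linarith
  · change Tendsto (fun s => ∫ z in L s, ρ z ^ 2) (𝓝[>] s) (𝓝 (∫ z in L s, ρ z ^ 2))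
    simp_rw [← integral_indicator (mL _)]
    refine tendsto_integral_filter_of_dominated_convergence
      ((L s).indicator fun z => ρ z ^ 2) ?_ ?_ ((iA s h1).integrable_indicator (mL s)) ?_
    · filter_upwards [self_mem_nhdsWithin] with t ht
      exact ((iA t (h1.trans ht)).integrable_indicator (mL t)).aestronglyMeasurable
    · filter_upwards [self_mem_nhdsWithin] with t ht
      refine Filter.Eventually.of_forall fun z => ?_
      rw [Real.norm_of_nonneg (Set.indicator_nonneg (fun z _ => sq_nonneg _) z)]
      exact Set.indicator_le_indicator_of_subset (LL s t (le_of_lt ht)) (fun z => sq_nonneg _) z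
    · refine Filter.Eventually.of_forall fun z => ?_
      by_cases hz : z ∈ L s
      · refine tendsto_const_nhds.congr' ?_
        filter_upwards [Ioo_mem_nhdsGT hz.2] with t ht
        rw [Set.indicator_of_mem hz, Set.indicator_of_mem (show z ∈ L t from ⟨hz.1, ht.2⟩)]
      · refine tendsto_const_nhds.congr' ?_
        filter_upwards [self_mem_nhdsWithin] with t ht
        rw [Set.indicator_of_notMem hz, Set.indicator_of_notMem fun h => hz (LL s t (le_of_lt ht) h)]
  · filter_upwards [iso s h1 τ hτ hτ1, self_mem_nhdsWithin] with ε h3 hε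
    exact level_energy hO hv hρ hκ₀ hκ₁ hε (hK s h1)
      (fun z hz h => flux z hz (h1.trans h)) h3

end LevelSets

theorem IsLocalMin.deriv_deriv_nonneg {g : ℝ → ℝ} {x : ℝ} (h : IsLocalMin g x)
    (hc : ContinuousAt g x) : 0 ≤ deriv (deriv g) x := by
  by_contra! hn
  have hmax := isLocalMax_of_deriv_deriv_neg hn h.deriv_eq_zero hc
  have he : g =ᶠ[nhds x] fun _ => g x := by
    filter_upwards [h, hmax] with y h1 h2 using le_antisymm h2 h1
  have : deriv (deriv g) x = 0 := by
    rw [he.deriv.deriv_eq]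
    simp
  exact hn.ne this

theorem fderiv_fderiv_apply_nonneg {f : ℂ → ℝ} {z : ℂ} (hf : ContDiffAt ℝ 2 f z)
    (h : IsLocalMin f z) (v : ℂ) : 0 ≤ fderiv ℝ (fun w => fderiv ℝ f w v) z v := by
  have hl : ∀ t : ℝ, HasDerivAt (fun t : ℝ => z + t • v) v t := fun t => by
    simpa using ((hasDerivAt_id t).smul_const v).const_add z
  have hct : Filter.Tendsto (fun t : ℝ => z + t • v) (nhds 0) (nhds z) := by
    simpa using (hl 0).continuousAt.tendsto
  have h1 : (deriv fun t : ℝ => f (z + t • v)) =ᶠ[nhds 0] fun t => fderiv ℝ f (z + t • v) v := by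
    filter_upwards [hct.eventually (hf.eventually (by simp))] with t ht
    exact ((ht.differentiableAt (by simp)).hasFDerivAt.comp_hasDerivAt t (hl t)).deriv
  have hd : DifferentiableAt ℝ (fun w => fderiv ℝ f w v) (z + (0 : ℝ) • v) := by
    have := (hf.fderiv_right (m := 1) (by norm_num)).clm_apply (contDiffAt_const (c := v))
    simpa using this.differentiableAt (by simp)
  have h2 : deriv (deriv fun t : ℝ => f (z + t • v)) 0 = fderiv ℝ (fun w => fderiv ℝ f w v) z v := by
    rw [h1.deriv_eq]
    have := (hd.hasFDerivAt.comp_hasDerivAt (0 : ℝ) (hl 0)).deriv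
    rw [zero_smul, add_zero] at this
    exact this
  rw [← h2]
  rw [← show z + (0 : ℝ) • v = z by simp] at h
  refine IsLocalMin.deriv_deriv_nonneg
    (IsLocalMin.comp_continuous (g := fun t : ℝ => z + t • v) h (hl 0).continuousAt) ?_
  exact ContinuousAt.comp (f := fun t : ℝ => z + t • v) (by simpa using hf.continuousAt)
    (hl 0).continuousAt

theorem lapC_nonneg_of_isLocalMin {f : ℂ → ℝ} {z : ℂ} (hf : ContDiffAt ℝ 2 f z)
    (h : IsLocalMin f z) : 0 ≤ lapC f z :=
  add_nonneg (fderiv_fderiv_apply_nonneg hf h 1) (fderiv_fderiv_apply_nonneg hf h Complex.I)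

theorem lapC_add {f g : ℂ → ℝ} {z : ℂ} (hf : ContDiffAt ℝ 2 f z) (hg : ContDiffAt ℝ 2 g z) :
    lapC (fun w => f w + g w) z = lapC f z + lapC g z := by
  have hd : ∀ v : ℂ, fderiv ℝ (fun w => fderiv ℝ (fun w => f w + g w) w v) z v =
      fderiv ℝ (fun w => fderiv ℝ f w v) z v + fderiv ℝ (fun w => fderiv ℝ g w v) z v := by
    intro v
    have e : (fun w => fderiv ℝ (fun w => f w + g w) w v) =ᶠ[nhds z]
        fun w => fderiv ℝ f w v + fderiv ℝ g w v := by
      filter_upwards [hf.eventually (by simp), hg.eventually (by simp)] with w h1 h2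
      rw [fderiv_fun_add (h1.differentiableAt (by simp)) (h2.differentiableAt (by simp))]
      rfl
    have i1 := ((hf.fderiv_right (m := 1) (by norm_num)).clm_apply
      (contDiffAt_const (c := v))).differentiableAt (by simp)
    have i2 := ((hg.fderiv_right (m := 1) (by norm_num)).clm_apply
      (contDiffAt_const (c := v))).differentiableAt (by simp)
    rw [e.fderiv_eq, fderiv_fun_add i1 i2]
    rfl
  have h1 := hd 1
  have h2 := hd Complex.I
  change fderiv ℝ (fun w => fderiv ℝ (fun w => f w + g w) w 1) z 1 +
    fderiv ℝ (fun w => fderiv ℝ (fun w => f w + g w) w Complex.I) z Complex.I = _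
  rw [h1, h2]
  change _ = (fderiv ℝ (fun w => fderiv ℝ f w 1) z 1 + fderiv ℝ (fun w => fderiv ℝ f w Complex.I) z Complex.I)
    + (fderiv ℝ (fun w => fderiv ℝ g w 1) z 1 + fderiv ℝ (fun w => fderiv ℝ g w Complex.I) z Complex.I)
  ring

theorem lapC_const_mul {f : ℂ → ℝ} (c : ℝ) (z : ℂ) :
    lapC (fun w => c * f w) z = c * lapC f z := by
  have hd : ∀ v : ℂ, fderiv ℝ (fun w => fderiv ℝ (fun w => c * f w) w v) z v =
      c * fderiv ℝ (fun w => fderiv ℝ f w v) z v := by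
    intro v
    have e : (fun w => fderiv ℝ (fun w => c * f w) w v) =
        fun w => c * fderiv ℝ f w v := by
      funext w
      have := congrFun (fderiv_const_smul_field (𝕜 := ℝ) (f := f) c) w
      change fderiv ℝ (fun w => c * f w) w = _ at this
      rw [this]; rfl
    rw [e]
    have := congrFun (fderiv_const_smul_field (𝕜 := ℝ) (f := fun w => fderiv ℝ f w v) c) z
    change fderiv ℝ (fun w => c * fderiv ℝ f w v) z = _ at this
    rw [this]; rfl
  have h1 := hd 1
  have h2 := hd Complex.I
  change fderiv ℝ (fun w => fderiv ℝ (fun w => c * f w) w 1) z 1 +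
    fderiv ℝ (fun w => fderiv ℝ (fun w => c * f w) w Complex.I) z Complex.I = c *
    (fderiv ℝ (fun w => fderiv ℝ f w 1) z 1 + fderiv ℝ (fun w => fderiv ℝ f w Complex.I) z Complex.I)
  rw [h1, h2]; ring

theorem lapC_re_sq (z : ℂ) : lapC (fun w : ℂ => w.re ^ 2) z = 2 := by
  have hre : ∀ w : ℂ, HasFDerivAt (fun w : ℂ => w.re) Complex.reCLM w :=
    fun w => Complex.reCLM.hasFDerivAt
  have h1 : ∀ w v : ℂ, fderiv ℝ (fun w : ℂ => w.re ^ 2) w v = 2 * v.re * w.re := by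
    intro w v
    rw [((hre w).pow 2).fderiv]
    simp; ring
  have h2 : ∀ v : ℂ, fderiv ℝ (fun w => fderiv ℝ (fun w : ℂ => w.re ^ 2) w v) z v =
      2 * v.re * v.re := by
    intro v
    simp_rw [h1]
    rw [((hre z).const_mul (2 * v.re)).fderiv]
    simp
  change fderiv ℝ (fun w => fderiv ℝ (fun w : ℂ => w.re ^ 2) w 1) z 1 +
    fderiv ℝ (fun w => fderiv ℝ (fun w : ℂ => w.re ^ 2) w Complex.I) z Complex.I = 2
  rw [h2, h2]; simp

/-- The weak minimum principle for superharmonic functions. -/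
theorem min_principle {C O : Set ℂ} (hC : IsCompact C) (hO : IsOpen O) (hOC : O ⊆ C) {k : ℂ → ℝ}
    (hk : ContinuousOn k C) (hk2 : ∀ z ∈ O, ContDiffAt ℝ 2 k z) (hlap : ∀ z ∈ O, lapC k z ≤ 0)
    {m : ℝ} (hb : ∀ z ∈ C \ O, m ≤ k z) {z : ℂ} (hz : z ∈ C) : m ≤ k z := by
  by_contra! hlt
  obtain ⟨M, hM⟩ := hC.bddAbove_image (f := fun w : ℂ => w.re ^ 2) (by fun_prop)
  have hM' : ∀ w ∈ C, w.re ^ 2 ≤ M := fun w hw => hM ⟨w, hw, rfl⟩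
  have hM0 : 0 ≤ M := (sq_nonneg _).trans (hM' z hz)
  obtain ⟨ε, hε, hε2⟩ : ∃ ε > 0, ε * M < m - k z :=
    ⟨(m - k z) / (M + 1) , by have := sub_pos.2 hlt; positivity, by
      rw [div_mul_eq_mul_div, div_lt_iff₀ (by positivity)]
      have := sub_pos.2 hlt
      nlinarith⟩
  obtain ⟨p, hp, hmin⟩ := hC.exists_isMinOn ⟨z, hz⟩
    (f := fun w => k w + (-ε) * w.re ^ 2) (hk.add (by fun_prop))
  have hpz : k p + (-ε) * p.re ^ 2 ≤ k z + (-ε) * z.re ^ 2 := hmin hz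
  have hpO : p ∈ O := by
    by_contra hn
    have h1 := hb p ⟨hp, hn⟩
    have h2 := hM' p hp
    nlinarith [sq_nonneg z.re]
  have hq : ContDiffAt ℝ 2 (fun w : ℂ => w.re ^ 2) p := Complex.reCLM.contDiff.contDiffAt.pow 2
  have hq' : ContDiffAt ℝ 2 (fun w : ℂ => (-ε) * w.re ^ 2) p := contDiffAt_const.mul hq
  have h3 := lapC_nonneg_of_isLocalMin ((hk2 p hpO).add hq')
    (hmin.isLocalMin (Filter.mem_of_superset (hO.mem_nhds hpO) hOC))
  have h4 := lapC_add (hk2 p hpO) hq'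
  have h5 := lapC_const_mul (f := fun w : ℂ => w.re ^ 2) (-ε) p
  rw [lapC_re_sq] at h5
  have h6 : lapC (k + fun w : ℂ => -ε * w.re ^ 2) p = lapC k p + -ε * 2 := by
    rw [← h5]; exact h4
  have := hlap p hpO
  have h7 : 0 ≤ lapC (k + fun w : ℂ => -ε * w.re ^ 2) p := h3
  linarith

open InnerProductSpace in
theorem lapC_eq_laplacian {f : ℂ → ℝ} {z : ℂ} (hf : ContDiffAt ℝ 2 f z) :
    lapC f z = Laplacian.laplacian f z := by
  have hd : DifferentiableAt ℝ (fderiv ℝ f) z :=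
    (hf.fderiv_right (m := 1) (by norm_num)).differentiableAt (by simp)
  have h1 : ∀ v : ℂ, fderiv ℝ (fun w => fderiv ℝ f w v) z v = fderiv ℝ (fderiv ℝ f) z v v := by
    intro v
    rw [fderiv_clm_apply hd (differentiableAt_const v)]
    simp
  rw [laplacian_eq_iteratedFDeriv_complexPlane]
  simp only [iteratedFDeriv_two_apply]
  change fderiv ℝ (fun w => fderiv ℝ f w 1) z 1 + fderiv ℝ (fun w => fderiv ℝ f w Complex.I) z
    Complex.I = _
  rw [h1, h1]
  simp

/-- The Poisson integral of `f` over the circle `|ζ - c| = R`. -/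
noncomputable def poiss (c : ℂ) (R : ℝ) (f : ℂ → ℝ) (w : ℂ) : ℝ :=
  circleAverage (poissonKernel c w • f) c R

section
variable {c w : ℂ} {R : ℝ} {f g : ℂ → ℝ}

theorem continuousOn_poissonKernel (hw : w ∈ Metric.ball c R) :
    ContinuousOn (poissonKernel c w) (Metric.sphere c |R|) := by
  rw [poissonKernel_eq_re_herglotzRieszKernel]
  exact Complex.continuous_re.comp_continuousOn (continuousOn_herglotzRieszKernel_sphere hw)

theorem poissonKernel_nonneg (hw : w ∈ Metric.ball c R) {ζ : ℂ} (hζ : ζ ∈ Metric.sphere c |R|) :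
    0 ≤ poissonKernel c w ζ := by
  rw [mem_ball_iff_norm] at hw
  rw [mem_sphere_iff_norm] at hζ
  rw [poissonKernel_def, hζ, sq_abs]
  have : ‖w - c‖ ^ 2 ≤ R ^ 2 := by
    have := norm_nonneg (w - c)
    nlinarith
  exact div_nonneg (by linarith) (sq_nonneg _)

theorem poiss_mono (hf : CircleIntegrable f c R) (hg : CircleIntegrable g c R)
    (h : ∀ ζ ∈ Metric.sphere c |R|, f ζ ≤ g ζ) (hw : w ∈ Metric.ball c R) :
    poiss c R f w ≤ poiss c R g w := by
  refine circleAverage_mono (hf.continuousOn_smul (continuousOn_poissonKernel hw))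
    (hg.continuousOn_smul (continuousOn_poissonKernel hw)) fun ζ hζ => ?_
  exact mul_le_mul_of_nonneg_left (h ζ hζ) (poissonKernel_nonneg hw hζ)

theorem poiss_re_affine (a : ℂ) (b : ℝ) (hw : w ∈ Metric.ball c R) :
    poiss c R (fun ζ => b + (a * ζ).re) w = b + (a * w).re := by
  refine InnerProductSpace.HarmonicOnNhd.circleAverage_poissonKernel_smul
    (f := fun ζ => b + (a * ζ).re) (fun ζ _ => ?_) hw
  have : AnalyticAt ℂ (fun ζ : ℂ => (b : ℂ) + a * ζ) ζ := by fun_prop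
  convert this.harmonicAt_re using 1
  ext ζ
  simp

/-- The Poisson integral is the real part of a holomorphic function. -/
theorem exists_holomorphic_re_eq_poiss (hf : CircleIntegrable f c R) :
    ∃ F : ℂ → ℂ, DifferentiableOn ℂ F (Metric.ball c R) ∧
      ∀ w ∈ Metric.ball c R, poiss c R f w = (F w).re := by
  have hf0 : CircleIntegrable (fun z => f (z + c)) 0 R := by
    rw [circleIntegrable_def] at hf ⊢
    convert hf using 2
    simp [circleMap, add_comm]
  have hf1 : CircleIntegrable (fun z => (f (z + c) : ℂ)) 0 R := by
    simp only [CircleIntegrable, intervalIntegrable_iff] at hf0 ⊢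
    exact Complex.ofRealCLM.integrable_comp hf0
  have hF := differentiableOn_circleAverage_herglotzRieszKernel_smul hf1
  refine ⟨fun w => circleAverage (fun ζ ↦ herglotzRieszKernel 0 (w - c) ζ • (f (ζ + c) : ℂ)) 0 R,
    hF.comp (g := fun w => circleAverage
      (fun ζ ↦ herglotzRieszKernel 0 w ζ • (f (ζ + c) : ℂ)) 0 R) (f := fun w => w - c)
      (by fun_prop) (fun w hw => by simpa [mem_ball_iff_norm, dist_eq_norm] using hw), fun w hw => ?_⟩
  rw [re_circleAverage_herglotzRieszKernel_smul hf0 (by simpa [mem_ball_iff_norm, dist_eq_norm] using hw),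
    poiss, ← circleAverage_map_add_const]
  congr 1
  ext ζ
  simp [poissonKernel_eq_re_herglotzRieszKernel, herglotzRieszKernel_add_const]

theorem contDiffAt_re_of_holomorphic {F : ℂ → ℂ} {s : Set ℂ} (hs : IsOpen s)
    (hF : DifferentiableOn ℂ F s) {z : ℂ} (hz : z ∈ s) (n : WithTop ℕ∞) :
    ContDiffAt ℝ n (fun w => (F w).re) z :=
  Complex.reCLM.contDiff.contDiffAt.comp z
    ((hF.analyticOnNhd hs z hz).contDiffAt.restrict_scalars ℝ)

theorem lapC_re_of_holomorphic {F : ℂ → ℂ} {s : Set ℂ} (hs : IsOpen s)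
    (hF : DifferentiableOn ℂ F s) {z : ℂ} (hz : z ∈ s) : lapC (fun w => (F w).re) z = 0 := by
  rw [lapC_eq_laplacian (contDiffAt_re_of_holomorphic hs hF hz 2)]
  exact (hF.analyticOnNhd hs z hz).harmonicAt_re.2.self_of_nhds

open Classical in
/-- Poisson modification: replace `f` inside a disc by its Poisson integral. -/
noncomputable def pmod (c : ℂ) (R : ℝ) (f : ℂ → ℝ) (w : ℂ) : ℝ :=
  if w ∈ Metric.ball c R then poiss c R f w else f w

theorem continuous_pmod (hf : Continuous f) (c : ℂ) (R : ℝ) : Continuous (pmod c R f) := by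
  classical
  rcases le_or_gt R 0 with hR | hR
  · convert hf using 1
    ext w
    rw [pmod, if_neg]
    simp [Metric.ball_eq_empty.2 hR]
  have hfi : CircleIntegrable f c R := hf.continuousOn.circleIntegrable'
  refine continuous_iff_continuousAt.2 fun p => ?_
  by_cases hp : p ∈ Metric.ball c R
  · obtain ⟨F, hF, hFe⟩ := exists_holomorphic_re_eq_poiss hfi
    refine (contDiffAt_re_of_holomorphic Metric.isOpen_ball hF hp 0).continuousAt.congr ?_
    filter_upwards [Metric.isOpen_ball.mem_nhds hp] with w hw
    rw [pmod, if_pos hw, hFe w hw]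
  have hpv : pmod c R f p = f p := if_neg hp
  by_cases hp' : p ∈ (Metric.closedBall c R)ᶜ
  · refine hf.continuousAt.congr ?_
    filter_upwards [Metric.isClosed_closedBall.isOpen_compl.mem_nhds hp'] with w hw
    rw [pmod, if_neg fun h => hw (Metric.ball_subset_closedBall h)]
  have hps : ‖p - c‖ = R := by
    simp only [Set.mem_compl_iff, not_not, mem_closedBall_iff_norm, mem_ball_iff_norm,
      not_lt] at hp hp'
    exact le_antisymm hp' hp
  rw [Metric.continuousAt_iff]
  intro ε hε
  obtain ⟨M, hM⟩ := (isCompact_sphere c R).bddAbove_image (f := fun ζ => |f ζ - f p|)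
    (by fun_prop)
  have hM' : ∀ ζ ∈ Metric.sphere c R, |f ζ - f p| ≤ M := fun ζ hζ => hM ⟨ζ, hζ, rfl⟩
  have hM0 : 0 ≤ M := (abs_nonneg _).trans (hM' p (by simp [mem_sphere_iff_norm, hps]))
  obtain ⟨d, hd, hdf⟩ := Metric.continuousAt_iff.1 (hf.continuousAt (x := p)) (ε / 2) (by positivity)
  set C := M / d ^ 2 with hC
  have hC0 : 0 ≤ C := by positivity
  -- a quadratic majorant that is the trace of an affine function on the circle
  set a : ℂ := -(2 * C) * (starRingEnd ℂ) (p - c) with ha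
  have hq : ∀ ζ : ℂ, ‖ζ - c‖ = R →
      C * ‖ζ - p‖ ^ 2 = C * (2 * R ^ 2) - (a * c).re + (a * ζ).re := by
    intro ζ hζ
    have h1 : ‖ζ - p‖ ^ 2 = ‖ζ - c‖ ^ 2 + ‖p - c‖ ^ 2
        - 2 * ((starRingEnd ℂ) (p - c) * (ζ - c)).re := by
      simp only [← Complex.normSq_eq_norm_sq, Complex.normSq_apply, Complex.mul_re,
        Complex.conj_re, Complex.conj_im, Complex.sub_re, Complex.sub_im]
      ring
    rw [h1, hζ, hps, ha]
    simp only [Complex.mul_re, Complex.neg_re, Complex.neg_im, Complex.mul_im, Complex.re_ofNat,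
      Complex.im_ofNat, Complex.ofReal_re, Complex.ofReal_im, Complex.sub_re, Complex.sub_im]
    ring
  set L : ℂ → ℝ := fun w => C * (2 * R ^ 2) - (a * c).re + (a * w).re with hL
  have hLp : L p = 0 := by rw [hL]; simp only []; rw [← hq p hps]; simp
  have hLc : Continuous L := by rw [hL]; fun_prop
  have hmaj : ∀ ζ ∈ Metric.sphere c |R|, |f ζ - f p| ≤ ε / 2 + L ζ := by
    intro ζ hζ
    rw [abs_of_pos hR] at hζ
    rw [hL]; simp only []
    rw [← hq ζ (mem_sphere_iff_norm.1 hζ)]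
    rcases lt_or_ge (dist ζ p) d with h | h
    · have := hdf h
      rw [Real.dist_eq] at this
      have : 0 ≤ C * ‖ζ - p‖ ^ 2 := by positivity
      linarith
    · have h1 := hM' ζ hζ
      rw [dist_eq_norm] at h
      have : M ≤ C * ‖ζ - p‖ ^ 2 := by
        rw [hC, div_mul_eq_mul_div, le_div_iff₀ (by positivity)]
        have : d ^ 2 ≤ ‖ζ - p‖ ^ 2 := by gcongr
        nlinarith
      linarith
  obtain ⟨d₂, hd₂, hL₂⟩ := Metric.continuousAt_iff.1 (hLc.continuousAt (x := p)) (ε / 2)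
    (by positivity)
  refine ⟨min d d₂, by positivity, fun w hw => ?_⟩
  rw [hpv]
  by_cases hwb : w ∈ Metric.ball c R
  · rw [pmod, if_pos hwb, Real.dist_eq]
    have h2 := hL₂ (hw.trans_le (min_le_right _ _))
    rw [hLp, Real.dist_eq, sub_zero] at h2
    have h3 := (le_abs_self _).trans_lt h2
    have i1 : poiss c R f w ≤ f p + ε / 2 + L w := by
      have := poiss_mono (g := fun ζ => (f p + ε / 2 + (C * (2 * R ^ 2) - (a * c).re)) + (a * ζ).re)
        hfi (Continuous.continuousOn (by fun_prop)).circleIntegrable'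
        (fun ζ hζ => by have := (abs_le.1 (hmaj ζ hζ)).2; simp only [hL] at this; linarith) hwb
      rw [poiss_re_affine a _ hwb] at this
      simp only [hL]; linarith
    have i2 : f p - ε / 2 - L w ≤ poiss c R f w := by
      have := poiss_mono
        (f := fun ζ => (f p - ε / 2 - (C * (2 * R ^ 2) - (a * c).re)) + (-a * ζ).re)
        (Continuous.continuousOn (by fun_prop)).circleIntegrable' hfi
        (fun ζ hζ => by
          have := (abs_le.1 (hmaj ζ hζ)).1
          simp only [hL] at this
          simp only [neg_mul, Complex.neg_re]
          linarith) hwb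
      rw [poiss_re_affine (-a) _ hwb] at this
      simp only [neg_mul, Complex.neg_re] at this
      simp only [hL]; linarith
    rw [abs_lt]
    constructor <;> linarith
  · rw [pmod, if_neg hwb]
    exact (hdf (hw.trans_le (min_le_left _ _))).trans (by linarith)

end

theorem comparison_principle {C O : Set ℂ} (hC : IsCompact C) (hO : IsOpen O) (hOC : O ⊆ C)
    {k l : ℂ → ℝ} (hk : ContinuousOn k C) (hl : ContinuousOn l C)
    (hk2 : ∀ z ∈ O, ContDiffAt ℝ 2 k z) (hl2 : ∀ z ∈ O, ContDiffAt ℝ 2 l z)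
    (hlap : ∀ z ∈ O, lapC k z ≤ lapC l z) (hb : ∀ z ∈ C \ O, l z ≤ k z) {z : ℂ} (hz : z ∈ C) :
    l z ≤ k z := by
  have hl2' : ∀ z ∈ O, ContDiffAt ℝ 2 (fun w => (-1) * l w) z :=
    fun z hz => contDiffAt_const.mul (hl2 z hz)
  have := min_principle (k := fun w => k w + (-1) * l w) (m := 0) hC hO hOC
    (hk.add (continuousOn_const.mul hl)) (fun z hz => (hk2 z hz).add (hl2' z hz))
    (fun z hz => by
      rw [lapC_add (hk2 z hz) (hl2' z hz), lapC_const_mul]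
      linarith [hlap z hz])
    (fun z hz => by linarith [hb z hz]) hz
  linarith

section
variable {c c' w : ℂ} {R R' : ℝ} {f g : ℂ → ℝ}

theorem contDiffAt_pmod (hf : Continuous f) (hw : w ∈ Metric.ball c R) (n : WithTop ℕ∞) :
    ContDiffAt ℝ n (pmod c R f) w ∧ lapC (pmod c R f) w = 0 := by
  obtain ⟨F, hF, hFe⟩ := exists_holomorphic_re_eq_poiss (c := c) (R := R)
    hf.continuousOn.circleIntegrable'
  have he : pmod c R f =ᶠ[nhds w] fun w => (F w).re := by
    filter_upwards [Metric.isOpen_ball.mem_nhds hw] with w hw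
    rw [pmod, if_pos hw, hFe w hw]
  have h2 := contDiffAt_re_of_holomorphic Metric.isOpen_ball hF hw
  refine ⟨(h2 n).congr_of_eventuallyEq he, ?_⟩
  rw [lapC_eq_laplacian ((h2 2).congr_of_eventuallyEq he),
    (InnerProductSpace.laplacian_congr_nhds he).self_of_nhds, ← lapC_eq_laplacian (h2 2),
    lapC_re_of_holomorphic Metric.isOpen_ball hF hw]

theorem pmod_of_notMem (hw : w ∉ Metric.ball c R) : pmod c R f w = f w := if_neg hw

theorem pmod_mono (hf : Continuous f) (hg : Continuous g) (h : ∀ z, f z ≤ g z) (w : ℂ) :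
    pmod c R f w ≤ pmod c R g w := by
  by_cases hw : w ∈ Metric.ball c R
  · rw [pmod, pmod, if_pos hw, if_pos hw]
    exact poiss_mono hf.continuousOn.circleIntegrable' hg.continuousOn.circleIntegrable'
      (fun z _ => h z) hw
  · rw [pmod_of_notMem hw, pmod_of_notMem hw]
    exact h w

theorem pmod_le (hf : Continuous f) (hf2 : ∀ z ∈ Metric.ball c R, ContDiffAt ℝ 2 f z)
    (hlap : ∀ z ∈ Metric.ball c R, lapC f z ≤ 0) (w : ℂ) : pmod c R f w ≤ f w := by
  by_cases hw : w ∈ Metric.ball c R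
  · refine comparison_principle (isCompact_closedBall c R) Metric.isOpen_ball
      Metric.ball_subset_closedBall hf.continuousOn (continuous_pmod hf c R).continuousOn hf2
      (fun z hz => (contDiffAt_pmod hf hz 2).1) (fun z hz => ?_)
      (fun z hz => (pmod_of_notMem hz.2).le) (Metric.ball_subset_closedBall hw)
    rw [(contDiffAt_pmod hf hz 2).2]
    exact hlap z hz
  · exact (pmod_of_notMem hw).le

theorem le_pmod (hf : Continuous f) (hf2 : ∀ z ∈ Metric.ball c R, ContDiffAt ℝ 2 f z)
    (hlap : ∀ z ∈ Metric.ball c R, 0 ≤ lapC f z) (w : ℂ) : f w ≤ pmod c R f w := by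
  by_cases hw : w ∈ Metric.ball c R
  · refine comparison_principle (isCompact_closedBall c R) Metric.isOpen_ball
      Metric.ball_subset_closedBall (continuous_pmod hf c R).continuousOn hf.continuousOn
      (fun z hz => (contDiffAt_pmod hf hz 2).1) hf2 (fun z hz => ?_)
      (fun z hz => (pmod_of_notMem hz.2).ge) (Metric.ball_subset_closedBall hw)
    rw [(contDiffAt_pmod hf hz 2).2]
    exact hlap z hz
  · exact (pmod_of_notMem hw).ge

/-- Poisson modification on one disc preserves superharmonicity on another. -/
theorem pmod_pmod_le (hf : Continuous f) (h : ∀ z, pmod c R f z ≤ f z)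
    (h' : ∀ z, pmod c' R' f z ≤ f z) (w : ℂ) :
    pmod c R (pmod c' R' f) w ≤ pmod c' R' f w := by
  have hg := continuous_pmod hf c' R'
  have h1 : ∀ z, pmod c R (pmod c' R' f) z ≤ f z := fun z => (pmod_mono hg hf h' z).trans (h z)
  by_cases hw : w ∈ Metric.ball c R ∧ w ∈ Metric.ball c' R'
  · refine comparison_principle (C := Metric.closedBall c R ∩ Metric.closedBall c' R')
      (O := Metric.ball c R ∩ Metric.ball c' R')
      ((isCompact_closedBall c R).inter (isCompact_closedBall c' R'))
      (Metric.isOpen_ball.inter Metric.isOpen_ball)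
      (Set.inter_subset_inter Metric.ball_subset_closedBall Metric.ball_subset_closedBall)
      hg.continuousOn (continuous_pmod hg c R).continuousOn
      (fun z hz => (contDiffAt_pmod hf hz.2 2).1) (fun z hz => (contDiffAt_pmod hg hz.1 2).1)
      (fun z hz => ?_) (fun z hz => ?_)
      ⟨Metric.ball_subset_closedBall hw.1, Metric.ball_subset_closedBall hw.2⟩
    · rw [(contDiffAt_pmod hf hz.2 2).2, (contDiffAt_pmod hg hz.1 2).2]
    · by_cases hz1 : z ∈ Metric.ball c R
      · rw [pmod_of_notMem (c := c') fun hz2 => hz.2 ⟨hz1, hz2⟩]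
        exact h1 z
      · exact (pmod_of_notMem hz1).le
  · by_cases hw1 : w ∈ Metric.ball c R
    · rw [pmod_of_notMem (c := c') fun hz2 => hw ⟨hw1, hz2⟩]
      exact h1 w
    · exact (pmod_of_notMem hw1).le

theorem tendsto_poiss {v : ℕ → ℂ → ℝ} {h : ℂ → ℝ} (hv : ∀ n, Continuous (v n)) {B : ℝ}
    (hB : ∀ n, ∀ ζ ∈ Metric.sphere c |R|, |v n ζ| ≤ B)
    (hlim : ∀ z, Filter.Tendsto (fun n => v n z) Filter.atTop (nhds (h z)))
    (hw : w ∈ Metric.ball c R) :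
    CircleIntegrable h c R ∧
      Filter.Tendsto (fun n => poiss c R (v n) w) Filter.atTop (nhds (poiss c R h w)) := by
  have hm : AEStronglyMeasurable (fun θ => h (circleMap c R θ)) :=
    aestronglyMeasurable_of_tendsto_ae Filter.atTop
      (fun n => ((hv n).comp (continuous_circleMap c R)).aestronglyMeasurable)
      (Filter.Eventually.of_forall fun θ => hlim _)
  have hhB : ∀ ζ ∈ Metric.sphere c |R|, |h ζ| ≤ B := fun ζ hζ =>
    le_of_tendsto (hlim ζ).abs (Filter.Eventually.of_forall fun n => hB n ζ hζ)
  have hcirc : CircleIntegrable h c R := by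
    rw [circleIntegrable_def, intervalIntegrable_iff]
    exact Measure.integrableOn_of_bounded (M := B) (by simp [ENNReal.mul_eq_top]) hm
      (Filter.Eventually.of_forall fun θ => hhB _ (circleMap_mem_sphere' c R θ))
  refine ⟨hcirc, Filter.Tendsto.const_smul ?_ _⟩
  obtain ⟨M, hM⟩ := (isCompact_sphere c |R|).bddAbove_image (f := poissonKernel c w)
    (continuousOn_poissonKernel hw)
  refine intervalIntegral.tendsto_integral_filter_of_dominated_convergence (fun _ => M * B)
    (Filter.Eventually.of_forall fun n => ?_) (Filter.Eventually.of_forall fun n => ?_)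
    intervalIntegrable_const ?_
  · have : CircleIntegrable (v n) c R := (hv n).continuousOn.circleIntegrable'
    exact (intervalIntegrable_iff.1
      (this.continuousOn_smul (continuousOn_poissonKernel hw))).aestronglyMeasurable
  · refine Filter.Eventually.of_forall fun θ _ => ?_
    have hθ := circleMap_mem_sphere' c R θ
    rw [Pi.smul_apply', norm_smul, Real.norm_eq_abs, Real.norm_eq_abs,
      abs_of_nonneg (poissonKernel_nonneg hw hθ)]
    exact mul_le_mul (hM ⟨_, hθ, rfl⟩) (hB n _ hθ) (abs_nonneg _)
      ((poissonKernel_nonneg hw hθ).trans (hM ⟨_, hθ, rfl⟩))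
  · exact Filter.Eventually.of_forall fun θ _ => (hlim _).const_mul _

/-- Between a subharmonic and a superharmonic barrier there is a function harmonic on a given
sequence of discs. -/
theorem exists_harmonic_between {c : ℕ → ℂ} {R : ℕ → ℝ} {lo up : ℂ → ℝ} (hlo : Continuous lo)
    (hup : Continuous up) (hle : ∀ z, lo z ≤ up z)
    (hlo2 : ∀ i, ∀ z ∈ Metric.ball (c i) (R i), ContDiffAt ℝ 2 lo z ∧ 0 ≤ lapC lo z)
    (hup2 : ∀ i, ∀ z ∈ Metric.ball (c i) (R i), ContDiffAt ℝ 2 up z ∧ lapC up z ≤ 0) :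
    ∃ h : ℂ → ℝ, (∀ z, lo z ≤ h z ∧ h z ≤ up z) ∧ ∀ i, ∃ F : ℂ → ℂ,
      DifferentiableOn ℂ F (Metric.ball (c i) (R i)) ∧
        ∀ z ∈ Metric.ball (c i) (R i), h z = (F z).re := by
  let e : ℕ → ℕ := fun n => n.unpair.1
  let v : ℕ → ℂ → ℝ := fun n => Nat.rec up (fun n f => pmod (c (e n)) (R (e n)) f) n
  have hv1 : ∀ n, v (n + 1) = pmod (c (e n)) (R (e n)) (v n) := fun n => rfl
  have hvc : ∀ n, Continuous (v n) := by
    intro n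
    induction n with
    | zero => exact hup
    | succ n ih => rw [hv1]; exact continuous_pmod ih _ _
  have hsup : ∀ n i z, pmod (c i) (R i) (v n) z ≤ v n z := by
    intro n
    induction n with
    | zero => exact fun i => pmod_le hup (fun z hz => (hup2 i z hz).1) fun z hz => (hup2 i z hz).2
    | succ n ih => intro i; rw [hv1]; exact pmod_pmod_le (hvc n) (ih i) (ih (e n))
  have hlov : ∀ n z, lo z ≤ v n z := by
    intro n
    induction n with
    | zero => exact hle
    | succ n ih =>
      intro z
      rw [hv1]
      exact (le_pmod hlo (fun z hz => (hlo2 (e n) z hz).1) (fun z hz => (hlo2 (e n) z hz).2)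
        z).trans (pmod_mono hlo (hvc n) ih z)
  have hanti : ∀ z, Antitone fun n => v n z := fun z =>
    antitone_nat_of_succ_le fun n => by rw [hv1]; exact hsup n _ z
  have hbdd : ∀ z, BddBelow (Set.range fun n => v n z) := fun z => ⟨lo z, by
    rintro _ ⟨n, rfl⟩
    exact hlov n z⟩
  refine ⟨fun z => ⨅ n, v n z, fun z => ⟨le_ciInf fun n => hlov n z, ciInf_le (hbdd z) 0⟩,
    fun i => ?_⟩
  have hlim : ∀ z, Filter.Tendsto (fun n => v n z) Filter.atTop (nhds (⨅ n, v n z)) :=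
    fun z => tendsto_atTop_ciInf (hanti z) (hbdd z)
  obtain ⟨B₁, hB₁⟩ := (isCompact_sphere (c i) |R i|).bddAbove_image hup.abs.continuousOn
  obtain ⟨B₂, hB₂⟩ := (isCompact_sphere (c i) |R i|).bddAbove_image hlo.abs.continuousOn
  have hB : ∀ n, ∀ ζ ∈ Metric.sphere (c i) |R i|, |v n ζ| ≤ max B₁ B₂ := fun n ζ hζ => by
    have h1 : |up ζ| ≤ B₁ := hB₁ ⟨ζ, hζ, rfl⟩
    have h2 : |lo ζ| ≤ B₂ := hB₂ ⟨ζ, hζ, rfl⟩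
    have h3 := hlov n ζ
    have h4 : v n ζ ≤ up ζ := hanti ζ (Nat.zero_le n)
    rw [abs_le] at *
    have := le_max_left B₁ B₂
    have := le_max_right B₁ B₂
    constructor <;> linarith
  rcases le_or_gt (R i) 0 with hR | hR
  · exact ⟨0, by simp [Metric.ball_eq_empty.2 hR]⟩
  obtain ⟨F, hF, hFe⟩ := exists_holomorphic_re_eq_poiss
    (tendsto_poiss hvc hB hlim (Metric.mem_ball_self hR)).1
  refine ⟨F, hF, fun z hz => ?_⟩
  rw [← hFe z hz]
  have ht := (tendsto_poiss hvc hB hlim hz).2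
  have hfix : ∃ᶠ n in Filter.atTop, v n z = poiss (c i) (R i) (v n) z := by
    refine Filter.frequently_atTop.2 fun m => ⟨Nat.pair i m + 1, ?_, ?_⟩
    · exact (Nat.right_le_pair i m).trans (Nat.le_succ _)
    · have he : e (Nat.pair i m) = i := by simp [e]
      have hv2 := hv1 (Nat.pair i m)
      rw [he] at hv2
      have h1 : v (Nat.pair i m + 1) z = poiss (c i) (R i) (v (Nat.pair i m)) z := by
        rw [hv2, pmod, if_pos hz]
      rw [h1]
      refine circleAverage_congr_sphere fun ζ hζ => ?_
      rw [abs_of_pos hR] at hζ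
      simp only [Pi.smul_apply', hv2]
      rw [pmod_of_notMem]
      simp only [Metric.mem_sphere] at hζ
      simp [hζ]
  by_contra hne
  obtain ⟨n, h1, h2⟩ := (hfix.and_eventually
    (((hlim z).prodMk_nhds ht).eventually (isClosed_diagonal.isOpen_compl.mem_nhds hne))).exists
  exact h2 h1

end

/-- Uniform limits on `K` of complex polynomials. -/
noncomputable def polyClosure (K : Set ℂ) [CompactSpace K] : Subalgebra ℂ C(K, ℂ) :=
  (polynomialFunctions K).topologicalClosure

/-- Uniform limits on `K` of real parts of complex polynomials. -/
noncomputable def polyReClosure (K : Set ℂ) [CompactSpace K] : Submodule ℝ C(K, ℝ) :=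
  (((polyClosure K).toSubmodule.restrictScalars ℝ).map
    (Complex.reCLM.compLeftContinuous ℝ K : C(K, ℂ) →L[ℝ] C(K, ℝ)).toLinearMap).topologicalClosure

section
variable {K : Set ℂ} [CompactSpace K]

theorem isClosed_polyClosure : IsClosed (polyClosure K : Set C(K, ℂ)) :=
  Subalgebra.isClosed_topologicalClosure _

theorem re_mem_polyReClosure {f : C(K, ℂ)} (hf : f ∈ polyClosure K) {g : C(K, ℝ)}
    (hg : ∀ z, g z = (f z).re) : g ∈ polyReClosure K := by
  refine Submodule.le_topologicalClosure _ ⟨f, hf, ?_⟩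
  ext z
  exact (hg z).symm

theorem exists_polynomial_of_mem {g : C(K, ℝ)} (hg : g ∈ polyReClosure K) {δ : ℝ} (hδ : 0 < δ) :
    ∃ P : Polynomial ℂ, ∀ z : K, |(P.eval (z : ℂ)).re - g z| < δ := by
  obtain ⟨_, ⟨f, hf, rfl⟩, h1⟩ := Metric.mem_closure_iff.1 hg (δ / 2) (by positivity)
  obtain ⟨p, hp, h2⟩ := Metric.mem_closure_iff.1 hf (δ / 2) (by positivity)
  change p ∈ (polynomialFunctions K : Set C(K, ℂ)) at hp
  rw [polynomialFunctions_coe] at hp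
  obtain ⟨P, rfl⟩ := hp
  refine ⟨P, fun z => ?_⟩
  have h3 := (ContinuousMap.dist_apply_le_dist z).trans_lt h1
  have h4 := (ContinuousMap.dist_apply_le_dist z).trans_lt h2
  have h5 := Complex.abs_re_le_norm (f z - P.eval (z : ℂ))
  rw [dist_eq_norm] at h4
  rw [Real.dist_eq] at h3
  change |g z - (f z).re| < _ at h3
  change ‖f z - P.eval (z : ℂ)‖ < _ at h4
  rw [Complex.sub_re] at h5
  have h6 := h5.trans_lt h4
  rw [abs_lt] at *
  constructor <;> linarith

theorem id_mem_polyClosure {f : C(K, ℂ)} (hf : ∀ z, f z = z) : f ∈ polyClosure K := by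
  refine Subalgebra.le_topologicalClosure _ ?_
  rw [← SetLike.mem_coe, polynomialFunctions_coe]
  refine ⟨Polynomial.X, ?_⟩
  ext z
  simp [hf]

theorem inv_mem_polyClosure (hK : IsPreconnected Kᶜ) {ζ : ℂ} (hζ : ζ ∉ K) {f : C(K, ℂ)}
    (hf : ∀ z, f z = (z - ζ)⁻¹) : f ∈ polyClosure K := by
  let i : C(K, ℂ) := ⟨fun z => z, continuous_subtype_val⟩
  let x : polyClosure K := ⟨i, id_mem_polyClosure fun z => rfl⟩
  have hi : spectrum ℂ i = K := by
    rw [ContinuousMap.spectrum_eq_range]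
    simp [i]
  have : IsClosed (polyClosure K : Set C(K, ℂ)) := isClosed_polyClosure
  have hs := Subalgebra.spectrum_eq_of_isPreconnected_compl (𝕜 := ℂ) (polyClosure K) x
    (by change IsPreconnected (spectrum ℂ i)ᶜ; rwa [hi])
  have hζs : ζ ∉ spectrum ℂ x := by
    rw [hs]
    change ζ ∉ spectrum ℂ i
    rwa [hi]
  obtain ⟨y, hy⟩ := spectrum.notMem_iff.1 hζs
  have hinv : f = -((y⁻¹ : (polyClosure K)ˣ) : polyClosure K).1 := by
    ext z
    have h1 : ((y : polyClosure K) * ((y⁻¹ : (polyClosure K)ˣ) : polyClosure K)) = 1 :=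
      Units.mul_inv y
    rw [hy] at h1
    have h2 := congrArg (fun t : polyClosure K => t.1 z) h1
    have h3 : (ζ - z) * (((y⁻¹ : (polyClosure K)ˣ) : polyClosure K).1 z) = 1 := h2
    have hne : ζ - z ≠ 0 := left_ne_zero_of_mul_eq_one h3
    have hne' : (z : ℂ) - ζ ≠ 0 := fun h => hne (by rw [← neg_sub, h, neg_zero])
    rw [hf, ContinuousMap.neg_apply, inv_eq_of_mul_eq_one_right]
    linear_combination h3
  rw [hinv]
  exact neg_mem (SetLike.coe_mem _)

theorem log_one_sub_mem {u : C(K, ℂ)} (hu : u ∈ polyClosure K) (hu1 : ‖u‖ < 1) {g : C(K, ℝ)}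
    (hg : ∀ z, g z = Real.log ‖1 - u z‖) : g ∈ polyReClosure K := by
  let a : ℕ → C(K, ℂ) := fun n => ((n : ℂ)⁻¹) • u ^ n
  have ha : ∀ n, a n ∈ polyClosure K := fun n => Subalgebra.smul_mem _ (pow_mem hu n) _
  have hsum : Summable a := by
    refine Summable.of_norm_bounded (summable_geometric_of_lt_one (norm_nonneg u) hu1) fun n => ?_
    rcases eq_or_ne n 0 with rfl | hn
    · simp [a]
    · have h1 : ‖(n : ℂ)⁻¹‖ ≤ 1 := by
        rw [norm_inv, Complex.norm_natCast]
        exact inv_le_one_of_one_le₀ (by exact_mod_cast Nat.one_le_iff_ne_zero.2 hn)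
      calc ‖a n‖ = ‖(n : ℂ)⁻¹‖ * ‖u ^ n‖ := norm_smul _ _
        _ ≤ 1 * ‖u‖ ^ n := mul_le_mul h1 (norm_pow_le' u (Nat.pos_of_ne_zero hn))
            (norm_nonneg _) zero_le_one
        _ = ‖u‖ ^ n := one_mul _
  have hmem : -(∑' n, a n) ∈ polyClosure K := by
    refine neg_mem (isClosed_polyClosure.mem_of_tendsto hsum.hasSum ?_)
    exact Filter.Eventually.of_forall fun s => sum_mem fun n _ => ha n
  refine re_mem_polyReClosure hmem fun z => ?_
  have hz : ‖u z‖ < 1 := (u.norm_coe_le_norm z).trans_lt hu1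
  have h1 := hsum.hasSum.map (ContinuousMap.evalCLM ℂ z : C(K, ℂ) →L[ℂ] ℂ)
    (ContinuousMap.evalCLM ℂ z : C(K, ℂ) →L[ℂ] ℂ).continuous
  have h2 := Complex.hasSum_taylorSeries_neg_log hz
  have h3 : (∑' n, a n) z = -Complex.log (1 - u z) := by
    refine h1.unique ?_
    convert h2 using 1
    ext n
    simp [a, div_eq_inv_mul]
  rw [hg, ContinuousMap.neg_apply, h3, neg_neg, Complex.log_re]

theorem dist_pos_of_compact {ζ : ℂ} (hζ : ζ ∉ K) : ∃ d > 0, ∀ z : K, d ≤ ‖(z : ℂ) - ζ‖ := by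
  have hc : IsClosed K := (isCompact_iff_compactSpace.2 ‹_›).isClosed
  obtain ⟨d, hd, h⟩ := Metric.isOpen_iff.1 hc.isOpen_compl ζ hζ
  refine ⟨d, hd, fun z => ?_⟩
  by_contra! hlt
  exact h (by rwa [mem_ball_iff_norm]) z.2

theorem log_norm_sub_mem (hK : IsPreconnected Kᶜ) {ζ : ℂ} (hζ : ζ ∉ K) {g : C(K, ℝ)}
    (hg : ∀ z, g z = Real.log ‖(z : ℂ) - ζ‖) : g ∈ polyReClosure K := by
  have hc : IsClosed K := (isCompact_iff_compactSpace.2 ‹_›).isClosed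
  have hne : ∀ {ζ}, ζ ∉ K → ∀ z : K, ‖(z : ℂ) - ζ‖ ≠ 0 := fun hζ z =>
    norm_ne_zero_iff.2 (sub_ne_zero.2 fun h => hζ (h ▸ z.2))
  let L : ∀ ζ, ζ ∉ K → C(K, ℝ) := fun ζ hζ =>
    ⟨fun z => Real.log ‖(z : ℂ) - ζ‖, Continuous.log (by fun_prop) (hne hζ)⟩
  let G : Set ℂ := {ζ | ∃ h : ζ ∉ K, L ζ h ∈ polyReClosure K}
  have hloc : ∀ ζ₀ (h₀ : ζ₀ ∉ K), ∀ᶠ ζ in nhds ζ₀, ∃ h : ζ ∉ K,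
      (L ζ h - L ζ₀ h₀) ∈ polyReClosure K := by
    intro ζ₀ h₀
    obtain ⟨d, hd, hdK⟩ := dist_pos_of_compact h₀
    filter_upwards [hc.isOpen_compl.mem_nhds h₀, Metric.ball_mem_nhds ζ₀ (half_pos hd)]
      with ζ h hζd
    refine ⟨h, ?_⟩
    let v : C(K, ℂ) := ⟨fun z => ((z : ℂ) - ζ₀)⁻¹, Continuous.inv₀ (by fun_prop)
      fun z => norm_ne_zero_iff.1 (hne h₀ z)⟩
    have hv : v ∈ polyClosure K := inv_mem_polyClosure hK h₀ fun z => rfl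
    refine log_one_sub_mem (u := (ζ - ζ₀) • v) (Subalgebra.smul_mem _ hv _) ?_ fun z => ?_
    · rw [ContinuousMap.norm_lt_iff _ zero_lt_one]
      intro z
      rw [mem_ball_iff_norm] at hζd
      change ‖(ζ - ζ₀) * ((z : ℂ) - ζ₀)⁻¹‖ < 1
      rw [norm_mul, norm_inv, ← div_eq_mul_inv, div_lt_one (hd.trans_le (hdK z))]
      linarith [hdK z]
    · change Real.log ‖(z : ℂ) - ζ‖ - Real.log ‖(z : ℂ) - ζ₀‖ =
        Real.log ‖1 - (ζ - ζ₀) * ((z : ℂ) - ζ₀)⁻¹‖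
      rw [← Real.log_div (hne h z) (hne h₀ z), ← norm_div]
      congr 2
      have := norm_ne_zero_iff.1 (hne h₀ z)
      field_simp
      ring
  have hGo : IsOpen G := isOpen_iff_mem_nhds.2 fun ζ₀ ⟨h₀, hm⟩ => by
    filter_upwards [hloc ζ₀ h₀] with ζ ⟨h, hd⟩
    exact ⟨h, by simpa using add_mem hd hm⟩
  have hGo' : IsOpen (Kᶜ \ G) := isOpen_iff_mem_nhds.2 fun ζ₀ ⟨h₀, hm⟩ => by
    filter_upwards [hloc ζ₀ h₀] with ζ ⟨h, hd⟩
    exact ⟨h, fun ⟨_, hm'⟩ => hm ⟨h₀, by simpa using sub_mem hm' hd⟩⟩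
  obtain ⟨r, hr⟩ := (isCompact_iff_compactSpace.2 ‹CompactSpace K›).isBounded.subset_closedBall 0
  have hfar : ((2 * (|r| + 1) : ℝ) : ℂ) ∈ G := by
    set ζ₁ : ℂ := ((2 * (|r| + 1) : ℝ) : ℂ) with hζ₁
    have hn : ‖ζ₁‖ = 2 * (|r| + 1) := by
      rw [hζ₁, Complex.norm_real, Real.norm_eq_abs, abs_of_pos (by positivity)]
    have hKr : ∀ z ∈ K, ‖z‖ ≤ |r| := fun z hz =>
      (mem_closedBall_zero_iff.1 (hr hz)).trans (le_abs_self r)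
    have hnot : ζ₁ ∉ K := fun h => by
      have := hKr _ h
      rw [hn] at this
      linarith [abs_nonneg r]
    have h0 : ζ₁ ≠ 0 := norm_ne_zero_iff.1 (by rw [hn]; positivity)
    let i : C(K, ℂ) := ⟨fun z => z, continuous_subtype_val⟩
    have h1 : (L ζ₁ hnot - algebraMap ℝ C(K, ℝ) (Real.log ‖ζ₁‖)) ∈ polyReClosure K := by
      refine log_one_sub_mem (u := ζ₁⁻¹ • i)
        (Subalgebra.smul_mem _ (id_mem_polyClosure fun z => rfl) _) ?_ fun z => ?_
      · rw [ContinuousMap.norm_lt_iff _ zero_lt_one]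
        intro z
        change ‖ζ₁⁻¹ * (z : ℂ)‖ < 1
        rw [norm_mul, norm_inv, inv_mul_lt_one₀ (by rw [hn]; positivity), hn]
        linarith [hKr z z.2, abs_nonneg r]
      · change Real.log ‖(z : ℂ) - ζ₁‖ - Real.log ‖ζ₁‖ = Real.log ‖1 - ζ₁⁻¹ * (z : ℂ)‖
        rw [← Real.log_div (hne hnot z) (norm_ne_zero_iff.2 h0), ← norm_div, ← norm_neg]
        congr 2
        field_simp
        ring
    have h2 : algebraMap ℝ C(K, ℝ) (Real.log ‖ζ₁‖) ∈ polyReClosure K :=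
      re_mem_polyReClosure (algebraMap_mem (polyClosure K) (Real.log ‖ζ₁‖ : ℂ)) fun z => by
        change Real.log ‖ζ₁‖ = ((Real.log ‖ζ₁‖ : ℝ) : ℂ).re
        simp
    exact ⟨hnot, by simpa using add_mem h1 h2⟩
  have hsub : Kᶜ ⊆ G := by
    refine hK.subset_left_of_subset_union hGo hGo' disjoint_sdiff_self_right
      (fun z hz => ?_) ⟨_, hfar.1, hfar⟩
    by_cases h : z ∈ G
    · exact Or.inl h
    · exact Or.inr ⟨hz, h⟩
  obtain ⟨h, hm⟩ := hsub hζ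
  convert hm using 1
  ext z
  exact hg z

end

theorem integral_inv_sq : ∫ ξ : ℂ, 1 / (‖ξ‖ ^ 2 + 1) ^ 2 = π ∧
    Integrable fun ξ : ℂ => 1 / (‖ξ‖ ^ 2 + 1) ^ 2 := by
  have h := integral_radial (f := fun x => 1 / (x ^ 2 + 1) ^ 2) (g := fun x => -(1 / 2) * (x ^ 2 + 1)⁻¹)
    (l := -(1 / 2) * 0) (fun x _ => ?_) (fun x _ => by positivity) ?_
  · exact ⟨h.2.trans (by norm_num; ring), h.1⟩
  · have h0 : x ^ 2 + 1 ≠ 0 := by positivity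
    refine (((((hasDerivAt_id x).fun_pow 2).add_const 1).fun_inv h0).const_mul (-(1 / 2))).congr_deriv ?_
    simp only [id]
    field_simp
    norm_num
  · refine Filter.Tendsto.const_mul _ (Filter.Tendsto.comp tendsto_inv_atTop_zero ?_)
    exact Filter.tendsto_atTop_add_const_right _ _ (Filter.tendsto_pow_atTop two_ne_zero)

/-- The kernels `δ² / (‖ζ‖² + δ²)²` form an approximate identity of mass `π`. -/
theorem tendsto_integral_approx {E : Type*} [NormedAddCommGroup E] [NormedSpace ℝ E]
    [CompleteSpace E] {g : ℂ → E}
    (hg : Continuous g) {B : ℝ} (hB : ∀ ζ, ‖g ζ‖ ≤ B) (z : ℂ) :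
    Filter.Tendsto (fun δ : ℝ => ∫ ζ, (δ ^ 2 / (‖ζ - z‖ ^ 2 + δ ^ 2) ^ 2) • g ζ)
      (nhdsWithin 0 (Set.Ioi 0)) (nhds (π • g z)) := by
  have h1 : ∀ δ ∈ Set.Ioi (0 : ℝ), ∫ ξ : ℂ, (1 / (‖ξ‖ ^ 2 + 1) ^ 2) • g (z + δ • ξ) =
      ∫ ζ, (δ ^ 2 / (‖ζ - z‖ ^ 2 + δ ^ 2) ^ 2) • g ζ := by
    intro δ hδ
    have hδ : 0 < δ := hδ
    rw [← integral_add_left_eq_self (fun ζ => (δ ^ 2 / (‖ζ - z‖ ^ 2 + δ ^ 2) ^ 2) • g ζ) z]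
    have := Measure.integral_comp_smul volume
      (fun η : ℂ => (δ ^ 2 / (‖z + η - z‖ ^ 2 + δ ^ 2) ^ 2) • g (z + η)) δ
    rw [Complex.finrank_real_complex, abs_of_pos (by positivity),
      eq_inv_smul_iff₀ (by positivity)] at this
    rw [← this, ← integral_smul]
    refine integral_congr_ae (Filter.Eventually.of_forall fun ξ => ?_)
    simp only [add_sub_cancel_left, norm_smul, Real.norm_eq_abs, mul_pow, sq_abs, smul_smul]
    congr 1
    have : ‖ξ‖ ^ 2 + 1 ≠ 0 := by positivity
    field_simp
  refine Filter.Tendsto.congr' (Filter.eventually_of_mem self_mem_nhdsWithin h1) ?_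
  rw [← integral_inv_sq.1, ← integral_smul_const]
  refine tendsto_integral_filter_of_dominated_convergence (fun ξ => 1 / (‖ξ‖ ^ 2 + 1) ^ 2 * B) ?_ ?_
    (integral_inv_sq.2.mul_const B) ?_
  · refine Filter.Eventually.of_forall fun δ => Continuous.aestronglyMeasurable ?_
    have : ∀ ξ : ℂ, (‖ξ‖ ^ 2 + 1) ^ 2 ≠ 0 := fun ξ => by positivity
    fun_prop (disch := assumption)
  · refine Filter.Eventually.of_forall fun δ => Filter.Eventually.of_forall fun ξ => ?_
    rw [norm_smul, Real.norm_of_nonneg (by positivity)]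
    gcongr
    exact hB _
  · refine Filter.Eventually.of_forall fun ξ => ?_
    have : Continuous fun δ : ℝ => (1 / (‖ξ‖ ^ 2 + 1) ^ 2) • g (z + δ • ξ) := by fun_prop
    simpa using (this.tendsto 0).mono_left nhdsWithin_le_nhds

theorem lapC_log_kernel (z : ℂ) {δ : ℝ} (hδ : 0 < δ) :
    ContDiff ℝ 2 (fun w : ℂ => log (‖w - z‖ ^ 2 + δ ^ 2) / 2) ∧
    ∀ w, lapC (fun w : ℂ => log (‖w - z‖ ^ 2 + δ ^ 2) / 2) w =
      2 * (δ ^ 2 / (‖w - z‖ ^ 2 + δ ^ 2) ^ 2) := by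
  simp only [div_eq_mul_inv _ (2 : ℝ)]
  have hp : ∀ w : ℂ, ‖w - z‖ ^ 2 + δ ^ 2 ≠ 0 := fun w => by positivity
  have hN : ∀ w : ℂ, HasFDerivAt (fun w : ℂ => ‖w - z‖ ^ 2 + δ ^ 2)
      (2 • (innerSL ℝ (w - z)).comp (ContinuousLinearMap.id ℝ ℂ)) w := fun w =>
    (((hasFDerivAt_id w).sub_const z).norm_sq).add_const _
  have hL : ∀ w : ℂ, HasFDerivAt (fun w : ℂ => log (‖w - z‖ ^ 2 + δ ^ 2) * 2⁻¹) _ w := fun w =>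
    ((hN w).log (hp w)).mul_const (2⁻¹ : ℝ)
  have hx : dx (fun w : ℂ => log (‖w - z‖ ^ 2 + δ ^ 2) * 2⁻¹) =
      fun w => (w - z).re * (‖w - z‖ ^ 2 + δ ^ 2)⁻¹ := by
    funext w
    rw [dx, (hL w).fderiv]
    simp [Complex.inner]
    ring
  have hy : dy (fun w : ℂ => log (‖w - z‖ ^ 2 + δ ^ 2) * 2⁻¹) =
      fun w => (w - z).im * (‖w - z‖ ^ 2 + δ ^ 2)⁻¹ := by
    funext w
    rw [dy, (hL w).fderiv]
    simp [Complex.inner]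
    ring
  refine ⟨?_, fun w => ?_⟩
  · refine ContDiff.mul (ContDiff.log ?_ hp) contDiff_const
    exact ((contDiff_id.sub contDiff_const).norm_sq ℝ).add contDiff_const
  · have hi : HasFDerivAt (fun w : ℂ => (‖w - z‖ ^ 2 + δ ^ 2)⁻¹) _ w :=
      (hasDerivAt_inv (hp w)).comp_hasFDerivAt w (hN w)
    have hre : HasFDerivAt (fun w : ℂ => (w - z).re) Complex.reCLM w :=
      Complex.reCLM.hasFDerivAt.comp w ((hasFDerivAt_id w).sub_const z)
    have him : HasFDerivAt (fun w : ℂ => (w - z).im) Complex.imCLM w :=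
      Complex.imCLM.hasFDerivAt.comp w ((hasFDerivAt_id w).sub_const z)
    rw [lapC, hx, hy, dx, dy, (hre.fun_mul hi).fderiv, (him.fun_mul hi).fderiv]
    have h := hp w
    simp [Complex.inner]
    have h2 : ‖w - z‖ ^ 2 = (w.re - z.re) ^ 2 + (w.im - z.im) ^ 2 := by
      rw [← Complex.normSq_eq_norm_sq, Complex.normSq_apply]
      simp
      ring
    rw [h2] at h ⊢
    field_simp
    ring

theorem exists_contDiff_cutoff {K V : Set ℂ} (hK : IsCompact K) (hV : IsOpen V) (hKV : K ⊆ V) :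
    ∃ χ : ℂ → ℝ, ContDiff ℝ ∞ χ ∧ HasCompactSupport χ ∧ tsupport χ ⊆ V ∧
      (∀ᶠ z in nhdsSet K, χ z = 1) ∧ ∀ z, 0 ≤ χ z ∧ χ z ≤ 1 := by
  obtain ⟨L, hL, hKL, hLV⟩ := exists_compact_between hK hV hKV
  obtain ⟨f, h0, h1, h2⟩ := exists_contMDiffMap_zero_one_nhds_of_isClosed (modelWithCornersSelf ℝ ℂ)
    (n := ⊤) (s := (interior L)ᶜ) (t := K) isOpen_interior.isClosed_compl hK.isClosed
    (Set.disjoint_left.2 fun z hz hz' => hz (hKL hz'))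
  have hs : tsupport f ⊆ L := by
    refine closure_minimal (fun z hz => ?_) hL.isClosed
    by_contra h
    exact hz (subset_of_mem_nhdsSet h0 (fun h' => h (interior_subset h')))
  exact ⟨f, f.contMDiff.contDiff, hL.of_isClosed_subset (isClosed_tsupport _) hs, hs.trans hLV, h1,
    fun z => ⟨(h2 z).1, (h2 z).2⟩⟩

theorem continuous_mul_of_eventually_zero {X : Type*} [TopologicalSpace X] {a b : X → ℝ}
    (ha : Continuous a) (hb : ∀ x, ContinuousAt b x ∨ ∀ᶠ y in nhds x, a y = 0) :
    Continuous fun x => a x * b x := by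
  refine continuous_iff_continuousAt.2 fun x => ?_
  obtain h | h := hb x
  · exact ha.continuousAt.mul h
  · have : (fun x => a x * b x) =ᶠ[nhds x] fun _ => 0 := h.mono fun y hy => by simp [hy]
    exact continuousAt_const.congr this.symm

theorem Filter.EventuallyEq.dx_eq {F : Type*} [NormedAddCommGroup F] [NormedSpace ℝ F] {f g : ℂ → F}
    {z : ℂ} (h : f =ᶠ[nhds z] g) : dx f =ᶠ[nhds z] dx g :=
  h.fderiv.fun_comp fun L => L 1

theorem Filter.EventuallyEq.dy_eq {F : Type*} [NormedAddCommGroup F] [NormedSpace ℝ F] {f g : ℂ → F}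
    {z : ℂ} (h : f =ᶠ[nhds z] g) : dy f =ᶠ[nhds z] dy g :=
  h.fderiv.fun_comp fun L => L Complex.I

theorem lapC_congr {F : Type*} [NormedAddCommGroup F] [NormedSpace ℝ F] {f g : ℂ → F}
    {z : ℂ} (h : f =ᶠ[nhds z] g) : lapC f z = lapC g z :=
  congrArg₂ (· + ·) h.dx_eq.dx_eq.self_of_nhds h.dy_eq.dy_eq.self_of_nhds

theorem integral_log_mul_lapC {g : ℂ → ℝ} (hg : ContDiff ℝ 2 g) (hc : HasCompactSupport g) {z : ℂ}
    (hz : ∀ᶠ w in nhds z, lapC g w = 0) : ∫ w, lapC g w * log ‖z - w‖ = 2 * π * g z := by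
  have hcl : Continuous (lapC g) := continuous_iff_continuousAt.2 fun w => continuousAt_lapC hg.contDiffAt
  have hsl : HasCompactSupport (lapC g) := hc.dx.dx.add hc.dy.dy
  have h1 : ∀ δ ∈ Set.Ioi (0 : ℝ), 2 * ∫ w, (δ ^ 2 / (‖w - z‖ ^ 2 + δ ^ 2) ^ 2) • g w =
      ∫ w in tsupport (lapC g), lapC g w * (log (‖w - z‖ ^ 2 + δ ^ 2) / 2) := by
    intro δ hδ
    rw [setIntegral_eq_integral_of_forall_compl_eq_zero fun w hw => by
      rw [image_eq_zero_of_notMem_tsupport hw, zero_mul],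
      ← integral_mul_lapC_comm hg hc (lapC_log_kernel z hδ).1, ← integral_const_mul]
    congr 1 with w
    rw [(lapC_log_kernel z hδ).2, smul_eq_mul]
    ring
  obtain ⟨B, hB⟩ := hc.exists_bound_of_continuous hg.continuous
  have h2 := (tendsto_integral_approx hg.continuous hB z).const_mul 2
  have h3 : Continuous fun δ : ℝ =>
      ∫ w in tsupport (lapC g), lapC g w * (log (‖w - z‖ ^ 2 + δ ^ 2) / 2) := by
    refine continuous_parametric_integral_of_continuous ?_ hsl
    refine continuous_mul_of_eventually_zero (X := ℝ × ℂ) (hcl.comp continuous_snd) fun x => ?_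
    by_cases hx : x.2 = z
    · exact Or.inr ((hx ▸ continuous_snd.tendsto x).eventually hz)
    · left
      refine (ContinuousAt.log (by fun_prop) ?_).div_const 2
      have := norm_pos_iff.2 (sub_ne_zero.2 hx)
      positivity
  have h4 := tendsto_nhds_unique (h2.congr' (Filter.eventually_of_mem self_mem_nhdsWithin h1))
    ((h3.tendsto 0).mono_left nhdsWithin_le_nhds)
  rw [setIntegral_eq_integral_of_forall_compl_eq_zero fun w hw => by
      rw [image_eq_zero_of_notMem_tsupport hw, zero_mul], smul_eq_mul, ← mul_assoc] at h4
  rw [h4]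
  congr 1 with w
  rw [norm_sub_rev]
  norm_num [Real.log_pow]

theorem integral_mem_of_isClosed {E : Type*} [NormedAddCommGroup E] [NormedSpace ℝ E]
    [CompleteSpace E] {p : Submodule ℝ E} (hp : IsClosed (p : Set E)) {F : ℂ → E}
    (hF : Integrable F) (h : ∀ w, F w ∈ p) : ∫ w, F w ∈ p := by
  have : CompleteSpace p := hp.completeSpace_coe
  have hi : Integrable fun w => (⟨F w, h w⟩ : p) :=
    ⟨hp.isClosedEmbedding_subtypeVal.isEmbedding.aestronglyMeasurable_comp_iff.1
      hF.aestronglyMeasurable, hF.hasFiniteIntegral⟩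
  have h1 : ∫ w, F w = p.subtypeL (∫ w, (⟨F w, h w⟩ : p)) := p.subtypeL.integral_comp_comm hi
  rw [h1]
  exact (∫ w, (⟨F w, h w⟩ : p)).2

/-- Runge's theorem for harmonic functions. -/
theorem exists_polynomial_re_approx {K V : Set ℂ} (hK : IsCompact K) (hKc : IsPreconnected Kᶜ)
    (hV : IsOpen V) (hKV : K ⊆ V) {h : ℂ → ℝ} (hh : ∀ z ∈ V, ContDiffAt ℝ ∞ h z)
    (hl : ∀ z ∈ V, lapC h z = 0) {δ : ℝ} (hδ : 0 < δ) :
    ∃ P : Polynomial ℂ, ∀ z ∈ K, |(P.eval z).re - h z| < δ := by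
  obtain ⟨χ, hχ, hχc, hχV, hχ1, -⟩ := exists_contDiff_cutoff hK hV hKV
  set g : ℂ → ℝ := fun z => χ z * h z with hgdef
  have hgs : tsupport g ⊆ tsupport χ := tsupport_mul_subset_left
  have hg : ContDiff ℝ ∞ g := contDiff_of_forall_tsupport fun z hz =>
    hχ.contDiffAt.mul (hh z (hχV (hgs hz)))
  have hgc : HasCompactSupport g := hχc.mul_right
  have hcl : Continuous (lapC g) :=
    continuous_iff_continuousAt.2 fun w => continuousAt_lapC (hg.of_le (by norm_cast)).contDiffAt
  have hsl : HasCompactSupport (lapC g) := hgc.dx.dx.add hgc.dy.dy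
  have hz0 : ∀ z ∈ K, ∀ᶠ w in nhds z, lapC g w = 0 := by
    intro z hz
    have h1 : ∀ᶠ w in nhds z, χ w = 1 := Filter.Eventually.filter_mono (nhds_le_nhdsSet hz) hχ1
    filter_upwards [h1.eventually_nhds, hV.mem_nhds (hKV hz)] with w hw hwV
    have : g =ᶠ[nhds w] h := hw.mono fun x hx => by simp [hgdef, hx]
    rw [← hl w hwV]
    exact lapC_congr this
  have := isCompact_iff_compactSpace.1 hK
  have hc2 : Continuous fun p : ℂ × K => lapC g p.1 * log ‖(p.2 : ℂ) - p.1‖ := by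
    refine continuous_mul_of_eventually_zero (hcl.comp continuous_fst) fun x => ?_
    by_cases hx : x.1 = x.2
    · exact Or.inr ((continuous_fst.tendsto x).eventually (hx ▸ hz0 x.2 x.2.2))
    · left
      exact ContinuousAt.log (by fun_prop) (norm_ne_zero_iff.2 (sub_ne_zero.2 (Ne.symm hx)))
  let F : C(ℂ, C(K, ℝ)) := ContinuousMap.curry ⟨_, hc2⟩
  have hFa : ∀ w (z : K), F w z = lapC g w * log ‖(z : ℂ) - w‖ := fun w z => rfl
  have hFm : ∀ w, F w ∈ polyReClosure K := by
    intro w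
    by_cases hw : w ∈ K
    · have : F w = 0 := by
        ext z
        rw [hFa, (hz0 w hw).self_of_nhds, zero_mul]
        rfl
      rw [this]
      exact zero_mem _
    · let G : C(K, ℝ) := ⟨fun z => log ‖(z : ℂ) - w‖, Continuous.log (by fun_prop) fun z =>
        norm_ne_zero_iff.2 (sub_ne_zero.2 fun h => hw (h ▸ z.2))⟩
      have : F w = lapC g w • G := by
        ext z
        rfl
      rw [this]
      exact Submodule.smul_mem _ _ (log_norm_sub_mem hKc hw fun z => rfl)
  have hFi : Integrable F := by
    refine F.continuous.integrable_of_hasCompactSupport (hsl.mono fun w hw h => hw ?_)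
    ext z
    rw [hFa, h, zero_mul]
    rfl
  have hm : ∫ w, F w ∈ polyReClosure K := by
    have hcl : IsClosed (polyReClosure K : Set C(K, ℝ)) := Submodule.isClosed_topologicalClosure _
    exact integral_mem_of_isClosed hcl hFi hFm
  obtain ⟨P, hP⟩ := exists_polynomial_of_mem ((polyReClosure K).smul_mem (2 * π)⁻¹ hm) hδ
  refine ⟨P, fun z hz => ?_⟩
  have h1 := hP ⟨z, hz⟩
  have h2 : (∫ w, F w) ⟨z, hz⟩ = 2 * π * h z := by
    have := (ContinuousMap.evalCLM ℝ (⟨z, hz⟩ : K) : C(K, ℝ) →L[ℝ] ℝ).integral_comp_comm hFi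
    refine this.symm.trans ((integral_log_mul_lapC (hg.of_le (by norm_cast)) hgc (hz0 z hz)).trans ?_)
    change 2 * π * (χ z * h z) = _
    rw [Set.mem_ofPred.1 (subset_of_mem_nhdsSet hχ1 hz), one_mul]
  rw [ContinuousMap.smul_apply, h2, smul_eq_mul, inv_mul_cancel_left₀ (by positivity)] at h1
  exact h1

theorem isPreconnected_norm_gt {R : ℝ} (hR : 0 < R) : IsPreconnected {z : ℂ | R < ‖z‖} := by
  have h : {z : ℂ | R < ‖z‖} = Complex.exp '' {z : ℂ | log R < z.re} := by
    ext z
    constructor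
    · intro hz
      have hz0 : 0 < ‖z‖ := hR.trans hz
      exact ⟨Complex.log z, by simpa [Complex.log_re] using log_lt_log hR hz, Complex.exp_log (norm_pos_iff.1 hz0)⟩
    · rintro ⟨w, hw, rfl⟩
      rw [Set.mem_ofPred, Complex.norm_exp]
      exact (log_lt_iff_lt_exp hR).1 hw
  rw [h]
  exact ((convex_halfSpace_re_gt _).isPreconnected).image _ Complex.continuous_exp.continuousOn

/-- A domain none of whose complementary pieces is compact (and relatively open). -/
def HoleFree (Ω : Set ℂ) : Prop :=
  ∀ E : Set ℂ, IsCompact E → Disjoint E Ω → IsOpen (Ω ∪ E) → E = ∅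

theorem isPreconnected_compl_superlevel {Ω : Set ℂ} (hΩ : HoleFree Ω) (hO : IsOpen Ω) {w : ℂ → ℝ} {t : ℝ}
    (hK : IsCompact {z | z ∈ Ω ∧ t ≤ w z}) (hw : ∀ z ∈ Ω, ContDiffAt ℝ 2 w z)
    (hl : ∀ z ∈ Ω, lapC w z ≤ 0) : IsPreconnected {z | z ∈ Ω ∧ t ≤ w z}ᶜ := by
  set K := {z | z ∈ Ω ∧ t ≤ w z} with hKdef
  have key : ∀ G₁ G₂ : Set ℂ, IsOpen G₁ → IsOpen G₂ → G₁ ∪ G₂ = Kᶜ → Disjoint G₁ G₂ →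
      Bornology.IsBounded G₁ → G₁ = ∅ := by
    intro G₁ G₂ o1 o2 hU hd hb
    have e1 : G₁ ∪ K = G₂ᶜ := by
      ext z
      have h1 : z ∈ G₁ ∪ G₂ ↔ z ∈ Kᶜ := by rw [hU]
      have h2 : z ∈ G₁ → z ∉ G₂ := fun h h' => Set.disjoint_left.1 hd h h'
      simp only [Set.mem_union, Set.mem_compl_iff] at h1 ⊢
      tauto
    have hC : IsCompact (G₁ ∪ K) := Metric.isCompact_of_isClosed_isBounded
      (e1 ▸ o2.isClosed_compl) (hb.union hK.isBounded)
    have hKΩ : K ⊆ Ω := fun z hz => hz.1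
    have h1 : (G₁ ∪ K) \ Ω = ∅ := by
      refine hΩ _ (hC.diff hO) Set.disjoint_sdiff_left ?_
      have : Ω ∪ (G₁ ∪ K) \ Ω = Ω ∪ G₁ := by
        rw [Set.union_sdiff_self, Set.union_comm G₁, ← Set.union_assoc, Set.union_eq_left.2 hKΩ]
      rw [this]
      exact hO.union o1
    have h2 : G₁ ∪ K ⊆ Ω := Set.sdiff_eq_empty.1 h1
    by_contra hne
    obtain ⟨z, hz⟩ := Set.nonempty_iff_ne_empty.2 hne
    have h3 := min_principle hC o1 Set.subset_union_left
      (fun x hx => (hw x (h2 hx)).continuousAt.continuousWithinAt)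
      (fun x hx => hw x (h2 (Or.inl hx))) (fun x hx => hl x (h2 (Or.inl hx)))
      (m := t) (fun x hx => (hx.1.resolve_left hx.2).2) (Or.inl hz)
    have h4 : z ∈ Kᶜ := hU ▸ Or.inl hz
    exact h4 ⟨h2 (Or.inl hz), h3⟩
  obtain ⟨R, hR⟩ := hK.isBounded.subset_closedBall 0
  set R' := max R 1
  have hout : {z : ℂ | R' < ‖z‖} ⊆ Kᶜ := fun z hz h => by
    have := mem_closedBall_zero_iff.1 (hR h)
    exact absurd (hz : R' < ‖z‖) (not_lt.2 (this.trans (le_max_left _ _)))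
  have hbd : ∀ G₁ G₂ : Set ℂ, G₁ ∪ G₂ = Kᶜ → Disjoint G₁ G₂ → {z : ℂ | R' < ‖z‖} ⊆ G₂ →
      Bornology.IsBounded G₁ := fun G₁ G₂ _ hd hs => by
    refine (Metric.isBounded_closedBall (x := (0 : ℂ)) (r := R')).subset fun z hz => ?_
    rw [mem_closedBall_zero_iff]
    by_contra! h
    exact Set.disjoint_left.1 hd hz (hs h)
  rw [isPreconnected_iff_subset_of_disjoint]
  intro u v hu hv huv hd
  have oK : IsOpen Kᶜ := hK.isClosed.isOpen_compl
  have e : (Kᶜ ∩ u) ∪ (Kᶜ ∩ v) = Kᶜ := by rw [← Set.inter_union_distrib_left]; exact Set.inter_eq_left.2 huv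
  have d : Disjoint (Kᶜ ∩ u) (Kᶜ ∩ v) := Set.disjoint_left.2 fun z h1 h2 =>
    (Set.mem_empty_iff_false z).1 (hd ▸ ⟨h1.1, h1.2, h2.2⟩)
  have concl : ∀ {a b : Set ℂ}, a ∪ Kᶜ ∩ b = Kᶜ → a = ∅ → Kᶜ ⊆ b := fun h h' => by
    rw [h', Set.empty_union] at h
    exact Set.inter_eq_left.1 h
  obtain h | h := isPreconnected_iff_subset_of_disjoint.1
    (isPreconnected_norm_gt (R := R') (by positivity)) u v hu hv (hout.trans huv)
    (Set.eq_empty_of_forall_notMem fun z hz =>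
      (Set.mem_empty_iff_false z).1 (hd ▸ ⟨hout hz.1, hz.2⟩))
  · left
    rw [Set.union_comm] at e
    exact concl e (key _ _ (oK.inter hv) (oK.inter hu) e d.symm
      (hbd _ _ e d.symm fun z hz => ⟨hout hz, h hz⟩))
  · right
    exact concl e (key _ _ (oK.inter hu) (oK.inter hv) e d (hbd _ _ e d fun z hz => ⟨hout hz, h hz⟩))

theorem exists_ball_cover {V : Set ℂ} (hV : IsOpen V) : ∃ (c : ℕ → ℂ) (R : ℕ → ℝ),
    (∀ i, Metric.ball (c i) (R i) ⊆ V) ∧ ∀ z ∈ V, ∃ i, z ∈ Metric.ball (c i) (R i) := by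
  classical
  let d := TopologicalSpace.denseSeq ℂ
  let R : ℕ → ℝ := fun i => if Metric.ball (d i.unpair.1) (1 / (i.unpair.2 + 1)) ⊆ V then
    1 / (i.unpair.2 + 1) else 0
  refine ⟨fun i => d i.unpair.1, R, fun i => ?_, fun z hz => ?_⟩
  · by_cases h : Metric.ball (d i.unpair.1) (1 / (i.unpair.2 + 1)) ⊆ V
    · simpa only [R, if_pos h] using h
    · simp only [R, if_neg h, Metric.ball_zero, Set.empty_subset]
  · obtain ⟨r, hr, hrV⟩ := Metric.isOpen_iff.1 hV z hz
    obtain ⟨m, hm⟩ := exists_nat_one_div_lt (half_pos hr)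
    obtain ⟨n, hn⟩ := Metric.denseRange_iff.1 (TopologicalSpace.denseRange_denseSeq ℂ) z
      (1 / ((m : ℝ) + 1)) (by positivity)
    have hs : Metric.ball (d n) (1 / ((m : ℝ) + 1)) ⊆ V := by
      refine (Metric.ball_subset_ball' ?_).trans hrV
      rw [dist_comm]
      have : dist z (d n) < _ := hn
      linarith
    refine ⟨Nat.pair n m, ?_⟩
    simp only [R, Nat.unpair_pair, if_pos hs]
    exact hn

theorem lapC_const (c : ℝ) (z : ℂ) : lapC (fun _ => c) z = 0 := by
  have h1 : dx (fun _ : ℂ => c) = fun _ => 0 := by funext; simp [dx]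
  have h2 : dy (fun _ : ℂ => c) = fun _ => 0 := by funext; simp [dy]
  rw [lapC, h1, h2]
  simp [dx, dy]

variable {Ω : Set ℂ} {U₁ U₂ : ℂ → ℝ}

/-- A polynomial whose real part approximates `U₁` on a thin shell of superlevel sets of
`U₂ - U₁`. -/
theorem exists_polynomial_shell (hΩ : HoleFree Ω) (hO : IsOpen Ω) (hU₁ : ContDiff ℝ ∞ U₁)
    (hU₂ : ContDiff ℝ ∞ U₂)
    (hw : ∀ z ∈ Ω, lapC (fun z => U₂ z - U₁ z) z = exp (2 * U₁ z) - exp (2 * U₂ z))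
    (hpos : ∀ z ∈ Ω, U₁ z < U₂ z)
    (hK : ∀ t, 0 < t → IsCompact {z | z ∈ Ω ∧ t ≤ U₂ z - U₁ z}) {s δ : ℝ} (hs : 0 < s) (hδ : 0 < δ) :
    ∃ P : Polynomial ℂ, ∃ ε₀ > 0, ∀ z ∈ Ω, s ≤ U₂ z - U₁ z → U₂ z - U₁ z ≤ s + ε₀ →
      |U₁ z - (P.eval z).re| ≤ δ := by
  set w : ℂ → ℝ := fun z => U₂ z - U₁ z with hwdef
  have sw : ContDiff ℝ ∞ w := hU₂.sub hU₁
  have hlneg : ∀ z ∈ Ω, lapC w z < 0 := fun z hz => by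
    rw [hw z hz]
    have := exp_lt_exp.2 (mul_lt_mul_of_pos_left (hpos z hz) two_pos)
    linarith
  obtain ⟨C, hC⟩ := (hK (s / 2) (by positivity)).exists_bound_of_continuousOn
    (f := fun z => lapC U₁ z / lapC w z) (fun z hz => (ContinuousAt.div
      (continuousAt_lapC (hU₁.of_le (by norm_cast)).contDiffAt)
      (continuousAt_lapC (sw.of_le (by norm_cast)).contDiffAt) (hlneg z hz.1).ne).continuousWithinAt)
  set D := max C 1
  have hD : 0 < D := lt_max_of_lt_right one_pos
  have hDb : ∀ z ∈ Ω, s / 2 ≤ w z → |lapC U₁ z| ≤ D * -lapC w z := fun z hz h => by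
    have h1 := (hC z ⟨hz, h⟩).trans (le_max_left C 1)
    rwa [norm_div, Real.norm_eq_abs, Real.norm_eq_abs, abs_of_neg (hlneg z hz),
      div_le_iff₀ (by linarith [hlneg z hz])] at h1
  obtain ⟨η, hη, hη1, hη2⟩ : ∃ η > 0, η ≤ s / 2 ∧ D * (2 * η) ≤ δ / 2 := by
    refine ⟨min (s / 2) (δ / (4 * D)), lt_min (by positivity) (by positivity), min_le_left _ _, ?_⟩
    refine (mul_le_mul_of_nonneg_left (mul_le_mul_of_nonneg_left (min_le_right _ _) zero_le_two) hD.le).trans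
      (le_of_eq ?_)
    field_simp
    norm_num
  set t := s - η with ht
  have ht0 : 0 < t := by linarith
  set m : ℂ → ℝ := Ω.indicator ((fun x => max (x - t) 0) ∘ w) with hm
  have cm : Continuous m := by
    have hs : tsupport m ⊆ {z | z ∈ Ω ∧ t ≤ w z} := by
      refine closure_minimal (fun z hz => ?_) (hK t ht0).isClosed
      have hzO : z ∈ Ω := Set.mem_of_indicator_ne_zero hz
      refine ⟨hzO, le_of_not_ge fun h => hz ?_⟩
      rw [hm, Set.indicator_of_mem hzO]
      exact max_eq_right (by linarith)
    refine continuous_of_tsupport fun z hz => ?_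
    have : ContinuousAt (fun z => max (w z - t) 0) z :=
      ((sw.continuous.sub continuous_const).max continuous_const).continuousAt
    refine this.congr ?_
    filter_upwards [hO.mem_nhds (hs hz).1] with x hx
    rw [hm, Set.indicator_of_mem hx]
    rfl
  have m0 : ∀ z, 0 ≤ m z := Set.indicator_nonneg fun z _ => le_max_right _ _
  set V := {z | z ∈ Ω ∧ t < w z} with hV
  have oV : IsOpen V := isOpen_superlevel hO (fun z _ => sw.continuous.continuousAt) t
  have mV : ∀ z ∈ V, m =ᶠ[nhds z] fun x => w x + -t := fun z hz => by
    filter_upwards [oV.mem_nhds hz] with x hx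
    rw [hm, Set.indicator_of_mem hx.1]
    exact max_eq_left (by linarith [hx.2])
  have hlap : ∀ a : ℝ, ∀ z ∈ V, ContDiffAt ℝ 2 (fun x => U₁ x + a * m x) z ∧
      lapC (fun x => U₁ x + a * m x) z = lapC U₁ z + a * lapC w z := fun a z hz => by
    have h1 : ContDiffAt ℝ 2 m z :=
      ((sw.of_le (by norm_cast)).contDiffAt.add contDiffAt_const).congr_of_eventuallyEq (mV z hz)
    have h2 : ContDiffAt ℝ 2 U₁ z := (hU₁.of_le (by norm_cast)).contDiffAt
    refine ⟨h2.add (contDiffAt_const.mul h1), ?_⟩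
    rw [lapC_add h2 (contDiffAt_const.mul h1), lapC_const_mul, lapC_congr (mV z hz),
      lapC_add (sw.of_le (by norm_cast)).contDiffAt contDiffAt_const]
    rw [lapC_const, add_zero]
  obtain ⟨c, R, hcV, hcov⟩ := exists_ball_cover oV
  obtain ⟨h, hb, hF⟩ := exists_harmonic_between (c := c) (R := R) (lo := fun x => U₁ x + -D * m x)
    (up := fun x => U₁ x + D * m x) (hU₁.continuous.add (continuous_const.mul cm))
    (hU₁.continuous.add (continuous_const.mul cm))
    (fun z => by nlinarith [mul_nonneg hD.le (m0 z)])
    (fun i z hz => ⟨(hlap _ z (hcV i hz)).1, by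
      rw [(hlap _ z (hcV i hz)).2]
      have := hDb z (hcV i hz).1 (by linarith [(hcV i hz).2])
      linarith [neg_abs_le (lapC U₁ z)]⟩)
    (fun i z hz => ⟨(hlap _ z (hcV i hz)).1, by
      rw [(hlap _ z (hcV i hz)).2]
      have := hDb z (hcV i hz).1 (by linarith [(hcV i hz).2])
      linarith [le_abs_self (lapC U₁ z)]⟩)
  have hloc : ∀ z ∈ V, ContDiffAt ℝ ∞ h z ∧ lapC h z = 0 := fun z hz => by
    obtain ⟨i, hi⟩ := hcov z hz
    obtain ⟨F, hF1, hF2⟩ := hF i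
    have he : h =ᶠ[nhds z] fun x => (F x).re :=
      Filter.eventually_of_mem (Metric.isOpen_ball.mem_nhds hi) hF2
    exact ⟨(contDiffAt_re_of_holomorphic Metric.isOpen_ball hF1 hi _).congr_of_eventuallyEq he,
      (lapC_congr he).trans (lapC_re_of_holomorphic Metric.isOpen_ball hF1 hi)⟩
  have hKV : {z | z ∈ Ω ∧ s ≤ w z} ⊆ V := fun z hz => ⟨hz.1, by linarith [hz.2]⟩
  obtain ⟨P, hP⟩ := exists_polynomial_re_approx (hK s hs)
    (isPreconnected_compl_superlevel hΩ hO (hK s hs) (fun z _ => (sw.of_le (by norm_cast)).contDiffAt)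
      fun z hz => (hlneg z hz).le) oV hKV (fun z hz => (hloc z hz).1) (fun z hz => (hloc z hz).2)
    (half_pos hδ)
  refine ⟨P, η, hη, fun z hz h1 h2 => ?_⟩
  have h3 := hP z ⟨hz, h1⟩
  have h4 := hb z
  have h5 : m z ≤ 2 * η := by
    rw [(mV z (hKV ⟨hz, h1⟩)).self_of_nhds]
    linarith
  have h6 : D * m z ≤ δ / 2 := (mul_le_mul_of_nonneg_left h5 hD.le).trans hη2
  rw [abs_le]
  rw [abs_lt] at h3
  constructor <;> linarith

/-- The isoperimetric inequality on superlevel sets of `U₂ - U₁` for the metric `exp (2 U₁) |dz|²`,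
whose curvature is at most `κ`. -/
theorem level_isoperimetric (hΩ : HoleFree Ω) (hO : IsOpen Ω) (hU₁ : ContDiff ℝ ∞ U₁)
    (hU₂ : ContDiff ℝ ∞ U₂)
    (hw : ∀ z ∈ Ω, lapC (fun z => U₂ z - U₁ z) z = exp (2 * U₁ z) - exp (2 * U₂ z))
    (hpos : ∀ z ∈ Ω, U₁ z < U₂ z)
    (hK : ∀ t, 0 < t → IsCompact {z | z ∈ Ω ∧ t ≤ U₂ z - U₁ z}) {κ : ℝ} (hκ : 0 < κ)
    (h₁ : ∀ z ∈ Ω, -lapC U₁ z ≤ κ * exp (2 * U₁ z)) {s τ : ℝ} (hs : 0 < s) (hτ : 0 < τ)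
    (hτ1 : τ < 1) : ∀ᶠ ε in nhdsWithin (0 : ℝ) (Set.Ioi 0), ∀ φ : ℂ → ℝ, ContDiff ℝ ∞ φ →
      (∀ z, 0 ≤ φ z) → tsupport φ ⊆ {z | z ∈ Ω ∧ s ≤ U₂ z - U₁ z} →
      (∀ z ∈ Ω, s + ε < U₂ z - U₁ z → φ z = 1) →
      (1 - τ) * (4 * π * (∫ z in {z | z ∈ Ω ∧ s + ε < U₂ z - U₁ z}, exp (U₁ z) ^ 2) -
        κ * (∫ z in {z | z ∈ Ω ∧ s + ε < U₂ z - U₁ z}, exp (U₁ z) ^ 2) ^ 2) ≤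
      (∫ z, exp (U₁ z) * gradN φ z) ^ 2 := by
  set δ := τ / 6 with hδ
  have hδ0 : 0 < δ := by positivity
  obtain ⟨P, ε₀, hε₀, hP⟩ := exists_polynomial_shell hΩ hO hU₁ hU₂ hw hpos hK hs hδ0
  set w : ℂ → ℝ := fun z => U₂ z - U₁ z with hwdef
  have sw : ContDiff ℝ ∞ w := hU₂.sub hU₁
  have cU₁ := hU₁.continuous
  have hPd : Differentiable ℂ fun z => P.eval z := P.differentiable
  have cP : Continuous fun z => (P.eval z).re := Complex.continuous_re.comp hPd.continuous
  filter_upwards [Ioo_mem_nhdsGT hε₀] with ε hε φ hφ hφ0 hφs hφ1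
  obtain ⟨hε, hεε⟩ := hε
  have hc : HasCompactSupport φ := (hK s hs).of_isClosed_subset (isClosed_tsupport _) hφs
  set O := {z | z ∈ Ω ∧ s + ε < w z} with hOdef
  have oO : IsOpen O := isOpen_superlevel hO (fun z _ => sw.continuous.continuousAt) _
  have hKO : O ⊆ {z | z ∈ Ω ∧ s + ε ≤ w z} := fun z hz => ⟨hz.1, hz.2.le⟩
  have cK := hK (s + ε) (by positivity)
  set A' := ∫ z in O, exp (P.eval z).re ^ 2 with hA'
  have iA : IntegrableOn (fun z => exp (P.eval z).re ^ 2) O :=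
    (ContinuousOn.integrableOn_compact cK (by fun_prop)).mono_set hKO
  have iB : IntegrableOn (fun z => exp (U₁ z) ^ 2) O :=
    (ContinuousOn.integrableOn_compact cK (by fun_prop)).mono_set hKO
  set E : ℂ → ℂ := fun z => Complex.exp (P.eval z) with hE
  have nE : ∀ z, ‖E z‖ = exp (P.eval z).re := fun z => Complex.norm_exp _
  have carl : ∀ ψ : ℂ → ℝ, ContDiff ℝ ∞ ψ → HasCompactSupport ψ → (∀ z, 0 ≤ ψ z) →
      4 * π * ∫ z, exp (P.eval z).re ^ 2 * ψ z ^ 2 ≤ (∫ z, exp (P.eval z).re * gradN ψ z) ^ 2 := by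
    intro ψ h1 h2 h3
    have := carleman_inequality (E := E) hPd.cexp (fun z => Complex.exp_ne_zero _) h1 h2 h3
    simpa only [nE] using this
  have carl' : ∀ (ψ : ℂ → ℝ) (S : Set ℂ), MeasurableSet S → ContDiff ℝ ∞ ψ → HasCompactSupport ψ →
      (∀ z, 0 ≤ ψ z) → (∀ z ∈ S, ψ z = 1) →
      4 * π * ∫ z in S, exp (P.eval z).re ^ 2 ≤ (∫ z, exp (P.eval z).re * gradN ψ z) ^ 2 := by
    intro ψ S hS h1 h2 h3 h4
    refine le_trans (mul_le_mul_of_nonneg_left ?_ (by positivity)) (carl ψ h1 h2 h3)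
    have e : ∫ z in S, exp (P.eval z).re ^ 2 = ∫ z in S, exp (P.eval z).re ^ 2 * ψ z ^ 2 :=
      setIntegral_congr_fun hS fun z hz => by simp [h4 z hz]
    rw [e]
    refine setIntegral_le_integral ?_ (Filter.Eventually.of_forall fun z => by positivity)
    refine Continuous.integrable_of_hasCompactSupport ?_ ?_
    · have := h1.continuous
      fun_prop
    · refine HasCompactSupport.mul_left ?_
      exact h2.comp_left (g := fun x => x ^ 2) (by simp)
  -- comparison of the two weights on the shell where `φ` is not locally constant
  have g1 : ∫ z, exp (P.eval z).re * gradN φ z ≤ exp δ * ∫ z, exp (U₁ z) * gradN φ z := by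
    have cg : Continuous (gradN φ) := by
      have := (hφ.dx (m := 0) (by simp)).continuous
      have := (hφ.dy (m := 0) (by simp)).continuous
      unfold gradN
      fun_prop
    have gc : HasCompactSupport (gradN φ) := by
      refine hc.mono' fun z hz => ?_
      by_contra h
      refine hz ?_
      have h1 := image_eq_zero_of_notMem_tsupport fun h' => h (tsupport_dx_subset φ h')
      have h2 := image_eq_zero_of_notMem_tsupport fun h' => h (tsupport_dy_subset φ h')
      simp [gradN, h1, h2]
    rw [← integral_const_mul]
    refine integral_mono (Continuous.integrable_of_hasCompactSupport (by fun_prop) gc.mul_left)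
      ((Continuous.integrable_of_hasCompactSupport (by fun_prop) gc.mul_left).const_mul _) fun z => ?_
    by_cases hz : gradN φ z = 0
    · simp [hz]
    have hz1 : z ∈ tsupport φ := by
      by_contra h
      have h1 := image_eq_zero_of_notMem_tsupport fun h' => h (tsupport_dx_subset φ h')
      have h2 := image_eq_zero_of_notMem_tsupport fun h' => h (tsupport_dy_subset φ h')
      exact hz (by simp [gradN, h1, h2])
    have hz2 : w z ≤ s + ε := by
      by_contra! h
      have : φ =ᶠ[nhds z] fun _ => 1 :=
        Filter.eventually_of_mem (oO.mem_nhds ⟨(hφs hz1).1, h⟩) fun x hx => hφ1 x hx.1 hx.2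
      refine hz ?_
      rw [gradN, this.dx_eq.self_of_nhds, this.dy_eq.self_of_nhds]
      simp [dx, dy]
    have := (abs_le.1 (hP z (hφs hz1).1 (hφs hz1).2 (hz2.trans (by linarith)))).1
    rw [← mul_assoc, ← exp_add]
    exact mul_le_mul_of_nonneg_right (exp_le_exp.2 (by linarith)) (Real.sqrt_nonneg _)
  have g2 : 4 * π * A' ≤ exp (2 * δ) * (∫ z, exp (U₁ z) * gradN φ z) ^ 2 := by
    refine (carl' φ O oO.measurableSet hφ hc hφ0 fun z hz => hφ1 z hz.1 hz.2).trans ?_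
    rw [mul_comm 2 δ, exp_mul, rpow_two, ← mul_pow]
    exact pow_le_pow_left₀ (integral_nonneg fun z => mul_nonneg (exp_pos _).le (Real.sqrt_nonneg _)) g1 2
  set p : ℂ → ℝ := fun z => U₁ z - (P.eval z).re with hp
  have sP : ContDiff ℝ ∞ fun z => (P.eval z).re := contDiff_iff_contDiffAt.2 fun z =>
    contDiffAt_re_of_holomorphic isOpen_univ hPd.differentiableOn (Set.mem_univ z) _
  have sp : ContDiff ℝ ∞ p := hU₁.sub sP
  have lp : ∀ z, lapC p z = lapC U₁ z := fun z => by
    have h1 : p = fun z => U₁ z + (-1) * (P.eval z).re := by funext z; simp only [hp]; ring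
    have h2 : ContDiffAt ℝ 2 (fun z => (P.eval z).re) z := (sP.of_le (by norm_cast)).contDiffAt
    rw [h1, lapC_add (hU₁.of_le (by norm_cast)).contDiffAt (contDiffAt_const.mul h2), lapC_const_mul,
      lapC_re_of_holomorphic isOpen_univ hPd.differentiableOn (Set.mem_univ z), mul_zero, add_zero]
  have ep : ∀ z, exp (P.eval z).re ^ 2 * exp (2 * p z) = exp (U₁ z) ^ 2 := fun z => by
    rw [← Real.exp_nat_mul, ← Real.exp_nat_mul, ← exp_add]
    congr 1
    simp only [hp]
    push_cast
    ring
  have pK : ∀ σ, δ < σ → IsCompact {z | z ∈ O ∧ σ ≤ p z} := fun σ hσ => by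
    have : {z | z ∈ O ∧ σ ≤ p z} = {z | z ∈ Ω ∧ s + ε ≤ w z} ∩ {z | σ ≤ p z} := by
      ext z
      refine ⟨fun h => ⟨hKO h.1, h.2⟩, fun h => ⟨⟨h.1.1, lt_of_le_of_ne h.1.2 fun he => ?_⟩, h.2⟩⟩
      have h1 := (abs_le.1 (hP z h.1.1 (by linarith) (by linarith))).2
      have h2 : σ ≤ p z := h.2
      exact absurd (h2.trans h1) (not_le.2 hσ)
    rw [this]
    exact cK.inter_right (isClosed_le continuous_const sp.continuous)
  have key := level_set_inequality (O := O) (v := p) (ρ := fun z => exp (P.eval z).re) (s₀ := δ)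
    (κ₀ := 0) (κ₁ := κ) (κ₀' := 0) oO (fun z _ => sp.contDiffAt)
    (fun z _ => (continuous_exp.comp cP).continuousAt) (fun z _ => exp_pos _) le_rfl hκ.le le_rfl pK
    (fun z hz _ => by
      rw [lp, ep, ← Real.exp_nat_mul]
      simpa using h₁ z hz.1)
    (fun σ hσ h => by
      have i1 := (integrableOn_superlevel (ρ := fun z => exp (P.eval z).re ^ 2) (pK σ hσ)
        fun z _ => (cP.rexp.pow 2).continuousAt)
      have i2 := (integrableOn_superlevel (ρ := fun z => exp (P.eval z).re ^ 2 * exp (2 * p z))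
        (pK σ hσ) fun z _ => by
          have := sp.continuous
          exact Continuous.continuousAt (by fun_prop))
      have : ∫ z in {z | z ∈ O ∧ σ < p z}, exp (P.eval z).re ^ 2 ≤
          ∫ z in {z | z ∈ O ∧ σ < p z}, exp (P.eval z).re ^ 2 * exp (2 * p z) :=
        setIntegral_mono_on i1 i2 (isOpen_superlevel oO (fun z _ => sp.continuous.continuousAt)
          σ).measurableSet fun z hz => le_mul_of_one_le_right (by positivity)
            (one_le_exp (by linarith [hz.2]))
      have := h.trans_le this
      simp only [zero_mul, sub_zero]
      positivity)
    (fun σ hσ τ' h1 h2 => by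
      filter_upwards [self_mem_nhdsWithin] with ε' hε' ψ ψs ψ0 ψK ψ1
      have hψc : HasCompactSupport ψ := (pK σ hσ).of_isClosed_subset (isClosed_tsupport _) ψK
      have := carl' ψ {z | z ∈ O ∧ σ + ε' < p z}
        (isOpen_superlevel oO (fun z _ => sp.continuous.continuousAt) _).measurableSet ψs hψc ψ0
        fun z hz => ψ1 z hz.1 hz.2
      refine le_trans ?_ this
      rw [zero_mul, sub_zero]
      refine mul_le_of_le_one_left (mul_nonneg (by positivity)
        (integral_nonneg fun z => by positivity)) (by linarith))
    (s := 2 * δ) (s₁ := 2 * δ) (by linarith) le_rfl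
  simp only [ep, sub_self, mul_zero, zero_mul, sub_zero] at key
  set T := {z | z ∈ O ∧ 2 * δ < p z} with hT
  have mT : MeasurableSet T :=
    (isOpen_superlevel oO (fun z _ => sp.continuous.continuousAt) _).measurableSet
  have hTO : T ⊆ O := fun z hz => hz.1
  have sA := setIntegral_sdiff mT iA hTO
  have sB := setIntegral_sdiff mT iB hTO
  have cmp : ∫ z in O \ T, exp (U₁ z) ^ 2 ≤ exp (4 * δ) * ∫ z in O \ T, exp (P.eval z).re ^ 2 := by
    rw [← integral_const_mul]
    refine setIntegral_mono_on (iB.mono_set Set.sdiff_subset)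
      ((iA.mono_set Set.sdiff_subset).const_mul _) (oO.measurableSet.diff mT) fun z hz => ?_
    rw [← ep, mul_comm]
    refine mul_le_mul_of_nonneg_right (exp_le_exp.2 ?_) (by positivity)
    have : p z ≤ 2 * δ := not_lt.1 fun h => hz.2 ⟨hz.1, h⟩
    linarith
  rw [sA, sB] at cmp
  have e4 : exp (2 * (2 * δ)) = exp (4 * δ) := by ring_nf
  rw [e4] at key
  set BO := ∫ z in O, exp (U₁ z) ^ 2
  set BT := ∫ z in T, exp (U₁ z) ^ 2
  set AT := ∫ z in T, exp (P.eval z).re ^ 2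
  set I := (∫ z, exp (U₁ z) * gradN φ z) ^ 2
  have hBT : BT ≤ BO := by
    have : 0 ≤ ∫ z in O \ T, exp (U₁ z) ^ 2 := integral_nonneg fun z => by positivity
    linarith
  have hBT0 : 0 ≤ BT := integral_nonneg fun z => by positivity
  have k1 : 4 * π * BO - κ * BO ^ 2 ≤ exp (4 * δ) * (4 * π * A') := by
    have h1 : κ * BT ^ 2 ≤ κ * BO ^ 2 :=
      mul_le_mul_of_nonneg_left (pow_le_pow_left₀ hBT0 hBT 2) hκ.le
    have h2 := mul_le_mul_of_nonneg_left cmp (by positivity : 0 ≤ 4 * π)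
    linarith
  have k2 : 4 * π * BO - κ * BO ^ 2 ≤ exp τ * I := by
    refine k1.trans ((mul_le_mul_of_nonneg_left g2 (exp_pos _).le).trans (le_of_eq ?_))
    rw [← mul_assoc, ← exp_add]
    congr 2
    rw [hδ]
    ring
  have k3 : 1 - τ ≤ exp (-τ) := by linarith [add_one_le_exp (-τ)]
  have hI : 0 ≤ I := sq_nonneg _
  calc _ ≤ (1 - τ) * (exp τ * I) := mul_le_mul_of_nonneg_left k2 (by linarith)
    _ ≤ exp (-τ) * (exp τ * I) := mul_le_mul_of_nonneg_right k3 (by positivity)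
    _ = I := by rw [← mul_assoc, ← exp_add, neg_add_cancel, exp_zero, one_mul]

/-- The sphere covering inequality. -/
theorem sphere_covering (hΩ : HoleFree Ω) (hO : IsOpen Ω) (hne : Ω.Nonempty)
    (hU₁ : ContDiff ℝ ∞ U₁) (hU₂ : ContDiff ℝ ∞ U₂)
    (hw : ∀ z ∈ Ω, lapC (fun z => U₂ z - U₁ z) z = exp (2 * U₁ z) - exp (2 * U₂ z))
    (hpos : ∀ z ∈ Ω, U₁ z < U₂ z)
    (hK : ∀ t, 0 < t → IsCompact {z | z ∈ Ω ∧ t ≤ U₂ z - U₁ z}) {κ : ℝ} (hκ : 0 < κ) (hκ1 : κ < 1)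
    (h₁ : ∀ z ∈ Ω, -lapC U₁ z ≤ κ * exp (2 * U₁ z)) (i₁ : IntegrableOn (fun z => exp (2 * U₁ z)) Ω)
    (i₂ : IntegrableOn (fun z => exp (2 * U₂ z)) Ω) :
    4 * π < ∫ z in Ω, (exp (2 * U₁ z) + exp (2 * U₂ z)) := by
  set w : ℂ → ℝ := fun z => U₂ z - U₁ z with hwdef
  have sw : ContDiff ℝ ∞ w := hU₂.sub hU₁
  have cU₁ := hU₁.continuous
  have cw := sw.continuous
  have e1 : ∀ z, exp (U₁ z) ^ 2 = exp (2 * U₁ z) := fun z => by rw [← Real.exp_nat_mul]; norm_num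
  have e2 : ∀ z, exp (U₁ z) ^ 2 * exp (2 * w z) = exp (2 * U₂ z) := fun z => by
    rw [e1, ← exp_add]
    congr 1
    simp only [hwdef]
    ring
  have e3 : ∀ z, exp (2 * U₁ z) * exp (2 * w z) = exp (2 * U₂ z) := fun z => by rw [← e1, e2]
  set L : ℝ → Set ℂ := fun s => {z | z ∈ Ω ∧ s < w z} with hL
  have oL : ∀ s, IsOpen (L s) := fun s => isOpen_superlevel hO (fun z _ => cw.continuousAt) s
  have hLΩ : ∀ s, L s ⊆ Ω := fun s z hz => hz.1
  have hlt : ∀ T ⊆ Ω, IsOpen T → T.Nonempty →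
      ∫ z in T, exp (2 * U₁ z) < ∫ z in T, exp (2 * U₂ z) := by
    intro T hT oT hTn
    rw [← sub_pos, ← integral_sub (i₂.mono_set hT) (i₁.mono_set hT)]
    have hp : ∀ z ∈ T, 0 < exp (2 * U₂ z) - exp (2 * U₁ z) := fun z hz =>
      sub_pos.2 (exp_lt_exp.2 (mul_lt_mul_of_pos_left (hpos z (hT hz)) two_pos))
    rw [setIntegral_pos_iff_support_of_nonneg_ae ((ae_restrict_iff' oT.measurableSet).2
      (Filter.Eventually.of_forall fun z hz => (hp z hz).le))
      ((i₂.mono_set hT).sub (i₁.mono_set hT))]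
    exact (oT.measure_pos volume hTn).trans_le (measure_mono fun z hz => ⟨(hp z hz).ne', hz⟩)
  have key : ∀ s s₁ : ℝ, 0 < s → s ≤ s₁ → _ := fun s s₁ h1 h2 =>
    level_set_inequality (O := Ω) (v := w) (ρ := fun z => exp (U₁ z)) (s₀ := 0) (κ₀ := 1) (κ₁ := 1)
    (κ₀' := κ) (s := s) (s₁ := s₁) hO (fun z _ => sw.contDiffAt)
    (fun z _ => (continuous_exp.comp cU₁).continuousAt) (fun z _ => exp_pos _) zero_le_one zero_le_one
    hκ1.le hK (fun z hz _ => by rw [hw z hz, e2, e1]; linarith)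
    (fun s hs h => by
      have hn : (L s).Nonempty := by
        by_contra! h'
        change 0 < ∫ z in L s, _ at h
        simp [h'] at h
      simp only [e1, e3, one_mul]
      exact sub_pos.2 (hlt _ (hLΩ s) (oL s) hn))
    (fun s hs τ hτ hτ1 => by
      exact level_isoperimetric hΩ hO hU₁ hU₂ hw hpos hK hκ h₁ hs hτ hτ1) h1 h2
  simp only [e1, e3, one_mul] at key
  obtain ⟨z₀, hz₀⟩ := hne
  have hw0 : 0 < w z₀ := sub_pos.2 (hpos z₀ hz₀)
  set s₁ := w z₀ / 2 with hs₁
  have hs₁0 : 0 < s₁ := by positivity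
  have hA1 : 0 < ∫ z in L s₁, exp (2 * U₁ z) := by
    rw [setIntegral_pos_iff_support_of_nonneg_ae (Filter.Eventually.of_forall fun z => (exp_pos _).le)
      (i₁.mono_set (hLΩ _))]
    refine ((oL s₁).measure_pos volume ⟨z₀, hz₀, by linarith⟩).trans_le (measure_mono fun z hz => ?_)
    exact ⟨(exp_pos _).ne', hz⟩
  have hlim : ∀ f : ℂ → ℝ, IntegrableOn f Ω → Filter.Tendsto (fun n : ℕ => ∫ z in L (s₁ / (n + 1)), f z)
      Filter.atTop (nhds (∫ z in Ω, f z)) := by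
    intro f hf
    have hU : ⋃ n : ℕ, L (s₁ / (n + 1)) = Ω := by
      refine Set.Subset.antisymm (Set.iUnion_subset fun n => hLΩ _) fun z hz => ?_
      obtain ⟨n, hn⟩ := exists_nat_one_div_lt (div_pos (sub_pos.2 (hpos z hz)) hs₁0)
      rw [lt_div_iff₀ hs₁0, one_div_mul_eq_div] at hn
      exact Set.mem_iUnion.2 ⟨n, hz, hn⟩
    have := tendsto_setIntegral_of_monotone (μ := volume) (f := f) (s := fun n : ℕ => L (s₁ / (n + 1)))
      (fun n => (oL _).measurableSet) (fun m n hmn z hz => ⟨hz.1, lt_of_le_of_lt (by gcongr) hz.2⟩)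
      (by rwa [hU])
    rwa [hU] at this
  have hs : Filter.Tendsto (fun n : ℕ => s₁ / ((n : ℝ) + 1)) Filter.atTop (nhds 0) := by
    have := tendsto_one_div_add_atTop_nhds_zero_nat (𝕜 := ℝ).const_mul s₁
    simpa [div_eq_mul_inv] using this
  set A := ∫ z in Ω, exp (2 * U₁ z) with hA
  set B := ∫ z in Ω, exp (2 * U₂ z) with hB
  have hexp : Filter.Tendsto (fun n : ℕ => exp (2 * (s₁ / ((n : ℝ) + 1)))) Filter.atTop (nhds 1) := by
    simpa [Function.comp_def] using (continuous_exp.tendsto _).comp (hs.const_mul 2)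
  have lA := hlim _ i₁
  have lB := hlim _ i₂
  have lim1 := (((hexp.const_mul 2).mul_const (1 - κ)).mul_const
    ((∫ z in L s₁, exp (2 * U₁ z)) ^ 2)).mul (hs.const_sub s₁)
  have lim2 := ((hexp.mul lA).mul (lA.const_sub (4 * π))).sub (lB.mul (lB.const_sub (4 * π)))
  have hfin := le_of_tendsto_of_tendsto' lim1 lim2 fun n => key _ s₁ (by positivity)
    (div_le_self hs₁0.le (by linarith [n.cast_nonneg (α := ℝ)]))
  have hpos' : 0 < 2 * 1 * (1 - κ) * (∫ z in L s₁, exp (2 * U₁ z)) ^ 2 * (s₁ - 0) := by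
    have : 0 < 1 - κ := by linarith
    rw [sub_zero]
    positivity
  have hAB : A < B := hlt Ω le_rfl hO ⟨z₀, hz₀⟩
  rw [integral_add i₁ i₂]
  change 4 * π < A + B
  nlinarith

section FaberKrahn

theorem sq_setIntegral_le {D : Set ℂ} (hD : volume D ≠ ⊤) {g : ℂ → ℝ} (hg : IntegrableOn g D)
    (hg2 : IntegrableOn (fun z => g z ^ 2) D) :
    (∫ z in D, g z) ^ 2 ≤ volume.real D * ∫ z in D, g z ^ 2 := by
  rcases (measureReal_nonneg (μ := volume) (s := D)).eq_or_lt with h | h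
  · have : volume D = 0 := by rwa [eq_comm, measureReal_eq_zero_iff hD] at h
    simp [setIntegral_measure_zero _ this, ← h]
  set m := (∫ z in D, g z) / volume.real D with hm
  have hi : IntegrableOn (fun _ : ℂ => m ^ 2) D := integrableOn_const hD
  have h1 : 0 ≤ ∫ z in D, (g z - m) ^ 2 := integral_nonneg fun z => sq_nonneg _
  have h2 : ∫ z in D, (g z - m) ^ 2
      = (∫ z in D, g z ^ 2) - 2 * m * (∫ z in D, g z) + volume.real D * m ^ 2 := by
    have e : ∀ z, (g z - m) ^ 2 = (g z ^ 2 - 2 * m * g z) + m ^ 2 := fun z => by ring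
    simp only [e]
    have i1 : IntegrableOn (fun z => g z ^ 2 - 2 * m * g z) D := hg2.sub (hg.const_mul _)
    rw [integral_add i1 hi, integral_sub hg2 (hg.const_mul _),
      integral_const_mul, setIntegral_const, smul_eq_mul]
  have h3 : ∫ z in D, g z = m * volume.real D := by rw [hm]; field_simp
  rw [h2, h3] at h1
  rw [h3]
  nlinarith

/-- The Faber–Krahn inequality in its crudest form: a domain that carries a positive solution of
`-Δv ≤ M v` with zero boundary values cannot be small. -/
theorem faber_krahn {D : Set ℂ} (hO : IsOpen D) (hb : Bornology.IsBounded D) (hne : D.Nonempty)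
    {v : ℂ → ℝ} (hv : ContDiff ℝ ∞ v) (hpos : ∀ z ∈ D, 0 < v z)
    (hK : ∀ t, 0 < t → IsCompact {z | z ∈ D ∧ t ≤ v z}) {M : ℝ} (hM : 0 ≤ M)
    (hlap : ∀ z ∈ D, -lapC v z ≤ M * v z) : 4 * π ≤ M * volume.real D := by
  have cv := hv.continuous
  have fin : volume D ≠ ⊤ := hb.measure_lt_top.ne
  have ic : ∀ f : ℂ → ℝ, Continuous f → IntegrableOn f D := fun f hf =>
    (hf.continuousOn.integrableOn_compact hb.isCompact_closure).mono_set subset_closure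
  have iv := ic _ cv
  have iv2 : IntegrableOn (fun z => v z ^ 2) D := ic _ (cv.pow 2)
  set I := ∫ z in D, v z ^ 2 with hI
  have I0 : 0 < I := by
    rw [hI, setIntegral_pos_iff_support_of_nonneg_ae
      (Filter.Eventually.of_forall fun z => sq_nonneg _) iv2]
    exact (hO.measure_pos volume hne).trans_le
      (measure_mono fun z hz => ⟨(pow_pos (hpos z hz) 2).ne', hz⟩)
  have key : ∀ s, 0 < s → 4 * π * (I - 4 * s * ∫ z in D, v z) ≤ volume.real D * (M * I) := by
    intro s hs
    obtain ⟨h, hh, h0, h1, hn, hle, -⟩ := exists_smooth_step s hs one_pos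
    have ch := hh.continuous
    have hprim : ∀ k : ℝ → ℝ, ContDiff ℝ ∞ k → (∀ x, HasDerivAt (fun x => ∫ t in s..x, k t) (k x) x) ∧
        ContDiff ℝ ∞ (fun x => ∫ t in s..x, k t) := fun k hk => by
      have hd : ∀ x, HasDerivAt (fun x => ∫ t in s..x, k t) (k x) x := fun x =>
        intervalIntegral.integral_hasDerivAt_right (hk.continuous.intervalIntegrable _ _)
          hk.continuous.stronglyMeasurable.stronglyMeasurableAtFilter hk.continuous.continuousAt
      refine ⟨hd, ?_⟩
      rw [contDiff_infty_iff_deriv, funext fun x => (hd x).deriv]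
      exact ⟨fun x => (hd x).differentiableAt, hk⟩
    have hz : ∀ k : ℝ → ℝ, (∀ x ≤ s, k x = 0) → ∀ x ≤ s, ∫ t in s..x, k t = 0 := fun k hk x hx => by
      rw [intervalIntegral.integral_congr (g := fun _ => (0 : ℝ)), intervalIntegral.integral_zero]
      intro t ht
      rw [Set.uIcc_of_ge hx] at ht
      exact hk t ht.2
    obtain ⟨dη, sη⟩ := hprim h hh
    obtain ⟨dF, sF⟩ := hprim (fun t => h t ^ 2) (hh.pow 2)
    have η0 := hz h h0
    have F0 := hz (fun t => h t ^ 2) fun x hx => by simp [h0 x hx]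
    set η := fun x => ∫ t in s..x, h t with hη
    set F := fun x => ∫ t in s..x, h t ^ 2 with hF
    have ηnn : ∀ x, 0 ≤ η x := fun x => by
      rcases le_total x s with hx | hx
      · exact (η0 x hx).ge
      · exact intervalIntegral.integral_nonneg hx fun t _ => hn t
    have ηge : ∀ x, x - 2 * s ≤ η x := fun x => by
      rcases le_total x (2 * s) with hx | hx
      · linarith [ηnn x]
      · have e : η (2 * s) + ∫ t in (2 * s)..x, h t = η x :=
          intervalIntegral.integral_add_adjacent_intervals (ch.intervalIntegrable _ _)
            (ch.intervalIntegrable _ _)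
        have e2 : ∫ t in (2 * s)..x, h t = ∫ t in (2 * s)..x, (1 : ℝ) :=
          intervalIntegral.integral_congr fun t ht => by
            rw [Set.uIcc_of_le hx] at ht
            exact h1 t (by linarith [ht.1])
        rw [e2, intervalIntegral.integral_const, smul_eq_mul, mul_one] at e
        linarith [ηnn (2 * s)]
    have Fnn : ∀ x, 0 ≤ F x := fun x => by
      rcases le_total x s with hx | hx
      · exact (F0 x hx).ge
      · exact intervalIntegral.integral_nonneg hx fun t _ => sq_nonneg _
    have Fle : ∀ x, 0 ≤ x → F x ≤ x := fun x hx0 => by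
      rcases le_total x s with hx | hx
      · exact (F0 x hx).trans_le hx0
      · calc F x ≤ ∫ t in s..x, (1 : ℝ) := intervalIntegral.integral_mono_on hx
              ((ch.pow 2).intervalIntegrable _ _) (by simp) fun t _ => pow_le_one₀ (hn t) (hle t)
          _ ≤ x := by simp [hs.le]
    obtain ⟨sφ, cφ, tφ⟩ := level_cutoff hO (fun z _ => hv.contDiffAt) (hK s hs) sη η0
    obtain ⟨sψ, cψ, tψ⟩ := level_cutoff hO (fun z _ => hv.contDiffAt) (hK s hs) sF F0
    set φ := D.indicator (η ∘ v) with hφ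
    set ψ := D.indicator (F ∘ v) with hψ
    have φn : ∀ z, 0 ≤ φ z := fun z => Set.indicator_nonneg (fun z _ => ηnn (v z)) z
    have carl := carleman_inequality (E := fun _ => 1) (by fun_prop) (by simp) sφ cφ φn
    simp only [norm_one, one_pow, one_mul] at carl
    have gz : ∀ z ∉ D, dx φ z = 0 ∧ dy φ z = 0 := fun z hz => by
      have hnt : z ∉ tsupport φ := fun h => hz (tφ h).1
      exact ⟨image_eq_zero_of_notMem_tsupport fun h => hnt (tsupport_dx_subset _ h),
        image_eq_zero_of_notMem_tsupport fun h => hnt (tsupport_dy_subset _ h)⟩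
    have gD : ∀ z ∈ D, dx φ z = h (v z) * dx v z ∧ dy φ z = h (v z) * dy v z ∧
        dx ψ z = h (v z) ^ 2 * dx v z ∧ dy ψ z = h (v z) ^ 2 * dy v z := fun z hz => by
      have dv : DifferentiableAt ℝ v z := (hv.differentiable (by simp)).differentiableAt
      have e1 : φ =ᶠ[nhds z] η ∘ v := by
        filter_upwards [hO.mem_nhds hz] with p hp using Set.indicator_of_mem hp _
      have e2 : ψ =ᶠ[nhds z] F ∘ v := by
        filter_upwards [hO.mem_nhds hz] with p hp using Set.indicator_of_mem hp _
      rw [e1.dx_eq.eq_of_nhds, e1.dy_eq.eq_of_nhds, e2.dx_eq.eq_of_nhds, e2.dy_eq.eq_of_nhds,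
        dx_comp (dη _).differentiableAt dv,
        dy_comp (dη _).differentiableAt dv, dx_comp (dF _).differentiableAt dv,
        dy_comp (dF _).differentiableAt dv, (dη _).deriv, (dF _).deriv]
      exact ⟨rfl, rfl, rfl, rfl⟩
    have gg : ∀ z, dx ψ z * dx v z + dy ψ z * dy v z = gradN φ z ^ 2 := fun z => by
      rw [gradN, Real.sq_sqrt (by positivity)]
      by_cases hz : z ∈ D
      · obtain ⟨a, b, c, d⟩ := gD z hz
        rw [a, b, c, d]; ring
      · have hnt : z ∉ tsupport ψ := fun h => hz (tψ h).1
        rw [(gz z hz).1, (gz z hz).2, image_eq_zero_of_notMem_tsupport fun h => hnt (tsupport_dx_subset _ h),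
          image_eq_zero_of_notMem_tsupport fun h => hnt (tsupport_dy_subset _ h)]
        ring
    have cg : Continuous (gradN φ) := by
      have h1 := (sφ.dx (m := 0) (by norm_cast)).continuous
      have h2 := (sφ.dy (m := 0) (by norm_cast)).continuous
      exact ((h1.pow 2).add (h2.pow 2)).sqrt
    have r1 : ∫ z, gradN φ z = ∫ z in D, gradN φ z :=
      (setIntegral_eq_integral_of_forall_compl_eq_zero fun z hz => by
        simp [gradN, gz z hz]).symm
    have r2 : ∫ z, φ z ^ 2 = ∫ z in D, φ z ^ 2 :=
      (setIntegral_eq_integral_of_forall_compl_eq_zero fun z hz => by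
        simp [hφ, hz]).symm
    have r3 : ∫ z, gradN φ z ^ 2 = ∫ z in D, gradN φ z ^ 2 :=
      (setIntegral_eq_integral_of_forall_compl_eq_zero fun z hz => by
        simp [gradN, gz z hz]).symm
    have r4 : ∫ z, ψ z * lapC v z = ∫ z in D, ψ z * lapC v z :=
      (setIntegral_eq_integral_of_forall_compl_eq_zero fun z hz => by
        simp [hψ, hz]).symm
    have green := integral_grad_mul_grad (sψ.of_le (by norm_cast)) cψ
      (fun z _ => hv.contDiffAt.of_le (by norm_cast))
    simp only [gg] at green
    have cl : Continuous (lapC v) := continuous_iff_continuousAt.2 fun z =>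
      continuousAt_lapC (hv.contDiffAt.of_le (by norm_cast))
    have e1 : ∫ z in D, gradN φ z ^ 2 ≤ M * I := by
      rw [← r3, green, r4, ← integral_neg, hI, ← integral_const_mul]
      refine setIntegral_mono_on (ic _ (sψ.continuous.mul cl).neg) (iv2.const_mul M)
        hO.measurableSet fun z hz => ?_
      have h3 : ψ z = F (v z) := Set.indicator_of_mem hz _
      have h4 := hpos z hz
      have h5 := Fle (v z) h4.le
      have h6 := Fnn (v z)
      rw [h3]
      calc -(F (v z) * lapC v z) = F (v z) * (-lapC v z) := by ring
        _ ≤ F (v z) * (M * v z) := by gcongr; exact hlap z hz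
        _ ≤ v z * (M * v z) := by gcongr
        _ = M * v z ^ 2 := by ring
    have e2 : I - 4 * s * ∫ z in D, v z ≤ ∫ z in D, φ z ^ 2 := by
      rw [hI, ← integral_const_mul, ← integral_sub iv2 (iv.const_mul _)]
      refine setIntegral_mono_on (iv2.sub (iv.const_mul _)) (ic _ (sφ.continuous.pow 2))
        hO.measurableSet fun z hz => ?_
      have h3 : φ z = η (v z) := Set.indicator_of_mem hz _
      have h4 := hpos z hz
      have h5 := ηge (v z)
      have h6 := ηnn (v z)
      rw [h3]
      rcases le_total (v z) (2 * s) with h7 | h7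
      · nlinarith [sq_nonneg (η (v z))]
      · nlinarith [pow_le_pow_left₀ (sub_nonneg.2 h7) h5 2, sq_nonneg s]
    calc 4 * π * (I - 4 * s * ∫ z in D, v z) ≤ 4 * π * ∫ z in D, φ z ^ 2 := by gcongr
      _ ≤ (∫ z in D, gradN φ z) ^ 2 := by rw [← r1, ← r2]; exact carl
      _ ≤ volume.real D * ∫ z in D, gradN φ z ^ 2 := sq_setIntegral_le fin (ic _ cg) (ic _ (cg.pow 2))
      _ ≤ _ := by gcongr
  have lim : Filter.Tendsto (fun s : ℝ => 4 * π * (I - 4 * s * ∫ z in D, v z))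
      (nhdsWithin 0 (Set.Ioi 0)) (nhds (4 * π * (I - 4 * 0 * ∫ z in D, v z))) :=
    (Continuous.tendsto (by fun_prop) 0).mono_left nhdsWithin_le_nhds
  have := le_of_tendsto lim (Filter.eventually_of_mem self_mem_nhdsWithin fun s hs => key s hs)
  rw [mul_zero, zero_mul, sub_zero, ← mul_assoc] at this
  rw [mul_comm M]
  exact le_of_mul_le_mul_right this I0

end FaberKrahn

section Nodal

theorem strong_min_principle {f : ℂ → ℝ} {c : ℂ} {R : ℝ} (hf : Continuous f)
    (hf2 : ∀ z ∈ Metric.ball c R, ContDiffAt ℝ 2 f z) (h0 : ∀ z ∈ Metric.ball c R, 0 ≤ f z)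
    (hlap : ∀ z ∈ Metric.ball c R, lapC f z ≤ 0) (hc : f c = 0) {z : ℂ}
    (hz : z ∈ Metric.ball c R) : f z = 0 := by
  rcases eq_or_ne z c with rfl | hzc
  · exact hc
  set r := ‖z - c‖ with hr
  have r0 : 0 < r := norm_pos_iff.2 (sub_ne_zero.2 hzc)
  have rR : r < R := mem_ball_iff_norm.1 hz
  have hsub : Metric.ball c r ⊆ Metric.ball c R := Metric.ball_subset_ball rR.le
  have h1 := pmod_le hf (fun z hz => hf2 z (hsub hz)) (fun z hz => hlap z (hsub hz)) c
  rw [pmod, if_pos (Metric.mem_ball_self r0), hc, poiss] at h1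
  have h2 : circleAverage (poissonKernel c c • f) c r = circleAverage f c r := by
    refine circleAverage_congr_sphere fun ζ hζ => ?_
    have : ζ - c ≠ 0 := norm_pos_iff.1 (by
      rw [mem_sphere_iff_norm.1 hζ]; exact abs_pos.2 r0.ne')
    simp [poissonKernel, this]
  rw [h2, circleAverage, smul_eq_mul] at h1
  have h3 : ∀ θ, circleMap c r θ ∈ Metric.ball c R := fun θ =>
    Metric.closedBall_subset_ball rR (circleMap_mem_closedBall c r0.le θ)
  by_contra hne
  have hzs : z ∈ Metric.sphere c |r| := by rw [abs_of_pos r0]; simp [hr]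
  rw [← image_circleMap_Ioc] at hzs
  obtain ⟨θ, hθ, hθz⟩ := hzs
  have := intervalIntegral.integral_pos two_pi_pos
    (hf.comp (continuous_circleMap c r)).continuousOn (fun θ _ => h0 _ (h3 θ))
    ⟨θ, Set.Ioc_subset_Icc_self hθ, (by
      rw [Function.comp_apply, hθz]; exact lt_of_le_of_ne (h0 z hz) (Ne.symm hne))⟩
  have : 0 < (2 * π)⁻¹ * ∫ θ in (0 : ℝ)..2 * π, f (circleMap c r θ) := mul_pos (by positivity) this
  linarith

/-- `E` is a union of bounded complementary components of `D`. -/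
def IsHole (D E : Set ℂ) : Prop := IsCompact E ∧ Disjoint E D ∧ IsOpen (D ∪ E)

theorem IsHole.empty {D : Set ℂ} (hD : IsOpen D) : IsHole D ∅ := by simp [IsHole, hD]

theorem IsHole.subset {D E X : Set ℂ} (h : IsHole D E) (hX : IsPreconnected X)
    (hd : Disjoint X D) (hne : (X ∩ E).Nonempty) : X ⊆ E := by
  have hXE : ∀ x ∈ X, x ∈ D ∪ E → x ∈ E := fun x hx h' =>
    h'.resolve_left (Set.disjoint_left.1 hd hx)
  rcases isPreconnected_iff_subset_of_disjoint.1 hX (D ∪ E) Eᶜ h.2.2 h.1.isClosed.isOpen_compl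
    (fun x _ => by simp only [Set.mem_union, Set.mem_compl_iff]; tauto)
    (Set.eq_empty_of_forall_notMem fun x hx => hx.2.2 (hXE x hx.1 hx.2.1)) with h1 | h1
  · exact fun x hx => hXE x hx (h1 hx)
  · obtain ⟨x, hx, hx'⟩ := hne
    exact absurd hx' (h1 hx)

theorem eq_empty_of_isCompact_isOpen {S : Set ℂ} (h1 : IsCompact S) (h2 : IsOpen S) : S = ∅ := by
  rcases isClopen_iff.1 ⟨h1.isClosed, h2⟩ with h | h
  · exact h
  · exact absurd (h ▸ h1) (noncompact_univ ℂ)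

/-- The connected component of `z` in the part of the upper half plane where `w ≠ 0`. -/
def nodal (w : ℂ → ℝ) (z : ℂ) : Set ℂ := connectedComponentIn {ζ | 0 < ζ.im ∧ w ζ ≠ 0} z

/-- A solution of `Δw = -V w` vanishing on the real line and at infinity. -/
structure NodalField (w V : ℂ → ℝ) (M : ℝ) : Prop where
  smooth : ContDiff ℝ ∞ w
  axis : ∀ z : ℂ, z.im = 0 → w z = 0
  pde : ∀ z, lapC w z = -(V z * w z)
  nonneg : ∀ z, 0 ≤ V z
  le : ∀ z, V z ≤ M
  lim : Filter.Tendsto w (Filter.cocompact ℂ) (nhds 0)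

namespace NodalField

variable {w V : ℂ → ℝ} {M : ℝ} {z z' : ℂ}

theorem neg (h : NodalField w V M) : NodalField (fun z => -w z) V M where
  smooth := h.smooth.neg
  axis z hz := by rw [h.axis z hz, neg_zero]
  pde z := by
    have := lapC_const_mul (f := w) (-1) z
    simp only [neg_mul, one_mul] at this
    rw [this, h.pde]
    ring
  nonneg := h.nonneg
  le := h.le
  lim := by simpa using h.lim.neg

theorem nodal_neg : nodal (fun z => -w z) z = nodal w z := by simp [nodal]

theorem isOpen_ne (h : NodalField w V M) : IsOpen {ζ : ℂ | 0 < ζ.im ∧ w ζ ≠ 0} :=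
  (isOpen_lt continuous_const Complex.continuous_im).inter
    (h.smooth.continuous.isOpen_preimage _ isOpen_compl_singleton)

theorem isOpen_nodal (h : NodalField w V M) : IsOpen (nodal w z) :=
  h.isOpen_ne.connectedComponentIn

theorem mem_nodal (hz : 0 < z.im ∧ w z ≠ 0) : z ∈ nodal w z := mem_connectedComponentIn hz

theorem nodal_subset : nodal w z ⊆ {ζ | 0 < ζ.im ∧ w ζ ≠ 0} := connectedComponentIn_subset _ _

theorem isPreconnected_nodal : IsPreconnected (nodal w z) := isPreconnected_connectedComponentIn

theorem nodal_eq (hz : z' ∈ nodal w z) : nodal w z = nodal w z' := connectedComponentIn_eq hz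

theorem disjoint_nodal (hne : nodal w z ≠ nodal w z') : Disjoint (nodal w z) (nodal w z') :=
  Set.disjoint_left.2 fun _ h h' => hne ((nodal_eq h).trans (nodal_eq h').symm)

theorem pos_of_mem (h : NodalField w V M) (hz : 0 < z.im) (hw : 0 < w z) (hz' : z' ∈ nodal w z) :
    0 < w z' := by
  by_contra! hn
  obtain ⟨p, hp, hp0⟩ := isPreconnected_nodal.intermediate_value hz' (mem_nodal ⟨hz, hw.ne'⟩)
    h.smooth.continuous.continuousOn ⟨hn, hw.le⟩
  exact (nodal_subset hp).2 hp0

theorem eq_zero_of_mem_closure (h : NodalField w V M) (hz : z' ∈ closure (nodal w z))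
    (hz' : z' ∉ nodal w z) : w z' = 0 := by
  by_contra hne
  have h1 : 0 ≤ z'.im := by
    have : closure (nodal w z) ⊆ {ζ : ℂ | 0 ≤ ζ.im} :=
      closure_minimal (fun p hp => (nodal_subset hp).1.le)
        (isClosed_le continuous_const Complex.continuous_im)
    exact this hz
  rcases h1.eq_or_lt with h1 | h1
  · exact hne (h.axis z' h1.symm)
  · obtain ⟨p, hp, hp'⟩ := mem_closure_iff.1 hz _ h.isOpen_nodal (mem_nodal ⟨h1, hne⟩)
    exact hz' (((nodal_eq hp').trans (nodal_eq hp).symm) ▸ mem_nodal ⟨h1, hne⟩)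

theorem isCompact_level (h : NodalField w V M) {t : ℝ} (ht : 0 < t) :
    IsCompact {p | p ∈ nodal w z ∧ t ≤ w p} := by
  have e : {p | p ∈ nodal w z ∧ t ≤ w p} = closure (nodal w z) ∩ {p | t ≤ w p} := by
    ext p
    refine ⟨fun hp => ⟨subset_closure hp.1, hp.2⟩, fun hp => ⟨?_, hp.2⟩⟩
    by_contra hn
    have := h.eq_zero_of_mem_closure hp.1 hn
    have := hp.2
    simp only [Set.mem_ofPred_eq] at this
    linarith
  obtain ⟨K, hK, hKs⟩ := Filter.mem_cocompact.1 (h.lim.eventually_lt_const ht)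
  rw [e]
  refine hK.of_isClosed_subset
    (isClosed_closure.inter (isClosed_le continuous_const h.smooth.continuous)) fun p hp => ?_
  by_contra hn
  have h1 := hKs hn
  have h2 := hp.2
  simp only [Set.mem_ofPred_eq] at h1 h2
  linarith

theorem faber_krahn (h : NodalField w V M) (hz : 0 < z.im ∧ w z ≠ 0)
    (hb : Bornology.IsBounded (nodal w z)) : 4 * π ≤ M * volume.real (nodal w z) := by
  wlog hw : 0 < w z generalizing w
  · have := this h.neg ⟨hz.1, neg_ne_zero.2 hz.2⟩ (by rwa [nodal_neg])
      (neg_pos.2 (lt_of_le_of_ne (not_lt.1 hw) hz.2))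
    rwa [nodal_neg] at this
  have hp : ∀ p ∈ nodal w z, 0 < w p := fun p hp => h.pos_of_mem hz.1 hw hp
  refine _root_.faber_krahn h.isOpen_nodal hb ⟨z, mem_nodal hz⟩ h.smooth hp
    (fun t ht => h.isCompact_level ht) ((h.nonneg z).trans (h.le z)) fun p hpz => ?_
  rw [h.pde, neg_neg]
  exact mul_le_mul_of_nonneg_right (h.le p) (hp p hpz).le

variable {E E' : Set ℂ}

theorem hole_im_pos (hE : IsHole (nodal w z) E) {p : ℂ} (hp : p ∈ E) : 0 < p.im := by
  by_contra! hn
  have hX : IsPreconnected {ζ : ℂ | ζ.im ≤ 0} := (convex_halfSpace_im_le 0).isPreconnected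
  have hs := hE.subset hX (Set.disjoint_left.2 fun x hx hx' => (nodal_subset hx').1.not_ge hx)
    ⟨p, hn, hp⟩
  obtain ⟨R, hR⟩ := hE.1.isBounded.exists_norm_le
  have := hR (((|R| + 1 : ℝ)) : ℂ) (hs (by simp))
  rw [Complex.norm_real, Real.norm_of_nonneg (by positivity)] at this
  linarith [le_abs_self R]

theorem exists_mem_hole (h : NodalField w V M) (hz : 0 < z.im ∧ w z ≠ 0)
    (hE : IsHole (nodal w z) E) (hne : E.Nonempty) : ∃ p ∈ E, 0 < p.im ∧ w p ≠ 0 := by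
  wlog hw : 0 < w z generalizing w
  · obtain ⟨p, hp⟩ := this h.neg ⟨hz.1, neg_ne_zero.2 hz.2⟩ (by rwa [nodal_neg])
      (neg_pos.2 (lt_of_le_of_ne (not_lt.1 hw) hz.2))
    exact ⟨p, by simpa using hp⟩
  by_contra! hn
  have h0 : ∀ p ∈ E, w p = 0 := fun p hp => hn p hp (hole_im_pos hE hp)
  have hp : ∀ p ∈ nodal w z, 0 < w p := fun p hp => h.pos_of_mem hz.1 hw hp
  have hnn : ∀ p ∈ nodal w z ∪ E, 0 ≤ w p := fun p hp' =>
    hp'.elim (fun h => (hp p h).le) fun h => (h0 p h).ge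
  refine hne.ne_empty (eq_empty_of_isCompact_isOpen hE.1 (Metric.isOpen_iff.2 fun c hc => ?_))
  obtain ⟨R, hR, hs⟩ := Metric.isOpen_iff.1 hE.2.2 c (Or.inr hc)
  refine ⟨R, hR, fun p hpR => (hs hpR).resolve_left fun hpz => (hp p hpz).ne' ?_⟩
  refine strong_min_principle h.smooth.continuous
    (fun z _ => h.smooth.contDiffAt.of_le (by norm_cast)) (fun z hz => hnn z (hs hz))
    (fun z hz => ?_) (h0 c hc) hpR
  rw [h.pde, neg_nonpos]
  exact mul_nonneg (h.nonneg z) (hnn z (hs hz))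

theorem exists_nodal_subset_hole (h : NodalField w V M) (hz : 0 < z.im ∧ w z ≠ 0)
    (hE : IsHole (nodal w z) E) (hne : E.Nonempty) :
    ∃ p, (0 < p.im ∧ w p ≠ 0) ∧ nodal w p ⊆ E := by
  obtain ⟨p, hp, hp'⟩ := h.exists_mem_hole hz hE hne
  refine ⟨p, hp', hE.subset isPreconnected_nodal (disjoint_nodal fun e => ?_) ⟨p, mem_nodal hp', hp⟩⟩
  exact Set.disjoint_left.1 hE.2.1 hp (e ▸ mem_nodal hp')

theorem hole_subset_hole (hE : IsHole (nodal w z) E) (hne : E.Nonempty)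
    (hE' : IsHole (nodal w z') E') (hs : nodal w z' ⊆ E) : E' ⊆ E := by
  have hd : Disjoint (nodal w z) (nodal w z') := (hE.2.1.mono_left hs).symm
  by_cases hi : (nodal w z ∩ E').Nonempty
  · have hs' := hE'.subset isPreconnected_nodal hd hi
    have e : E ∪ E' = (nodal w z ∪ E) ∪ (nodal w z' ∪ E') := by
      rw [Set.union_union_union_comm, eq_comm, Set.union_eq_right]
      exact Set.union_subset (hs'.trans Set.subset_union_right) (hs.trans Set.subset_union_left)
    have := eq_empty_of_isCompact_isOpen (hE.1.union hE'.1) (e ▸ hE.2.2.union hE'.2.2)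
    exact absurd (Set.union_empty_iff.1 this).1 hne.ne_empty
  · rw [Set.not_nonempty_iff_eq_empty] at hi
    have hi' : ∀ x ∈ E', x ∉ nodal w z := fun x hx hx' => by
      have : x ∈ nodal w z ∩ E' := ⟨hx', hx⟩
      simp [hi] at this
    have e1 : E' \ E = E' \ (nodal w z ∪ E) := by
      ext x
      have := hi' x
      simp only [Set.mem_sdiff, Set.mem_union]
      tauto
    have e2 : E' \ E = (nodal w z' ∪ E') \ E := by
      ext x
      have := @hs x
      simp only [Set.mem_sdiff, Set.mem_union]
      tauto
    refine Set.sdiff_eq_empty.1 (eq_empty_of_isCompact_isOpen ?_ ?_)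
    · rw [e1]; exact hE'.1.diff hE.2.2
    · rw [e2]; exact hE'.2.2.sdiff hE.1.isClosed

theorem exists_holeFree_of_hole (h : NodalField w V M) (n : ℕ) : ∀ z E, (0 < z.im ∧ w z ≠ 0) →
    IsHole (nodal w z) E → E.Nonempty → M * volume.real E < 4 * π * n →
    ∃ p, (0 < p.im ∧ w p ≠ 0) ∧ nodal w p ⊆ E ∧ HoleFree (nodal w p) := by
  have hM : 0 ≤ M := (h.nonneg 0).trans (h.le 0)
  induction n with
  | zero =>
    intro z E _ _ _ hv
    have : 0 ≤ M * volume.real E := by positivity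
    simp at hv
    linarith
  | succ n ih =>
    intro z E hz hE hne hv
    obtain ⟨p, hp, hpE⟩ := h.exists_nodal_subset_hole hz hE hne
    by_cases hf : HoleFree (nodal w p)
    · exact ⟨p, hp, hpE, hf⟩
    · rw [HoleFree] at hf
      push Not at hf
      obtain ⟨E', h1, h2, h3, hne'⟩ := hf
      have hE' : IsHole (nodal w p) E' := ⟨h1, h2, h3⟩
      have hs := hole_subset_hole hE hne hE' hpE
      have hb := hE.1.isBounded.subset hpE
      have fk := h.faber_krahn hp hb
      have hadd : volume.real (nodal w p ∪ E') = volume.real (nodal w p) + volume.real E' :=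
        measureReal_union h2.symm h1.measurableSet hb.measure_lt_top.ne h1.measure_lt_top.ne
      have hle : volume.real (nodal w p ∪ E') ≤ volume.real E :=
        measureReal_mono (Set.union_subset hpE hs) hE.1.measure_lt_top.ne
      rw [hadd] at hle
      obtain ⟨q, hq, hq2, hq3⟩ := ih p E' hp hE' hne' (by
        push_cast at hv
        nlinarith [mul_le_mul_of_nonneg_left hle hM])
      exact ⟨q, hq, hq2.trans hs, hq3⟩

theorem exists_holeFree (h : NodalField w V M) (hz : 0 < z.im ∧ w z ≠ 0) :
    ∃ p E, (0 < p.im ∧ w p ≠ 0) ∧ IsHole (nodal w z) E ∧ HoleFree (nodal w p) ∧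
      nodal w p ⊆ nodal w z ∪ E := by
  by_cases hf : HoleFree (nodal w z)
  · exact ⟨z, ∅, hz, IsHole.empty h.isOpen_nodal, hf, Set.subset_union_left⟩
  · rw [HoleFree] at hf
    push Not at hf
    obtain ⟨E, h1, h2, h3, hne⟩ := hf
    obtain ⟨n, hn⟩ := exists_nat_gt (M * volume.real E / (4 * π))
    rw [div_lt_iff₀' (by positivity)] at hn
    obtain ⟨p, hp, hpE, hpf⟩ := h.exists_holeFree_of_hole n z E hz ⟨h1, h2, h3⟩
      hne hn
    exact ⟨p, E, hp, ⟨h1, h2, h3⟩, hpf, hpE.trans Set.subset_union_right⟩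

theorem disjoint_nodal_hole (hne : nodal w z ≠ nodal w z') (hE : IsHole (nodal w z) E) {p : ℂ}
    (hp : p ∈ closure (nodal w z')) (hp0 : p.im = 0) : Disjoint (nodal w z') E := by
  by_contra hd
  have hs := hE.subset isPreconnected_nodal (disjoint_nodal hne.symm)
    (Set.not_disjoint_iff_nonempty_inter.1 hd)
  exact (hole_im_pos hE (closure_minimal hs hE.1.isClosed hp)).ne' hp0

theorem disjoint_filled (hne : nodal w z ≠ nodal w z') (hE : IsHole (nodal w z) E)
    (hE' : IsHole (nodal w z') E') {p p' : ℂ} (hp : p ∈ closure (nodal w z)) (hp0 : p.im = 0)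
    (hp' : p' ∈ closure (nodal w z')) (hp0' : p'.im = 0) :
    Disjoint (nodal w z ∪ E) (nodal w z' ∪ E') := by
  have h1 := disjoint_nodal_hole hne hE hp' hp0'
  have h2 := disjoint_nodal_hole hne.symm hE' hp hp0
  have h3 := disjoint_nodal hne
  have e : (nodal w z ∪ E) ∩ (nodal w z' ∪ E') = E ∩ E' := by
    rw [Set.disjoint_left] at h1 h2 h3
    ext x
    have := @h1 x
    have := @h2 x
    have := @h3 x
    simp only [Set.mem_inter_iff, Set.mem_union]
    tauto
  rw [Set.disjoint_iff_inter_eq_empty, e]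
  exact eq_empty_of_isCompact_isOpen (hE.1.inter hE'.1) (e ▸ hE.2.2.inter hE'.2.2)

end NodalField

end Nodal

section PlaneField

open ComplexConjugate

theorem dx_comp_conj {F : Type*} [NormedAddCommGroup F] [NormedSpace ℝ F] (f : ℂ → F) :
    dx (fun z => f (conj z)) = fun z => dx f (conj z) := by
  ext z
  have := Complex.conjCLE.comp_right_fderiv (f := f) (x := z)
  simp only [dx]
  change fderiv ℝ (f ∘ Complex.conjCLE) z 1 = _
  rw [this]
  simp

theorem dy_comp_conj {F : Type*} [NormedAddCommGroup F] [NormedSpace ℝ F] (f : ℂ → F) :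
    dy (fun z => f (conj z)) = fun z => -dy f (conj z) := by
  ext z
  have := Complex.conjCLE.comp_right_fderiv (f := f) (x := z)
  simp only [dy]
  change fderiv ℝ (f ∘ Complex.conjCLE) z Complex.I = _
  rw [this]
  simp

theorem lapC_comp_conj (f : ℂ → ℝ) (z : ℂ) : lapC (fun z => f (conj z)) z = lapC f (conj z) := by
  have h : dy (fun z => -dy f (conj z)) z = dy (dy f) (conj z) := by
    have h1 := congr_fun (dy_comp_conj (dy f)) z
    simp only [dy, fderiv_fun_neg, neg_apply] at h1 ⊢
    rw [h1, neg_neg]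
  simp only [lapC, dx_comp_conj, dy_comp_conj, h]

/-- A conformal factor on the plane with curvature between `0` and `1` in the sense of the
hypothesis `sub`, whose odd part with respect to conjugation solves the difference equation. -/
structure PlaneField (U : ℂ → ℝ) (κ B : ℝ) : Prop where
  smooth : ContDiff ℝ ∞ U
  κ_pos : 0 < κ
  κ_lt : κ < 1
  sub : ∀ z, -lapC U z ≤ κ * exp (2 * U z)
  bound : ∀ z, exp (2 * U z) ≤ B
  int : Integrable fun z => exp (2 * U z)
  pde : ∀ z, lapC (fun z => U z - U (conj z)) z = exp (2 * U (conj z)) - exp (2 * U z)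
  lim : Filter.Tendsto (fun z => U z - U (conj z)) (Filter.cocompact ℂ) (nhds 0)

/-- The odd part of `U` with respect to conjugation (up to a factor `2`). -/
def oddPart (U : ℂ → ℝ) (z : ℂ) : ℝ := U z - U (conj z)

/-- The potential in the linear equation satisfied by `oddPart U`. -/
noncomputable def oddPot (U : ℂ → ℝ) (z : ℂ) : ℝ :=
  (exp (2 * U z) - exp (2 * U (conj z))) / oddPart U z

theorem exp_sub_exp_div_mem {a b : ℝ} : 0 ≤ (exp (2 * a) - exp (2 * b)) / (a - b) ∧
    (exp (2 * a) - exp (2 * b)) / (a - b) ≤ 2 * max (exp (2 * a)) (exp (2 * b)) := by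
  wlog h : b ≤ a generalizing a b
  · have := this (a := b) (b := a) (not_le.1 h).le
    rwa [← neg_sub (exp (2 * a)), ← neg_sub a b, neg_div_neg_eq, max_comm] at this
  have h1 : exp (2 * b) ≤ exp (2 * a) := exp_le_exp.2 (by linarith)
  refine ⟨div_nonneg (sub_nonneg.2 h1) (sub_nonneg.2 h), ?_⟩
  rw [max_eq_left h1]
  refine div_le_of_le_mul₀ (sub_nonneg.2 h) (by positivity) ?_
  have h2 := add_one_le_exp (2 * b - 2 * a)
  have h3 : exp (2 * b) = exp (2 * a) * exp (2 * b - 2 * a) := by rw [← exp_add]; ring_nf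
  rw [h3]
  nlinarith [exp_pos (2 * a)]

namespace PlaneField

variable {U : ℂ → ℝ} {κ B : ℝ}

theorem smooth_conj (h : PlaneField U κ B) : ContDiff ℝ ∞ fun z => U (conj z) :=
  h.smooth.comp Complex.conjCLE.contDiff

theorem integrable_conj (h : PlaneField U κ B) : Integrable fun z => exp (2 * U (conj z)) :=
  (Complex.conjLIE.measurePreserving.integrable_comp_emb
    Complex.conjLIE.toHomeomorph.measurableEmbedding).2 h.int

theorem nodalField (h : PlaneField U κ B) : NodalField (oddPart U) (oddPot U) (2 * B) where
  smooth := h.smooth.sub h.smooth_conj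
  axis z hz := by rw [oddPart, Complex.conj_eq_iff_im.2 hz, sub_self]
  pde z := by
    change lapC (fun z => U z - U (conj z)) z = _
    rw [h.pde]
    by_cases h0 : oddPart U z = 0
    · have : U z = U (conj z) := sub_eq_zero.1 h0
      rw [h0, this]; simp
    · rw [oddPot, div_mul_cancel₀ _ h0]; ring
  nonneg z := exp_sub_exp_div_mem.1
  le z := exp_sub_exp_div_mem.2.trans
    (mul_le_mul_of_nonneg_left (max_le (h.bound _) (h.bound _)) two_pos.le)
  lim := h.lim

variable {z : ℂ}

theorem area_nodal (h : PlaneField U κ B) (hz : 0 < z.im ∧ oddPart U z ≠ 0)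
    (hf : HoleFree (nodal (oddPart U) z)) :
    4 * π < ∫ p in nodal (oddPart U) z, (exp (2 * U p) + exp (2 * U (conj p))) := by
  have hN := h.nodalField
  have s' := h.smooth_conj
  have hsub : ∀ z, -lapC (fun z => U (conj z)) z ≤ κ * exp (2 * U (conj z)) := fun z => by
    rw [lapC_comp_conj]; exact h.sub _
  have hne : (nodal (oddPart U) z).Nonempty := ⟨z, NodalField.mem_nodal hz⟩
  have i1 := h.int.integrableOn (s := nodal (oddPart U) z)
  have i2 := h.integrable_conj.integrableOn (s := nodal (oddPart U) z)
  rcases hz.2.lt_or_gt with hw | hw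
  · have e : ∀ p, U (conj p) - U p = -oddPart U p := fun p => by rw [oddPart]; ring
    have hn := NodalField.nodal_neg (w := oddPart U) (z := z)
    refine sphere_covering hf hN.isOpen_nodal hne h.smooth s' (fun p _ => ?_) (fun p hp => ?_)
      (fun t ht => ?_) h.κ_pos h.κ_lt (fun p _ => h.sub p) i1 i2
    · have := lapC_const_mul (f := oddPart U) (-1) p
      simp only [e]
      simp only [neg_mul, one_mul] at this
      have h2 := h.pde p
      change lapC (oddPart U) p = _ at h2
      rw [this, h2]
      ring
    · have := hN.neg.pos_of_mem (z := z) (z' := p) hz.1 (neg_pos.2 hw) (by rwa [hn])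
      rw [← e] at this
      linarith
    · have := hN.neg.isCompact_level (z := z) ht
      rw [hn] at this
      simpa only [e] using this
  · have ec : ∀ p, exp (2 * U p) + exp (2 * U (conj p)) = exp (2 * U (conj p)) + exp (2 * U p) :=
      fun p => add_comm _ _
    simp_rw [ec]
    refine sphere_covering hf hN.isOpen_nodal hne s' h.smooth (fun p _ => h.pde p) (fun p hp => ?_)
      (fun t ht => hN.isCompact_level ht) h.κ_pos h.κ_lt (fun p _ => hsub p) i2 i1
    exact sub_pos.1 (hN.pos_of_mem hz.1 hw hp)

theorem integral_upper (h : PlaneField U κ B) :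
    ∫ p in {p : ℂ | 0 < p.im}, (exp (2 * U p) + exp (2 * U (conj p))) = ∫ p, exp (2 * U p) := by
  have mU : MeasurableSet {p : ℂ | 0 < p.im} := measurableSet_lt measurable_const Complex.measurable_im
  have mL : MeasurableSet {p : ℂ | p.im < 0} := measurableSet_lt Complex.measurable_im measurable_const
  rw [integral_add h.int.integrableOn h.integrable_conj.integrableOn]
  have e1 : ∫ p in {p : ℂ | 0 < p.im}, exp (2 * U (conj p)) = ∫ p in {p : ℂ | p.im < 0}, exp (2 * U p) := by
    have := Complex.conjLIE.measurePreserving.setIntegral_preimage_emb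
      Complex.conjLIE.toHomeomorph.measurableEmbedding (fun p => exp (2 * U p)) {p : ℂ | p.im < 0}
    rw [← this]
    congr 2
    ext p
    simp
  have hz : volume {p : ℂ | p.im = 0} = 0 := by
    have := Measure.addHaar_submodule (volume : Measure ℂ) (LinearMap.ker Complex.imLm) (fun h => by
      have : Complex.I ∈ LinearMap.ker Complex.imLm := h ▸ Submodule.mem_top
      simp at this)
    convert this using 2
    ext p
    simp
  have e2 : ({p : ℂ | 0 < p.im} ∪ {p : ℂ | p.im < 0} : Set ℂ) =ᵐ[volume] Set.univ := by
    refine Filter.eventuallyEq_univ.2 (mem_ae_iff.2 (measure_mono_null (fun p hp => ?_) hz))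
    simp only [Set.mem_compl_iff, Set.mem_union, Set.mem_ofPred_eq, not_or, not_lt] at hp
    exact le_antisymm hp.1 hp.2
  have hd : Disjoint {p : ℂ | 0 < p.im} {p : ℂ | p.im < 0} :=
    Set.disjoint_left.2 fun p (hp : 0 < p.im) (hp' : p.im < 0) => lt_asymm hp hp'
  rw [e1, ← setIntegral_union hd mL
    h.int.integrableOn h.int.integrableOn, setIntegral_congr_set e2, setIntegral_univ]

/-- There are at most two nodal domains that reach the real line. -/
theorem not_three_nodal (h : PlaneField U κ B) (hB : ∫ p, exp (2 * U p) ≤ 12 * π) {z x : Fin 3 → ℂ}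
    (hz : ∀ i, 0 < (z i).im ∧ oddPart U (z i) ≠ 0)
    (hx : ∀ i, x i ∈ closure (nodal (oddPart U) (z i))) (hx0 : ∀ i, (x i).im = 0)
    (hne : ∀ i j, i ≠ j → nodal (oddPart U) (z i) ≠ nodal (oddPart U) (z j)) : False := by
  have hN := h.nodalField
  choose p E hp hE hf hs using fun i => hN.exists_holeFree (hz i)
  have hd : Pairwise (Function.onFun Disjoint fun i => nodal (oddPart U) (p i)) := fun i j hij =>
    (NodalField.disjoint_filled (hne i j hij) (hE i) (hE j) (hx i) (hx0 i) (hx j)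
      (hx0 j)).mono (hs i) (hs j)
  have hi : Integrable fun p => exp (2 * U p) + exp (2 * U (conj p)) := h.int.add h.integrable_conj
  have h1 := integral_iUnion (μ := volume) (fun i => (hN.isOpen_nodal (z := p i)).measurableSet) hd
    hi.integrableOn
  rw [tsum_fintype, Fin.sum_univ_three] at h1
  have h2 : ∫ q in ⋃ i, nodal (oddPart U) (p i), (exp (2 * U q) + exp (2 * U (conj q)))
      ≤ ∫ q in {q : ℂ | 0 < q.im}, (exp (2 * U q) + exp (2 * U (conj q))) :=
    setIntegral_mono_set hi.integrableOn (Filter.Eventually.of_forall fun q => by positivity)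
      (Set.iUnion_subset fun i q hq => (NodalField.nodal_subset hq).1).eventuallyLE
  rw [h.integral_upper] at h2
  have := h.area_nodal (hp 0) (hf 0)
  have := h.area_nodal (hp 1) (hf 1)
  have := h.area_nodal (hp 2) (hf 2)
  linarith

end PlaneField

end PlaneField

section CauchyTransform

open Filter Topology ComplexConjugate

theorem integral_inv_ball {ρ : ℝ} (hρ : 0 ≤ ρ) (z : ℂ) :
    IntegrableOn (fun ζ : ℂ => ‖z - ζ‖⁻¹) (Metric.ball z ρ) ∧
      ∫ ζ in Metric.ball z ρ, ‖z - ζ‖⁻¹ = 2 * π * ρ := by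
  set f : ℝ → ℝ := (Set.Iio ρ).indicator fun x => x⁻¹ with hf
  have e : ∀ ζ : ℂ, f ‖z - ζ‖ = (Metric.ball z ρ).indicator (fun ζ => ‖z - ζ‖⁻¹) ζ := fun ζ => by
    by_cases h : ‖z - ζ‖ < ρ
    · rw [hf, Set.indicator_of_mem (by exact h), Set.indicator_of_mem (by rwa [mem_ball_iff_norm'])]
    · rw [hf, Set.indicator_of_notMem (by exact h),
        Set.indicator_of_notMem (by rwa [mem_ball_iff_norm'])]
  have hp : Set.EqOn (fun y : ℝ => y ^ (Module.finrank ℝ ℂ - 1) • f y)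
      ((Set.Iio ρ).indicator fun _ => (1 : ℝ)) (Set.Ioi 0) := fun y hy => by
    have hy : y ≠ 0 := ne_of_gt hy
    by_cases h : y ∈ Set.Iio ρ
    · simp [hf, Set.indicator_of_mem h, hy]
    · simp [hf, Set.indicator_of_notMem h]
  have h1 : Integrable fun ζ : ℂ => f ‖ζ‖ := by
    rw [integrable_fun_norm_addHaar, integrableOn_congr_fun hp measurableSet_Ioi, IntegrableOn,
      integrable_indicator_iff measurableSet_Iio, IntegrableOn, Measure.restrict_restrict
      measurableSet_Iio]
    rw [Set.inter_comm, Set.Ioi_inter_Iio]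
    exact integrableOn_const (by simp)
  have h2 : ∫ ζ : ℂ, f ‖ζ‖ = 2 * π * ρ := by
    rw [integral_fun_norm_addHaar, setIntegral_congr_fun measurableSet_Ioi hp,
      setIntegral_indicator measurableSet_Iio, Set.Ioi_inter_Iio]
    simp [Measure.real, hρ, mul_assoc]
  have h3 := h1.comp_sub_left z
  have h4 := integral_sub_left_eq_self (μ := volume) (fun ζ : ℂ => f ‖ζ‖) z
  simp only [e] at h3 h4
  rw [integral_indicator Metric.isOpen_ball.measurableSet, h2] at h4
  exact ⟨(integrable_indicator_iff Metric.isOpen_ball.measurableSet).1 h3, h4⟩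

theorem locallyIntegrable_inv : LocallyIntegrable fun ζ : ℂ => ζ⁻¹ := fun x => by
  refine ⟨Metric.ball 0 (‖x‖ + 1), Metric.isOpen_ball.mem_nhds (by simp), ?_⟩
  have := (integral_inv_ball (by positivity : 0 ≤ ‖x‖ + 1) 0).1
  refine (integrable_norm_iff measurable_inv.aestronglyMeasurable).1 ?_
  simpa [IntegrableOn] using this

/-- The Cauchy transform. -/
noncomputable def cauchyT (h : ℂ → ℂ) (z : ℂ) : ℂ := ∫ ζ, h ζ * (z - ζ)⁻¹

variable {h ψ : ℂ → ℂ} {z : ℂ}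

theorem continuous_cauchyT (hc : Continuous h) (hs : HasCompactSupport h) : Continuous (cauchyT h) :=
  hs.continuous_convolution_left (ContinuousLinearMap.mul ℝ ℂ) (μ := volume) hc locallyIntegrable_inv

theorem integrable_cauchyT (hc : Continuous h) (hs : HasCompactSupport h) (z : ℂ) :
    Integrable fun ζ => h ζ * (z - ζ)⁻¹ :=
  hs.convolutionExists_left (ContinuousLinearMap.mul ℝ ℂ) (μ := volume) hc locallyIntegrable_inv z

/-- The Cauchy–Pompeiu formula. -/
theorem cauchyT_dbar (hψ : ContDiff ℝ 1 ψ) (hs : HasCompactSupport ψ) (z : ℂ) :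
    cauchyT (dbar ψ) z = π * ψ z := by
  have cψ := hψ.continuous
  have sd : HasCompactSupport (dbar ψ) := hs.mono' (subset_tsupport _ |>.trans (tsupport_dbar_subset ψ))
  set D : ℝ → ℂ → ℂ := fun δ ζ => (z - ζ) * conj (z - ζ) + (δ : ℂ) ^ 2 with hD
  have eD : ∀ δ ζ, D δ ζ = ((‖ζ - z‖ ^ 2 + δ ^ 2 : ℝ) : ℂ) := fun δ ζ => by
    simp only [hD]
    rw [Complex.mul_conj, Complex.normSq_eq_norm_sq, norm_sub_rev]
    push_cast; rfl
  have nD : ∀ δ, 0 < δ → ∀ ζ, D δ ζ ≠ 0 := fun δ hδ ζ => by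
    rw [eD]; exact_mod_cast (by positivity : ‖ζ - z‖ ^ 2 + δ ^ 2 ≠ 0)
  set K : ℝ → ℂ → ℂ := fun δ ζ => conj (z - ζ) * (D δ ζ)⁻¹ with hK
  have sK : ∀ δ, 0 < δ → ContDiff ℝ 1 (K δ) := fun δ hδ => by
    have h1 : ContDiff ℝ 1 fun ζ => conj (z - ζ) :=
      Complex.conjCLE.contDiff.comp (contDiff_const.sub contDiff_id)
    have h2 : ContDiff ℝ 1 (D δ) := ((contDiff_const.sub contDiff_id).mul h1).add contDiff_const
    exact h1.mul (h2.inv (nD δ hδ))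
  have dK : ∀ δ, 0 < δ → ∀ ζ, dbar (K δ) ζ = -((δ ^ 2 / (‖ζ - z‖ ^ 2 + δ ^ 2) ^ 2 : ℝ) : ℂ) := by
    intro δ hδ ζ
    have w1 : HasWirt (fun ζ => z - ζ) (-1) 0 ζ := ((hasDerivAt_id ζ).const_sub z).hasWirt
    have w2 : HasWirt (fun ζ => conj (z - ζ)) 0 (-1) ζ := by
      have := (hasWirt_conj (z - ζ)).comp_holo ((hasDerivAt_id ζ).const_sub z)
      simpa using this
    have w3 : HasWirt (D δ) _ _ ζ := (w1.mul w2).add (hasWirt_const ((δ : ℂ) ^ 2) ζ)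
    have w4 := w2.mul (HasWirt.holo_comp (hasDerivAt_inv (nD δ hδ ζ)) w3)
    have hn := nD δ hδ ζ
    rw [w4.dbar_eq]
    have : ((δ ^ 2 / (‖ζ - z‖ ^ 2 + δ ^ 2) ^ 2 : ℝ) : ℂ) = (δ : ℂ) ^ 2 / D δ ζ ^ 2 := by
      rw [eD]; push_cast; rfl
    rw [this]
    field_simp
    simp only [hD]
    ring
  have hB : ∃ B : ℝ, ∀ ζ : ℂ, ‖ψ ζ‖ ≤ B := hs.exists_bound_of_continuous cψ
  obtain ⟨B, hB⟩ := hB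
  have l1 := tendsto_integral_approx cψ hB z
  have l2 : Tendsto (fun δ : ℝ => ∫ ζ, dbar ψ ζ * K δ ζ) (𝓝[>] 0) (𝓝 (cauchyT (dbar ψ) z)) := by
    refine tendsto_integral_filter_of_dominated_convergence (fun ζ => ‖dbar ψ ζ * (z - ζ)⁻¹‖) ?_ ?_
      (integrable_cauchyT (continuous_dbar hψ) sd z).norm ?_
    · filter_upwards [self_mem_nhdsWithin] with δ hδ
      exact ((continuous_dbar hψ).mul (sK δ hδ).continuous).aestronglyMeasurable
    · filter_upwards [self_mem_nhdsWithin] with δ hδ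
      refine Filter.Eventually.of_forall fun ζ => ?_
      rw [norm_mul (dbar ψ ζ) (K δ ζ), norm_mul (dbar ψ ζ) ((z - ζ)⁻¹)]
      refine mul_le_mul_of_nonneg_left ?_ (norm_nonneg (dbar ψ ζ))
      simp only [hK]
      rw [eD, norm_mul, Complex.norm_conj, norm_inv, norm_inv, Complex.norm_real,
        Real.norm_of_nonneg (by positivity), norm_sub_rev ζ z]
      rcases (norm_nonneg (z - ζ)).eq_or_lt with h0 | h0
      · rw [← h0]; simp
      · have hδ : 0 < δ := hδ
        rw [← div_eq_mul_inv, div_le_iff₀ (by positivity)]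
        have : ‖z - ζ‖⁻¹ * (‖z - ζ‖ ^ 2 + δ ^ 2) = ‖z - ζ‖ + ‖z - ζ‖⁻¹ * δ ^ 2 := by field_simp
        rw [this]
        linarith [(by positivity : 0 ≤ ‖z - ζ‖⁻¹ * δ ^ 2)]
    · refine Filter.Eventually.of_forall fun ζ => Tendsto.const_mul _ ?_
      rcases eq_or_ne z ζ with rfl | hne
      · simp [hK]
      have hw : z - ζ ≠ 0 := sub_ne_zero.2 hne
      have hw' : conj (z - ζ) ≠ 0 := (map_ne_zero _).2 hw
      have : ContinuousAt (fun δ : ℝ => K δ ζ) 0 := by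
        simp only [hK, hD]
        refine ContinuousAt.mul continuousAt_const (ContinuousAt.inv₀ (by fun_prop) ?_)
        simp only [Complex.ofReal_zero, ne_eq, OfNat.ofNat_ne_zero, not_false_eq_true, zero_pow,
          add_zero]
        exact mul_ne_zero hw hw'
      have h2 : K 0 ζ = (z - ζ)⁻¹ := by
        simp only [hK, hD, Complex.ofReal_zero, ne_eq, OfNat.ofNat_ne_zero, not_false_eq_true,
          zero_pow, add_zero]
        field_simp
      have := this.tendsto
      rw [h2] at this
      exact this.mono_left nhdsWithin_le_nhds
  have e : ∀ δ ∈ Set.Ioi (0 : ℝ), ∫ ζ, (δ ^ 2 / (‖ζ - z‖ ^ 2 + δ ^ 2) ^ 2) • ψ ζ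
      = ∫ ζ, dbar ψ ζ * K δ ζ := fun δ hδ => by
    have := integral_mul_dbar hψ hs (fun z _ => (sK δ hδ).contDiffAt (x := z))
    simp only [dK δ hδ, mul_neg, integral_neg, neg_inj] at this
    rw [← this]
    exact integral_congr_ae (Filter.Eventually.of_forall fun ζ => by
      simp only [Complex.real_smul]; ring)
  have := tendsto_nhds_unique (l1.congr' (eventually_of_mem self_mem_nhdsWithin e)) l2
  rw [← this, Complex.real_smul]

/-- Division by `ζ` when the first moment vanishes. -/
theorem cauchyT_div (hc : Continuous h) (hs : HasCompactSupport h)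
    (hc' : Continuous fun ζ => h ζ / ζ) (h0 : cauchyT h 0 = 0) (hz : z ≠ 0) :
    cauchyT (fun ζ => h ζ / ζ) z = cauchyT h z / z := by
  have h00 : h 0 = 0 := by
    have h1 : Tendsto (fun ζ => h ζ / ζ * ζ) (𝓝[≠] 0) (𝓝 (h 0 / 0 * 0)) :=
      ((hc'.mul continuous_id).tendsto 0).mono_left nhdsWithin_le_nhds
    rw [mul_zero] at h1
    refine tendsto_nhds_unique ((hc.tendsto 0).mono_left nhdsWithin_le_nhds) (h1.congr' ?_)
    filter_upwards [self_mem_nhdsWithin] with ζ hζ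
    exact div_mul_cancel₀ _ hζ
  have e : ∀ᵐ ζ : ℂ, h ζ / ζ * (z - ζ)⁻¹ = (h ζ * (z - ζ)⁻¹ - h ζ * (0 - ζ)⁻¹) / z := by
    filter_upwards [Measure.ae_ne volume z] with ζ hζ
    rcases eq_or_ne ζ 0 with rfl | h1
    · simp [h00]
    have h2 : z - ζ ≠ 0 := sub_ne_zero.2 (Ne.symm hζ)
    rw [zero_sub]
    field_simp
    ring
  rw [cauchyT, integral_congr_ae e, integral_div, integral_sub (integrable_cauchyT hc hs z)
    (integrable_cauchyT hc hs 0)]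
  change (cauchyT h z - cauchyT h 0) / z = _
  rw [h0, sub_zero]

theorem norm_cauchyT_le {A R : ℝ} (hR : 0 ≤ R) (hA : ∀ ζ, ‖h ζ‖ ≤ A) (hs : ∀ ζ, R ≤ ‖ζ‖ → h ζ = 0)
    (hz : ‖z‖ ≤ R) : ‖cauchyT h z‖ ≤ A * (4 * π * R) := by
  obtain ⟨h1, h2⟩ := integral_inv_ball (by positivity : 0 ≤ 2 * R) z
  have e : cauchyT h z = ∫ ζ in Metric.ball z (2 * R), h ζ * (z - ζ)⁻¹ :=
    (setIntegral_eq_integral_of_forall_compl_eq_zero fun ζ hζ => by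
      rw [hs ζ, zero_mul]
      rw [mem_ball_iff_norm, not_lt] at hζ
      linarith [norm_sub_le ζ z]).symm
  rw [e]
  calc _ ≤ ∫ ζ in Metric.ball z (2 * R), A * ‖z - ζ‖⁻¹ :=
        norm_integral_le_of_norm_le (h1.const_mul A) (Filter.Eventually.of_forall fun ζ => by
          rw [norm_mul, norm_inv]
          exact mul_le_mul_of_nonneg_right (hA ζ) (by positivity))
    _ = _ := by rw [integral_const_mul, h2]; ring

end CauchyTransform

section LocalStructure

open Filter Topology

/-- The complex gradient `v_x - i v_y`. -/
noncomputable def cgrad (v : ℂ → ℝ) (z : ℂ) : ℂ := dx v z - dy v z * Complex.I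

variable {v : ℂ → ℝ} {M R : ℝ}

theorem fderiv_eq_cgrad (v : ℂ → ℝ) (z h : ℂ) : fderiv ℝ v z h = (cgrad v z * h).re := by
  have : h = h.re • (1 : ℂ) + h.im • Complex.I := by
    apply Complex.ext <;> simp
  conv_lhs => rw [this]
  rw [map_add, map_smul, map_smul]
  simp only [cgrad, dx, dy, smul_eq_mul, Complex.mul_re, Complex.sub_re, Complex.ofReal_re,
    Complex.I_re, mul_zero, Complex.ofReal_im, Complex.I_im, mul_one, Complex.sub_im,
    Complex.mul_im]
  ring

theorem norm_fderiv_le_cgrad (v : ℂ → ℝ) (z : ℂ) : ‖fderiv ℝ v z‖ ≤ ‖cgrad v z‖ :=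
  ContinuousLinearMap.opNorm_le_bound _ (norm_nonneg _) fun h => by
    rw [fderiv_eq_cgrad, ← norm_mul]
    exact Complex.abs_re_le_norm _

theorem contDiff_cgrad (hv : ContDiff ℝ ∞ v) : ContDiff ℝ ∞ (cgrad v) :=
  (Complex.ofRealCLM.contDiff.comp (hv.dx (by norm_cast))).sub
    ((Complex.ofRealCLM.contDiff.comp (hv.dy (by norm_cast))).mul contDiff_const)

theorem dx_dy_comm (hv : ContDiff ℝ ∞ v) (z : ℂ) : dx (dy v) z = dy (dx v) z := by
  have h1 : DifferentiableAt ℝ (fderiv ℝ v) z :=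
    ((hv.fderiv_right (m := 1) (by norm_cast)).differentiable (by simp)) z
  have hs := (hv.contDiffAt (x := z)).isSymmSndFDerivAt (by simp; norm_cast)
  have e1 : dx (dy v) z = fderiv ℝ (fderiv ℝ v) z 1 Complex.I := by
    rw [dx, show dy v = fun z => fderiv ℝ v z Complex.I from rfl,
      fderiv_clm_apply h1 (differentiableAt_const _)]
    simp
  have e2 : dy (dx v) z = fderiv ℝ (fderiv ℝ v) z Complex.I 1 := by
    rw [dy, show dx v = fun z => fderiv ℝ v z 1 from rfl,
      fderiv_clm_apply h1 (differentiableAt_const _)]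
    simp
  rw [e1, e2, hs.eq]

theorem dbar_cgrad (hv : ContDiff ℝ ∞ v) (z : ℂ) : dbar (cgrad v) z = (lapC v z / 2 : ℝ) := by
  have h1 : DifferentiableAt ℝ (dx v) z :=
    ((hv.dx (m := 1) (by norm_cast)).differentiable (by simp)) z
  have h2 : DifferentiableAt ℝ (dy v) z :=
    ((hv.dy (m := 1) (by norm_cast)).differentiable (by simp)) z
  have hd : HasFDerivAt (cgrad v) (Complex.ofRealCLM.comp (fderiv ℝ (dx v) z)
      - (Complex.ofRealCLM.comp (fderiv ℝ (dy v) z)).smulRight Complex.I) z := by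
    refine HasFDerivAt.sub (Complex.ofRealCLM.hasFDerivAt.comp z h1.hasFDerivAt) ?_
    exact (Complex.ofRealCLM.hasFDerivAt.comp z h2.hasFDerivAt).mul_const' Complex.I
  have e : ∀ a, fderiv ℝ (cgrad v) z a
      = fderiv ℝ (dx v) z a - fderiv ℝ (dy v) z a * Complex.I := fun a => by
    rw [hd.fderiv]; simp
  have hc := dx_dy_comm hv z
  have e1 : dx (cgrad v) z = dx (dx v) z - dx (dy v) z * Complex.I := e 1
  have e2 : dy (cgrad v) z = dy (dx v) z - dy (dy v) z * Complex.I := e Complex.I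
  rw [dbar, e1, e2, hc, lapC]
  push_cast
  linear_combination (-((dy (dy v) z : ℝ) : ℂ) / 2) * Complex.I_sq

theorem abs_le_of_fderiv_le {r : ℂ → ℝ} (hr : Differentiable ℝ r) (h0 : r 0 = 0) {C : ℝ} {z : ℂ}
    (h : ∀ x, ‖x‖ ≤ ‖z‖ → ‖fderiv ℝ r x‖ ≤ C) : |r z| ≤ C * ‖z‖ := by
  have := (convex_closedBall (0 : ℂ) ‖z‖).norm_image_sub_le_of_norm_fderiv_le (𝕜 := ℝ)
    (C := C) (fun x _ => hr x) (fun x hx => h x (mem_closedBall_zero_iff.1 hx))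
    (x := 0) (y := z) (by simp) (by simp)
  rwa [h0, sub_zero, sub_zero] at this

theorem isLittleO_of_fderiv {r : ℂ → ℝ} (hr : Differentiable ℝ r) (h0 : r 0 = 0) {k : ℕ}
    (h : (fderiv ℝ r) =o[𝓝 0] fun z => ‖z‖ ^ k) : r =o[𝓝 0] fun z => ‖z‖ ^ (k + 1) := by
  rw [Asymptotics.isLittleO_iff] at h ⊢
  intro c hc
  obtain ⟨ε, hε, hb⟩ := Metric.eventually_nhds_iff_ball.1 (h hc)
  refine Metric.eventually_nhds_iff_ball.2 ⟨ε, hε, fun z hz => ?_⟩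
  rw [mem_ball_zero_iff] at hz
  have := abs_le_of_fderiv_le hr h0 (C := c * ‖z‖ ^ k) (z := z) fun x hx => ?_
  · rwa [norm_pow, norm_norm, pow_succ, ← mul_assoc]
  · have h1 := hb x (by rw [mem_ball_zero_iff]; linarith)
    rw [norm_pow, norm_norm] at h1
    exact h1.trans (by gcongr)

theorem isLittleO_of_tendsto_div {f : ℂ → ℂ} (hf : Continuous f) {k : ℕ}
    (h : Tendsto (fun z => f z / z ^ k) (𝓝[≠] 0) (𝓝 0)) : f =o[𝓝 0] fun z => ‖z‖ ^ k := by
  have h0 : f 0 = 0 := by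
    have h1 : Tendsto (fun z => z ^ k * (f z / z ^ k)) (𝓝[≠] (0 : ℂ)) (𝓝 ((0 : ℂ) ^ k * 0)) :=
      (((continuous_pow k).tendsto 0).mono_left nhdsWithin_le_nhds).mul h
    rw [mul_zero] at h1
    refine tendsto_nhds_unique ((hf.tendsto 0).mono_left nhdsWithin_le_nhds) (h1.congr' ?_)
    filter_upwards [self_mem_nhdsWithin] with ζ hζ
    exact mul_div_cancel₀ _ (pow_ne_zero k hζ)
  rw [Asymptotics.isLittleO_iff]
  intro c hc
  have h2 := (tendsto_zero_iff_norm_tendsto_zero.1 h).eventually (ge_mem_nhds hc)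
  rw [eventually_nhdsWithin_iff] at h2
  filter_upwards [h2] with z hz
  rcases eq_or_ne z 0 with rfl | hne
  · rw [h0, norm_zero]; positivity
  · have := hz hne
    rw [norm_div, norm_pow, div_le_iff₀ (by positivity)] at this
    rwa [norm_pow, norm_norm]

theorem order_dichotomy (hv : ContDiff ℝ ∞ v) (h0 : v 0 = 0) (hM0 : 0 ≤ M)
    (hM : ∀ z, |lapC v z| ≤ M * |v z|) : (∀ᶠ z in 𝓝 0, v z = 0) ∨
      ∃ (k : ℕ) (γ : ℂ), γ ≠ 0 ∧ Tendsto (fun z => cgrad v z / z ^ k) (𝓝[≠] 0) (𝓝 γ) := by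
  obtain ⟨R, hR, hMR⟩ : ∃ R : ℝ, 0 < R ∧ M * R ^ 2 ≤ 1 / 2 := by
    refine ⟨1 / (2 * (M + 1)), by positivity, ?_⟩
    rw [div_pow, one_pow, mul_one_div, div_le_iff₀ (by positivity)]
    nlinarith
  obtain ⟨χ, hχ, hχc, hχs, hχ1, -⟩ := exists_contDiff_cutoff (isCompact_closedBall (0 : ℂ) (R / 2))
    (Metric.isOpen_ball (x := (0 : ℂ)) (ε := R)) (Metric.closedBall_subset_ball (by linarith))
  have hcg := contDiff_cgrad hv
  set ψ : ℂ → ℂ := fun z => χ z * cgrad v z with hψ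
  have sψ : ContDiff ℝ ∞ ψ := (Complex.ofRealCLM.contDiff.comp hχ).mul hcg
  have ψχ : tsupport ψ ⊆ tsupport χ := closure_mono fun z hz => by
    contrapose! hz
    rw [Function.notMem_support] at hz ⊢
    simp [hψ, hz]
  have cψ : HasCompactSupport ψ := hχc.of_isClosed_subset (isClosed_tsupport _) ψχ
  have sψ1 : ContDiff ℝ 1 ψ := sψ.of_le (by norm_cast)
  set H := dbar ψ with hH
  have cH : Continuous H := continuous_dbar sψ1
  have sH : HasCompactSupport H :=
    cψ.mono' ((subset_tsupport _).trans (tsupport_dbar_subset ψ))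
  have suppH : ∀ ζ, R ≤ ‖ζ‖ → H ζ = 0 := fun ζ hζ => by
    by_contra hne
    have := hχs (ψχ (tsupport_dbar_subset ψ (subset_tsupport _ hne)))
    rw [mem_ball_zero_iff] at this
    linarith
  have near : ∀ z, ‖z‖ ≤ R / 2 → ψ =ᶠ[𝓝 z] cgrad v := fun z hz => by
    have := (eventually_nhdsSet_iff_forall.1 hχ1) z (by simpa using hz)
    filter_upwards [this] with ζ hζ
    simp [hψ, hζ]
  have Hv : ∀ z, ‖z‖ ≤ R / 2 → ‖H z‖ ≤ M / 2 * |v z| := fun z hz => by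
    have e : H z = dbar (cgrad v) z := by
      simp only [hH, dbar, (near z hz).dx_eq.eq_of_nhds, (near z hz).dy_eq.eq_of_nhds]
    rw [e, dbar_cgrad hv, Complex.norm_real, Real.norm_eq_abs, abs_div, abs_two]
    linarith [hM z]
  obtain ⟨C, hC⟩ : ∃ C : ℝ, ∀ ζ : ℂ, ‖H ζ‖ ≤ C := sH.exists_bound_of_continuous cH
  have hC0 : 0 ≤ C := (norm_nonneg _).trans (hC 0)
  set h : ℕ → ℂ → ℂ := fun k ζ => H ζ / ζ ^ k with hh
  have sh : ∀ k, HasCompactSupport (h k) := fun k =>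
    sH.mono fun z hz => by
      contrapose! hz
      rw [Function.notMem_support] at hz ⊢
      simp [hh, hz]
  set P : ℕ → Prop := fun k => Continuous (h k) ∧ ∀ z ≠ 0, π * (ψ z / z ^ k) = cauchyT (h k) z
    with hP
  have πne : (π : ℂ) ≠ 0 := by exact_mod_cast Real.pi_ne_zero
  have lim : ∀ k, P k → Tendsto (fun z => cgrad v z / z ^ k) (𝓝[≠] 0)
      (𝓝 (cauchyT (h k) 0 / π)) := fun k hk => by
    have h1 := (((continuous_cauchyT hk.1 (sh k)).tendsto 0).mono_left
      (nhdsWithin_le_nhds (s := {0}ᶜ))).div_const (π : ℂ)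
    refine h1.congr' ?_
    filter_upwards [self_mem_nhdsWithin, nhdsWithin_le_nhds (near 0 (by simp; positivity))]
      with z hz hz'
    rw [← hk.2 z hz, mul_div_cancel_left₀ _ πne, hz']
  have hv1 : Differentiable ℝ v := hv.differentiable (by simp)
  have step : ∀ k, P k → cauchyT (h k) 0 = 0 → P (k + 1) := fun k hk h00 => by
    have h1 := lim k hk
    rw [h00, zero_div] at h1
    have h2 := isLittleO_of_tendsto_div hcg.continuous h1
    have h3 : v =o[𝓝 0] fun z => ‖z‖ ^ (k + 1) :=
      isLittleO_of_fderiv hv1 h0 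
        (Asymptotics.IsBigO.trans_isLittleO (Asymptotics.isBigO_of_le _ (norm_fderiv_le_cgrad v)) h2)
    have h4 : H =o[𝓝 0] fun z => ‖z‖ ^ (k + 1) := by
      refine Asymptotics.IsBigO.trans_isLittleO (Asymptotics.IsBigO.of_bound (M / 2) ?_) h3
      filter_upwards [Metric.closedBall_mem_nhds (0 : ℂ) (half_pos hR)] with z hz
      rw [mem_closedBall_zero_iff] at hz
      exact Hv z hz
    have ek : h (k + 1) = fun ζ => h k ζ / ζ := by
      ext ζ; simp only [hh]; rw [div_div, pow_succ]
    have c' : Continuous (h (k + 1)) := by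
      rw [continuous_iff_continuousAt]
      intro z
      rcases eq_or_ne z 0 with rfl | hne
      · have : h (k + 1) 0 = 0 := by simp [hh]
        rw [ContinuousAt, this, tendsto_zero_iff_norm_tendsto_zero]
        have := h4.norm_left.tendsto_div_nhds_zero
        refine this.congr fun z => ?_
        simp [hh]
      · exact cH.continuousAt.div (by fun_prop) (pow_ne_zero _ hne)
    refine ⟨c', fun z hz => ?_⟩
    rw [ek] at c' ⊢
    rw [cauchyT_div hk.1 (sh k) c' h00 hz, ← hk.2 z hz, pow_succ, ← div_div]
    ring
  have P0 : P 0 := ⟨by simpa [hh] using cH, fun z _ => by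
    simp only [hh, pow_zero, div_one]; exact (cauchyT_dbar sψ1 cψ z).symm⟩
  by_cases hall : ∀ k, P k → cauchyT (h k) 0 = 0
  swap
  · push Not at hall
    obtain ⟨k, hk, hne⟩ := hall
    exact Or.inr ⟨k, _, div_ne_zero hne πne, lim k hk⟩
  left
  have hPk : ∀ k, P k := fun k => Nat.rec P0 (fun k hk => step k hk (hall k hk)) k
  have cg0 : cgrad v 0 = 0 := by
    have h1 := cauchyT_dbar sψ1 cψ 0
    have h2 : cauchyT (dbar ψ) 0 = 0 := by simpa [hh] using hall 0 P0
    rw [h2, (near 0 (by simp; positivity)).eq_of_nhds] at h1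
    exact (mul_eq_zero.1 h1.symm).resolve_left πne
  have key : ∀ m : ℕ, ∀ z, ‖z‖ ≤ R / 2 → ‖cgrad v z‖ ≤ 8 * R * C * (2 * ‖z‖ / R) ^ m := fun m => by
    obtain ⟨p, hp, hmax⟩ := (isCompact_closedBall (0 : ℂ) (R / 2)).exists_isMaxOn
      ⟨0, by simp; positivity⟩ (continuous_cauchyT (hPk m).1 (sh m)).norm.continuousOn
    set A := ‖cauchyT (h m) p‖ with hA
    have hA0 : 0 ≤ A := norm_nonneg _
    have g1 : ∀ z, ‖z‖ ≤ R / 2 → ‖cgrad v z‖ ≤ A / π * ‖z‖ ^ m := fun z hz => by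
      rcases eq_or_ne z 0 with rfl | hne
      · rw [cg0, norm_zero]; positivity
      · have h1 : ‖cauchyT (h m) z‖ ≤ A := hmax (mem_closedBall_zero_iff.2 hz)
        rw [← (hPk m).2 z hne, (near z hz).eq_of_nhds, norm_mul, norm_div, norm_pow,
          Complex.norm_real, Real.norm_of_nonneg Real.pi_pos.le] at h1
        rw [div_mul_eq_mul_div, le_div_iff₀ Real.pi_pos, mul_comm]
        rwa [← mul_div_assoc, div_le_iff₀ (by positivity)] at h1
    have g2 : ∀ z, ‖z‖ ≤ R / 2 → |v z| ≤ A / π * ‖z‖ ^ m * ‖z‖ := fun z hz =>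
      abs_le_of_fderiv_le hv1 h0 fun x hx =>
        (norm_fderiv_le_cgrad v x).trans ((g1 x (hx.trans hz)).trans (by gcongr))
    have g3 : ∀ ζ, ‖h m ζ‖ ≤ M / 2 * (A / π * (R / 2)) + C * (2 / R) ^ m := fun ζ => by
      rcases le_or_gt ‖ζ‖ (R / 2) with hz | hz
      · refine le_trans ?_ (le_add_of_nonneg_right (by positivity))
        have h1 := Hv ζ hz
        rcases eq_or_ne ζ 0 with rfl | hne
        · rw [h0, abs_zero, mul_zero] at h1
          simp only [hh, norm_div]
          rw [le_antisymm h1 (norm_nonneg _), zero_div]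
          positivity
        · simp only [hh, norm_div, norm_pow]
          rw [div_le_iff₀ (by positivity)]
          refine h1.trans ?_
          rw [mul_assoc]
          refine mul_le_mul_of_nonneg_left ((g2 ζ hz).trans ?_) (by positivity)
          rw [mul_right_comm]
          gcongr
      · refine le_trans ?_ (le_add_of_nonneg_left (by positivity))
        simp only [hh, norm_div, norm_pow]
        rw [div_le_iff₀ (pow_pos (by linarith) m), mul_assoc, ← mul_pow]
        refine (hC ζ).trans (le_mul_of_one_le_right hC0 (one_le_pow₀ ?_))
        rw [div_mul_eq_mul_div, le_div_iff₀ hR]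
        linarith
    have hp := mem_closedBall_zero_iff.1 hp
    have g4 := norm_cauchyT_le hR.le g3 (fun ζ hζ => by simp only [hh]; rw [suppH ζ hζ, zero_div])
      (hp.trans (by linarith))
    have e : (M / 2 * (A / π * (R / 2)) + C * (2 / R) ^ m) * (4 * π * R)
        = M * R ^ 2 * A + 4 * π * R * C * (2 / R) ^ m := by
      field_simp; ring
    rw [e] at g4
    have g5 : A ≤ π * (8 * R * C * (2 / R) ^ m) := by
      have := mul_le_mul_of_nonneg_right hMR hA0
      linarith
    intro z hz
    refine (g1 z hz).trans ?_
    have : 2 * ‖z‖ / R = 2 / R * ‖z‖ := by ring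
    rw [this, mul_pow, ← mul_assoc]
    refine mul_le_mul_of_nonneg_right ?_ (by positivity)
    rw [div_le_iff₀ Real.pi_pos]
    linarith
  filter_upwards [Metric.ball_mem_nhds (0 : ℂ) (half_pos hR)] with z hz
  rw [mem_ball_zero_iff] at hz
  have cg : ∀ x, ‖x‖ ≤ ‖z‖ → cgrad v x = 0 := fun x hx => by
    have h1 : 2 * ‖x‖ / R < 1 := by rw [div_lt_one hR]; linarith
    have h2 := (tendsto_pow_atTop_nhds_zero_of_lt_one (by positivity) h1).const_mul (8 * R * C)
    rw [mul_zero] at h2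
    exact norm_le_zero_iff.1 (ge_of_tendsto h2 (Eventually.of_forall fun m => key m x (by linarith)))
  have := abs_le_of_fderiv_le hv1 h0 (C := 0) (z := z) fun x hx => by
    simpa [cg x hx] using norm_fderiv_le_cgrad v x
  rw [zero_mul] at this
  exact abs_nonpos_iff.1 this

theorem cgrad_comp_add_left (v : ℂ → ℝ) (a z : ℂ) : cgrad (fun z => v (a + z)) z = cgrad v (a + z) := by
  simp only [cgrad, dx, dy, fderiv_comp_add_left]

theorem lapC_comp_add_left (v : ℂ → ℝ) (a z : ℂ) : lapC (fun z => v (a + z)) z = lapC v (a + z) := by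
  have h1 : dx (fun z => v (a + z)) = fun z => dx v (a + z) := by
    ext z; simp only [dx, fderiv_comp_add_left]
  have h2 : dy (fun z => v (a + z)) = fun z => dy v (a + z) := by
    ext z; simp only [dy, fderiv_comp_add_left]
  rw [lapC, h1, h2, dx, dy, fderiv_comp_add_left (f := dx v), fderiv_comp_add_left (f := dy v)]
  rfl

theorem unique_continuation (hv : ContDiff ℝ ∞ v) (hM0 : 0 ≤ M)
    (hM : ∀ z, |lapC v z| ≤ M * |v z|) {a : ℂ} (ha : ∀ᶠ z in 𝓝 a, v z = 0) (z : ℂ) : v z = 0 := by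
  set Z := {a | ∀ᶠ z in 𝓝 a, v z = 0} with hZ
  have op : IsOpen Z := isOpen_setOfPred_eventually_nhds
  have cl : IsClosed Z := by
    refine isClosed_of_closure_subset fun b hb => ?_
    have vb : v b = 0 := by
      have : Z ⊆ v ⁻¹' {0} := fun x hx => Eventually.self_of_nhds hx
      exact closure_minimal this (isClosed_singleton.preimage hv.continuous) hb
    have tr : Tendsto (fun z => b + z) (𝓝 0) (𝓝 b) := by
      have : Continuous fun z => b + z := by fun_prop
      simpa using this.tendsto 0
    rcases order_dichotomy (v := fun z => v (b + z)) (hv.comp (contDiff_const.add contDiff_id))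
      (by simpa using vb) hM0 (fun z => by rw [lapC_comp_add_left]; exact hM _) with h | ⟨k, γ, hγ, hl⟩
    · have : Tendsto (fun z => z - b) (𝓝 b) (𝓝 0) := by
        have : Continuous fun z => z - b := by fun_prop
        simpa using this.tendsto b
      filter_upwards [this.eventually h] with z hz
      simpa using hz
    · by_contra hbZ
      have h1 := hl.eventually_ne hγ
      rw [eventually_nhdsWithin_iff] at h1
      have : Tendsto (fun z => z - b) (𝓝 b) (𝓝 0) := by
        have : Continuous fun z => z - b := by fun_prop
        simpa using this.tendsto b
      obtain ⟨x, hx, hxZ⟩ := mem_closure_iff_nhds.1 hb _ (this.eventually h1)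
      have hne : x - b ≠ 0 := sub_ne_zero.2 fun h => hbZ (h ▸ hxZ)
      have hx : x - b ∈ ({0}ᶜ : Set ℂ) → cgrad (fun z => v (b + z)) (x - b) / (x - b) ^ k ≠ 0 := hx
      refine hx hne ?_
      rw [cgrad_comp_add_left, add_sub_cancel, div_eq_zero_iff]
      left
      have hc : v =ᶠ[𝓝 x] fun _ => (0 : ℝ) := hxZ
      have d : fderiv ℝ v x = 0 := by rw [hc.fderiv_eq]; simp
      simp [cgrad, dx, dy, d]
  have : Z = Set.univ := IsClopen.eq_univ ⟨cl, op⟩ ⟨a, ha⟩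
  have hz : z ∈ Z := this ▸ Set.mem_univ z
  exact hz.self_of_nhds

end LocalStructure

section Crossing

open Filter Topology ComplexConjugate

theorem exists_log_on {Γ T : Set ℂ} (hΓ : IsClosed Γ) (hT : IsPreconnected T) (hd : Disjoint T Γ)
    {p q : ℂ} (hp : p ∈ T) (hq : q ∈ T) :
    ∃ L : ℂ → ℂ, ContinuousOn L Γ ∧ ∀ ζ ∈ Γ, Complex.exp (L ζ) = (ζ - p) / (ζ - q) := by
  have ne : ∀ x ∈ T, ∀ ζ ∈ Γ, ζ - x ≠ 0 := fun x hx ζ hζ h =>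
    Set.disjoint_left.1 hd hx (sub_eq_zero.1 h ▸ hζ)
  refine hT.induction₂ (fun p q => ∃ L : ℂ → ℂ, ContinuousOn L Γ ∧
    ∀ ζ ∈ Γ, Complex.exp (L ζ) = (ζ - p) / (ζ - q)) (fun x hx => ?_) ?_ ?_ hp hq
  · obtain ⟨ε, hε, hb⟩ := Metric.isOpen_iff.1 hΓ.isOpen_compl x (Set.disjoint_left.1 hd hx)
    filter_upwards [nhdsWithin_le_nhds (Metric.ball_mem_nhds x hε), self_mem_nhdsWithin] with y hy hyT
    have hs : ∀ ζ ∈ Γ, (ζ - y) / (ζ - x) ∈ Complex.slitPlane := fun ζ hζ => by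
      have h1 : ε ≤ ‖ζ - x‖ := by
        by_contra! h
        exact hb (mem_ball_iff_norm.2 h) hζ
      have h2 : (ζ - y) / (ζ - x) = 1 + (x - y) / (ζ - x) := by
        have := ne x hx ζ hζ
        field_simp; ring
      rw [h2]
      refine Complex.mem_slitPlane_of_norm_lt_one ?_
      rw [norm_div, div_lt_one (hε.trans_le h1)]
      rw [mem_ball_iff_norm'] at hy
      exact hy.trans_le h1
    refine ⟨fun ζ => -Complex.log ((ζ - y) / (ζ - x)), ?_, fun ζ hζ => ?_⟩
    · exact (ContinuousOn.clog (ContinuousOn.div (by fun_prop) (by fun_prop) (ne x hx)) hs).neg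
    · rw [Complex.exp_neg, Complex.exp_log (Complex.slitPlane_ne_zero (hs ζ hζ)), inv_div]
  · rintro x y z hx hy hz ⟨L, h1, h2⟩ ⟨L', h3, h4⟩
    refine ⟨fun ζ => L ζ + L' ζ, h1.add h3, fun ζ hζ => ?_⟩
    rw [Complex.exp_add, h2 ζ hζ, h4 ζ hζ, div_mul_div_cancel₀ (ne y hy ζ hζ)]
  · rintro x y hx hy ⟨L, h1, h2⟩
    refine ⟨fun ζ => -L ζ, h1.neg, fun ζ hζ => ?_⟩
    rw [Complex.exp_neg, h2 ζ hζ, inv_div]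

theorem no_crossing {Γ T : Set ℂ} (hΓ : IsClosed Γ) (hc : IsPreconnected (Γ \ {0}))
    (hT : IsPreconnected T) (hd : Disjoint T Γ) {p a b : ℂ} (hp : p ∈ T) (hp' : -p ∈ T)
    (hseg : ∀ t : ℝ, t ≠ 0 → |t| ≤ 1 → (t : ℂ) * p ∉ Γ) (h0 : (0 : ℂ) ∈ Γ)
    (ha : ∀ s : ℝ, 0 < s → s ≤ 1 → (s : ℂ) * a ∈ Γ) (hb : ∀ s : ℝ, 0 < s → s ≤ 1 → (s : ℂ) * b ∈ Γ)
    (hai : (a * conj p).im < 0) (hbi : 0 < (b * conj p).im) : False := by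
  obtain ⟨L, hL, hexp⟩ := exists_log_on hΓ hT hd hp hp'
  have ne : ∀ ζ ∈ Γ, ζ - -p ≠ 0 := fun ζ hζ h =>
    Set.disjoint_left.1 hd hp' (sub_eq_zero.1 h ▸ hζ)
  have hp0 : p ≠ 0 := fun h => by simp [h] at hai
  set g : ℂ → ℂ := fun ζ => (ζ - p) / (ζ - -p) with hg
  have slit : ∀ ζ ∈ Γ \ {0}, g ζ ∈ Complex.slitPlane := fun ζ hζ => by
    by_contra hn
    rw [Complex.mem_slitPlane_iff, not_or, not_lt, not_not] at hn
    have e : g ζ = ((g ζ).re : ℂ) := Complex.ext (by simp) (by simp [hn.2])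
    set r := (g ζ).re
    have hr : (1 - r : ℝ) ≠ 0 := by linarith [hn.1]
    have hr' : (1 - r : ℂ) ≠ 0 := by exact_mod_cast hr
    have e2 : ζ - p = r * (ζ - -p) := by rw [← e, hg]; exact (div_mul_cancel₀ _ (ne ζ hζ.1)).symm
    have e3 : ζ = (((1 + r) / (1 - r) : ℝ) : ℂ) * p := by
      push_cast
      field_simp
      linear_combination e2
    refine hseg ((1 + r) / (1 - r)) (fun h => hζ.2 ?_) ?_ (e3 ▸ hζ.1)
    · rw [h] at e3; simpa using e3
    · rw [abs_div, div_le_one (abs_pos.2 hr), abs_of_pos (by linarith [hn.1] : 0 < 1 - r), abs_le]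
      constructor <;> linarith [hn.1]
  have cg : ContinuousOn g (Γ \ {0}) :=
    ContinuousOn.div (by fun_prop) (by fun_prop) fun ζ hζ => ne ζ hζ.1
  set D : ℂ → ℂ := fun ζ => L ζ - Complex.log (g ζ) with hD
  have cD : ContinuousOn D (Γ \ {0}) := (hL.mono Set.sdiff_subset).sub (cg.clog slit)
  have iD : ∀ ζ ∈ Γ \ {0}, ∃ n : ℤ, D ζ = n * (2 * π * Complex.I) := fun ζ hζ => by
    have hne := Complex.slitPlane_ne_zero (slit ζ hζ)
    rw [← Complex.exp_eq_one_iff, hD, Complex.exp_sub, Complex.exp_log hne, hexp ζ hζ.1]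
    exact div_self hne
  have kD : ∀ ζ ∈ Γ \ {0}, ∀ ξ ∈ Γ \ {0}, D ζ = D ξ := by
    have key : ∀ ζ ∈ Γ \ {0}, ∀ ξ ∈ Γ \ {0}, ∀ n m : ℤ, D ζ = n * (2 * π * Complex.I) →
        D ξ = m * (2 * π * Complex.I) → n < m → False := fun ζ hζ ξ hξ n m hn hm hnm => by
      have im : ∀ k : ℤ, ((k : ℂ) * (2 * π * Complex.I)).im = 2 * π * k := fun k => by
        simp; ring
      have cI : ContinuousOn (fun ζ => (D ζ).im) (Γ \ {0}) := Complex.continuous_im.comp_continuousOn cD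
      have h1 : (n : ℝ) + 1 ≤ m := by exact_mod_cast hnm
      obtain ⟨x, hx, hxe⟩ := hc.intermediate_value hζ hξ cI
        (show 2 * π * (n + 1 / 2) ∈ Set.Icc _ _ by
          simp only [hn, hm, im]
          constructor <;> nlinarith [Real.pi_pos])
      obtain ⟨k, hk⟩ := iD x hx
      simp only [hk, im] at hxe
      have h2 := mul_left_cancel₀ (by positivity) hxe
      have h3 : (2 * k : ℝ) = 2 * n + 1 := by rw [h2]; ring
      have h4 : 2 * k = 2 * n + 1 := by exact_mod_cast h3
      omega
    intro ζ hζ ξ hξ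
    obtain ⟨n, hn⟩ := iD ζ hζ
    obtain ⟨m, hm⟩ := iD ξ hξ
    rcases lt_trichotomy n m with h | h | h
    · exact (key ζ hζ ξ hξ n m hn hm h).elim
    · rw [hn, hm, h]
    · exact (key ξ hξ ζ hζ m n hm hn h).elim
  have gim : ∀ s : ℝ, ∀ a, (g (s * a)).im = 2 * s * (a * conj p).im * (Complex.normSq (s * a - -p))⁻¹ := by
    intro s a
    simp only [hg]
    rw [div_eq_mul_inv, Complex.inv_def, ← mul_assoc, Complex.im_mul_ofReal]
    congr 1
    simp [Complex.mul_im, Complex.mul_re]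
    ring
  have l0 : ∀ a : ℂ, Tendsto (fun s : ℝ => (s : ℂ) * a) (𝓝[>] 0) (𝓝 0) := fun a => by
    have : Continuous fun s : ℝ => (s : ℂ) * a := by fun_prop
    simpa using (this.tendsto 0).mono_left nhdsWithin_le_nhds
  have lg : ∀ a : ℂ, Tendsto (fun s : ℝ => g (s * a)) (𝓝[>] 0) (𝓝 (-1)) := fun a => by
    have h1 : ContinuousAt g 0 := ContinuousAt.div (by fun_prop) (by fun_prop) (by simpa using hp0)
    have h2 : g 0 = -1 := by simp [hg, neg_div, div_self hp0]
    have := h1.tendsto.comp (l0 a)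
    rwa [h2] at this
  have lL : ∀ a : ℂ, (∀ s : ℝ, 0 < s → s ≤ 1 → (s : ℂ) * a ∈ Γ) →
      Tendsto (fun s : ℝ => L (s * a)) (𝓝[>] 0) (𝓝 (L 0)) := fun a ha => by
    refine (hL 0 h0).tendsto.comp (tendsto_nhdsWithin_iff.2 ⟨l0 a, ?_⟩)
    filter_upwards [Ioc_mem_nhdsGT (zero_lt_one' ℝ)] with s hs using ha s hs.1 hs.2
  have nz : ∀ a : ℂ, a ≠ 0 → (∀ s : ℝ, 0 < s → s ≤ 1 → (s : ℂ) * a ∈ Γ) → ∀ s : ℝ, 0 < s → s ≤ 1 →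
      (s : ℂ) * a ∈ Γ \ {0} := fun a h0 ha s h1 h2 =>
    ⟨ha s h1 h2, mul_ne_zero (by exact_mod_cast h1.ne') h0⟩
  have ha0 : a ≠ 0 := fun h => by simp [h] at hai
  have hb0 : b ≠ 0 := fun h => by simp [h] at hbi
  have ta := (lL a ha).sub ((Complex.tendsto_log_nhdsWithin_im_neg_of_re_neg_of_im_zero
    (z := -1) (by simp) (by simp)).comp (tendsto_nhdsWithin_iff.2 ⟨lg a, by
      filter_upwards [Ioc_mem_nhdsGT (zero_lt_one' ℝ)] with s hs
      rw [gim]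
      exact mul_neg_of_neg_of_pos (mul_neg_of_pos_of_neg (by linarith [hs.1]) hai)
        (inv_pos.2 (Complex.normSq_pos.2 (ne _ (ha s hs.1 hs.2))))⟩))
  have tb := (lL b hb).sub ((Complex.tendsto_log_nhdsWithin_im_nonneg_of_re_neg_of_im_zero
    (z := -1) (by simp) (by simp)).comp (tendsto_nhdsWithin_iff.2 ⟨lg b, by
      filter_upwards [Ioc_mem_nhdsGT (zero_lt_one' ℝ)] with s hs
      rw [gim]
      exact mul_nonneg (mul_nonneg (by linarith [hs.1]) hbi.le)
        (inv_nonneg.2 (Complex.normSq_nonneg _))⟩))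
  have := tendsto_nhds_unique (ta.congr' (by
    filter_upwards [Ioc_mem_nhdsGT (zero_lt_one' ℝ)] with s hs
    exact kD _ (nz a ha0 ha s hs.1 hs.2) _ (nz b hb0 hb s hs.1 hs.2))) tb
  have := congrArg Complex.im this
  simp at this
  linarith [Real.pi_pos]

end Crossing

section NodalCrossing

open Filter Topology ComplexConjugate

theorem preconnected_ray {a : ℂ} : IsPreconnected ((fun s : ℝ => (s : ℂ) * a) '' Set.Ioc 0 1) :=
  isPreconnected_Ioc.image _ (by fun_prop)

namespace NodalField

variable {w V : ℂ → ℝ} {M : ℝ}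

theorem ray_subset {a : ℂ} (ha : ∀ s : ℝ, 0 < s → s ≤ 1 → 0 < ((s : ℂ) * a).im ∧ w (s * a) ≠ 0) :
    (fun s : ℝ => (s : ℂ) * a) '' Set.Ioc 0 1 ⊆ nodal w a :=
  preconnected_ray.subset_connectedComponentIn ⟨1, by simp, by simp⟩ (by
    rintro _ ⟨s, hs, rfl⟩; exact ha s hs.1 hs.2)

theorem zero_mem_closure {a : ℂ}
    (ha : ∀ s : ℝ, 0 < s → s ≤ 1 → 0 < ((s : ℂ) * a).im ∧ w (s * a) ≠ 0) :
    (0 : ℂ) ∈ closure (nodal w a) := by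
  have h1 : Tendsto (fun s : ℝ => (s : ℂ) * a) (𝓝[>] 0) (𝓝 0) := by
    have : Continuous fun s : ℝ => (s : ℂ) * a := by fun_prop
    simpa using (this.tendsto 0).mono_left nhdsWithin_le_nhds
  refine mem_closure_of_tendsto h1 ?_
  filter_upwards [Ioc_mem_nhdsGT (zero_lt_one' ℝ)] with s hs
  exact ray_subset ha ⟨s, hs, rfl⟩

theorem exists_neg_above (h : NodalField w V M) {x : ℂ} (hx : x.im = 0) (hd : dy w x < 0) :
    ∃ z, 0 < z.im ∧ w z < 0 ∧ x ∈ closure (nodal w z) := by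
  have h1 : HasDerivAt (fun t : ℝ => w (x + t * Complex.I)) (dy w x) 0 := by
    have e : HasDerivAt (fun t : ℝ => x + t * Complex.I) Complex.I 0 := by
      simpa using ((Complex.ofRealCLM.hasDerivAt (x := (0 : ℝ))).mul_const Complex.I).const_add x
    have h2 : HasFDerivAt w (fderiv ℝ w x) (x + ((0 : ℝ) : ℂ) * Complex.I) := by
      simpa using (h.smooth.differentiable (by simp) x).hasFDerivAt
    exact h2.comp_hasDerivAt 0 e
  have h2 : ∀ᶠ t : ℝ in 𝓝[>] 0, w (x + t * Complex.I) < 0 := by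
    have := (hasDerivAt_iff_tendsto_slope_zero.1 h1).mono_left (nhdsGT_le_nhdsNE 0)
    filter_upwards [this.eventually (gt_mem_nhds hd), self_mem_nhdsWithin] with t ht ht0
    have ht0 : 0 < t := ht0
    simp only [zero_add, Complex.ofReal_zero, zero_mul, add_zero, h.axis x hx, sub_zero,
      smul_eq_mul] at ht
    exact (pos_iff_neg_of_mul_neg ht).1 (inv_pos.2 ht0)
  obtain ⟨r, hr, hlt⟩ := mem_nhdsGT_iff_exists_Ioc_subset.1 h2
  have hr : 0 < r := hr
  have im : ∀ t : ℝ, (x + t * Complex.I).im = t := fun t => by simp [hx]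
  refine ⟨x + r * Complex.I, by rwa [im], hlt ⟨hr, le_rfl⟩, ?_⟩
  have sub : (fun t : ℝ => x + t * Complex.I) '' Set.Ioc 0 r ⊆ nodal w (x + r * Complex.I) :=
    (isPreconnected_Ioc.image _ (by fun_prop)).subset_connectedComponentIn
      ⟨r, ⟨hr, le_rfl⟩, rfl⟩ (by
        rintro _ ⟨t, ht, rfl⟩
        exact ⟨by simpa only [im] using ht.1, (hlt ht).ne⟩)
  have h3 : Tendsto (fun t : ℝ => x + t * Complex.I) (𝓝[>] 0) (𝓝 x) := by
    have : Continuous fun t : ℝ => x + t * Complex.I := by fun_prop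
    simpa using (this.tendsto 0).mono_left nhdsWithin_le_nhds
  refine mem_closure_of_tendsto h3 ?_
  filter_upwards [Ioc_mem_nhdsGT hr] with t ht
  exact sub ⟨t, ht, rfl⟩

theorem not_enclosed (h : NodalField w V M) {a p b x : ℂ}
    (ha : ∀ s : ℝ, 0 < s → s ≤ 1 → 0 < ((s : ℂ) * a).im ∧ 0 < w (s * a))
    (hp : ∀ s : ℝ, 0 < s → s ≤ 1 → 0 < ((s : ℂ) * p).im ∧ w (s * p) < 0)
    (hb : ∀ s : ℝ, 0 < s → s ≤ 1 → 0 < ((s : ℂ) * b).im ∧ 0 < w (s * b))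
    (hai : (a * conj p).im < 0) (hbi : 0 < (b * conj p).im)
    (hab : nodal w a = nodal w b) (hx : x.im = 0) (hx0 : x ≠ 0)
    (hxp : x ∈ closure (nodal w p)) : False := by
  have ha1 := ha 1 one_pos le_rfl
  have hb1 := hb 1 one_pos le_rfl
  have hp1 := hp 1 one_pos le_rfl
  simp only [Complex.ofReal_one, one_mul] at ha1 hb1 hp1
  have hmb : b ∈ nodal w a := hab ▸ mem_nodal ⟨hb1.1, hb1.2.ne'⟩
  have hma : a ∈ nodal w a := mem_nodal ⟨ha1.1, ha1.2.ne'⟩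
  have hmp : p ∈ nodal w p := mem_nodal ⟨hp1.1, hp1.2.ne⟩
  have ra := ray_subset fun s h1 h2 => ⟨(ha s h1 h2).1, (ha s h1 h2).2.ne'⟩
  have rb := ray_subset fun s h1 h2 => ⟨(hb s h1 h2).1, (hb s h1 h2).2.ne'⟩
  rw [← hab] at rb
  have posA : ∀ z ∈ nodal w a, 0 < w z := fun z hz => h.pos_of_mem ha1.1 ha1.2 hz
  have hdis : Disjoint (nodal w p) (nodal w a) :=
    disjoint_nodal fun e => (posA p (e ▸ hmp)).not_gt hp1.2
  obtain ⟨γ, hγ⟩ := ((h.isOpen_nodal.isConnected_iff_isPathConnected (U := nodal w a)).1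
    ⟨⟨a, hma⟩, isPreconnected_nodal⟩).joinedIn a hma b hmb
  set Γ : Set ℂ := insert 0 ((fun s : ℝ => (s : ℂ) * a) '' Set.Ioc 0 1 ∪ Set.range γ ∪
    (fun s : ℝ => (s : ℂ) * b) '' Set.Ioc 0 1) with hΓ
  have sub : (fun s : ℝ => (s : ℂ) * a) '' Set.Ioc 0 1 ∪ Set.range γ ∪
    (fun s : ℝ => (s : ℂ) * b) '' Set.Ioc 0 1 ⊆ nodal w a :=
    Set.union_subset (Set.union_subset ra (Set.range_subset_iff.2 hγ)) rb
  have subΓ : ∀ z ∈ Γ, z = 0 ∨ z ∈ nodal w a := fun z hz => hz.imp id fun h => sub h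
  have e0 : Γ \ {0} = (fun s : ℝ => (s : ℂ) * a) '' Set.Ioc 0 1 ∪ Set.range γ ∪
      (fun s : ℝ => (s : ℂ) * b) '' Set.Ioc 0 1 := by
    refine Set.insert_sdiff_self_of_notMem fun h0 => ?_
    have := (nodal_subset (sub h0)).1
    simp at this
  have conn : IsPreconnected (Γ \ {0}) := by
    rw [e0]
    refine IsPreconnected.union b (Or.inr ⟨1, γ.target⟩) ⟨1, by simp, by simp⟩
      (IsPreconnected.union a ⟨1, by simp, by simp⟩ ⟨0, γ.source⟩ preconnected_ray
        (isPreconnected_range γ.continuous)) preconnected_ray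
  have closed : IsClosed Γ := by
    have seg : ∀ a : ℂ, IsCompact ((fun s : ℝ => (s : ℂ) * a) '' Set.Icc 0 1) := fun a =>
      isCompact_Icc.image (by fun_prop)
    have : Γ = (fun s : ℝ => (s : ℂ) * a) '' Set.Icc 0 1 ∪ Set.range γ ∪
      (fun s : ℝ => (s : ℂ) * b) '' Set.Icc 0 1 := by
      rw [hΓ, ← Set.Ioc_insert_left zero_le_one, Set.image_insert_eq, Set.image_insert_eq]
      simp only [Complex.ofReal_zero, zero_mul]
      ext z
      simp only [Set.mem_insert_iff, Set.mem_union]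
      tauto
    rw [this]
    exact (((seg a).union (isCompact_range γ.continuous)).union (seg b)).isClosed
  have imΓ : ∀ z ∈ Γ, 0 ≤ z.im := fun z hz => by
    rcases subΓ z hz with rfl | h
    · simp
    · exact (nodal_subset h).1.le
  have hxΓ : x ∈ Γᶜ := fun hxG => by
    rcases subΓ x hxG with h | h
    · exact hx0 h
    · exact (nodal_subset h).1.ne' hx
  obtain ⟨ε, hε, hball⟩ := Metric.isOpen_iff.1 closed.isOpen_compl x hxΓ
  have lowc : IsPreconnected {z : ℂ | z.im < 0} := (convex_halfSpace_im_lt 0).isPreconnected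
  obtain ⟨y, hy, hyp⟩ := Metric.mem_closure_iff.1 hxp ε hε
  have hT : IsPreconnected (nodal w p ∪ Metric.ball x ε ∪ {z : ℂ | z.im < 0}) := by
    refine IsPreconnected.union (x - (ε / 2 : ℝ) * Complex.I) (Or.inr ?_) ?_
      (IsPreconnected.union y hy (Metric.mem_ball'.2 hyp) isPreconnected_nodal
        (convex_ball x ε).isPreconnected) lowc
    · rw [mem_ball_iff_norm, sub_sub_cancel_left, norm_neg, norm_mul, Complex.norm_I, mul_one,
        Complex.norm_real, Real.norm_of_nonneg (by positivity)]
      linarith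
    · simp [hx]; linarith
  refine no_crossing (p := p) (a := a) (b := b) closed conn hT ?_ (Or.inl (Or.inl hmp))
    (Or.inr ?_) ?_ (Set.mem_insert _ _) (fun s h1 h2 => Or.inr (Or.inl (Or.inl ⟨s, ⟨h1, h2⟩, rfl⟩)))
    (fun s h1 h2 => Or.inr (Or.inr ⟨s, ⟨h1, h2⟩, rfl⟩)) hai hbi
  · refine Set.disjoint_left.2 ?_
    rintro z ((hz | hz) | hz) hzG
    · rcases subΓ z hzG with rfl | h
      · have := (nodal_subset hz).1
        simp at this
      · exact Set.disjoint_left.1 hdis hz h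
    · exact hball hz hzG
    · exact (imΓ z hzG).not_gt hz
  · simpa using hp1.1
  · intro t ht0 ht1 hmem
    rcases lt_or_gt_of_ne ht0 with ht | ht
    · have h1 := imΓ _ hmem
      rw [Complex.im_ofReal_mul] at h1
      nlinarith [hp1.1]
    · have h1 := hp t ht (le_trans (le_abs_self t) ht1)
      rcases subΓ _ hmem with h2 | h2
      · rw [h2] at h1; simp at h1
      · exact (posA _ h2).not_gt h1.2

theorem crossing (h : NodalField w V M)
    (hT : ∀ z x : Fin 3 → ℂ, (∀ i, 0 < (z i).im ∧ w (z i) ≠ 0) → (∀ i, x i ∈ closure (nodal w (z i))) →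
      (∀ i, (x i).im = 0) → (∀ i j, i ≠ j → nodal w (z i) ≠ nodal w (z j)) → False)
    {k : ℕ} (hk : 2 ≤ k) {c : ℝ} (hc : 0 < c)
    (has : (fun z : ℂ => w z - c * (z ^ (k + 1)).im) =o[𝓝 0] fun z => ‖z‖ ^ (k + 1))
    {x : ℂ} (hx : x.im = 0) (hx0 : x ≠ 0) (hd : dy w x < 0) : False := by
  rw [Asymptotics.isLittleO_iff] at has
  obtain ⟨ε, hε, hb⟩ := Metric.eventually_nhds_iff_ball.1 (has (half_pos hc))
  obtain ⟨r, hr, hrε⟩ : ∃ r, 0 < r ∧ r < ε := ⟨ε / 2, by positivity, by linarith⟩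
  set a : ℝ → ℂ := fun θ => r * Complex.exp (θ * Complex.I) with ha
  have hn : (3 : ℝ) ≤ (k + 1 : ℝ) := by exact_mod_cast Nat.succ_le_succ hk
  have na : ∀ θ, ‖a θ‖ = r := fun θ => by
    rw [ha, norm_mul, Complex.norm_exp_ofReal_mul_I, Complex.norm_real, Real.norm_of_nonneg hr.le,
      mul_one]
  have ima : ∀ θ, (a θ).im = r * Real.sin θ := fun θ => by
    simp only [ha, Complex.im_ofReal_mul, Complex.exp_ofReal_mul_I_im]
  have ipow : ∀ (s θ : ℝ), (((s : ℂ) * a θ) ^ (k + 1)).im = (s * r) ^ (k + 1) * Real.sin ((k + 1) * θ) := by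
    intro s θ
    have : ((s : ℂ) * a θ) ^ (k + 1) = (((s * r) ^ (k + 1) : ℝ) : ℂ) *
        Complex.exp (((k + 1) * θ : ℝ) * Complex.I) := by
      simp only [ha]
      rw [← mul_assoc, mul_pow, ← Complex.exp_nat_mul]
      push_cast
      ring_nf
    rw [this, Complex.im_ofReal_mul, Complex.exp_ofReal_mul_I_im]
  have est : ∀ (s θ : ℝ), 0 < s → s ≤ 1 →
      |w (s * a θ) - c * ((s * r) ^ (k + 1) * Real.sin ((k + 1) * θ))| ≤ c / 2 * (s * r) ^ (k + 1) := by
    intro s θ h1 h2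
    have e : ‖(s : ℂ) * a θ‖ = s * r := by
      rw [norm_mul, na, Complex.norm_real, Real.norm_of_nonneg h1.le]
    have := hb (s * a θ) (by rw [mem_ball_zero_iff, e]; nlinarith)
    rwa [norm_pow, norm_norm, e, ipow, Real.norm_eq_abs] at this
  have imp : ∀ s θ : ℝ, 0 < s → 0 < θ → θ < π → 0 < ((s : ℂ) * a θ).im := fun s θ h1 h2 h3 => by
    rw [Complex.im_ofReal_mul, ima]
    exact mul_pos h1 (mul_pos hr (Real.sin_pos_of_pos_of_lt_pi h2 h3))
  have pos : ∀ θ : ℝ, Real.sin ((k + 1) * θ) = 1 → ∀ s : ℝ, 0 < s → s ≤ 1 → 0 < w (s * a θ) := by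
    intro θ hθ s h1 h2
    have h3 := est s θ h1 h2
    rw [hθ, abs_le] at h3
    nlinarith [h3.1, (by positivity : 0 < c * (s * r) ^ (k + 1))]
  have neg : ∀ θ : ℝ, Real.sin ((k + 1) * θ) = -1 → ∀ s : ℝ, 0 < s → s ≤ 1 → w (s * a θ) < 0 := by
    intro θ hθ s h1 h2
    have h3 := est s θ h1 h2
    rw [hθ, abs_le] at h3
    nlinarith [h3.2, (by positivity : 0 < c * (s * r) ^ (k + 1))]
  have hk0 : (0 : ℝ) < k + 1 := by positivity
  have ang : ∀ m : ℝ, 0 < m → m ≤ 5 → 0 < m * π / 2 / (k + 1) ∧ m * π / 2 / (k + 1) < π := by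
    intro m h1 h2
    have := Real.pi_pos
    refine ⟨by positivity, ?_⟩
    rw [div_lt_iff₀ hk0]
    nlinarith
  have mulang : ∀ m : ℝ, (k + 1) * (m * π / 2 / (k + 1)) = m * π / 2 := fun m => by field_simp
  set θ : ℝ → ℝ := fun m => m * π / 2 / (k + 1) with hθ
  have s1 : Real.sin ((k + 1) * θ 1) = 1 := by rw [mulang, one_mul, Real.sin_pi_div_two]
  have s3 : Real.sin ((k + 1) * θ 3) = -1 := by
    rw [mulang, show 3 * π / 2 = π / 2 + π by ring, Real.sin_add_pi, Real.sin_pi_div_two]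
  have s5 : Real.sin ((k + 1) * θ 5) = 1 := by
    rw [mulang, show 5 * π / 2 = π / 2 + 2 * π by ring, Real.sin_add_two_pi, Real.sin_pi_div_two]
  have A1 : ∀ s : ℝ, 0 < s → s ≤ 1 → 0 < ((s : ℂ) * a (θ 1)).im ∧ 0 < w (s * a (θ 1)) :=
    fun s h1 h2 => ⟨imp s _ h1 (ang 1 (by norm_num) (by norm_num)).1 (ang 1 (by norm_num) (by norm_num)).2,
      pos _ s1 s h1 h2⟩
  have A3 : ∀ s : ℝ, 0 < s → s ≤ 1 → 0 < ((s : ℂ) * a (θ 3)).im ∧ w (s * a (θ 3)) < 0 :=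
    fun s h1 h2 => ⟨imp s _ h1 (ang 3 (by norm_num) (by norm_num)).1 (ang 3 (by norm_num) (by norm_num)).2,
      neg _ s3 s h1 h2⟩
  have A5 : ∀ s : ℝ, 0 < s → s ≤ 1 → 0 < ((s : ℂ) * a (θ 5)).im ∧ 0 < w (s * a (θ 5)) :=
    fun s h1 h2 => ⟨imp s _ h1 (ang 5 (by norm_num) (by norm_num)).1 (ang 5 (by norm_num) (by norm_num)).2,
      pos _ s5 s h1 h2⟩
  have ne : ∀ {z z' : ℂ}, 0 < z.im → 0 < w z → 0 < z'.im → w z' < 0 → nodal w z ≠ nodal w z' :=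
    fun {z z'} h1 h2 h3 h4 e =>
      (h.pos_of_mem h1 h2 (e ▸ mem_nodal ⟨h3, h4.ne⟩)).not_gt h4
  have B1 := A1 1 one_pos le_rfl
  have B3 := A3 1 one_pos le_rfl
  have B5 := A5 1 one_pos le_rfl
  simp only [Complex.ofReal_one, one_mul] at B1 B3 B5
  have C1 := zero_mem_closure fun s h1 h2 => ⟨(A1 s h1 h2).1, (A1 s h1 h2).2.ne'⟩
  have C3 := zero_mem_closure fun s h1 h2 => ⟨(A3 s h1 h2).1, (A3 s h1 h2).2.ne⟩
  have C5 := zero_mem_closure fun s h1 h2 => ⟨(A5 s h1 h2).1, (A5 s h1 h2).2.ne'⟩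
  have n13 := ne B1.1 B1.2 B3.1 B3.2
  have n53 := ne B5.1 B5.2 B3.1 B3.2
  have three : ∀ p q t x y u : ℂ, (0 < p.im ∧ w p ≠ 0) → (0 < q.im ∧ w q ≠ 0) → (0 < t.im ∧ w t ≠ 0) →
      x ∈ closure (nodal w p) → y ∈ closure (nodal w q) → u ∈ closure (nodal w t) →
      x.im = 0 → y.im = 0 → u.im = 0 → nodal w p ≠ nodal w q → nodal w p ≠ nodal w t →
      nodal w q ≠ nodal w t → False := by
    intro p q t x y u h1 h2 h3 h4 h5 h6 h7 h8 h9 n1 n2 n3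
    refine hT ![p, q, t] ![x, y, u] ?_ ?_ ?_ ?_
    · simp [Fin.forall_fin_succ, h1, h2, h3]
    · simp [Fin.forall_fin_succ, h4, h5, h6]
    · simp [Fin.forall_fin_succ, h7, h8, h9]
    · simp [Fin.forall_fin_succ, n1, n2, n3, n1.symm, n2.symm, n3.symm]
  by_cases h15 : nodal w (a (θ 1)) = nodal w (a (θ 5))
  swap
  · exact three _ _ _ 0 0 0 ⟨B1.1, B1.2.ne'⟩ ⟨B3.1, B3.2.ne⟩ ⟨B5.1, B5.2.ne'⟩ C1 C3 C5 rfl rfl rfl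
      n13 h15 n53.symm
  obtain ⟨z, hz1, hz2, hz3⟩ := h.exists_neg_above hx hd
  by_cases h3z : nodal w (a (θ 3)) = nodal w z
  swap
  · exact three _ _ _ 0 0 x ⟨B1.1, B1.2.ne'⟩ ⟨B3.1, B3.2.ne⟩ ⟨hz1, hz2.ne⟩ C1 C3 hz3 rfl rfl hx
      n13 (ne B1.1 B1.2 hz1 hz2) h3z
  have cross : ∀ θ φ : ℝ, (a θ * conj (a φ)).im = r ^ 2 * Real.sin (θ - φ) := fun θ φ => by
    simp only [ha, map_mul, Complex.conj_ofReal, Complex.mul_im, Complex.mul_re, Complex.conj_re,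
      Complex.conj_im, Complex.exp_ofReal_mul_I_re, Complex.exp_ofReal_mul_I_im, Complex.ofReal_re,
      Complex.ofReal_im, Real.sin_sub]
    ring
  have hk1 : 0 < Real.sin (π / (k + 1)) :=
    Real.sin_pos_of_pos_of_lt_pi (div_pos Real.pi_pos hk0) (by
      rw [div_lt_iff₀ hk0]; nlinarith [Real.pi_pos])
  refine h.not_enclosed A1 A3 A5 ?_ ?_ h15 hx hx0 (h3z ▸ hz3)
  · rw [cross, show θ 1 - θ 3 = -(π / (k + 1)) by simp only [hθ]; ring, Real.sin_neg]
    nlinarith [pow_pos hr 2]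
  · rw [cross, show θ 5 - θ 3 = π / (k + 1) by simp only [hθ]; ring]
    positivity

end NodalField

end NodalCrossing

section HalfPlane

open Filter Topology ComplexConjugate

theorem setIntegral_upper (g : ℂ → ℝ) : ∫ z in {z : ℂ | 0 < z.im}, g z
    = ∫ p in (Set.univ ×ˢ Set.Ioi (0 : ℝ) : Set (ℝ × ℝ)), g (p.1 + p.2 * Complex.I) := by
  have := Complex.volume_preserving_equiv_real_prod.symm.setIntegral_preimage_emb
    Complex.measurableEquivRealProd.symm.measurableEmbedding g {z : ℂ | 0 < z.im}
  rw [← this]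
  have e : ∀ p : ℝ × ℝ, Complex.measurableEquivRealProd.symm p = p.1 + p.2 * Complex.I := fun p => by
    apply Complex.ext <;> simp
  have e2 : Complex.measurableEquivRealProd.symm ⁻¹' {z : ℂ | 0 < z.im}
      = Set.univ ×ˢ Set.Ioi (0 : ℝ) := by
    ext p
    simp
  rw [e2]
  simp only [e]

variable {F : ℂ → ℝ}

theorem isClosedEmbedding_line_re (y : ℝ) : IsClosedEmbedding fun x : ℝ => (x : ℂ) + y * Complex.I :=
  Isometry.isClosedEmbedding (Isometry.of_dist_eq fun a b => by
    rw [dist_add_right, Complex.dist_of_im_eq (by simp)]; simp [Real.dist_eq])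

theorem isClosedEmbedding_line_im (x : ℝ) : IsClosedEmbedding fun y : ℝ => (x : ℂ) + y * Complex.I :=
  Isometry.isClosedEmbedding (Isometry.of_dist_eq fun a b => by
    rw [dist_add_left, dist_eq_norm, ← sub_mul, norm_mul, Complex.norm_I, mul_one, ← Complex.ofReal_sub,
      Complex.norm_real, Real.dist_eq, Real.norm_eq_abs])

theorem integrable_prod_line {g : ℂ → ℝ} (hg : Continuous g) (hc : HasCompactSupport g) :
    Integrable fun p : ℝ × ℝ => g (p.1 + p.2 * Complex.I) := by
  have e : (fun p : ℝ × ℝ => g (p.1 + p.2 * Complex.I))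
      = g ∘ Complex.equivRealProdCLM.symm.toHomeomorph := by
    ext p; congr 1; apply Complex.ext <;> simp
  rw [e]
  exact (hg.comp (Homeomorph.continuous _)).integrable_of_hasCompactSupport (hc.comp_homeomorph _)

theorem integral_upper_dy (hF : ContDiff ℝ 1 F) (hc : HasCompactSupport F) :
    ∫ z in {z : ℂ | 0 < z.im}, dy F z = -∫ x : ℝ, F x := by
  have cd : Continuous (dy F) := (hF.dy (m := 0) (by norm_num)).continuous
  rw [setIntegral_upper, Measure.volume_eq_prod, setIntegral_prod _
    (integrable_prod_line cd hc.dy).integrableOn, Measure.restrict_univ, ← integral_neg]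
  congr 1
  ext x
  have hs : ContDiff ℝ 1 fun y : ℝ => F (x + y * Complex.I) :=
    hF.comp (contDiff_const.add (Complex.ofRealCLM.contDiff.mul contDiff_const))
  have := (hc.comp_isClosedEmbedding (isClosedEmbedding_line_im x)).integral_Ioi_deriv_eq
    (f := fun y : ℝ => F (x + y * Complex.I)) hs 0
  simp only [Complex.ofReal_zero, zero_mul, add_zero] at this
  rw [← this]
  congr 1
  ext y
  have e : HasDerivAt (fun t : ℝ => (x : ℂ) + t * Complex.I) Complex.I y := by
    simpa using ((Complex.ofRealCLM.hasDerivAt (x := y)).mul_const Complex.I).const_add (x : ℂ)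
  exact (((hF.differentiable (by simp) _).hasFDerivAt.comp_hasDerivAt y e).deriv).symm

theorem integral_upper_dx (hF : ContDiff ℝ 1 F) (hc : HasCompactSupport F) :
    ∫ z in {z : ℂ | 0 < z.im}, dx F z = 0 := by
  have cd : Continuous (dx F) := (hF.dx (m := 0) (by norm_num)).continuous
  have hi := integrable_prod_line cd hc.dx
  rw [setIntegral_upper, Measure.volume_eq_prod, ← setIntegral_prod_swap, setIntegral_prod
    (fun p : ℝ × ℝ => dx F (p.swap.1 + p.swap.2 * Complex.I)) hi.swap.integrableOn]
  refine integral_eq_zero_of_ae (Eventually.of_forall fun y => ?_)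
  rw [Measure.restrict_univ]
  have hd : ∀ x : ℝ, HasDerivAt (fun x : ℝ => F (x + y * Complex.I)) (dx F (x + y * Complex.I)) x :=
    fun x => (hF.differentiable (by simp) _).hasFDerivAt.comp_hasDerivAt x
      ((Complex.ofRealCLM.hasDerivAt (x := x)).add_const (y * Complex.I))
  have cl := isClosedEmbedding_line_re y
  exact integral_eq_zero_of_hasDerivAt_of_integrable hd
    ((cd.comp cl.continuous).integrable_of_hasCompactSupport (hc.dx.comp_isClosedEmbedding cl))
    ((hF.continuous.comp cl.continuous).integrable_of_hasCompactSupport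
      (hc.comp_isClosedEmbedding cl))

theorem half_green {φ w : ℂ → ℝ} (hφ : ContDiff ℝ ∞ φ) (hc : HasCompactSupport φ)
    (hw : ContDiff ℝ ∞ w) (h0 : ∀ z : ℂ, z.im = 0 → w z = 0) :
    ∫ z in {z : ℂ | 0 < z.im}, φ z * lapC w z
      = (∫ z in {z : ℂ | 0 < z.im}, lapC φ z * w z) - ∫ x : ℝ, φ x * dy w x := by
  have one : (1 : WithTop ℕ∞) + 1 ≤ ∞ := by norm_cast
  have d : ∀ {f : ℂ → ℝ}, ContDiff ℝ ∞ f → Differentiable ℝ f := fun h => h.differentiable (by simp)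
  have dx1 : ∀ {f : ℂ → ℝ}, ContDiff ℝ ∞ f → ContDiff ℝ ∞ (dx f) := fun h => h.dx (by norm_cast)
  have dy1 : ∀ {f : ℂ → ℝ}, ContDiff ℝ ∞ f → ContDiff ℝ ∞ (dy f) := fun h => h.dy (by norm_cast)
  have s1 : ContDiff ℝ ∞ fun z => φ z * dx w z - w z * dx φ z :=
    (hφ.mul (dx1 hw)).sub (hw.mul (dx1 hφ))
  have s2 : ContDiff ℝ ∞ fun z => φ z * dy w z - w z * dy φ z :=
    (hφ.mul (dy1 hw)).sub (hw.mul (dy1 hφ))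
  have c1 : HasCompactSupport fun z => φ z * dx w z - w z * dx φ z := hc.mul_right.sub hc.dx.mul_left
  have c2 : HasCompactSupport fun z => φ z * dy w z - w z * dy φ z := hc.mul_right.sub hc.dy.mul_left
  have e1 := integral_upper_dx (s1.of_le (by norm_cast)) c1
  have e2 := integral_upper_dy (s2.of_le (by norm_cast)) c2
  have i1 : IntegrableOn (fun z => dx (fun z => φ z * dx w z - w z * dx φ z) z) {z : ℂ | 0 < z.im} :=
    ((dx1 s1).continuous.integrable_of_hasCompactSupport c1.dx).integrableOn
  have i2 : IntegrableOn (fun z => dy (fun z => φ z * dy w z - w z * dy φ z) z) {z : ℂ | 0 < z.im} :=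
    ((dy1 s2).continuous.integrable_of_hasCompactSupport c2.dy).integrableOn
  have e3 : ∀ x : ℝ, φ x * dy w x - w x * dy φ x = φ x * dy w x := fun x => by
    rw [h0 x (by simp), zero_mul, sub_zero]
  simp only [e3] at e2
  have cl : ∀ {f : ℂ → ℝ}, ContDiff ℝ ∞ f → Continuous (lapC f) := fun h =>
    (dx1 (dx1 h)).continuous.add (dy1 (dy1 h)).continuous
  have i3 : IntegrableOn (fun z => φ z * lapC w z) {z : ℂ | 0 < z.im} :=
    ((hφ.continuous.mul (cl hw)).integrable_of_hasCompactSupport hc.mul_right).integrableOn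
  have cφ : HasCompactSupport (lapC φ) := hc.dx.dx.add hc.dy.dy
  have i4 : IntegrableOn (fun z => lapC φ z * w z) {z : ℂ | 0 < z.im} :=
    (((cl hφ).mul hw.continuous).integrable_of_hasCompactSupport cφ.mul_right).integrableOn
  have e4 : ∀ z, dx (fun z => φ z * dx w z - w z * dx φ z) z + dy (fun z => φ z * dy w z - w z * dy φ z) z
      = φ z * lapC w z - lapC φ z * w z := fun z => by
    have m : ∀ {f g : ℂ → ℝ}, ContDiff ℝ ∞ f → ContDiff ℝ ∞ g → ∀ a, fderiv ℝ (fun z => f z * g z) z a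
        = fderiv ℝ f z a * g z + f z * fderiv ℝ g z a := fun hf hg a => by
      rw [fderiv_fun_mul (d hf z) (d hg z)]
      simp only [add_apply, smul_apply, smul_eq_mul]
      ring
    have s : ∀ {f g : ℂ → ℝ}, ContDiff ℝ ∞ f → ContDiff ℝ ∞ g → ∀ a, fderiv ℝ (fun z => f z - g z) z a
        = fderiv ℝ f z a - fderiv ℝ g z a := fun hf hg a => by
      rw [fderiv_fun_sub (d hf z) (d hg z)]; rfl
    change fderiv ℝ (fun z => φ z * dx w z - w z * dx φ z) z 1
      + fderiv ℝ (fun z => φ z * dy w z - w z * dy φ z) z Complex.I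
      = φ z * (fderiv ℝ (dx w) z 1 + fderiv ℝ (dy w) z Complex.I)
        - (fderiv ℝ (dx φ) z 1 + fderiv ℝ (dy φ) z Complex.I) * w z
    rw [s (hφ.mul (dx1 hw)) (hw.mul (dx1 hφ)), s (hφ.mul (dy1 hw)) (hw.mul (dy1 hφ)),
      m hφ (dx1 hw), m hw (dx1 hφ), m hφ (dy1 hw), m hw (dy1 hφ)]
    simp only [dx, dy]
    ring
  have := integral_add i1 i2
  rw [integral_congr_ae (Eventually.of_forall e4), integral_sub i3 i4, e1, e2] at this
  linarith

end HalfPlane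

section Cutoffs

open Filter Topology

/-- A sequence of cutoffs exhausting the plane, obtained by dilation. -/
structure CutoffSeq (χ : ℕ → ℂ → ℝ) (C : ℝ) : Prop where
  smooth : ∀ n, ContDiff ℝ ∞ (χ n)
  compact : ∀ n, HasCompactSupport (χ n)
  nonneg : ∀ n z, 0 ≤ χ n z
  le_one : ∀ n z, χ n z ≤ 1
  eq_one : ∀ (n : ℕ) z, ‖z‖ ≤ n + 1 → χ n z = 1
  lap_zero : ∀ (n : ℕ) z, ‖z‖ ≤ n + 1 → lapC (χ n) z = 0
  lap_int : ∀ n, ∫ z, |lapC (χ n) z| ≤ C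

theorem lapC_comp_smul (f : ℂ → ℝ) (c : ℝ) (z : ℂ) :
    lapC (fun z => f (c • z)) z = c ^ 2 * lapC f (c • z) := by
  have h : ∀ (g : ℂ → ℝ) (z a : ℂ), fderiv ℝ (fun z => g (c • z)) z a = c * fderiv ℝ g (c • z) a :=
    fun g z a => by rw [fderiv_comp_smul]; rfl
  have h1 : dx (fun z => f (c • z)) = fun z => c * dx f (c • z) := by ext z; exact h f z 1
  have h2 : dy (fun z => f (c • z)) = fun z => c * dy f (c • z) := by ext z; exact h f z Complex.I
  have h3 : ∀ (g : ℂ → ℝ) (z a : ℂ), fderiv ℝ (fun z => c * g z) z a = c * fderiv ℝ g z a :=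
    fun g z a => by
      rw [show (fun z => c * g z) = c • g from rfl, fderiv_const_smul_field]; rfl
  rw [lapC, h1, h2]
  change fderiv ℝ (fun z => c * dx f (c • z)) z 1 + fderiv ℝ (fun z => c * dy f (c • z)) z Complex.I
    = c ^ 2 * (fderiv ℝ (dx f) (c • z) 1 + fderiv ℝ (dy f) (c • z) Complex.I)
  rw [h3 (fun z => dx f (c • z)), h3 (fun z => dy f (c • z)), h (dx f), h (dy f)]
  ring

theorem exists_cutoffSeq : ∃ χ C, CutoffSeq χ C := by
  obtain ⟨χ, h1, h2, -, h3, h4⟩ := exists_contDiff_cutoff (isCompact_closedBall (0 : ℂ) 1)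
    isOpen_univ (Set.subset_univ _)
  have pos : ∀ n : ℕ, 0 < ((n : ℝ) + 1)⁻¹ := fun n => by positivity
  have near : ∀ (n : ℕ) (z : ℂ), ‖z‖ ≤ n + 1 → χ =ᶠ[𝓝 (((n : ℝ) + 1)⁻¹ • z)] fun _ => 1 := fun n z hz => by
    refine (eventually_nhdsSet_iff_forall.1 h3) _ ?_
    rw [mem_closedBall_zero_iff, norm_smul, Real.norm_of_nonneg (pos n).le, inv_mul_le_iff₀ (by positivity)]
    simpa using hz
  refine ⟨fun n z => χ (((n : ℝ) + 1)⁻¹ • z), ∫ z, |lapC χ z|, fun n => h1.comp (contDiff_const_smul _),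
    fun n => h2.comp_smul (pos n).ne', fun n z => (h4 _).1, fun n z => (h4 _).2,
    fun n z hz => (near n z hz).eq_of_nhds, fun n z hz => ?_, fun n => ?_⟩
  · rw [lapC_comp_smul, lapC_congr (near n z hz), lapC_const, mul_zero]
  · simp only [lapC_comp_smul, abs_mul, abs_pow, abs_of_pos (pos n)]
    rw [integral_const_mul, Measure.integral_comp_smul volume (fun z => |lapC χ z|)]
    rw [Complex.finrank_real_complex, abs_of_pos (inv_pos.2 (pow_pos (pos n) 2)), smul_eq_mul,
      mul_inv_cancel_left₀ (pow_pos (pos n) 2).ne']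

namespace CutoffSeq

variable {χ : ℕ → ℂ → ℝ} {C : ℝ}

theorem continuous_lap (h : CutoffSeq χ C) (n : ℕ) : Continuous (lapC (χ n)) :=
  (((h.smooth n).dx (m := ∞) (by norm_cast)).dx (m := ∞) (by norm_cast)).continuous.add
    (((h.smooth n).dy (m := ∞) (by norm_cast)).dy (m := ∞) (by norm_cast)).continuous

theorem tendsto_lap (h : CutoffSeq χ C) {v : ℂ → ℝ} (hl : Tendsto v (cocompact ℂ) (𝓝 0))
    (s : Set ℂ) : Tendsto (fun n => ∫ z in s, lapC (χ n) z * v z) atTop (𝓝 0) := by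
  have hC : 0 ≤ C := (integral_nonneg fun _ => abs_nonneg _).trans (h.lap_int 0)
  rw [Metric.tendsto_atTop]
  intro ε hε
  have hδ : 0 < ε / (C + 1) := by positivity
  have h1 := (tendsto_zero_iff_norm_tendsto_zero.1 hl).eventually (ge_mem_nhds hδ)
  rw [← Metric.cobounded_eq_cocompact, ← comap_norm_atTop, eventually_comap] at h1
  obtain ⟨R, hR⟩ := eventually_atTop.1 h1
  refine ⟨⌈R⌉₊, fun n hn => ?_⟩
  have hn : R ≤ n := (Nat.le_ceil R).trans (by exact_mod_cast hn)
  have hi : Integrable fun z => |lapC (χ n) z| :=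
    (h.continuous_lap n).abs.integrable_of_hasCompactSupport
      (((h.compact n).dx.dx.add (h.compact n).dy.dy).norm)
  rw [dist_zero_right]
  calc _ ≤ ∫ z in s, ε / (C + 1) * |lapC (χ n) z| :=
        norm_integral_le_of_norm_le (hi.integrableOn.const_mul _) (Eventually.of_forall fun z => by
          rw [norm_mul, mul_comm, Real.norm_eq_abs (lapC (χ n) z)]
          rcases le_or_gt ‖z‖ (n + 1) with hz | hz
          · rw [h.lap_zero n z hz]; simp
          · exact mul_le_mul_of_nonneg_right (hR ‖z‖ (by linarith) z rfl) (abs_nonneg _))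
    _ ≤ ε / (C + 1) * C := by
        rw [integral_const_mul]
        refine mul_le_mul_of_nonneg_left ?_ hδ.le
        exact (setIntegral_le_integral hi (Eventually.of_forall fun _ => abs_nonneg _)).trans (h.lap_int n)
    _ < ε := by
        rw [div_mul_eq_mul_div, div_lt_iff₀ (by positivity)]
        nlinarith

theorem tendsto_integral (h : CutoffSeq χ C) {g : ℂ → ℝ} {s : Set ℂ} (hg : IntegrableOn g s) :
    Tendsto (fun n => ∫ z in s, χ n z * g z) atTop (𝓝 (∫ z in s, g z)) := by
  refine tendsto_integral_of_dominated_convergence (fun z => ‖g z‖)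
    (fun n => (h.smooth n).continuous.aestronglyMeasurable.mul hg.aestronglyMeasurable) hg.norm
    (fun n => Eventually.of_forall fun z => ?_) (Eventually.of_forall fun z => ?_)
  · rw [norm_mul, Real.norm_of_nonneg (h.nonneg n z)]
    exact mul_le_of_le_one_left (norm_nonneg _) (h.le_one n z)
  · refine tendsto_const_nhds.congr' ?_
    filter_upwards [eventually_ge_atTop ⌈‖z‖⌉₊] with n hn
    have hn : ‖z‖ ≤ n := (Nat.le_ceil _).trans (by exact_mod_cast hn)
    rw [h.eq_one n z (by linarith), one_mul]

end CutoffSeq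

theorem NodalField.boundary_zero {w V : ℂ → ℝ} {M : ℝ} (h : NodalField w V M)
    (hi : IntegrableOn (lapC w) {z : ℂ | 0 < z.im}) (h0 : ∫ z in {z : ℂ | 0 < z.im}, lapC w z = 0)
    (hpos : ∀ x : ℝ, 0 ≤ dy w x) (x : ℝ) : dy w x = 0 := by
  obtain ⟨χ, C, hχ⟩ := exists_cutoffSeq
  have cw : Continuous fun x : ℝ => dy w x :=
    (h.smooth.dy (m := ∞) (by norm_cast)).continuous.comp Complex.continuous_ofReal
  have emb : IsClosedEmbedding fun x : ℝ => (x : ℂ) := Complex.isometry_ofReal.isClosedEmbedding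
  have cs : ∀ n, HasCompactSupport fun x : ℝ => χ n x * dy w x := fun n =>
    ((hχ.compact n).comp_isClosedEmbedding emb).mul_right
  have cc : ∀ n, Continuous fun x : ℝ => χ n x * dy w x := fun n =>
    ((hχ.smooth n).continuous.comp Complex.continuous_ofReal).mul cw
  have lim : Tendsto (fun n => ∫ x : ℝ, χ n x * dy w x) atTop (𝓝 0) := by
    have h1 := (hχ.tendsto_lap h.lim {z : ℂ | 0 < z.im}).sub (hχ.tendsto_integral hi)
    rw [h0, sub_zero] at h1
    refine h1.congr fun n => ?_
    rw [half_green (hχ.smooth n) (hχ.compact n) h.smooth h.axis]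
    ring
  by_contra hne
  obtain ⟨N, hN⟩ := exists_nat_ge ‖(x : ℂ)‖
  have p : 0 < ∫ x : ℝ, χ N x * dy w x :=
    (cc N).integral_pos_of_hasCompactSupport_nonneg_nonzero (cs N)
      (fun x => mul_nonneg (hχ.nonneg N x) (hpos x)) (x := x) (by
        rw [hχ.eq_one N x (by linarith), one_mul]; exact hne)
  obtain ⟨R, hR⟩ := (hχ.compact N).isCompact.isBounded.exists_norm_le
  refine p.not_ge (ge_of_tendsto lim ?_)
  filter_upwards [eventually_ge_atTop ⌈R⌉₊] with n hn
  have hn : R ≤ n := (Nat.le_ceil _).trans (by exact_mod_cast hn)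
  refine integral_mono ((cc N).integrable_of_hasCompactSupport (cs N))
    ((cc n).integrable_of_hasCompactSupport (cs n)) fun y => mul_le_mul_of_nonneg_right ?_ (hpos y)
  by_cases hy : (y : ℂ) ∈ tsupport (χ N)
  · rw [hχ.eq_one n y (by linarith [hR _ hy])]
    exact hχ.le_one N y
  · rw [image_eq_zero_of_notMem_tsupport hy]
    exact hχ.nonneg n y

end Cutoffs

section Symmetric

open Filter Topology ComplexConjugate

theorem dx_eq_zero_of_axis {w : ℂ → ℝ} (hw : Differentiable ℝ w) (h0 : ∀ z : ℂ, z.im = 0 → w z = 0)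
    (x : ℝ) : dx w x = 0 := by
  have h1 : HasDerivAt (fun t : ℝ => w t) (dx w x) x :=
    (hw _).hasFDerivAt.comp_hasDerivAt x Complex.ofRealCLM.hasDerivAt
  have h2 : (fun t : ℝ => w t) = fun _ => 0 := by
    ext t
    exact h0 t (Complex.ofReal_im t)
  rw [h2] at h1
  exact h1.unique (hasDerivAt_const x 0)

theorem axis_asymptotics {w : ℂ → ℝ} (hw : ContDiff ℝ ∞ w) (h0 : ∀ z : ℂ, z.im = 0 → w z = 0)
    (h1 : dy w 0 = 0) (h2 : dx (dy w) 0 = 0) {k : ℕ} {γ : ℂ} (hγ : γ ≠ 0)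
    (hlim : Tendsto (fun z => cgrad w z / z ^ k) (𝓝[≠] 0) (𝓝 γ)) :
    2 ≤ k ∧ ∃ c : ℝ, c ≠ 0 ∧ Tendsto (fun x : ℝ => dy w x / x ^ k) (𝓝[≠] 0) (𝓝 ((k + 1) * c)) ∧
      (fun z => w z - c * (z ^ (k + 1)).im) =o[𝓝 0] fun z => ‖z‖ ^ (k + 1) := by
  have dw : Differentiable ℝ w := hw.differentiable (by simp)
  have hk : ((k : ℝ) + 1) ≠ 0 := by positivity
  have hT : Tendsto (fun x : ℝ => (x : ℂ)) (𝓝[≠] 0) (𝓝[≠] 0) :=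
    tendsto_nhdsWithin_iff.2 ⟨(Complex.continuous_ofReal.tendsto' 0 0 Complex.ofReal_zero).mono_left
      nhdsWithin_le_nhds, eventually_mem_nhdsWithin.mono fun x hx => by simpa using hx⟩
  have hr : Tendsto (fun x : ℝ => ((-(dy w x / x ^ k) : ℝ) : ℂ) * Complex.I) (𝓝[≠] 0) (𝓝 γ) :=
    (hlim.comp hT).congr fun x => by
      simp only [Function.comp, cgrad, dx_eq_zero_of_axis dw h0 x]
      push_cast
      ring
  have hre : γ.re = 0 := by
    refine tendsto_nhds_unique ((Complex.continuous_re.tendsto γ).comp hr)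
      (tendsto_const_nhds.congr fun x => ?_)
    rw [Function.comp_apply, Complex.re_ofReal_mul, Complex.I_re, mul_zero]
  have him : Tendsto (fun x : ℝ => dy w x / x ^ k) (𝓝[≠] 0) (𝓝 (-γ.im)) := by
    have := ((Complex.continuous_im.tendsto γ).comp hr).neg
    simpa only [Function.comp, Complex.im_ofReal_mul, Complex.I_im, mul_one, neg_neg] using this
  have hne : -γ.im ≠ 0 := fun h => hγ (Complex.ext hre (by simpa using h))
  have cdy : Continuous (dy w) := (hw.dy (m := ∞) (by norm_cast)).continuous
  refine ⟨?_, -γ.im / (k + 1), div_ne_zero hne hk, by rwa [mul_div_cancel₀ _ hk], ?_⟩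
  · by_contra! hlt
    refine hne (tendsto_nhds_unique him ?_)
    obtain rfl | rfl : k = 0 ∨ k = 1 := by omega
    · simp only [pow_zero, div_one]
      have := (cdy.comp Complex.continuous_ofReal).tendsto' 0 0 (by simpa using h1)
      exact this.mono_left nhdsWithin_le_nhds
    · have h3 : HasDerivAt (fun t : ℝ => dy w t) (dx (dy w) (0 : ℝ)) 0 :=
        (((hw.dy (m := ∞) (by norm_cast)).differentiable (by simp) _).hasFDerivAt.comp_hasDerivAt
          (0 : ℝ) Complex.ofRealCLM.hasDerivAt)
      rw [Complex.ofReal_zero, h2, hasDerivAt_iff_tendsto_slope] at h3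
      refine h3.congr fun x => ?_
      rw [slope_def_field, Complex.ofReal_zero, h1, sub_zero, sub_zero, pow_one]
  · have hγe : γ = -((-γ.im : ℝ) * Complex.I) := Complex.ext (by simp [hre]) (by simp)
    have dI : ∀ z, HasFDerivAt (fun z : ℂ => -γ.im / (k + 1) * (z ^ (k + 1)).im)
        (Complex.reCLM ∘L ((γ * z ^ k) • (1 : ℂ →L[ℝ] ℂ))) z := fun z => by
      have e := ((hasDerivAt_pow (k + 1) z).hasFDerivAt.restrictScalars ℝ)
      have := (Complex.imCLM.hasFDerivAt.comp z e).const_mul (-γ.im / (k + 1))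
      refine this.congr_fderiv ?_
      ext h
      have e1 : (γ * z ^ k * h).re = -γ.im * (z ^ k * h).im := by
        conv_lhs => rw [hγe]
        simp only [Complex.neg_re, neg_mul, Complex.mul_re, Complex.mul_im, Complex.I_re, Complex.I_im,
          Complex.ofReal_re, Complex.ofReal_im]
        ring
      have e2 : (h * (((k + 1 : ℕ) : ℂ) * z ^ k)).im = (k + 1) * (z ^ k * h).im := by
        rw [show h * (((k + 1 : ℕ) : ℂ) * z ^ k) = (((k : ℝ) + 1 : ℝ) : ℂ) * (z ^ k * h) by push_cast; ring,
          Complex.im_ofReal_mul]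
      simp [e1] at *
      rw [e2]
      field_simp
    refine isLittleO_of_fderiv (fun z => (dw z).sub (dI z).differentiableAt) (by simp [h0 0]) ?_
    have h4 := isLittleO_of_tendsto_div (f := fun z => cgrad w z - γ * z ^ k) (k := k)
      ((contDiff_cgrad hw).continuous.sub (by fun_prop)) (by
        have := hlim.sub_const γ
        rw [sub_self] at this
        refine this.congr' ?_
        filter_upwards [eventually_mem_nhdsWithin] with z hz
        rw [sub_div, mul_div_cancel_right₀ _ (pow_ne_zero _ hz)])
    refine (Asymptotics.IsBigO.of_bound 1 (Eventually.of_forall fun z => ?_)).trans_isLittleO h4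
    rw [one_mul]
    refine ContinuousLinearMap.opNorm_le_bound _ (norm_nonneg _) fun h => ?_
    rw [((dw z).hasFDerivAt.sub (dI z)).fderiv, sub_apply, fderiv_eq_cgrad, ← norm_mul, sub_mul]
    exact Complex.abs_re_le_norm (cgrad w z * h - γ * z ^ k * h)

theorem PlaneField.oddPart_eq_zero {U : ℂ → ℝ} {κ B : ℝ} (h : PlaneField U κ B)
    (hB : ∫ p, exp (2 * U p) ≤ 12 * π) (h1 : dy (oddPart U) 0 = 0) (h2 : dx (dy (oddPart U)) 0 = 0)
    (h3 : ∫ z in {z : ℂ | 0 < z.im}, exp (2 * U (conj z)) = ∫ z in {z : ℂ | 0 < z.im}, exp (2 * U z))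
    (z : ℂ) : oddPart U z = 0 := by
  have key : ∀ w V M, NodalField w V M → (∀ z, nodal w z = nodal (oddPart U) z) →
      (∀ z, w z ≠ 0 → oddPart U z ≠ 0) → IntegrableOn (lapC w) {z : ℂ | 0 < z.im} →
      ∫ z in {z : ℂ | 0 < z.im}, lapC w z = 0 → dy w 0 = 0 → ∀ (k : ℕ) (c : ℝ), 2 ≤ k → 0 < c →
      Tendsto (fun x : ℝ => dy w x / x ^ k) (𝓝[≠] 0) (𝓝 ((k + 1) * c)) →
      ¬ (fun z => w z - c * (z ^ (k + 1)).im) =o[𝓝 0] fun z => ‖z‖ ^ (k + 1) := by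
    intro w V M N hn hw hi hz hd k c hk hc ht ho
    by_cases hpos : ∀ x : ℝ, 0 ≤ dy w x
    · have : (0 : ℝ) = (k + 1) * c := tendsto_nhds_unique
        (tendsto_const_nhds.congr fun x => by rw [N.boundary_zero hi hz hpos x, zero_div]) ht
      exact this.not_lt (by positivity)
    · push Not at hpos
      obtain ⟨x, hx⟩ := hpos
      refine N.crossing (fun z x h1 h2 h3 h4 => ?_) hk hc ho (Complex.ofReal_im x)
        (fun h0 => by rw [h0, hd] at hx; exact lt_irrefl _ hx) hx
      simp only [hn] at h2 h4
      exact h.not_three_nodal hB (fun i => ⟨(h1 i).1, hw _ (h1 i).2⟩) h2 h3 h4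
  have N := h.nodalField
  have hM0 : 0 ≤ 2 * B := (N.nonneg 0).trans (N.le 0)
  have hM : ∀ z, |lapC (oddPart U) z| ≤ 2 * B * |oddPart U z| := fun z => by
    rw [N.pde, abs_neg, abs_mul, abs_of_nonneg (N.nonneg z)]
    exact mul_le_mul_of_nonneg_right (N.le z) (abs_nonneg _)
  have hl : lapC (oddPart U) = fun z => exp (2 * U (conj z)) - exp (2 * U z) := funext h.pde
  have hi : IntegrableOn (lapC (oddPart U)) {z : ℂ | 0 < z.im} := by
    rw [hl]
    exact (h.integrable_conj.sub h.int).integrableOn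
  have hz : ∫ z in {z : ℂ | 0 < z.im}, lapC (oddPart U) z = 0 := by
    rw [hl, integral_sub h.integrable_conj.integrableOn h.int.integrableOn, h3, sub_self]
  rcases order_dichotomy N.smooth (N.axis 0 (by simp)) hM0 hM with h0 | ⟨k, γ, hγ, hlim⟩
  · exact unique_continuation N.smooth hM0 hM h0 z
  · obtain ⟨hk, c, hc, ht, ho⟩ := axis_asymptotics N.smooth N.axis h1 h2 hγ hlim
    rcases hc.lt_or_gt with hc | hc
    · have el : lapC (fun z => -oddPart U z) = fun z => -lapC (oddPart U) z := by
        ext z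
        simpa only [neg_mul, one_mul] using lapC_const_mul (f := oddPart U) (-1) z
      have ed : ∀ z, dy (fun z => -oddPart U z) z = -dy (oddPart U) z := fun z => by
        simp only [dy, fderiv_fun_neg, neg_apply]
      refine (key _ _ _ N.neg (fun z => NodalField.nodal_neg) (fun z => neg_ne_zero.1) (by rw [el]; exact hi.neg)
        (by rw [el, integral_neg, hz, neg_zero]) (by rw [ed, h1, neg_zero]) k (-c) hk (neg_pos.2 hc)
        (by simpa only [ed, neg_div, mul_neg] using ht.neg) ?_).elim
      refine ho.neg_left.congr_left fun z => ?_
      ring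
    · exact (key _ _ _ N (fun _ => rfl) (fun _ => id) hi hz h1 k c hk hc ht ho).elim

end Symmetric

section Stereographic

open Filter Topology ComplexConjugate

variable {u : E3 → ℝ} {α : ℝ} {x : E3}

theorem MFE.contDiffAt (hu : MFE u α) (hx : x ≠ 0) : ContDiffAt ℝ ∞ u x :=
  hu.1.contDiffAt (isOpen_compl_singleton.mem_nhds hx)

theorem MFE.contDiffAt_fderiv (hu : MFE u α) (hx : x ≠ 0) : ContDiffAt ℝ ∞ (fderiv ℝ u) x :=
  (hu.contDiffAt hx).fderiv_right (by norm_cast)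

theorem Hom0.fderiv_eq (hu : Hom0 u) {r : ℝ} (hr : 0 < r) :
    fderiv ℝ u = fun x => r • fderiv ℝ u (r • x) := by
  ext1 x
  rw [← fderiv_comp_smul]
  congr 1
  ext1 x
  exact (hu x r hr).symm

theorem Hom0.fderiv_fderiv (hu : Hom0 u) {r : ℝ} (hr : 0 < r) (x v w : E3) :
    fderiv ℝ (fderiv ℝ u) x v w = r ^ 2 * fderiv ℝ (fderiv ℝ u) (r • x) v w := by
  conv_lhs => rw [hu.fderiv_eq hr]
  have : (fun x => r • fderiv ℝ u (r • x)) = r • fun x => fderiv ℝ u (r • x) := rfl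
  rw [this, fderiv_const_smul_field (f := fun x => fderiv ℝ u (r • x)) r, Pi.smul_apply, fderiv_comp_smul]
  simp only [smul_apply, smul_eq_mul]
  ring

theorem lap_eq_sum (b : OrthonormalBasis (Fin 3) ℝ E3) (u : E3 → ℝ) (x : E3) :
    lap u x = fderiv ℝ (fderiv ℝ u) x (b 0) (b 0) + fderiv ℝ (fderiv ℝ u) x (b 1) (b 1)
      + fderiv ℝ (fderiv ℝ u) x (b 2) (b 2) := by
  have h1 := congr_fun (InnerProductSpace.laplacian_eq_iteratedFDeriv_orthonormalBasis u b) x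
  have h2 := congr_fun (InnerProductSpace.laplacian_eq_iteratedFDeriv_orthonormalBasis u
    (EuclideanSpace.basisFun (Fin 3) ℝ)) x
  rw [h1] at h2
  simp only [EuclideanSpace.basisFun_apply] at h2
  rw [lap, ← h2, Fin.sum_univ_three]
  simp only [iteratedFDeriv_two_apply, Matrix.cons_val_zero, Matrix.cons_val_one]

theorem Hom0.lap_smul (hu : Hom0 u) {r : ℝ} (hr : 0 < r) (x : E3) :
    lap u x = r ^ 2 * lap u (r • x) := by
  simp only [lap_eq_sum (EuclideanSpace.basisFun (Fin 3) ℝ), hu.fderiv_fderiv hr x]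
  ring

theorem MFE.fderiv_self (hu : MFE u α) (hx : x ≠ 0) : fderiv ℝ u x x = 0 := by
  have h1 : HasDerivAt (fun t : ℝ => u (t • x)) (fderiv ℝ u ((1 : ℝ) • x) ((1 : ℝ) • x)) 1 :=
    ((hu.contDiffAt (by simpa using hx)).differentiableAt (by simp)).hasFDerivAt.comp_hasDerivAt (1 : ℝ)
      ((hasDerivAt_id (1 : ℝ)).smul_const x)
  rw [one_smul] at h1
  have h2 : (fun t : ℝ => u (t • x)) =ᶠ[𝓝 1] fun _ => u x := by
    filter_upwards [lt_mem_nhds (zero_lt_one' ℝ)] with t ht using hu.2.1 x t ht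
  exact h1.unique ((hasDerivAt_const _ _).congr_of_eventuallyEq h2)

theorem MFE.fderiv_fderiv_self (hu : MFE u α) (hx : x ≠ 0) (v : E3) :
    fderiv ℝ (fderiv ℝ u) x v x = -fderiv ℝ u x v := by
  have h1 := ((hu.contDiffAt_fderiv hx).differentiableAt (by simp)).hasFDerivAt.clm_apply (hasFDerivAt_id x)
  have h2 : (fun x => fderiv ℝ u x x) =ᶠ[𝓝 x] fun _ => 0 := by
    filter_upwards [isOpen_ne.mem_nhds hx] with z hz using hu.fderiv_self hz
  have h3 := h1.unique ((hasFDerivAt_const _ _).congr_of_eventuallyEq h2)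
  have h4 := DFunLike.congr_fun h3 v
  simp at h4
  linarith

theorem MFE.fderiv_fderiv_comm (hu : MFE u α) (hx : x ≠ 0) (v w : E3) :
    fderiv ℝ (fderiv ℝ u) x v w = fderiv ℝ (fderiv ℝ u) x w v :=
  (hu.contDiffAt hx).isSymmSndFDerivAt (by simp; norm_cast) v w

/-- The inverse stereographic projection in the orthonormal frame `b`, with values on the
ray through the corresponding point of the sphere. -/
noncomputable def ray (b : OrthonormalBasis (Fin 3) ℝ E3) (ζ : ℂ) : E3 :=
  (2 * ζ.re) • b 0 + (2 * ζ.im) • b 1 + (1 - (ζ.re ^ 2 + ζ.im ^ 2)) • b 2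

variable (b : OrthonormalBasis (Fin 3) ℝ E3)

theorem inner_ray (ζ ζ' : ℂ) : ⟪ray b ζ, ray b ζ'⟫ = 4 * ζ.re * ζ'.re + 4 * ζ.im * ζ'.im
    + (1 - (ζ.re ^ 2 + ζ.im ^ 2)) * (1 - (ζ'.re ^ 2 + ζ'.im ^ 2)) := by
  simp only [ray, inner_add_left, inner_add_right, real_inner_smul_left, real_inner_smul_right,
    b.inner_eq_ite]
  simp
  ring

theorem norm_ray (ζ : ℂ) : ‖ray b ζ‖ = 1 + (ζ.re ^ 2 + ζ.im ^ 2) := by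
  rw [norm_eq_sqrt_real_inner, inner_ray, Real.sqrt_eq_iff_mul_self_eq_of_pos (by positivity)]
  ring

theorem ray_ne_zero (ζ : ℂ) : ray b ζ ≠ 0 := by
  rw [← norm_ne_zero_iff, norm_ray]
  positivity

theorem contDiff_ray : ContDiff ℝ ∞ (ray b) := by
  have h1 : ContDiff ℝ ∞ Complex.re := Complex.reCLM.contDiff
  have h2 : ContDiff ℝ ∞ Complex.im := Complex.imCLM.contDiff
  exact (((contDiff_const.mul h1).smul contDiff_const).add ((contDiff_const.mul h2).smul
    contDiff_const)).add ((contDiff_const.sub ((h1.pow 2).add (h2.pow 2))).smul contDiff_const)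

theorem fderiv_ray (ζ h : ℂ) : fderiv ℝ (ray b) ζ h = (2 * h.re) • b 0 + (2 * h.im) • b 1
    - (2 * (ζ.re * h.re + ζ.im * h.im)) • b 2 := by
  have h1 : HasFDerivAt Complex.re Complex.reCLM ζ := Complex.reCLM.hasFDerivAt
  have h2 : HasFDerivAt Complex.im Complex.imCLM ζ := Complex.imCLM.hasFDerivAt
  have := (((h1.const_mul 2).smul_const (b 0)).add ((h2.const_mul 2).smul_const (b 1))).add
    ((((h1.pow 2).add (h2.pow 2)).const_sub 1).smul_const (b 2))
  have e : ray b = fun ζ => (2 * ζ.re) • b 0 + (2 * ζ.im) • b 1 + (1 - (ζ.re ^ 2 + ζ.im ^ 2)) • b 2 := rfl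
  rw [e]
  erw [this.fderiv]
  simp
  module

theorem fderiv_fderiv_ray (ζ h k : ℂ) : fderiv ℝ (fun ζ => fderiv ℝ (ray b) ζ h) ζ k
    = -(2 * (k.re * h.re + k.im * h.im)) • b 2 := by
  have h1 : HasFDerivAt Complex.re Complex.reCLM ζ := Complex.reCLM.hasFDerivAt
  have h2 : HasFDerivAt Complex.im Complex.imCLM ζ := Complex.imCLM.hasFDerivAt
  simp only [fderiv_ray]
  have := ((((h1.mul_const h.re).add (h2.mul_const h.im)).const_mul 2).smul_const (b 2)).const_sub
    ((2 * h.re) • b 0 + (2 * h.im) • b 1)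
  erw [this.fderiv]
  simp
  module

variable {b}

theorem MFE.fderiv_comp_ray (hu : MFE u α) (ζ h : ℂ) :
    fderiv ℝ (fun ζ => u (ray b ζ)) ζ h = fderiv ℝ u (ray b ζ) (fderiv ℝ (ray b) ζ h) := by
  rw [fderiv_fun_comp ζ ((hu.contDiffAt (ray_ne_zero b ζ)).differentiableAt (by simp))
    ((contDiff_ray b).differentiable (by simp) ζ)]
  rfl

theorem MFE.fderiv_fderiv_comp_ray (hu : MFE u α) (ζ h k : ℂ) :
    fderiv ℝ (fun ζ => fderiv ℝ (fun ζ => u (ray b ζ)) ζ h) ζ k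
      = fderiv ℝ (fderiv ℝ u) (ray b ζ) (fderiv ℝ (ray b) ζ k) (fderiv ℝ (ray b) ζ h)
        - 2 * (k.re * h.re + k.im * h.im) * fderiv ℝ u (ray b ζ) (b 2) := by
  simp only [hu.fderiv_comp_ray]
  have d1 : DifferentiableAt ℝ (fun ζ => fderiv ℝ u (ray b ζ)) ζ :=
    ((hu.contDiffAt_fderiv (ray_ne_zero b ζ)).differentiableAt (by simp)).comp ζ
      ((contDiff_ray b).differentiable (by simp) ζ)
  have d2 : DifferentiableAt ℝ (fun ζ => fderiv ℝ (ray b) ζ h) ζ :=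
    (((contDiff_ray b).fderiv_right (m := ∞) (by norm_cast)).clm_apply contDiff_const).differentiable
      (by simp) ζ
  rw [fderiv_clm_apply d1 d2]
  simp only [add_apply, ContinuousLinearMap.comp_apply, ContinuousLinearMap.flip_apply, fderiv_fderiv_ray,
    map_smul, smul_eq_mul]
  rw [fderiv_fun_comp ζ ((hu.contDiffAt_fderiv (ray_ne_zero b ζ)).differentiableAt (by simp))
    ((contDiff_ray b).differentiable (by simp) ζ)]
  simp only [ContinuousLinearMap.comp_apply]
  ring

theorem MFE.lapC_comp_ray (hu : MFE u α) (ζ : ℂ) :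
    lapC (fun ζ => u (ray b ζ)) ζ = 4 * lap u (ray b ζ) := by
  have h1 := hu.fderiv_fderiv_comp_ray (b := b) ζ 1 1
  have h2 := hu.fderiv_fderiv_comp_ray (b := b) ζ Complex.I Complex.I
  have h3 := hu.fderiv_fderiv_self (ray_ne_zero b ζ) (b 2)
  have s1 := hu.fderiv_fderiv_comm (ray_ne_zero b ζ) (b 0) (b 2)
  have s2 := hu.fderiv_fderiv_comm (ray_ne_zero b ζ) (b 1) (b 2)
  rw [show fderiv ℝ (fderiv ℝ u) (ray b ζ) (b 2) (ray b ζ) = fderiv ℝ (fderiv ℝ u) (ray b ζ) (b 2)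
    ((2 * ζ.re) • b 0 + (2 * ζ.im) • b 1 + (1 - (ζ.re ^ 2 + ζ.im ^ 2)) • b 2) from rfl] at h3
  rw [lapC, lap_eq_sum b]
  change fderiv ℝ (fun ζ => fderiv ℝ (fun ζ => u (ray b ζ)) ζ 1) ζ 1
    + fderiv ℝ (fun ζ => fderiv ℝ (fun ζ => u (ray b ζ)) ζ Complex.I) ζ Complex.I = _
  rw [h1, h2]
  simp only [fderiv_ray, map_add, map_sub, map_smul, add_apply, sub_apply, smul_apply, smul_eq_mul,
    Complex.one_re, Complex.one_im, Complex.I_re, Complex.I_im, s1, s2] at h3 ⊢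
  linear_combination (-4) * h3

theorem MFE.lapC_comp_ray_eq (hu : MFE u α) (ζ : ℂ) : lapC (fun ζ => u (ray b ζ)) ζ
    = 4 / (‖ζ‖ ^ 2 + 1) ^ 2 * (α - exp (2 * u (ray b ζ))) := by
  have hn : ‖ray b ζ‖ = ‖ζ‖ ^ 2 + 1 := by rw [norm_ray, Complex.sq_norm, Complex.normSq_apply]; ring
  have hp : 0 < ‖ray b ζ‖⁻¹ := by rw [hn]; positivity
  have hs : ‖ray b ζ‖⁻¹ • ray b ζ ∈ S2 := by
    rw [S2, mem_sphere_zero_iff_norm, norm_smul, norm_inv, norm_norm,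
      inv_mul_cancel₀ (norm_ne_zero_iff.2 (ray_ne_zero b ζ))]
  have := hu.2.2 _ hs
  rw [hu.2.1 _ _ hp] at this
  rw [hu.lapC_comp_ray, hu.2.1.lap_smul hp, hn, ← this, inv_pow]
  rw [hn]
  field_simp
  ring

end Stereographic

section ConformalFactor

open Filter Topology ComplexConjugate

variable {u : E3 → ℝ} {α : ℝ} (b : OrthonormalBasis (Fin 3) ℝ E3)

theorem sq_norm_eq (ζ : ℂ) : ‖ζ‖ ^ 2 = ζ.re ^ 2 + ζ.im ^ 2 := by
  rw [Complex.sq_norm, Complex.normSq_apply]; ring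

/-- The inverse stereographic projection in the orthonormal frame `b`. -/
noncomputable def sph (ζ : ℂ) : E3 := (‖ζ‖ ^ 2 + 1)⁻¹ • ray b ζ

theorem norm_sph (ζ : ℂ) : ‖sph b ζ‖ = 1 := by
  rw [sph, norm_smul, norm_ray, ← sq_norm_eq, norm_inv, Real.norm_of_nonneg (by positivity)]
  field_simp
  ring

theorem inner_ray_one (ζ : ℂ) : ⟪ray b ζ, b 1⟫ = 2 * ζ.im := by
  simp [ray, inner_add_left, real_inner_smul_left, b.inner_eq_ite]

theorem inner_ray_two (ζ : ℂ) : ⟪ray b ζ, b 2⟫ = 1 - ‖ζ‖ ^ 2 := by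
  simp [ray, inner_add_left, real_inner_smul_left, b.inner_eq_ite, sq_norm_eq]

theorem sq_norm_sph_add (ζ : ℂ) : ‖sph b ζ + b 2‖ ^ 2 = 4 / (‖ζ‖ ^ 2 + 1) := by
  rw [norm_add_sq_real, norm_sph, b.norm_eq_one, sph, real_inner_smul_left, inner_ray_two]
  field_simp
  ring

theorem tendsto_sph : Tendsto (sph b) (cocompact ℂ) (𝓝 (-b 2)) := by
  rw [tendsto_iff_norm_sub_tendsto_zero]
  have h1 : Tendsto (fun ζ : ℂ => ‖ζ‖ ^ 2 + 1) (cocompact ℂ) atTop :=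
    tendsto_atTop_add_const_right _ _ ((tendsto_pow_atTop two_ne_zero).comp tendsto_norm_cocompact_atTop)
  have h2 := (h1.inv_tendsto_atTop.const_mul 4).sqrt
  rw [mul_zero, Real.sqrt_zero] at h2
  refine h2.congr fun ζ => ?_
  rw [sub_neg_eq_add, ← Real.sqrt_sq (norm_nonneg (sph b ζ + b 2)), sq_norm_sph_add, div_eq_mul_inv]
  rfl

variable {b}

theorem Hom0.sph_eq (hu : Hom0 u) (ζ : ℂ) : u (sph b ζ) = u (ray b ζ) := hu _ _ (by positivity)

theorem MFE.tendsto_ray (hu : MFE u α) : Tendsto (fun ζ => u (ray b ζ)) (cocompact ℂ) (𝓝 (u (-b 2))) := by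
  have h0 : -b 2 ≠ 0 := neg_ne_zero.2 (norm_ne_zero_iff.1 (by simp))
  exact ((hu.contDiffAt h0).continuousAt.tendsto.comp (tendsto_sph b)).congr fun ζ => hu.2.1.sph_eq ζ

theorem MFE.contDiff_ray (hu : MFE u α) : ContDiff ℝ ∞ fun ζ => u (ray b ζ) :=
  contDiff_iff_contDiffAt.2 fun ζ =>
    (hu.contDiffAt (ray_ne_zero b ζ)).comp ζ (_root_.contDiff_ray b).contDiffAt

theorem MFE.exists_le (hu : MFE u α) : ∃ M, ∀ ζ, u (ray b ζ) ≤ M := by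
  obtain ⟨M, hM⟩ := (isCompact_sphere (0 : E3) 1).exists_bound_of_continuousOn
    (hu.1.continuousOn.mono fun x hx => ne_zero_of_mem_unit_sphere (⟨x, hx⟩ : Metric.sphere (0 : E3) 1))
  refine ⟨M, fun ζ => ?_⟩
  rw [← hu.2.1.sph_eq]
  exact (le_abs_self _).trans (hM _ (mem_sphere_zero_iff_norm.2 (norm_sph b ζ)))

theorem contDiff_log_norm : ContDiff ℝ ∞ fun ζ : ℂ => log (‖ζ‖ ^ 2 + 1) :=
  ((contDiff_norm_sq ℝ).add contDiff_const).log fun ζ => by positivity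

theorem lapC_log_norm (ζ : ℂ) : lapC (fun ζ => log (‖ζ‖ ^ 2 + 1)) ζ = 4 / (‖ζ‖ ^ 2 + 1) ^ 2 := by
  have hN : ∀ ζ : ℂ, ζ.re ^ 2 + ζ.im ^ 2 + 1 ≠ 0 := fun ζ => by positivity
  have h1 : ∀ ζ : ℂ, HasFDerivAt Complex.re Complex.reCLM ζ := fun ζ => Complex.reCLM.hasFDerivAt
  have h2 : ∀ ζ : ℂ, HasFDerivAt Complex.im Complex.imCLM ζ := fun ζ => Complex.imCLM.hasFDerivAt
  have hd : ∀ ζ : ℂ, HasFDerivAt (fun ζ : ℂ => ζ.re ^ 2 + ζ.im ^ 2 + 1)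
      ((2 * ζ.re) • Complex.reCLM + (2 * ζ.im) • Complex.imCLM) ζ := fun ζ =>
    ((((h1 ζ).pow 2).add ((h2 ζ).pow 2)).add_const 1).congr_fderiv (by ext h; simp)
  have hf : ∀ ζ h : ℂ, fderiv ℝ (fun ζ : ℂ => log (ζ.re ^ 2 + ζ.im ^ 2 + 1)) ζ h
      = 2 * (ζ.re * h.re + ζ.im * h.im) * (ζ.re ^ 2 + ζ.im ^ 2 + 1)⁻¹ := fun ζ h => by
    rw [((hd ζ).log (hN ζ)).fderiv]
    simp
    ring
  have hs : ∀ h : ℂ, fderiv ℝ (fun ζ => fderiv ℝ (fun ζ : ℂ => log (ζ.re ^ 2 + ζ.im ^ 2 + 1)) ζ h) ζ h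
      = 2 * (h.re ^ 2 + h.im ^ 2) / (ζ.re ^ 2 + ζ.im ^ 2 + 1)
        - 4 * (ζ.re * h.re + ζ.im * h.im) ^ 2 / (ζ.re ^ 2 + ζ.im ^ 2 + 1) ^ 2 := fun h => by
    simp only [hf]
    have hi := (hasDerivAt_inv (hN ζ)).comp_hasFDerivAt ζ (hd ζ)
    have hm := ((((h1 ζ).mul_const h.re).fun_add ((h2 ζ).mul_const h.im)).const_mul 2).fun_mul hi
    erw [hm.fderiv]
    simp
    field_simp
    ring
  simp only [sq_norm_eq]
  change fderiv ℝ (fun ζ => fderiv ℝ (fun ζ : ℂ => log (ζ.re ^ 2 + ζ.im ^ 2 + 1)) ζ 1) ζ 1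
    + fderiv ℝ (fun ζ => fderiv ℝ (fun ζ : ℂ => log (ζ.re ^ 2 + ζ.im ^ 2 + 1)) ζ Complex.I) ζ Complex.I = _
  rw [hs, hs]
  simp
  field_simp
  ring

variable (b) in
/-- The conformal factor of the metric with factor `exp (2 u)` in stereographic coordinates. -/
noncomputable def conf (u : E3 → ℝ) (ζ : ℂ) : ℝ := u (ray b ζ) + (log 2 - log (‖ζ‖ ^ 2 + 1))

theorem exp_conf (u : E3 → ℝ) (ζ : ℂ) :
    exp (2 * conf b u ζ) = 4 / (‖ζ‖ ^ 2 + 1) ^ 2 * exp (2 * u (ray b ζ)) := by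
  have h : (0 : ℝ) < ‖ζ‖ ^ 2 + 1 := by positivity
  rw [conf, mul_add, exp_add, mul_comm (exp _)]
  congr 1
  rw [← Real.log_div two_ne_zero h.ne', two_mul, exp_add, Real.exp_log (by positivity)]
  field_simp
  norm_num

theorem oddPart_conf (u : E3 → ℝ) : oddPart (conf b u) = fun ζ => u (ray b ζ) - u (ray b (conj ζ)) := by
  ext ζ
  simp only [oddPart, conf, RCLike.norm_conj]
  ring

theorem MFE.lapC_conf (hu : MFE u α) (ζ : ℂ) :
    lapC (conf b u) ζ = 4 * (α - 1) / (‖ζ‖ ^ 2 + 1) ^ 2 - exp (2 * conf b u ζ) := by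
  have h1 : conf b u = fun ζ => u (ray b ζ) + (log 2 + (-1) * log (‖ζ‖ ^ 2 + 1)) := by
    ext ζ; simp only [conf]; ring
  have s1 : ContDiff ℝ ∞ fun ζ : ℂ => (-1) * log (‖ζ‖ ^ 2 + 1) := contDiff_const.mul contDiff_log_norm
  rw [exp_conf, h1, lapC_add (hu.contDiff_ray.contDiffAt.of_le (by norm_cast))
    ((contDiff_const.add s1).contDiffAt.of_le (by norm_cast)),
    lapC_add contDiffAt_const (s1.contDiffAt.of_le (by norm_cast)), lapC_const, lapC_const_mul,
    hu.lapC_comp_ray_eq, lapC_log_norm]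
  field_simp
  ring

theorem MFE.contDiff_conf (hu : MFE u α) : ContDiff ℝ ∞ (conf b u) :=
  hu.contDiff_ray.add (contDiff_const.sub contDiff_log_norm)

theorem MFE.integrable_exp_conf (hu : MFE u α) : Integrable fun ζ => exp (2 * conf b u ζ) := by
  obtain ⟨M, hM⟩ := hu.exists_le (b := b)
  refine (integral_inv_sq.2.const_mul (4 * exp (2 * M))).mono'
    ((contDiff_const.mul hu.contDiff_conf).exp.continuous.aestronglyMeasurable)
    (Eventually.of_forall fun ζ => ?_)
  rw [Real.norm_of_nonneg (exp_pos _).le, exp_conf]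
  calc _ ≤ 4 / (‖ζ‖ ^ 2 + 1) ^ 2 * exp (2 * M) := by gcongr; exact hM ζ
    _ = _ := by ring

theorem MFE.planeField (hu : MFE u α) (hα : 1 < α) : ∃ κ B, PlaneField (conf b u) κ B := by
  obtain ⟨M, hM⟩ := hu.exists_le (b := b)
  have hd : ∀ ζ : ℂ, 4 / (‖ζ‖ ^ 2 + 1) ^ 2 ≤ 4 := fun ζ => by
    rw [div_le_iff₀ (by positivity)]
    nlinarith [sq_nonneg ‖ζ‖, sq_nonneg (‖ζ‖ ^ 2)]
  have hE : ∀ ζ, exp (2 * u (ray b ζ)) ≤ exp (2 * M) := fun ζ => exp_le_exp.2 (by linarith [hM ζ])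
  have hp := exp_pos (2 * M)
  have hl := fun ζ => hu.lapC_conf (b := b) ζ
  refine ⟨1 - (α - 1) / (exp (2 * M) + α), 4 * exp (2 * M), hu.contDiff_conf, ?_, ?_, fun ζ => ?_,
    fun ζ => ?_, hu.integrable_exp_conf, fun ζ => ?_, ?_⟩
  · rw [sub_pos, div_lt_one (by linarith)]
    linarith
  · have : 0 < (α - 1) / (exp (2 * M) + α) := div_pos (by linarith) (by linarith)
    linarith
  · rw [hl, exp_conf]
    have h1 : (α - 1) / (exp (2 * M) + α) * exp (2 * u (ray b ζ)) ≤ α - 1 := by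
      rw [div_mul_eq_mul_div, div_le_iff₀ (by linarith)]
      exact mul_le_mul_of_nonneg_left (by linarith [hE ζ]) (by linarith)
    have h2 := mul_le_mul_of_nonneg_left h1 (show 0 ≤ 4 / (‖ζ‖ ^ 2 + 1) ^ 2 by positivity)
    have h3 : 4 * (α - 1) / (‖ζ‖ ^ 2 + 1) ^ 2 = 4 / (‖ζ‖ ^ 2 + 1) ^ 2 * (α - 1) := by ring
    rw [h3]
    linarith
  · rw [exp_conf]
    exact mul_le_mul (hd ζ) (hE ζ) (exp_pos _).le (by norm_num)
  · have h1 : (fun z => conf b u z - conf b u (conj z)) = fun z => conf b u z + (-1) * conf b u (conj z) := by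
      ext z; ring
    have s1 : ContDiff ℝ ∞ fun z => conf b u (conj z) := hu.contDiff_conf.comp Complex.conjCLE.contDiff
    rw [h1, lapC_add (hu.contDiff_conf.contDiffAt.of_le (by norm_cast))
      ((contDiff_const.mul s1).contDiffAt.of_le (by norm_cast)), lapC_const_mul, lapC_comp_conj, hl, hl,
      RCLike.norm_conj]
    ring
  · have h1 := hu.tendsto_ray (b := b)
    have h2 := h1.sub (h1.comp Complex.conjCLE.toHomeomorph.isClosedEmbedding.tendsto_cocompact)
    rw [sub_self] at h2
    exact h2.congr fun ζ => (congr_fun (oddPart_conf u) ζ).symm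

theorem MFE.integral_exp_conf (hu : MFE u α) : ∫ ζ, exp (2 * conf b u ζ) = 4 * α * π := by
  have e : ∀ ζ, lapC (fun ζ => u (ray b ζ)) ζ = 4 * α * (1 / (‖ζ‖ ^ 2 + 1) ^ 2) - exp (2 * conf b u ζ) :=
    fun ζ => by rw [hu.lapC_comp_ray_eq, exp_conf]; ring
  have i1 := integral_inv_sq.2.const_mul (4 * α)
  have i2 := hu.integrable_exp_conf (b := b)
  have hi : Integrable (lapC fun ζ => u (ray b ζ)) := (i1.sub i2).congr (Eventually.of_forall fun ζ => (e ζ).symm)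
  suffices h : ∫ ζ, lapC (fun ζ => u (ray b ζ)) ζ = 0 by
    rw [integral_congr_ae (Eventually.of_forall e), integral_sub i1 i2, integral_const_mul,
      integral_inv_sq.1] at h
    linarith
  obtain ⟨χ, C, hχ⟩ := exists_cutoffSeq
  have hl : Tendsto (fun ζ => u (ray b ζ) + -u (-b 2)) (cocompact ℂ) (𝓝 0) := by
    simpa using (hu.tendsto_ray (b := b)).add_const (-u (-b 2))
  have h1 := hχ.tendsto_lap hl Set.univ
  have h2 := hχ.tendsto_integral (s := Set.univ) hi.integrableOn
  simp only [setIntegral_univ] at h1 h2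
  refine tendsto_nhds_unique (h2.congr fun n => ?_) h1
  rw [← integral_mul_lapC_comm ((hχ.smooth n).of_le (by norm_cast)) (hχ.compact n)
    ((hu.contDiff_ray.add contDiff_const).of_le (by norm_cast))]
  congr 1
  ext ζ
  rw [lapC_add (hu.contDiff_ray.contDiffAt.of_le (by norm_cast)) contDiffAt_const, lapC_const, add_zero]

end ConformalFactor

section ConformalHausdorff

open Filter Topology ENNReal NNReal Set

variable {X Y : Type*} [MetricSpace X] [MeasurableSpace X] [BorelSpace X]
  [MetricSpace Y] [MeasurableSpace Y] [BorelSpace Y] {f : X → Y} {ρ : X → ℝ≥0}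

theorem MeasureTheory.Measure.le_of_forall_subset_le {ι Z : Type*} [Countable ι] [MeasurableSpace Z]
    {μ ν : Measure Z} {A : ι → Set Z} (hA : ∀ i, MeasurableSet (A i)) (hd : Pairwise (Function.onFun Disjoint A))
    (hU : ⋃ i, A i = univ) (h : ∀ i, ∀ s ⊆ A i, MeasurableSet s → μ s ≤ ν s) : μ ≤ ν := by
  refine Measure.le_iff.2 fun s hs => ?_
  have h1 : ∀ m : Measure Z, m s = ∑' i, m (s ∩ A i) := fun m => by
    rw [← measure_iUnion (fun i j hij => (hd hij).mono inter_subset_right inter_subset_right)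
      fun i => hs.inter (hA i), ← inter_iUnion, hU, inter_univ]
  rw [h1 μ, h1 ν]
  exact ENNReal.tsum_le_tsum fun i => h i _ inter_subset_right (hs.inter (hA i))

theorem hausdorffMeasure_image_le_of_le (hdist : ∀ x y, dist (f x) (f y) ^ 2 = ρ x * ρ y * dist x y ^ 2)
    {s : Set X} {a : ℝ≥0} (h : ∀ x ∈ s, ρ x ≤ a) : μH[2] (f '' s) ≤ (a : ℝ≥0∞) ^ 2 * μH[2] s := by
  have h1 : LipschitzOnWith a f s := LipschitzOnWith.of_dist_le_mul fun x hx y hy => by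
    refine abs_le_of_sq_le_sq' ?_ (by positivity) |>.2
    rw [hdist, mul_pow, sq (a : ℝ)]
    have := h x hx
    have := h y hy
    gcongr
  simpa using h1.hausdorffMeasure_image_le (d := 2) (by norm_num)

theorem hausdorffMeasure_le_image_of_le (hdist : ∀ x y, dist (f x) (f y) ^ 2 = ρ x * ρ y * dist x y ^ 2)
    {s : Set X} {a : ℝ≥0} (ha : 0 < a) (h : ∀ x ∈ s, a ≤ ρ x) :
    (a : ℝ≥0∞) ^ 2 * μH[2] s ≤ μH[2] (f '' s) := by
  have h1 : AntilipschitzWith a⁻¹ (fun x : s => f x) := AntilipschitzWith.of_le_mul_dist fun x y => by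
    rw [NNReal.coe_inv, ← div_eq_inv_mul, le_div_iff₀' (by exact_mod_cast ha)]
    refine abs_le_of_sq_le_sq' ?_ (by positivity) |>.2
    rw [hdist, mul_pow, sq (a : ℝ)]
    have := h x x.2
    have := h y y.2
    rw [Subtype.dist_eq]
    gcongr
  have h2 := h1.le_hausdorffMeasure_image (d := 2) (by norm_num) univ
  rw [image_univ, ← image_eq_range, ← (isometry_subtype_coe (s := s)).hausdorffMeasure_image (Or.inl (by norm_num)),
    image_univ, Subtype.range_coe] at h2
  have ha' : (a : ℝ≥0∞) ^ 2 ≠ 0 := by simpa using ha.ne'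
  calc (a : ℝ≥0∞) ^ 2 * μH[2] s
      ≤ (a : ℝ≥0∞) ^ 2 * ((a⁻¹ : ℝ≥0) ^ (2 : ℝ) * μH[2] (f '' s)) := by gcongr
    _ = μH[2] (f '' s) := by
      rw [ENNReal.coe_inv ha.ne', ENNReal.rpow_ofNat, ← ENNReal.inv_pow, ← mul_assoc,
        ENNReal.mul_inv_cancel ha' (by simp), one_mul]

theorem comap_hausdorffMeasure_eq (hf : MeasurableEmbedding f) (hρ : Measurable ρ) (hρ0 : ∀ x, 0 < ρ x)
    (hdist : ∀ x y, dist (f x) (f y) ^ 2 = ρ x * ρ y * dist x y ^ 2) :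
    Measure.comap f μH[2] = Measure.withDensity μH[2] fun x => ((ρ x ^ 2 : ℝ≥0) : ℝ≥0∞) := by
  set μ := Measure.comap f μH[2]
  set ν := Measure.withDensity μH[2] fun x => ((ρ x ^ 2 : ℝ≥0) : ℝ≥0∞)
  have key : ∀ t : ℝ≥0, 1 < t → μ ≤ (t ^ 2 : ℝ≥0) • ν ∧ ν ≤ (t ^ 2 : ℝ≥0) • μ := by
    intro t ht
    have ht0 : 0 < t := zero_lt_one.trans ht
    set A : ℤ → Set X := fun n => ρ ⁻¹' Ico (t ^ n) (t ^ (n + 1))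
    have hA : ∀ n, MeasurableSet (A n) := fun n => hρ measurableSet_Ico
    have hd : Pairwise (Function.onFun Disjoint A) := fun m n hmn => by
      refine Set.disjoint_left.2 fun x hm hn => hmn ?_
      have h1 := (zpow_lt_zpow_iff_right₀ ht).1 (hm.1.trans_lt hn.2)
      have h2 := (zpow_lt_zpow_iff_right₀ ht).1 (hn.1.trans_lt hm.2)
      omega
    have hU : ⋃ n, A n = univ := eq_univ_of_forall fun x => mem_iUnion.2 <| by
      obtain ⟨n, hn⟩ := exists_mem_Ico_zpow (x := (ρ x : ℝ)) (y := (t : ℝ)) (by exact_mod_cast hρ0 x)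
        (by exact_mod_cast ht)
      exact ⟨n, by exact_mod_cast hn.1, by exact_mod_cast hn.2⟩
    have hμ : ∀ s, μ s = μH[2] (f '' s) := fun s => hf.comap_apply _ s
    have e1 : ∀ n : ℤ, ((t ^ (n + 1) : ℝ≥0) : ℝ≥0∞) ^ 2
        = ((t ^ 2 : ℝ≥0) : ℝ≥0∞) * ((t ^ n : ℝ≥0) : ℝ≥0∞) ^ 2 := fun n => by
      rw [zpow_add_one₀ ht0.ne']
      norm_cast
      ring
    constructor
    · refine Measure.le_of_forall_subset_le hA hd hU fun n s hs hsm => ?_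
      rw [hμ, Measure.smul_apply, ENNReal.smul_def, smul_eq_mul]
      refine (hausdorffMeasure_image_le_of_le hdist fun x hx => (hs hx).2.le).trans ?_
      rw [e1, mul_assoc]
      gcongr
      rw [withDensity_apply _ hsm, ← setLIntegral_const]
      refine setLIntegral_mono' hsm fun x hx => ?_
      have := (hs hx).1
      norm_cast
      gcongr
    · refine Measure.le_of_forall_subset_le hA hd hU fun n s hs hsm => ?_
      rw [Measure.smul_apply, ENNReal.smul_def, smul_eq_mul, hμ]
      refine le_trans ?_ (mul_le_mul_right (hausdorffMeasure_le_image_of_le hdist (zpow_pos ht0 n)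
        fun x hx => (hs hx).1) _)
      rw [← mul_assoc, ← e1, withDensity_apply _ hsm, ← setLIntegral_const]
      refine setLIntegral_mono' hsm fun x hx => ?_
      have := (hs hx).2.le
      norm_cast
      gcongr
  have lim : ∀ a b : ℝ≥0∞, (∀ t : ℝ≥0, 1 < t → a ≤ (t ^ 2 : ℝ≥0) * b) → a ≤ b := fun a b h => by
    have h1 : Tendsto (fun t : ℝ≥0 => ((t ^ 2 : ℝ≥0) : ℝ≥0∞) * b) (𝓝[>] 1) (𝓝 (((1 ^ 2 : ℝ≥0) : ℝ≥0∞) * b)) := by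
      refine ENNReal.Tendsto.mul_const (ENNReal.tendsto_coe.2 ?_) (Or.inl (by simp))
      exact ((continuous_pow 2).tendsto 1).mono_left nhdsWithin_le_nhds
    rw [one_pow, ENNReal.coe_one, one_mul] at h1
    exact ge_of_tendsto h1 (eventually_mem_nhdsWithin.mono fun t ht => h t ht)
  ext s hs
  refine le_antisymm (lim _ _ fun t ht => ?_) (lim _ _ fun t ht => ?_)
  · exact (key t ht).1 s
  · exact (key t ht).2 s

end ConformalHausdorff

section HalfSphere

open Filter Topology ComplexConjugate Set NNReal

variable {u : E3 → ℝ} {α : ℝ} (b : OrthonormalBasis (Fin 3) ℝ E3)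

theorem continuous_sph : Continuous (sph b) :=
  ((continuous_norm.pow 2).add_const 1).inv₀ (fun ζ => (by positivity : (0 : ℝ) < ‖ζ‖ ^ 2 + 1).ne')
    |>.smul (contDiff_ray b).continuous

theorem sq_dist_sph (ζ ζ' : ℂ) : dist (sph b ζ) (sph b ζ') ^ 2
    = 2 / (‖ζ‖ ^ 2 + 1) * (2 / (‖ζ'‖ ^ 2 + 1)) * dist ζ ζ' ^ 2 := by
  have h : dist (sph b ζ) (sph b ζ') ^ 2 = 2 - 2 * ((‖ζ‖ ^ 2 + 1)⁻¹ * ((‖ζ'‖ ^ 2 + 1)⁻¹ * ⟪ray b ζ, ray b ζ'⟫)) := by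
    rw [dist_eq_norm, norm_sub_sq_real, norm_sph, norm_sph]
    simp only [sph, real_inner_smul_left, real_inner_smul_right]
    ring
  have h1 : ‖ζ‖ ^ 2 + 1 ≠ 0 := by positivity
  have h2 : ‖ζ'‖ ^ 2 + 1 ≠ 0 := by positivity
  rw [h, inner_ray, dist_eq_norm]
  field_simp
  simp only [sq_norm_eq, Complex.sub_re, Complex.sub_im]
  ring

theorem injective_sph : Function.Injective (sph b) := fun ζ ζ' h => by
  have h1 := sq_dist_sph b ζ ζ'
  rw [h, dist_self, zero_pow two_ne_zero, eq_comm] at h1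
  have h2 : 2 / (‖ζ‖ ^ 2 + 1) * (2 / (‖ζ'‖ ^ 2 + 1)) ≠ 0 := by positivity
  exact dist_eq_zero.1 (pow_eq_zero_iff two_ne_zero |>.1 ((mul_eq_zero.1 h1).resolve_left h2))

theorem measurableEmbedding_sph : MeasurableEmbedding (sph b) :=
  (continuous_sph b).measurableEmbedding (injective_sph b)

theorem exists_sph_eq {x : E3} (hx : x ∈ S2) (h : x ≠ -b 2) : ∃ ζ, sph b ζ = x := by
  have hx1 : ‖x‖ = 1 := mem_sphere_zero_iff_norm.1 hx
  have hsum := b.sum_repr x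
  have hsq := b.sum_sq_norm_inner_right x
  simp only [Fin.sum_univ_three, b.repr_apply_apply, Real.norm_eq_abs, sq_abs, hx1] at hsum hsq
  set p := ⟪b 0, x⟫
  set q := ⟪b 1, x⟫
  set r := ⟪b 2, x⟫ with hr
  have hr1 : 1 + r ≠ 0 := fun h0 => h <| by
    have hp : p = 0 := by nlinarith [sq_nonneg p, sq_nonneg q]
    have hq : q = 0 := by nlinarith [sq_nonneg p, sq_nonneg q]
    rw [← hsum, hp, hq, eq_neg_of_add_eq_zero_right h0]
    simp
  have hζ : ‖(⟨p / (1 + r), q / (1 + r)⟩ : ℂ)‖ ^ 2 + 1 = 2 / (1 + r) := by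
    rw [sq_norm_eq]
    field_simp
    linear_combination hsq
  refine ⟨⟨p / (1 + r), q / (1 + r)⟩, ?_⟩
  rw [sph, hζ, ray, ← sq_norm_eq, eq_sub_of_add_eq hζ, ← hsum, smul_add, smul_add, smul_smul, smul_smul, smul_smul]
  congr 2
  · congr 1
    field_simp
  · congr 1
    field_simp
  · field_simp
    ring

theorem range_sph : range (sph b) = S2 \ {-b 2} := by
  ext x
  constructor
  · rintro ⟨ζ, rfl⟩
    refine ⟨mem_sphere_zero_iff_norm.2 (norm_sph b ζ), fun h => ?_⟩
    have h1 := sq_norm_sph_add b ζ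
    rw [mem_singleton_iff.1 h, neg_add_cancel, norm_zero, zero_pow two_ne_zero] at h1
    have : 4 / (‖ζ‖ ^ 2 + 1) ≠ 0 := by positivity
    exact this h1.symm
  · exact fun hx => exists_sph_eq b hx.1 hx.2

theorem reflect_sph (ζ : ℂ) : Refl (b 1) (sph b ζ) = sph b (conj ζ) := by
  rw [Refl, sph, sph, real_inner_smul_left, inner_ray_one, Complex.norm_conj, ray, ray, Complex.conj_re,
    Complex.conj_im, neg_sq]
  module

theorem exists_setIntegral_sph : ∃ c : ℝ, 0 < c ∧ ∀ (g : E3 → ℝ) (T : Set E3), MeasurableSet T →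
    ∫ x in {x ∈ S2 | x ∈ T}, g x ∂μH[2] = c * ∫ ζ in sph b ⁻¹' T, 4 / (‖ζ‖ ^ 2 + 1) ^ 2 * g (sph b ζ) := by
  have hH : (μH[2] : Measure ℂ).IsAddHaarMeasure := by
    have := isAddHaarMeasure_hausdorffMeasure (E := ℂ)
    rwa [Complex.finrank_real_complex] at this
  set c := Measure.addHaarScalarFactor (μH[2] : Measure ℂ) volume
  have hc : 0 < c := Measure.addHaarScalarFactor_pos_of_isAddHaarMeasure _ _
  have hcv : (μH[2] : Measure ℂ) = c • volume := Measure.isAddLeftInvariant_eq_smul _ _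
  refine ⟨c, hc, fun g T hT => ?_⟩
  set ρ : ℂ → ℝ≥0 := fun ζ => 2 / (‖ζ‖₊ ^ 2 + 1)
  have hρ : Measurable ρ := (measurable_nnnorm.pow_const 2).add_const 1 |>.const_div 2
  have hcomap := comap_hausdorffMeasure_eq (measurableEmbedding_sph b) hρ (fun ζ => by positivity)
    fun ζ ζ' => by simpa [ρ] using sq_dist_sph b ζ ζ'
  have hnull : (μH[2] : Measure E3) {-b 2} = 0 :=
    have := Measure.nullSingletonClass_hausdorff E3 (d := 2) two_pos
    measure_singleton _
  have hset : {x ∈ S2 | x ∈ T} =ᵐ[μH[2]] (T ∩ range (sph b) : Set E3) := by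
    have h1 : T ∩ range (sph b) = {x ∈ S2 | x ∈ T} \ {-b 2} := by
      rw [range_sph]
      ext x
      simp only [mem_inter_iff, Set.mem_sdiff, mem_ofPred_eq]
      tauto
    rw [h1]
    exact (sdiff_null_ae_eq_self hnull).symm
  rw [setIntegral_congr_set hset, ← Measure.restrict_restrict hT, ← (measurableEmbedding_sph b).map_comap,
    (measurableEmbedding_sph b).setIntegral_map, hcomap,
    setIntegral_withDensity_eq_setIntegral_smul (hρ.pow_const 2) _ ((measurableEmbedding_sph b).measurable hT),
    hcv, Measure.restrict_smul, integral_smul_nnreal_measure, NNReal.smul_def, smul_eq_mul]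
  congr 1
  refine integral_congr_ae (Eventually.of_forall fun ζ => ?_)
  simp only [ρ, NNReal.smul_def, smul_eq_mul]
  push_cast
  rw [div_pow]
  norm_num

theorem upper_ae_eq : ({ζ : ℂ | 0 ≤ ζ.im} : Set ℂ) =ᵐ[volume] {ζ : ℂ | 0 < ζ.im} := by
  have h0 : volume {ζ : ℂ | ζ.im = 0} = 0 := by
    refine Measure.addHaar_submodule volume (LinearMap.ker Complex.imLm) fun h => ?_
    have h1 : Complex.I ∈ LinearMap.ker Complex.imLm := h ▸ Submodule.mem_top
    simp at h1
  have h1 : {ζ : ℂ | 0 < ζ.im} = {ζ : ℂ | 0 ≤ ζ.im} \ {ζ : ℂ | ζ.im = 0} := by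
    ext ζ
    rw [Set.mem_sdiff, mem_ofPred_eq, mem_ofPred_eq, mem_ofPred_eq, lt_iff_le_and_ne, ne_comm]
  rw [h1]
  exact (sdiff_null_ae_eq_self h0).symm

theorem MFE.setIntegral_eq_iff (hu : MFE u α) :
    (∫ x in halfSphere (b 1), exp (2 * u x) ∂μH[2]) = (∫ x in halfSphere (-b 1), exp (2 * u x) ∂μH[2]) ↔
      ∫ ζ in {ζ : ℂ | 0 < ζ.im}, exp (2 * conf b u (conj ζ)) = ∫ ζ in {ζ : ℂ | 0 < ζ.im}, exp (2 * conf b u ζ) := by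
  obtain ⟨c, hc, h⟩ := exists_setIntegral_sph b
  have hinner : ∀ ζ : ℂ, ⟪sph b ζ, b 1⟫ = (‖ζ‖ ^ 2 + 1)⁻¹ * (2 * ζ.im) := fun ζ => by
    rw [sph, real_inner_smul_left, inner_ray_one]
  have hsign : ∀ ζ : ℂ, 0 < (‖ζ‖ ^ 2 + 1)⁻¹ := fun ζ => by positivity
  have hm : ∀ y : E3, MeasurableSet {x : E3 | 0 ≤ ⟪x, y⟫} := fun y =>
    (isClosed_le continuous_const (continuous_id.inner continuous_const)).measurableSet
  have h1 : sph b ⁻¹' {x | 0 ≤ ⟪x, b 1⟫} = {ζ : ℂ | 0 ≤ ζ.im} := by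
    ext ζ
    rw [mem_preimage, mem_ofPred_eq, hinner, mul_nonneg_iff_of_pos_left (hsign ζ),
      mul_nonneg_iff_of_pos_left two_pos, mem_ofPred_eq]
  have h2 : sph b ⁻¹' {x | 0 ≤ ⟪x, -b 1⟫} = Complex.conjLIE ⁻¹' {ζ : ℂ | 0 ≤ ζ.im} := by
    ext ζ
    rw [mem_preimage, mem_ofPred_eq, inner_neg_right, hinner, ← mul_neg, ← mul_neg,
      mul_nonneg_iff_of_pos_left (hsign ζ), mul_nonneg_iff_of_pos_left two_pos, mem_preimage, mem_ofPred_eq,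
      Complex.conjLIE_apply, Complex.conj_im]
  have e : ∀ ζ, 4 / (‖ζ‖ ^ 2 + 1) ^ 2 * exp (2 * u (sph b ζ)) = exp (2 * conf b u ζ) := fun ζ => by
    rw [exp_conf, hu.2.1.sph_eq]
  have h3 : ∫ ζ in Complex.conjLIE ⁻¹' {ζ : ℂ | 0 ≤ ζ.im}, exp (2 * conf b u ζ)
      = ∫ ζ in {ζ : ℂ | 0 ≤ ζ.im}, exp (2 * conf b u (conj ζ)) := by
    rw [← Complex.conjLIE.measurePreserving.setIntegral_preimage_emb
      Complex.conjLIE.toHomeomorph.measurableEmbedding]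
    simp
  have h4 := h (fun x => exp (2 * u x)) _ (hm (b 1))
  have h5 := h (fun x => exp (2 * u x)) _ (hm (-b 1))
  rw [h1] at h4
  rw [h2] at h5
  simp only [mem_ofPred_eq] at h4 h5
  rw [halfSphere, halfSphere, h4, h5, mul_right_inj' hc.ne']
  simp only [e]
  rw [h3, setIntegral_congr_set upper_ae_eq, setIntegral_congr_set upper_ae_eq, eq_comm]

end HalfSphere

section Symmetry

open ComplexConjugate

variable {u : E3 → ℝ} {α : ℝ}

theorem exists_orthonormalBasis_cross {q z : E3} (hq : ‖q‖ = 1) (hz : ‖z‖ = 1) (hzq : ⟪z, q⟫ = 0) :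
    ∃ b : OrthonormalBasis (Fin 3) ℝ E3, b 0 = z ∧ b 1 = cross q z ∧ b 2 = q := by
  have hq' : ⟪q, q⟫ = 1 := by rw [real_inner_self_eq_norm_sq, hq, one_pow]
  have hz' : ⟪z, z⟫ = 1 := by rw [real_inner_self_eq_norm_sq, hz, one_pow]
  have hon : Orthonormal ℝ ![z, cross q z, q] := by
    rw [orthonormal_iff_ite]
    simp only [EuclideanSpace.inner_eq_star_dotProduct, dotProduct, Fin.sum_univ_three, star_trivial,
      Pi.star_apply] at hq' hz' hzq
    have h0 : cross q z 0 = q 1 * z 2 - q 2 * z 1 := by simp [cross, cross_apply]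
    have h1 : cross q z 1 = q 2 * z 0 - q 0 * z 2 := by simp [cross, cross_apply]
    have h2 : cross q z 2 = q 0 * z 1 - q 1 * z 0 := by simp [cross, cross_apply]
    intro i j
    fin_cases i <;> fin_cases j <;>
      simp [-inner_self_eq_norm_sq_to_K, EuclideanSpace.inner_eq_star_dotProduct, dotProduct,
        Fin.sum_univ_three, h0, h1, h2]
    · linear_combination hz'
    · ring
    · linear_combination hzq
    · ring
    · linear_combination hq' * (z 0 * z 0 + z 1 * z 1 + z 2 * z 2) + hz'
        - (q 0 * z 0 + q 1 * z 1 + q 2 * z 2) * hzq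
    · ring
    · linear_combination hzq
    · ring
    · linear_combination hq'
  have hspan : ⊤ ≤ Submodule.span ℝ (Set.range ![z, cross q z, q]) :=
    (hon.linearIndependent.span_eq_top_of_card_eq_finrank (by simp)).ge
  exact ⟨OrthonormalBasis.mk hon hspan, by simp, by simp, by simp⟩

theorem MFE.eq_reflect (hu : MFE u α) (hα1 : 1 < α) (hα2 : α ≤ 3) (b : OrthonormalBasis (Fin 3) ℝ E3)
    (hcrit : fderiv ℝ u (b 2) (b 1) = 0) (hhess : fderiv ℝ (fderiv ℝ u) (b 2) (b 0) (b 1) = 0)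
    (harea : (∫ x in halfSphere (b 1), exp (2 * u x) ∂μH[2]) = ∫ x in halfSphere (-b 1), exp (2 * u x) ∂μH[2])
    {x : E3} (hx : x ∈ S2) : u (Refl (b 1) x) = u x := by
  obtain ⟨κ, B, h⟩ := hu.planeField (b := b) hα1
  set g : ℂ → ℝ := fun ζ => u (ray b ζ)
  have hg : ContDiff ℝ ∞ g := hu.contDiff_ray
  have hgd : Differentiable ℝ g := hg.differentiable (by simp)
  have hgc : Differentiable ℝ fun ζ => g (conj ζ) := hgd.comp Complex.conjCLE.differentiable
  have hdd : Differentiable ℝ (dy g) := (hg.dy (m := ∞) (by simp)).differentiable (by simp)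
  have hdc : Differentiable ℝ fun ζ => dy g (conj ζ) := hdd.comp Complex.conjCLE.differentiable
  have hray : ray b 0 = b 2 := by simp [ray]
  have hodd : oddPart (conf b u) = fun ζ => g ζ - g (conj ζ) := oddPart_conf u
  have hdy : dy (oddPart (conf b u)) = fun ζ => dy g ζ + dy g (conj ζ) := by
    rw [hodd]
    funext ζ
    have e := congrFun (dy_comp_conj g) ζ
    rw [dy] at e ⊢
    rw [fderiv_fun_sub (hgd ζ) (hgc ζ), sub_apply, e, sub_neg_eq_add]
    rfl
  have h1 : dy (oddPart (conf b u)) 0 = 0 := by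
    rw [hdy]
    have : dy g 0 = 0 := by
      rw [dy, hu.fderiv_comp_ray, hray, fderiv_ray]
      simp [hcrit]
    simp [this]
  have h2 : dx (dy (oddPart (conf b u))) 0 = 0 := by
    have e : dx (dy g) 0 = 0 := by
      have := hu.fderiv_fderiv_comp_ray (b := b) 0 Complex.I 1
      rw [dx]
      refine this.trans ?_
      rw [hray, fderiv_ray, fderiv_ray]
      simp [hhess]
    have e' := congrFun (dx_comp_conj (dy g)) 0
    rw [map_zero, e, dx] at e'
    rw [hdy, dx, fderiv_fun_add (hdd 0) (hdc 0), add_apply, e', add_zero]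
    exact e
  have hB : ∫ p, exp (2 * conf b u p) ≤ 12 * π := by
    rw [hu.integral_exp_conf]
    nlinarith [pi_pos]
  have h3 := hu.setIntegral_eq_iff b |>.1 harea
  by_cases hx2 : x = -b 2
  · rw [hx2, Refl]
    simp [inner_neg_left, b.inner_eq_ite]
  · obtain ⟨ζ, rfl⟩ := exists_sph_eq b hx hx2
    rw [reflect_sph, hu.2.1.sph_eq, hu.2.1.sph_eq]
    have := h.oddPart_eq_zero hB h1 h2 h3 ζ
    rw [hodd] at this
    exact (sub_eq_zero.1 this).symm

end Symmetry

theorem stmt12 (α : ℝ) (hα1 : 2 < α) (hα2 : α ≤ 3) (u : E3 → ℝ) (hu : MFE u α)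
    (q z : E3) (hq : q ∈ S2) (hcrit : fderiv ℝ u q = 0)
    (hzq : ⟪z, q⟫ = 0) (hz1 : ‖z‖ = 1) (heig : HessEigen u q z)
    (y : E3) (hy : y = cross q z)
    (harea : (∫ x in halfSphere y, Real.exp (2 * u x) ∂μH[2]) =
      ∫ x in halfSphere (-y), Real.exp (2 * u x) ∂μH[2]) :
    ∀ x ∈ S2, u (Refl y x) = u x := by
  obtain ⟨b, rfl, hb1, rfl⟩ := exists_orthonormalBasis_cross (mem_sphere_zero_iff_norm.1 hq) hz1 hzq
  obtain rfl : y = b 1 := hy.trans hb1.symm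
  obtain ⟨lam, hlam⟩ := heig
  refine fun x hx => hu.eq_reflect (by linarith) hα2 b (by rw [hcrit, zero_apply]) ?_ harea hx
  have := hlam (b 1) (by simp [b.inner_eq_ite])
  rw [iteratedFDeriv_two_apply] at this
  simpa [b.inner_eq_ite] using this
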